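/- For all α, d₀ > 0 and a, f, h ∈ ℕ with h ≥ 1 there exist η > 0 and n₀ ∈ ℕ such that the following holds for all n ≥ n₀ divisible by f and all d ≥ d₀: if F is a graph with f vertices and h edges satisfying a(F) ≤ a, G is an n-vertex (η,d)-quasirandom graph, and φ is an edge-colouring of G that is (1−α)·fdn/(2h)-bounded and locally ηn/(log n)^{2a}-bounded, then G has an α-decomposition into rainbow F-factors. -/

import Mathlib

namespace Paper

variable {V : Type*} {W : Type*} {C : Type*}

/-- The set of edges of `G` receiving colour `c` under `φ`. -/
def colourCls (G : SimpleGraph V) (φ : Sym2 V → C) (c : C) : Set (Sym2 V) :=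
  {e | e ∈ G.edgeSet ∧ φ e = c}

/-- `φ` is a (globally) `g`-bounded edge-colouring of `G`:
every colour is used on at most `g` edges. -/
def GBounded (G : SimpleGraph V) (φ : Sym2 V → C) (g : ℝ) : Prop :=
  ∀ c : C, ((colourCls G φ c).ncard : ℝ) ≤ g

/-- `φ` is a locally `l`-bounded edge-colouring of `G`:
every vertex is incident to at most `l` edges of each colour. -/
def LBounded (G : SimpleGraph V) (φ : Sym2 V → C) (l : ℝ) : Prop :=
  ∀ (v : V) (c : C), (({u | G.Adj v u ∧ φ s(v, u) = c}).ncard : ℝ) ≤ l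

/-- A set of edges is rainbow if the colouring is injective on it. -/
def Rainbow (φ : Sym2 V → C) (E : Set (Sym2 V)) : Prop :=
  Set.InjOn φ E

/-- The set of common neighbours `w` of `u` and `v` with `φ(uw) = φ(vw)`. -/
def monoSet (G : SimpleGraph V) (φ : Sym2 V → C) (u v : V) : Set V :=
  {w | G.Adj u w ∧ G.Adj v w ∧ φ s(u, w) = φ s(v, w)}

/-- The monochromatic codegree `c^φ_G(u,v)`. -/
noncomputable def monoCodeg (G : SimpleGraph V) (φ : Sym2 V → C) (u v : V) : ℕ :=
  (monoSet G φ u v).ncard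

/-- Degree of `u` into the set `S`. -/
noncomputable def degIn (G : SimpleGraph V) (u : V) (S : Set V) : ℕ :=
  (G.neighborSet u ∩ S).ncard

/-- Codegree of `u,v` into the set `S`. -/
noncomputable def codegIn (G : SimpleGraph V) (u v : V) (S : Set V) : ℕ :=
  (G.neighborSet u ∩ G.neighborSet v ∩ S).ncard

/-- `G` restricted to `S` is `(ε,d)`-quasirandom: all degrees (within `S`)
are `(d ± ε)|S|` and all but at most `ε|S|²` unordered pairs of distinct
vertices of `S` have codegree (within `S`) equal to `(d² ± ε)|S|`. -/
def QuasirandomOn (G : SimpleGraph V) (S : Set V) (ε d : ℝ) : Prop :=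
  (∀ v ∈ S, |(degIn G v S : ℝ) - d * S.ncard| ≤ ε * S.ncard) ∧
  ((({p : Sym2 V | ∃ u v, p = s(u, v) ∧ u ≠ v ∧ u ∈ S ∧ v ∈ S ∧
        ¬ (|(codegIn G u v S : ℝ) - d ^ 2 * S.ncard| ≤ ε * S.ncard)}).ncard : ℝ)
      ≤ ε * (S.ncard : ℝ) ^ 2)

/-- `G` is `(ε,d)`-quasirandom. -/
def Quasirandom (G : SimpleGraph V) (ε d : ℝ) : Prop :=
  QuasirandomOn G Set.univ ε d

/-- Edges of `G` with one endpoint in `X` and the other in `Y`. -/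
def edgesBetween (G : SimpleGraph V) (X Y : Set V) : Set (Sym2 V) :=
  {e | e ∈ G.edgeSet ∧ ∃ u v, e = s(u, v) ∧ u ∈ X ∧ v ∈ Y}

/-- The pair `(A,B)` is `(ε,d)`-regular in `G`. -/
def RegularPair (G : SimpleGraph V) (A B : Set V) (ε d : ℝ) : Prop :=
  ∀ X ⊆ A, ∀ Y ⊆ B, ε * A.ncard ≤ (X.ncard : ℝ) → ε * B.ncard ≤ (Y.ncard : ℝ) →
    |((edgesBetween G X Y).ncard : ℝ) / ((X.ncard : ℝ) * (Y.ncard : ℝ)) - d| ≤ ε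

/-- The pair `(A,B)` is `(ε,d)`-superregular in `G`. -/
def SuperregularPair (G : SimpleGraph V) (A B : Set V) (ε d : ℝ) : Prop :=
  RegularPair G A B ε d ∧
  (∀ u ∈ A, |(degIn G u B : ℝ) - d * B.ncard| ≤ ε * B.ncard) ∧
  (∀ v ∈ B, |(degIn G v A : ℝ) - d * A.ncard| ≤ ε * A.ncard)

/-- `H` is a copy of `F`: a subgraph of `G` isomorphic to `F`. -/
def IsCopy (F : SimpleGraph W) {G : SimpleGraph V} (H : G.Subgraph) : Prop :=
  Nonempty (F ≃g H.coe)

/-- `L` is the union of the family `𝒞` of pairwise vertex-disjoint copies of `F`. -/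
def IsFactorFrom (F : SimpleGraph W) {G : SimpleGraph V} (L : G.Subgraph)
    (𝒞 : Set G.Subgraph) : Prop :=
  (∀ H ∈ 𝒞, IsCopy F H) ∧
  𝒞.Pairwise (fun H₁ H₂ => Disjoint H₁.verts H₂.verts) ∧
  L = sSup 𝒞

/-- `L` consists of vertex-disjoint copies of `F`. -/
def IsFFactorSub (F : SimpleGraph W) {G : SimpleGraph V} (L : G.Subgraph) : Prop :=
  ∃ 𝒞 : Set G.Subgraph, IsFactorFrom F L 𝒞

/-- An `ε`-decomposition: pairwise edge-disjoint subgraphs of `G` which together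
contain all but at most an `ε`-proportion of the edges of `G`. -/
def ApxDecomp (G : SimpleGraph V) (ε : ℝ) {t : ℕ} (L : Fin t → G.Subgraph) : Prop :=
  (Pairwise fun i j => Disjoint (L i).edgeSet (L j).edgeSet) ∧
  ((G.edgeSet \ ⋃ i, (L i).edgeSet).ncard : ℝ) ≤ ε * (G.edgeSet.ncard : ℝ)

/-- `a(F) ≤ a`, where `a(F) = max {Δ(F), a'(F), a''(F)}`. -/
def AParamLe (F : SimpleGraph W) (a : ℕ) : Prop :=
  (∀ v, (F.neighborSet v).ncard ≤ a) ∧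
  (∀ u v, F.Adj u v →
    (F.neighborSet u).ncard + (F.neighborSet v).ncard - 2 ≤ a) ∧
  (∀ u v w, F.Adj u v → F.Adj v w → u ≠ w →
    (F.neighborSet u).ncard + (F.neighborSet v).ncard + (F.neighborSet w).ncard - 4 ≤ a)

end Paper

open Paper

namespace RainbowFactor

set_option linter.unusedSectionVars false

open scoped Classical in
/-- One step of the exponential moment method for a random variable with small increments. -/
theorem sum_mul_exp_le {Ω : Type*} [Fintype Ω] (w y : Ω → ℝ) (L : Ω → Prop) (lam B μ ν : ℝ)
    (hlam : 0 ≤ lam) (hB : lam * B ≤ 1) (hw : ∀ o, 0 ≤ w o) (hsum : ∑ o, w o = 1)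
    (hb : ∀ o, 0 < w o → L o → |y o| ≤ B)
    (hμ : ∑ o, (if L o then w o * y o else 0) ≤ μ)
    (hν : ∑ o, (if L o then w o * y o ^ 2 else 0) ≤ ν) :
    ∑ o, (if L o then w o * Real.exp (lam * y o) else 0) ≤ Real.exp (lam * (μ + lam * ν)) := by
  have h1 : ∀ o, (if L o then w o * Real.exp (lam * y o) else 0) ≤
      w o + lam * (if L o then w o * y o else 0)
        + lam ^ 2 * (if L o then w o * y o ^ 2 else 0) := by
    intro o
    split_ifs with h
    · rcases (hw o).eq_or_lt with h0 | h0
      · simp [← h0]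
      · have hy := hb o h0 h
        have h2 : |lam * y o| ≤ 1 := by
          rw [abs_mul, abs_of_nonneg hlam]
          exact (mul_le_mul_of_nonneg_left hy hlam).trans hB
        have h3 := (abs_le.1 (Real.abs_exp_sub_one_sub_id_le h2)).2
        have h4 : Real.exp (lam * y o) ≤ 1 + lam * y o + lam ^ 2 * y o ^ 2 := by
          nlinarith
        calc w o * Real.exp (lam * y o) ≤ w o * (1 + lam * y o + lam ^ 2 * y o ^ 2) :=
              mul_le_mul_of_nonneg_left h4 (hw o)
          _ = _ := by ring
    · simpa using hw o
  calc _ ≤ ∑ o, (w o + lam * (if L o then w o * y o else 0)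
        + lam ^ 2 * (if L o then w o * y o ^ 2 else 0)) := Finset.sum_le_sum fun o _ => h1 o
    _ = 1 + lam * ∑ o, (if L o then w o * y o else 0)
        + lam ^ 2 * ∑ o, (if L o then w o * y o ^ 2 else 0) := by
      rw [Finset.sum_add_distrib, Finset.sum_add_distrib, hsum, Finset.mul_sum, Finset.mul_sum]
    _ ≤ 1 + lam * μ + lam ^ 2 * ν := by gcongr
    _ ≤ Real.exp (lam * (μ + lam * ν)) := by
      have := Real.add_one_le_exp (lam * (μ + lam * ν))
      nlinarith

open scoped Classical in
/-- A derandomised concentration inequality: if from every good state some random step moves all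
the statistics `Y p` with small drift, small variance and small increments, then some trajectory
keeps all statistics below `ε`. -/
theorem exists_trajectory {S P Ω : Type*} [Fintype P] [Fintype Ω]
    (Inv : S → Prop) (live : P → S → Prop) (Y : P → ℕ → S → ℝ) (T : ℕ)
    (lam B μ ν ε : ℝ) (s₀ : S) (h0 : Inv s₀) (hY0 : ∀ p, live p s₀ → Y p 0 s₀ ≤ 0)
    (hlam : 0 < lam) (hB : lam * B ≤ 1) (hμ0 : 0 ≤ μ) (hν0 : 0 ≤ ν)
    (hcard : Real.log (Fintype.card P) ≤ lam * (ε / 2))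
    (hdrift : T * (μ + lam * ν) ≤ ε / 2)
    (hstep : ∀ k < T, ∀ s, Inv s → (∀ p, live p s → Y p k s ≤ ε) →
      ∃ (w : Ω → ℝ) (next : Ω → S), (∀ o, 0 ≤ w o) ∧ ∑ o, w o = 1 ∧
        (∀ o, 0 < w o → Inv (next o)) ∧ (∀ p o, live p (next o) → live p s) ∧
        ∀ p, live p s →
          (∀ o, 0 < w o → live p (next o) → |Y p (k + 1) (next o) - Y p k s| ≤ B) ∧
          ∑ o, (if live p (next o) then w o * (Y p (k + 1) (next o) - Y p k s) else 0) ≤ μ ∧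
          ∑ o, (if live p (next o) then w o * (Y p (k + 1) (next o) - Y p k s) ^ 2 else 0) ≤ ν) :
    ∃ s, Inv s ∧ ∀ p, live p s → Y p T s ≤ ε := by
  set c := μ + lam * ν with hc
  have hc0 : 0 ≤ c := by positivity
  set Φ : ℕ → S → ℝ := fun k s =>
    ∑ p, if live p s then Real.exp (lam * (Y p k s - k * c)) else 0 with hΦ
  have hgood : ∀ k ≤ T, ∀ s, Φ k s ≤ Fintype.card P → ∀ p, live p s → Y p k s ≤ ε := by
    intro k hk s hs p hp
    have h1 : Real.exp (lam * (Y p k s - k * c)) ≤ Fintype.card P := by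
      refine le_trans ?_ hs
      have := Finset.single_le_sum (f := fun p => if live p s then
        Real.exp (lam * (Y p k s - k * c)) else 0) (s := Finset.univ)
        (fun q _ => by split_ifs <;> positivity) (Finset.mem_univ p)
      simpa [hp] using this
    have h2 : lam * (Y p k s - k * c) ≤ lam * (ε / 2) := by
      refine le_trans ?_ hcard
      rw [Real.le_log_iff_exp_le (lt_of_lt_of_le (Real.exp_pos _) h1)]
      exact h1
    have h3 := le_of_mul_le_mul_left h2 hlam
    have h4 : (k : ℝ) * c ≤ T * c := by gcongr
    linarith
  have key : ∀ k ≤ T, ∃ s, Inv s ∧ Φ k s ≤ Fintype.card P := by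
    intro k
    induction k with
    | zero =>
      intro _
      refine ⟨s₀, h0, ?_⟩
      calc Φ 0 s₀ ≤ ∑ p : P, (1 : ℝ) := by
            refine Finset.sum_le_sum fun p _ => ?_
            split_ifs with hp
            · rw [Real.exp_le_one_iff]
              have := hY0 p hp
              simp only [Nat.cast_zero, zero_mul, sub_zero]
              nlinarith
            · norm_num
        _ = _ := by simp
    | succ k ih =>
      intro hk
      obtain ⟨s, hs, hΦs⟩ := ih (by omega)
      obtain ⟨w, next, hw, hsum, hInv, hlive, hp⟩ :=
        hstep k (by omega) s hs (hgood k (by omega) s hΦs)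
      have havg : ∑ o, w o * Φ (k + 1) (next o) ≤ Φ k s := by
        have : ∀ p, ∑ o, w o * (if live p (next o) then
            Real.exp (lam * (Y p (k + 1) (next o) - (k + 1 : ℕ) * c)) else 0) ≤
            if live p s then Real.exp (lam * (Y p k s - k * c)) else 0 := by
          intro p
          by_cases hl : live p s
          · obtain ⟨h1, h2, h3⟩ := hp p hl
            have h4 := sum_mul_exp_le w (fun o => Y p (k + 1) (next o) - Y p k s)
              (fun o => live p (next o)) lam B μ ν hlam.le hB hw hsum h1 h2 h3
            rw [if_pos hl]
            calc _ = Real.exp (lam * (Y p k s - k * c)) * Real.exp (-(lam * c)) *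
                  ∑ o, (if live p (next o) then
                    w o * Real.exp (lam * (Y p (k + 1) (next o) - Y p k s)) else 0) := by
                  rw [Finset.mul_sum]
                  refine Finset.sum_congr rfl fun o _ => ?_
                  split_ifs
                  · rw [← Real.exp_add, mul_left_comm (Real.exp _), ← Real.exp_add]
                    congr 2
                    push_cast
                    ring
                  · simp
              _ ≤ Real.exp (lam * (Y p k s - k * c)) * Real.exp (-(lam * c)) *
                  Real.exp (lam * (μ + lam * ν)) := by gcongr
              _ = _ := by
                rw [mul_assoc, ← Real.exp_add, ← hc]
                simp
          · rw [if_neg hl]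
            refine le_of_eq (Finset.sum_eq_zero fun o _ => ?_)
            rw [if_neg (fun h => hl (hlive p o h)), mul_zero]
        calc ∑ o, w o * Φ (k + 1) (next o) = ∑ p, ∑ o, w o * (if live p (next o) then
              Real.exp (lam * (Y p (k + 1) (next o) - (k + 1 : ℕ) * c)) else 0) := by
              rw [Finset.sum_comm]
              exact Finset.sum_congr rfl fun o _ => by rw [hΦ, Finset.mul_sum]
          _ ≤ _ := Finset.sum_le_sum fun p _ => this p
      by_contra hcon
      push Not at hcon
      have hlt : Φ k s < ∑ o, w o * Φ (k + 1) (next o) := by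
        have hpos : ∃ o, 0 < w o := by
          by_contra h
          push Not at h
          have : ∑ o, w o ≤ 0 := Finset.sum_nonpos fun o _ => h o
          linarith
        calc Φ k s ≤ Fintype.card P := hΦs
          _ = ∑ o, w o * (Fintype.card P : ℝ) := by rw [← Finset.sum_mul, hsum, one_mul]
          _ < _ := by
            obtain ⟨o, ho⟩ := hpos
            refine Finset.sum_lt_sum (fun o _ => ?_) ⟨o, Finset.mem_univ _, ?_⟩
            · rcases (hw o).eq_or_lt with h | h
              · simp [← h]
              · exact mul_le_mul_of_nonneg_left (hcon _ (hInv o h)).le (hw o)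
            · exact mul_lt_mul_of_pos_left (hcon _ (hInv o ho)) ho
      linarith
  obtain ⟨s, hs, hΦs⟩ := key T le_rfl
  exact ⟨s, hs, hgood T le_rfl s hΦs⟩

section Kill

variable {X Ω : Type*} [DecidableEq X] [Fintype Ω]

theorem sum_hit_le (w : Ω → ℝ) (kill : Ω → Finset X) (T : Finset X) (π : ℝ)
    (hw : ∀ o, 0 ≤ w o) (ha : ∀ x ∈ T, ∑ o, (if x ∈ kill o then w o else 0) = π) :
    ∑ o, (if ¬ Disjoint (kill o) T then w o else 0) ≤ T.card * π := by
  calc _ ≤ ∑ o, ∑ x ∈ T, (if x ∈ kill o then w o else 0) := by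
        refine Finset.sum_le_sum fun o _ => ?_
        split_ifs with h
        · exact Finset.sum_nonneg fun x _ => by split_ifs <;> simp [hw]
        · obtain ⟨x, hx, hx'⟩ := Finset.not_disjoint_iff.1 h
          refine le_trans ?_ (Finset.single_le_sum (f := fun x => if x ∈ kill o then w o else 0)
            (fun y _ => ?_) hx')
          · simp [hx]
          · split_ifs <;> simp [hw]
    _ = ∑ x ∈ T, π := by
        rw [Finset.sum_comm]
        exact Finset.sum_congr rfl ha
    _ = _ := by simp

theorem sum_hit_avoid_le (w : Ω → ℝ) (kill : Ω → Finset X) (g : Finset X) (x : X) (hx : x ∈ g)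
    (π : ℝ) (hw : ∀ o, 0 ≤ w o) (ha : ∀ x ∈ g, ∑ o, (if x ∈ kill o then w o else 0) = π) :
    ∑ o, (if x ∉ kill o ∧ ¬ Disjoint (kill o) g then w o else 0) ≤ (g.card - 1) * π := by
  have h := sum_hit_le w kill (g.erase x) π hw (fun y hy => ha y (Finset.mem_of_mem_erase hy))
  have hc : ((g.erase x).card : ℝ) = g.card - 1 := by
    rw [Finset.card_erase_of_mem hx, Nat.cast_sub (Finset.card_pos.2 ⟨x, hx⟩)]
    simp
  rw [hc] at h
  refine le_trans (Finset.sum_le_sum fun o _ => ?_) h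
  by_cases h1 : x ∉ kill o ∧ ¬ Disjoint (kill o) g
  · have : ¬ Disjoint (kill o) (g.erase x) := by
      obtain ⟨y, hy, hy'⟩ := Finset.not_disjoint_iff.1 h1.2
      exact Finset.not_disjoint_iff.2
        ⟨y, hy, Finset.mem_erase.2 ⟨fun h => h1.1 (h ▸ hy), hy'⟩⟩
    rw [if_pos h1, if_pos this]
  · rw [if_neg h1]
    split_ifs <;> simp [hw]

theorem le_sum_hit_avoid (w : Ω → ℝ) (kill : Ω → Finset X) (g : Finset X) (x : X) (hx : x ∈ g)
    (π δ : ℝ) (hδ : 0 ≤ δ) (hw : ∀ o, 0 ≤ w o)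
    (ha : ∀ x ∈ g, ∑ o, (if x ∈ kill o then w o else 0) = π)
    (hb : ∀ x ∈ g, ∀ y ∈ g, x ≠ y → ∑ o, (if x ∈ kill o ∧ y ∈ kill o then w o else 0) ≤ δ) :
    (g.card - 1) * π - g.card ^ 2 * δ ≤
      ∑ o, (if x ∉ kill o ∧ ¬ Disjoint (kill o) g then w o else 0) := by
  have hpt : ∀ o, (∑ y ∈ g.erase x, if y ∈ kill o then w o else 0) -
      (∑ y ∈ g, ∑ z ∈ g.erase y, if y ∈ kill o ∧ z ∈ kill o then w o else 0) ≤
      (if x ∉ kill o ∧ ¬ Disjoint (kill o) g then w o else 0) := by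
    intro o
    set n : ℕ := (g ∩ kill o).card with hn
    have e1 : (∑ y ∈ g, ∑ z ∈ g.erase y, if y ∈ kill o ∧ z ∈ kill o then w o else 0) =
        (n * ((n : ℝ) - 1)) * w o := by
      have : ∀ y ∈ g, (∑ z ∈ g.erase y, if y ∈ kill o ∧ z ∈ kill o then w o else 0) =
          if y ∈ kill o then ((n : ℝ) - 1) * w o else 0 := by
        intro y hy
        by_cases hyk : y ∈ kill o
        · simp only [hyk, true_and, if_true]
          rw [Finset.sum_ite_mem, Finset.sum_const, nsmul_eq_mul]
          congr 1
          have : (g.erase y) ∩ kill o = (g ∩ kill o).erase y := by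
            rw [Finset.erase_inter]
          rw [this, Finset.card_erase_of_mem (Finset.mem_inter.2 ⟨hy, hyk⟩), Nat.cast_sub]
          · simp [hn]
          · exact Finset.card_pos.2 ⟨y, Finset.mem_inter.2 ⟨hy, hyk⟩⟩
        · simp [hyk]
      rw [Finset.sum_congr rfl this, Finset.sum_ite_mem, Finset.sum_const, nsmul_eq_mul]
      ring
    have e2 : (∑ y ∈ g.erase x, if y ∈ kill o then w o else 0) ≤ n * w o := by
      calc _ ≤ ∑ y ∈ g, if y ∈ kill o then w o else 0 := by
            refine Finset.sum_le_sum_of_subset_of_nonneg (Finset.erase_subset _ _)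
              fun y _ _ => ?_
            split_ifs <;> simp [hw]
        _ = _ := by rw [Finset.sum_ite_mem, Finset.sum_const, nsmul_eq_mul]
    rw [e1]
    have hn2 : (n : ℝ) * ((n : ℝ) - 1) ≥ n - 1 := by
      rcases Nat.eq_zero_or_pos n with h | h
      · rw [h]; simp
      · have : (1 : ℝ) ≤ n := by exact_mod_cast h
        nlinarith
    by_cases hd : Disjoint (kill o) g
    · have : g ∩ kill o = ∅ := Finset.disjoint_iff_inter_eq_empty.1 hd.symm
      have hn0 : n = 0 := by rw [hn, this]; simp
      rw [hn0] at e2 ⊢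
      simp only [hd, not_true, and_false, if_false]
      simp at e2 ⊢
      exact e2
    · by_cases hxk : x ∈ kill o
      · have e3 : (∑ y ∈ g.erase x, if y ∈ kill o then w o else 0) = (n - 1) * w o := by
          rw [Finset.sum_ite_mem, Finset.sum_const, nsmul_eq_mul, Finset.erase_inter,
            Finset.card_erase_of_mem (Finset.mem_inter.2 ⟨hx, hxk⟩), Nat.cast_sub]
          · simp [hn]
          · exact Finset.card_pos.2 ⟨x, Finset.mem_inter.2 ⟨hx, hxk⟩⟩
        rw [e3]
        simp only [hxk, not_true, false_and, if_false]
        nlinarith [hw o, mul_le_mul_of_nonneg_right hn2 (hw o)]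
      · simp only [hxk, hd, not_false_eq_true, and_self, if_true]
        nlinarith [hw o, mul_le_mul_of_nonneg_right hn2 (hw o)]
  have hc : ((g.erase x).card : ℝ) = g.card - 1 := by
    rw [Finset.card_erase_of_mem hx, Nat.cast_sub (Finset.card_pos.2 ⟨x, hx⟩)]
    simp
  have h1 : ∑ o, (∑ y ∈ g.erase x, if y ∈ kill o then w o else 0) = (g.card - 1) * π := by
    rw [Finset.sum_comm, Finset.sum_congr rfl
      (fun y hy => ha y (Finset.mem_of_mem_erase hy))]
    simp [hc]
  have h2 : ∑ o, (∑ y ∈ g, ∑ z ∈ g.erase y, if y ∈ kill o ∧ z ∈ kill o then w o else 0) ≤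
      g.card ^ 2 * δ := by
    rw [Finset.sum_comm]
    calc _ ≤ ∑ y ∈ g, (g.card : ℝ) * δ := by
          refine Finset.sum_le_sum fun y hy => ?_
          rw [Finset.sum_comm]
          calc _ ≤ ∑ z ∈ g.erase y, δ := Finset.sum_le_sum fun z hz =>
                hb y hy z (Finset.mem_of_mem_erase hz) (Finset.ne_of_mem_erase hz).symm
            _ = (g.erase y).card * δ := by simp
            _ ≤ g.card * δ := by
              gcongr
              exact Finset.erase_subset _ _
      _ = _ := by simp; ring
  calc _ ≤ ∑ o, ((∑ y ∈ g.erase x, if y ∈ kill o then w o else 0) -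
      (∑ y ∈ g, ∑ z ∈ g.erase y, if y ∈ kill o ∧ z ∈ kill o then w o else 0)) := by
        rw [Finset.sum_sub_distrib, h1]
        linarith
    _ ≤ _ := Finset.sum_le_sum fun o _ => hpt o

end Kill

/-- Number of edges of `S` met by the set `k`. -/
def lossOf {X E : Type*} [DecidableEq X] (vs : E → Finset X) (S : Finset E) (k : Finset X) : ℝ :=
  ((S.filter fun g => ¬ Disjoint k (vs g)).card : ℝ)

section Loss

variable {X E Ω : Type*} [DecidableEq X] [Fintype Ω] (vs : E → Finset X) (S : Finset E)

theorem lossOf_nonneg (k : Finset X) : 0 ≤ lossOf vs S k := Nat.cast_nonneg _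

theorem lossOf_le_sum (k : Finset X) (C : ℝ)
    (hC : ∀ y ∈ k, ((S.filter fun g => y ∈ vs g).card : ℝ) ≤ C) :
    lossOf vs S k ≤ k.card * C := by
  classical
  have : (S.filter fun g => ¬ Disjoint k (vs g)) ⊆ k.biUnion fun y =>
      S.filter fun g => y ∈ vs g := by
    intro g hg
    rw [Finset.mem_filter] at hg
    obtain ⟨y, hy, hy'⟩ := Finset.not_disjoint_iff.1 hg.2
    exact Finset.mem_biUnion.2 ⟨y, hy, Finset.mem_filter.2 ⟨hg.1, hy'⟩⟩
  calc lossOf vs S k ≤ ((k.biUnion fun y => S.filter fun g => y ∈ vs g).card : ℝ) := by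
        rw [lossOf]
        exact_mod_cast Finset.card_le_card this
    _ ≤ ∑ y ∈ k, ((S.filter fun g => y ∈ vs g).card : ℝ) := by
        exact_mod_cast Finset.card_biUnion_le
    _ ≤ ∑ y ∈ k, C := Finset.sum_le_sum hC
    _ = _ := by simp

theorem sum_mul_lossOf (w : Ω → ℝ) (kill : Ω → Finset X) (L : Ω → Prop) [DecidablePred L] :
    ∑ o, (if L o then w o * lossOf vs S (kill o) else 0) =
      ∑ g ∈ S, ∑ o, (if L o ∧ ¬ Disjoint (kill o) (vs g) then w o else 0) := by
  rw [Finset.sum_comm]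
  refine Finset.sum_congr rfl fun o _ => ?_
  split_ifs with h
  · simp only [h, true_and]
    rw [lossOf, Finset.card_filter]
    push_cast
    rw [Finset.mul_sum]
    refine Finset.sum_congr rfl fun g _ => ?_
    split_ifs <;> simp
  · simp [h]

theorem card_filter_sdiff (A k : Finset X) (P : E → Prop) [DecidablePred P] [Fintype E] :
    (((Finset.univ.filter fun g => vs g ⊆ A \ k ∧ P g).card : ℕ) : ℝ) =
    ((Finset.univ.filter fun g => vs g ⊆ A ∧ P g).card : ℝ) -
      lossOf vs (Finset.univ.filter fun g => vs g ⊆ A ∧ P g) k := by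
  rw [lossOf, eq_sub_iff_add_eq, ← Nat.cast_add, Nat.cast_inj]
  rw [← Finset.card_filter_add_card_filter_not
    (s := Finset.univ.filter fun g => vs g ⊆ A ∧ P g) (p := fun g => Disjoint k (vs g))]
  congr 2
  ext g
  simp only [Finset.mem_filter, Finset.mem_univ, true_and, Finset.subset_sdiff]
  constructor
  · rintro ⟨⟨h1, h2⟩, h3⟩
    exact ⟨⟨h1, h3⟩, h2.symm⟩
  · rintro ⟨⟨h1, h3⟩, h2⟩
    exact ⟨⟨h1, h2.symm⟩, h3⟩

end Loss

/-- Moment bounds for the one-step change of a normalised decreasing quantity. -/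
theorem ratio_step {Ω : Type*} [Fintype Ω] (w η : Ω → ℝ) (L : Ω → Prop) [DecidablePred L]
    (u ξ b m : ℝ)
    (hw : ∀ o, 0 ≤ w o) (hsum : ∑ o, w o = 1) (hu : 0 ≤ u) (hu2 : u ≤ 1 / 2) (hξ : 0 ≤ ξ)
    (hη0 : ∀ o, 0 ≤ η o) (hη : ∀ o, 0 < w o → L o → η o ≤ b)
    (hm : ∑ o, (if L o then w o * η o else 0) ≤ m) (hb : 0 ≤ b) :
    (∀ o, 0 < w o → L o → |(ξ * u - η o) / (1 - u)| ≤ 2 * (ξ * u + b)) ∧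
    ∑ o, (if L o then w o * ((ξ * u - η o) / (1 - u)) ^ 2 else 0) ≤
      4 * ((ξ * u) ^ 2 + b * m) ∧
    ∑ o, (if L o then w o * ((ξ * u - η o) / (1 - u)) else 0) =
      (ξ * u * ∑ o, (if L o then w o else 0) - ∑ o, (if L o then w o * η o else 0)) / (1 - u) := by
  have h1u : 0 < 1 - u := by linarith
  have hξu : 0 ≤ ξ * u := mul_nonneg hξ hu
  refine ⟨fun o ho hL => ?_, ?_, ?_⟩
  · have h1 := hη o ho hL
    have h2 := hη0 o
    rw [abs_div, abs_of_pos h1u, div_le_iff₀ h1u, abs_le]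
    constructor <;> nlinarith
  · have hpt : ∀ o, (if L o then w o * ((ξ * u - η o) / (1 - u)) ^ 2 else 0) ≤
        4 * (w o * (ξ * u) ^ 2 + b * (if L o then w o * η o else 0)) := by
      intro o
      split_ifs with h
      · rcases (hw o).eq_or_lt with h0 | h0
        · simp [← h0]
        · have h1 := hη o h0 h
          have h2 := hη0 o
          have h3 : ((ξ * u - η o) / (1 - u)) ^ 2 ≤ 4 * ((ξ * u) ^ 2 + b * η o) := by
            rw [div_pow, div_le_iff₀ (by positivity)]
            have h4 : 1 ≤ 4 * (1 - u) ^ 2 := by nlinarith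
            have h5 : (ξ * u - η o) ^ 2 ≤ (ξ * u) ^ 2 + b * η o := by nlinarith
            have h6 : 0 ≤ (ξ * u) ^ 2 + b * η o := by positivity
            nlinarith
          calc _ ≤ w o * (4 * ((ξ * u) ^ 2 + b * η o)) :=
                mul_le_mul_of_nonneg_left h3 (hw o)
            _ = _ := by ring
      · have := hw o
        simp only [mul_zero, add_zero]
        positivity
    refine (Finset.sum_le_sum fun o _ => hpt o).trans ?_
    rw [← Finset.mul_sum, Finset.sum_add_distrib, ← Finset.sum_mul, hsum, ← Finset.mul_sum]
    nlinarith [mul_le_mul_of_nonneg_left hm hb]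
  · rw [Finset.mul_sum, ← Finset.sum_sub_distrib, Finset.sum_div]
    refine Finset.sum_congr rfl fun o _ => ?_
    split_ifs <;> ring

/-- A random set `kill` hitting every element of `A` with probability exactly `π`, and every pair
with probability at most `δ'`. -/
structure KillLaw {X Ω : Type*} [DecidableEq X] [Fintype Ω] (A : Finset X) (w : Ω → ℝ)
    (kill : Ω → Finset X) (r : ℕ) (π δ' : ℝ) : Prop where
  nonneg : ∀ o, 0 ≤ w o
  sum_one : ∑ o, w o = 1
  hit : ∀ x ∈ A, ∑ o, (if x ∈ kill o then w o else 0) = π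
  pair : ∀ x ∈ A, ∀ y ∈ A, x ≠ y → ∑ o, (if x ∈ kill o ∧ y ∈ kill o then w o else 0) ≤ δ'
  card_le : ∀ o, (kill o).card ≤ r

section Steps

variable {X E Ω : Type*} [DecidableEq X] [Fintype Ω] {A : Finset X} {w : Ω → ℝ}
  {kill : Ω → Finset X} {r : ℕ} {π δ' : ℝ}

theorem KillLaw.avoid (law : KillLaw A w kill r π δ') {x : X} (hx : x ∈ A) :
    ∑ o, (if x ∉ kill o then w o else 0) = 1 - π := by
  have h := law.hit x hx
  rw [← law.sum_one, ← h, ← Finset.sum_sub_distrib]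
  refine Finset.sum_congr rfl fun o _ => ?_
  by_cases hh : x ∈ kill o <;> simp [hh]

theorem deg_step (law : KillLaw A w kill r π δ') (vs : E → Finset X) (S : Finset E) (x : X)
    (hx : x ∈ A) (hS : ∀ g ∈ S, vs g ⊆ A ∧ x ∈ vs g ∧ (vs g).card = r) (c N u : ℝ)
    (hr : 1 ≤ r) (hπ : 0 ≤ π) (hδ' : 0 ≤ δ') (hc : 0 ≤ c) (hN : 0 < N) (hu : u = (r - 1) * π)
    (hu2 : u ≤ 1 / 2) (hcod : ∀ y, x ≠ y → ((S.filter fun g => y ∈ vs g).card : ℝ) ≤ c)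
    (hξ : (S.card : ℝ) / N ≤ 2) :
    (∀ o, 0 < w o → x ∉ kill o →
      |(S.card / N * u - lossOf vs S (kill o) / N) / (1 - u)| ≤ 2 * (2 * u + r * c / N)) ∧
    ∑ o, (if x ∉ kill o then w o *
      ((S.card / N * u - lossOf vs S (kill o) / N) / (1 - u)) ^ 2 else 0) ≤
        4 * ((2 * u) ^ 2 + r * c / N * (2 * u)) ∧
    ∑ o, (if x ∉ kill o then w o *
      ((S.card / N * u - lossOf vs S (kill o) / N) / (1 - u)) else 0) ≤ 4 * r ^ 2 * δ' ∧
    -∑ o, (if x ∉ kill o then w o *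
      ((S.card / N * u - lossOf vs S (kill o) / N) / (1 - u)) else 0) ≤ 4 * u * π := by
  have hr1 : (1 : ℝ) ≤ r := by exact_mod_cast hr
  have hu0 : 0 ≤ u := by rw [hu]; exact mul_nonneg (by linarith) hπ
  have h1u : 0 < 1 - u := by linarith
  have hξ0 : 0 ≤ (S.card : ℝ) / N := by positivity
  have hmean : ∑ o, (if x ∉ kill o then w o * (lossOf vs S (kill o) / N) else 0) =
      (∑ g ∈ S, ∑ o, (if x ∉ kill o ∧ ¬ Disjoint (kill o) (vs g) then w o else 0)) / N := by
    rw [← sum_mul_lossOf, Finset.sum_div]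
    refine Finset.sum_congr rfl fun o _ => ?_
    split_ifs <;> ring
  have hup : ∑ o, (if x ∉ kill o then w o * (lossOf vs S (kill o) / N) else 0) ≤
      S.card / N * u := by
    rw [hmean, div_mul_eq_mul_div]
    gcongr
    calc _ ≤ ∑ g ∈ S, u := by
          refine Finset.sum_le_sum fun g hg => ?_
          obtain ⟨h1, h2, h3⟩ := hS g hg
          have := sum_hit_avoid_le w kill (vs g) x h2 π law.nonneg fun y hy => law.hit y (h1 hy)
          rwa [h3, ← hu] at this
      _ = _ := by simp
  have hlow : S.card / N * (u - r ^ 2 * δ') ≤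
      ∑ o, (if x ∉ kill o then w o * (lossOf vs S (kill o) / N) else 0) := by
    rw [hmean, div_mul_eq_mul_div]
    gcongr
    calc _ = ∑ g ∈ S, (u - r ^ 2 * δ') := by simp; ring
      _ ≤ _ := by
          refine Finset.sum_le_sum fun g hg => ?_
          obtain ⟨h1, h2, h3⟩ := hS g hg
          have := le_sum_hit_avoid w kill (vs g) x h2 π δ' hδ' law.nonneg
            (fun y hy => law.hit y (h1 hy))
            fun y hy z hz => law.pair y (h1 hy) z (h1 hz)
          rwa [h3, ← hu] at this
  have hav := law.avoid hx
  have hrc : 0 ≤ r * c / N := by positivity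
  obtain ⟨a1, a2, a3⟩ := ratio_step w (fun o => lossOf vs S (kill o) / N) (fun o => x ∉ kill o)
    u (S.card / N) (r * c / N) (2 * u) law.nonneg law.sum_one hu0 hu2 hξ0
    (fun o => div_nonneg (lossOf_nonneg _ _ _) hN.le)
    (by
      intro o _ ho
      gcongr
      refine (lossOf_le_sum vs S (kill o) c fun y hy => hcod y ?_).trans ?_
      · rintro rfl; exact ho hy
      · gcongr
        exact law.card_le o)
    (hup.trans (by gcongr)) hrc
  refine ⟨fun o ho hL => (a1 o ho hL).trans (by gcongr), a2.trans (by gcongr), ?_, ?_⟩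
  · rw [a3, hav, div_le_iff₀ h1u]
    have : (S.card : ℝ) / N * u * (1 - π) ≤ S.card / N * u := by
      nlinarith [mul_nonneg (mul_nonneg hξ0 hu0) hπ]
    have h2 : (S.card : ℝ) / N * (r ^ 2 * δ') ≤ 2 * (r ^ 2 * δ') := by gcongr
    have h3 : 0 ≤ r ^ 2 * δ' := by positivity
    nlinarith
  · rw [a3, hav, ← neg_div, div_le_iff₀ h1u]
    have h2 : (S.card : ℝ) / N * (u * π) ≤ 2 * (u * π) := by gcongr
    have h3 : 0 ≤ u * π := by positivity
    nlinarith

theorem weight_step (law : KillLaw A w kill r π δ') (Z : Finset X) (hZ : Z ⊆ A) (ω : X → ℝ)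
    (δ b ξ : ℝ) (hω0 : ∀ x, 0 ≤ ω x) (hωδ : ∀ x, ω x ≤ δ) (hπ : 0 ≤ π) (hπ2 : π ≤ 1 / 2)
    (hb : 0 < b) (hξ : ξ = (∑ x ∈ Z, ω x) / b) (Ξ : ℝ) (hΞ : ξ ≤ Ξ) (hδ : 0 ≤ δ):
    (∀ o, 0 < w o →
      |(ξ * π - (∑ x ∈ Z ∩ kill o, ω x) / b) / (1 - π)| ≤ 2 * (Ξ * π + r * δ / b)) ∧
    ∑ o, w o * ((ξ * π - (∑ x ∈ Z ∩ kill o, ω x) / b) / (1 - π)) ^ 2 ≤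
        4 * ((Ξ * π) ^ 2 + r * δ / b * (Ξ * π)) ∧
    ∑ o, w o * ((ξ * π - (∑ x ∈ Z ∩ kill o, ω x) / b) / (1 - π)) ≤ 0 := by
  have hξ0 : 0 ≤ ξ := by
    rw [hξ]; exact div_nonneg (Finset.sum_nonneg fun x _ => hω0 x) hb.le
  have hmean : ∑ o, w o * ((∑ x ∈ Z ∩ kill o, ω x) / b) = ξ * π := by
    calc _ = (∑ o, ∑ x ∈ Z, ω x * (if x ∈ kill o then w o else 0)) / b := by
          rw [Finset.sum_div]
          refine Finset.sum_congr rfl fun o _ => ?_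
          rw [← mul_div_assoc, ← Finset.sum_ite_mem, Finset.mul_sum]
          congr 1
          refine Finset.sum_congr rfl fun x _ => ?_
          split_ifs <;> ring
      _ = _ := by
          rw [Finset.sum_comm, hξ, div_mul_eq_mul_div, Finset.sum_mul]
          congr 1
          refine Finset.sum_congr rfl fun x hx => ?_
          rw [← Finset.mul_sum, law.hit x (hZ hx)]
  have hrb : 0 ≤ r * δ / b := by positivity
  obtain ⟨a1, a2, a3⟩ := ratio_step w (fun o => (∑ x ∈ Z ∩ kill o, ω x) / b) (fun _ => True)
    π ξ (r * δ / b) (ξ * π) law.nonneg law.sum_one hπ hπ2 hξ0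
    (fun o => div_nonneg (Finset.sum_nonneg fun x _ => hω0 x) hb.le)
    (by
      intro o _ _
      gcongr
      calc _ ≤ ∑ x ∈ Z ∩ kill o, δ := Finset.sum_le_sum fun x _ => hωδ x
        _ = (Z ∩ kill o).card * δ := by simp
        _ ≤ _ := by
          gcongr
          exact (Finset.card_le_card Finset.inter_subset_right).trans (law.card_le o))
    (by simpa using hmean.le) hrb
  simp only [if_true] at a2 a3
  refine ⟨fun o ho => (a1 o ho trivial).trans (by gcongr), a2.trans (by gcongr), ?_⟩
  rw [a3, hmean, law.sum_one]
  simp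

theorem edges_step (law : KillLaw A w kill r π δ') (vs : E → Finset X) (S : Finset E)
    (hS : ∀ g ∈ S, vs g ⊆ A ∧ (vs g).card = r) (c N u Ξ : ℝ)
    (hπ : 0 ≤ π) (hc : 0 ≤ c) (hN : 0 < N) (hu : u = r * π)
    (hu2 : u ≤ 1 / 2) (hcod : ∀ y, ((S.filter fun g => y ∈ vs g).card : ℝ) ≤ c)
    (hξ : (S.card : ℝ) / N ≤ Ξ) :
    (∀ o, 0 < w o →
      |(S.card / N * u - lossOf vs S (kill o) / N) / (1 - u)| ≤ 2 * (Ξ * u + r * c / N)) ∧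
    ∑ o, w o * ((S.card / N * u - lossOf vs S (kill o) / N) / (1 - u)) ^ 2 ≤
        4 * ((Ξ * u) ^ 2 + r * c / N * (Ξ * u)) ∧
    -∑ o, w o * ((S.card / N * u - lossOf vs S (kill o) / N) / (1 - u)) ≤ 0 := by
  have hu0 : 0 ≤ u := by rw [hu]; positivity
  have h1u : 0 < 1 - u := by linarith
  have hξ0 : 0 ≤ (S.card : ℝ) / N := by positivity
  have hmean : ∑ o, w o * (lossOf vs S (kill o) / N) ≤ S.card / N * u := by
    have h := sum_mul_lossOf vs S w kill (fun _ => True)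
    simp only [if_true, true_and] at h
    calc _ = (∑ o, w o * lossOf vs S (kill o)) / N := by
          rw [Finset.sum_div]
          exact Finset.sum_congr rfl fun o _ => by ring
      _ ≤ (∑ g ∈ S, u) / N := by
          rw [h]
          gcongr with g hg
          obtain ⟨h1, h3⟩ := hS g hg
          have := sum_hit_le w kill (vs g) π law.nonneg fun y hy => law.hit y (h1 hy)
          rwa [h3, ← hu] at this
      _ = _ := by simp; ring
  have hrc : 0 ≤ r * c / N := by positivity
  obtain ⟨a1, a2, a3⟩ := ratio_step w (fun o => lossOf vs S (kill o) / N) (fun _ => True)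
    u (S.card / N) (r * c / N) (S.card / N * u) law.nonneg law.sum_one hu0 hu2 hξ0
    (fun o => div_nonneg (lossOf_nonneg _ _ _) hN.le)
    (by
      intro o _ ho
      gcongr
      refine (lossOf_le_sum vs S (kill o) c fun y hy => hcod y).trans ?_
      gcongr
      exact law.card_le o)
    (by simpa using hmean) hrc
  simp only [if_true] at a2 a3
  refine ⟨fun o ho => (a1 o ho trivial).trans (by gcongr), a2.trans (by gcongr), ?_⟩
  rw [a3, law.sum_one, ← neg_div]
  refine div_nonpos_of_nonpos_of_nonneg ?_ h1u.le
  linarith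

/-- Moment bounds for a small nonnegative increment minus a deterministic compensator. -/
theorem compensated_step (w y : Ω → ℝ) (hw : ∀ o, 0 ≤ w o) (hsum : ∑ o, w o = 1) (δ m c : ℝ)
    (hy0 : ∀ o, 0 ≤ y o) (hy : ∀ o, y o ≤ δ) (hm : ∑ o, w o * y o ≤ m) (hc0 : 0 ≤ c) :
    (∀ o, |y o - c| ≤ δ + c) ∧ ∑ o, w o * (y o - c) ^ 2 ≤ δ * m + c ^ 2 ∧
    ∑ o, w o * (y o - c) = ∑ o, w o * y o - c := by
  have hδ : 0 ≤ δ := by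
    by_contra h
    have : Nonempty Ω := by
      by_contra hne
      rw [not_nonempty_iff] at hne
      simp at hsum
    obtain ⟨o⟩ := this
    linarith [hy0 o, hy o]
  refine ⟨fun o => abs_le.2 ⟨by linarith [hy0 o], by linarith [hy o]⟩, ?_, ?_⟩
  · calc _ ≤ ∑ o, (δ * (w o * y o) + w o * c ^ 2) := by
          refine Finset.sum_le_sum fun o _ => ?_
          have : (y o - c) ^ 2 ≤ δ * y o + c ^ 2 := by nlinarith [hy0 o, hy o]
          nlinarith [mul_le_mul_of_nonneg_left this (hw o)]
      _ = δ * ∑ o, w o * y o + c ^ 2 := by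
          rw [Finset.sum_add_distrib, ← Finset.mul_sum, ← Finset.sum_mul, hsum, one_mul]
      _ ≤ _ := by gcongr
  · simp only [mul_sub]
    rw [Finset.sum_sub_distrib, ← Finset.sum_mul, hsum, one_mul]

end Steps

section Law

variable {X E : Type*} [Fintype E] [DecidableEq X]

/-- Number of alive edges at `x`. -/
def aliveDeg (vs : E → Finset X) (A : Finset X) (x : X) : ℕ :=
  (Finset.univ.filter fun g => vs g ⊆ A ∧ x ∈ vs g).card

/-- The vertices removed by an elementary event: an edge, a single vertex, or nothing. -/
def killSet (vs : E → Finset X) : E ⊕ X ⊕ Unit → Finset X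
  | Sum.inl g => vs g
  | Sum.inr (Sum.inl y) => {y}
  | Sum.inr (Sum.inr _) => ∅

theorem sum_aliveDeg (vs : E → Finset X) (A : Finset X) (r : ℕ) (hvs : ∀ g, (vs g).card = r) :
    ∑ y ∈ A, aliveDeg vs A y = r * (Finset.univ.filter fun g => vs g ⊆ A).card := by
  simp only [aliveDeg, Finset.card_filter]
  rw [Finset.sum_comm, Finset.mul_sum]
  refine Finset.sum_congr rfl fun g _ => ?_
  by_cases h : vs g ⊆ A
  · simp only [h, true_and, if_true, mul_one]
    rw [← Finset.card_filter, ← hvs g]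
    congr 1
    ext y
    simp only [Finset.mem_filter]
    exact ⟨fun h => h.2, fun h' => ⟨h h', h'⟩⟩
  · simp [h]

variable [Fintype X]

/-- Probabilities of the elementary events in one step of the nibble. -/
noncomputable def stepWeight (vs : E → Finset X) (A : Finset X) (p D' : ℝ) : E ⊕ X ⊕ Unit → ℝ
  | Sum.inl g => if vs g ⊆ A then p else 0
  | Sum.inr (Sum.inl y) => if y ∈ A then p * (D' - aliveDeg vs A y) else 0
  | Sum.inr (Sum.inr _) => 1 - ((∑ g : E, if vs g ⊆ A then p else 0) +
      ∑ y : X, if y ∈ A then p * (D' - aliveDeg vs A y) else 0)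

theorem killLaw_step (vs : E → Finset X) (r : ℕ) (hr : 1 ≤ r) (hvs : ∀ g, (vs g).card = r)
    (A : Finset X) (p D' c : ℝ) (hp : 0 ≤ p)
    (hdeg : ∀ y ∈ A, (aliveDeg vs A y : ℝ) ≤ D') (hA : A.card * (p * D') ≤ 1)
    (hcod : ∀ x y, x ≠ y → ((Finset.univ.filter fun g => x ∈ vs g ∧ y ∈ vs g).card : ℝ) ≤ c) :
    KillLaw A (stepWeight vs A p D') (killSet vs) r (p * D') (p * c) := by
  have hr1 : (1 : ℝ) ≤ r := by exact_mod_cast hr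
  have hsum := sum_aliveDeg vs A r hvs
  have hsum' : ∑ y ∈ A, (aliveDeg vs A y : ℝ) =
      r * ((Finset.univ.filter fun g => vs g ⊆ A).card : ℝ) := by exact_mod_cast hsum
  have e1 : (∑ g : E, if vs g ⊆ A then p else 0) =
      (Finset.univ.filter fun g => vs g ⊆ A).card * p := by
    rw [← Finset.sum_filter]; simp
  have e2 : (∑ y : X, if y ∈ A then p * (D' - aliveDeg vs A y) else 0) =
      p * (A.card * D' - r * ((Finset.univ.filter fun g => vs g ⊆ A).card : ℝ)) := by
    rw [Finset.sum_ite_mem, Finset.univ_inter, ← Finset.mul_sum, Finset.sum_sub_distrib, hsum']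
    simp
  have htot : 0 ≤ 1 - ((∑ g : E, if vs g ⊆ A then p else 0) +
      ∑ y : X, if y ∈ A then p * (D' - aliveDeg vs A y) else 0) := by
    rw [e1, e2]
    have : (0 : ℝ) ≤ p * ((Finset.univ.filter fun g => vs g ⊆ A).card : ℝ) := by positivity
    nlinarith
  refine ⟨?_, ?_, ?_, ?_, ?_⟩
  · rintro (g | y | _)
    · simp only [stepWeight]; split_ifs <;> simp [hp]
    · simp only [stepWeight]
      split_ifs with h
      · exact mul_nonneg hp (by linarith [hdeg y h])
      · simp
    · exact htot
  · rw [Fintype.sum_sum_type, Fintype.sum_sum_type]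
    simp only [stepWeight, Finset.univ_unique, Finset.sum_singleton]
    ring
  · intro x hx
    rw [Fintype.sum_sum_type, Fintype.sum_sum_type]
    have h1 : ∀ g : E, (if x ∈ killSet vs (Sum.inl g) then stepWeight vs A p D' (Sum.inl g) else 0)
        = if vs g ⊆ A ∧ x ∈ vs g then p else 0 := by
      intro g
      by_cases h1 : x ∈ vs g <;> by_cases h2 : vs g ⊆ A <;> simp [killSet, stepWeight, h1, h2]
    have h2 : ∀ y : X, (if x ∈ killSet vs (Sum.inr (Sum.inl y)) then
        stepWeight vs A p D' (Sum.inr (Sum.inl y)) else 0)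
        = if y = x then p * (D' - aliveDeg vs A x) else 0 := by
      intro y
      by_cases h1 : y = x
      · subst h1; simp [killSet, stepWeight, hx]
      · simp [killSet, h1, Ne.symm h1]
    have h3 : ∀ u : Unit, (if x ∈ killSet vs (Sum.inr (Sum.inr u)) then
        stepWeight vs A p D' (Sum.inr (Sum.inr u)) else 0) = 0 := by
      intro u; simp [killSet]
    rw [Finset.sum_congr rfl fun g _ => h1 g, Finset.sum_congr rfl fun g _ => h2 g,
      Finset.sum_congr rfl fun g _ => h3 g, Finset.sum_ite_eq', ← Finset.sum_filter]
    simp [aliveDeg]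
    ring
  · intro x _ y _ hxy
    rw [Fintype.sum_sum_type, Fintype.sum_sum_type]
    have h1 : ∀ g : E, (if x ∈ killSet vs (Sum.inl g) ∧ y ∈ killSet vs (Sum.inl g) then
        stepWeight vs A p D' (Sum.inl g) else 0) ≤ if x ∈ vs g ∧ y ∈ vs g then p else 0 := by
      intro g
      by_cases h1 : x ∈ vs g <;> by_cases h2 : y ∈ vs g <;> by_cases h3 : vs g ⊆ A <;>
        simp [killSet, stepWeight, h1, h2, h3, hp]
    have h2 : ∀ z : X, (if x ∈ killSet vs (Sum.inr (Sum.inl z)) ∧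
        y ∈ killSet vs (Sum.inr (Sum.inl z)) then
        stepWeight vs A p D' (Sum.inr (Sum.inl z)) else 0) = 0 := by
      intro z
      rw [if_neg]
      simp only [killSet, Finset.mem_singleton]
      rintro ⟨rfl, rfl⟩
      exact hxy rfl
    have h3 : ∀ u : Unit, (if x ∈ killSet vs (Sum.inr (Sum.inr u)) ∧
        y ∈ killSet vs (Sum.inr (Sum.inr u)) then
        stepWeight vs A p D' (Sum.inr (Sum.inr u)) else 0) = 0 := by
      intro u; simp [killSet]
    rw [Finset.sum_congr rfl fun g _ => h2 g,
      Finset.sum_congr rfl fun g _ => h3 g]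
    calc _ ≤ ∑ g : E, (if x ∈ vs g ∧ y ∈ vs g then p else 0) := by
          simpa using Finset.sum_le_sum fun g _ => h1 g
      _ = p * ((Finset.univ.filter fun g => x ∈ vs g ∧ y ∈ vs g).card : ℝ) := by
          rw [← Finset.sum_filter]; simp; ring
      _ ≤ _ := mul_le_mul_of_nonneg_left (hcod x y hxy) hp
  · rintro (g | y | _)
    · exact (hvs g).le
    · simpa [killSet] using hr
    · simp [killSet]

theorem killSet_subset (vs : E → Finset X) (A : Finset X) (p D' : ℝ) (o : E ⊕ X ⊕ Unit)
    (ho : 0 < stepWeight vs A p D' o) : killSet vs o ⊆ A := by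
  rcases o with g | y | _
  · simp only [stepWeight] at ho
    split_ifs at ho with h
    · exact h
    · simp at ho
  · simp only [stepWeight] at ho
    split_ifs at ho with h
    · simpa [killSet] using h
    · simp at ho
  · simp [killSet]

end Law

open scoped Classical in
/-- The increments `y` on the event `L` are bounded by `B`, with drift at most `μ` and second moment
at most `ν`. -/
def SmallStep {Ω : Type*} [Fintype Ω] (w : Ω → ℝ) (L : Ω → Prop) (y : Ω → ℝ) (B μ ν : ℝ) : Prop :=
  (∀ o, 0 < w o → L o → |y o| ≤ B) ∧ ∑ o, (if L o then w o * y o else 0) ≤ μ ∧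
    ∑ o, (if L o then w o * y o ^ 2 else 0) ≤ ν

section SmallStep

variable {Ω : Type*} [Fintype Ω] {w : Ω → ℝ} {L L' : Ω → Prop} {y y' : Ω → ℝ} {B B' μ μ' ν ν' : ℝ}

theorem SmallStep.mono (h : SmallStep w L y B μ ν) (h1 : B ≤ B') (h2 : μ ≤ μ') (h3 : ν ≤ ν') :
    SmallStep w L y B' μ' ν' :=
  ⟨fun o ho hL => (h.1 o ho hL).trans h1, h.2.1.trans h2, h.2.2.trans h3⟩

theorem SmallStep.congr (h : SmallStep w L y B μ ν) (hw : ∀ o, 0 ≤ w o) (hL : ∀ o, L o ↔ L' o)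
    (hy : ∀ o, 0 < w o → y o = y' o) : SmallStep w L' y' B μ ν := by
  obtain rfl : L = L' := funext fun o => propext (hL o)
  refine ⟨fun o ho hLo => hy o ho ▸ h.1 o ho hLo, le_trans (le_of_eq ?_) h.2.1,
    le_trans (le_of_eq ?_) h.2.2⟩ <;>
  · refine Finset.sum_congr rfl fun o _ => ?_
    rcases (hw o).eq_or_lt with h0 | h0
    · simp [← h0]
    · rw [hy o h0]

theorem SmallStep.of_pos [DecidablePred L] (h1 : ∀ o, 0 < w o → L o → |y o| ≤ B)
    (h2 : ∑ o, (if L o then w o * y o ^ 2 else 0) ≤ ν)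
    (h3 : ∑ o, (if L o then w o * y o else 0) ≤ μ) : SmallStep w L y B μ ν :=
  ⟨h1, by convert h3, by convert h2⟩

theorem SmallStep.of_neg [DecidablePred L] (h1 : ∀ o, 0 < w o → L o → |y o| ≤ B)
    (h2 : ∑ o, (if L o then w o * y o ^ 2 else 0) ≤ ν)
    (h3 : -∑ o, (if L o then w o * y o else 0) ≤ μ) : SmallStep w L (fun o => -y o) B μ ν := by
  classical
  refine ⟨fun o ho hL => by rw [abs_neg]; exact h1 o ho hL, ?_, ?_⟩
  · rw [← Finset.sum_neg_distrib] at h3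
    convert h3 using 2 with o
    split_ifs <;> simp
  · simp only [neg_sq]
    convert h2

end SmallStep

theorem ratio_change (a l N u : ℝ) (hN : N ≠ 0) (hu : 1 - u ≠ 0) :
    (a / N * u - l / N) / (1 - u) = (a - l) / (N * (1 - u)) - a / N := by
  field_simp
  ring

section Stats

variable {X E Ω : Type*} [Fintype E] [DecidableEq X] [Fintype Ω] {A : Finset X} {w : Ω → ℝ}
  {kill : Ω → Finset X} {r : ℕ} {π δ' : ℝ}

theorem q_facts (r : ℕ) (hr : 1 ≤ r) (q : ℝ) (hq : 0 < q) (hq1 : q ≤ 1) (Q : ℝ)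
    (hQ : Q = r ^ 2 / q ^ 2) :
    1 ≤ Q ∧ (r : ℝ) ≤ Q ∧ (r : ℝ) ^ 2 ≤ Q ∧ r / q ≤ Q ∧ (r : ℝ) ^ 2 / q ≤ Q ∧ r / q ^ 2 ≤ Q ∧
      1 / q ≤ Q ∧
      1 / q ^ 2 ≤ Q := by
  have hr1 : (1 : ℝ) ≤ r := by exact_mod_cast hr
  have h2 : (r : ℝ) ≤ r ^ 2 := by nlinarith
  have h3 : q ^ 2 ≤ q := by nlinarith
  have h4 : q ^ 2 ≤ 1 := by nlinarith
  have hq2 : 0 < q ^ 2 := by positivity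
  have h1 : (1 : ℝ) ≤ r ^ 2 := by nlinarith
  subst hQ
  refine ⟨?_, ?_, ?_, ?_, ?_, ?_, ?_, ?_⟩
  · rw [le_div_iff₀ hq2]; nlinarith
  · rw [le_div_iff₀ hq2]; nlinarith
  · rw [le_div_iff₀ hq2]; nlinarith
  all_goals gcongr

theorem degree_stats (law : KillLaw A w kill r π δ') (vs : E → Finset X)
    (hvs : ∀ g, (vs g).card = r) (x : X) (hx : x ∈ A) (D s q δ : ℝ)
    (hr : 1 ≤ r) (hπ : 0 ≤ π) (hπδ : π ≤ δ) (hδ' : 0 ≤ δ') (hδ'q : δ' ≤ π * δ / q)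
    (hD : 0 < D) (hq : 0 < q) (hqs : q ≤ s) (hs1 : s ≤ 1)
    (hπr : r * π ≤ 1 / 2)
    (hcod : ∀ y, x ≠ y → ((Finset.univ.filter fun g => x ∈ vs g ∧ y ∈ vs g).card : ℝ) ≤ δ * D)
    (hξ : (aliveDeg vs A x : ℝ) / (D * s) ≤ 2) :
    let C := 100 * (r ^ 2 / q ^ 2 : ℝ)
    let y := fun o => (aliveDeg vs (A \ kill o) x : ℝ) / (D * (s * (1 - (r - 1) * π))) -
      (aliveDeg vs A x : ℝ) / (D * s)
    SmallStep w (fun o => x ∉ kill o) y (C * δ) (C * δ * π) (C * δ * π) ∧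
    SmallStep w (fun o => x ∉ kill o) (fun o => - y o) (C * δ) (C * δ * π) (C * δ * π) := by
  intro C y
  classical
  have hr1 : (1 : ℝ) ≤ r := by exact_mod_cast hr
  obtain ⟨Q1, Q2, Q3, Q4, Q5, Q6, Q7, Q8⟩ := q_facts r hr q hq (hqs.trans hs1) _ rfl
  set Q : ℝ := r ^ 2 / q ^ 2 with hQ
  have hδ : 0 ≤ δ := hπ.trans hπδ
  have hs : 0 < s := hq.trans_le hqs
  set u : ℝ := (r - 1) * π with hu
  have hu0 : 0 ≤ u := mul_nonneg (by linarith) hπ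
  have hur : u ≤ r * π := by rw [hu]; nlinarith
  have hN : 0 < D * s := by positivity
  set S := Finset.univ.filter fun g => vs g ⊆ A ∧ x ∈ vs g with hS
  obtain ⟨a1, a2, a3, a4⟩ := deg_step law vs S x hx
    (fun g hg => by
      rw [hS, Finset.mem_filter] at hg
      exact ⟨hg.2.1, hg.2.2, hvs g⟩) (δ * D) (D * s) u hr hπ hδ' (by positivity) hN hu
      (hur.trans hπr)
      (fun y hxy => le_trans (by
        gcongr
        intro g hg
        simp only [hS, Finset.mem_filter, Finset.mem_univ, true_and] at hg ⊢
        exact ⟨hg.1.2, hg.2⟩) (hcod y hxy)) hξ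
  have hy : ∀ o, (S.card / (D * s) * u - lossOf vs S (kill o) / (D * s)) / (1 - u) = y o := by
    intro o
    rw [ratio_change _ _ _ _ hN.ne' (by linarith), ← card_filter_sdiff, mul_assoc]
    rfl
  simp only [hy] at a1 a2 a3 a4
  have hc : r * (δ * D) / (D * s) = r / s * δ := by field_simp
  have hrs : r / s * δ ≤ Q * δ := by
    have : (r : ℝ) / s ≤ r / q := by gcongr
    gcongr; linarith
  have hu1 : u ≤ Q * δ := hur.trans (by gcongr)
  have hu2 : u ^ 2 ≤ Q * δ * π := by
    calc u ^ 2 ≤ (r * π) ^ 2 := by gcongr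
      _ = r ^ 2 * π * π := by ring
      _ ≤ Q * δ * π := by gcongr
  have hu3 : r / s * δ * u ≤ Q * δ * π := by
    calc r / s * δ * u ≤ r / q * δ * (r * π) := by gcongr
      _ = (r ^ 2 / q) * δ * π := by ring
      _ ≤ _ := by gcongr
  have hu4 : (r : ℝ) ^ 2 * δ' ≤ Q * δ * π := by
    calc (r : ℝ) ^ 2 * δ' ≤ r ^ 2 * (π * δ / q) := by gcongr
      _ = (r ^ 2 / q) * δ * π := by ring
      _ ≤ _ := by gcongr
  have hu5 : u * π ≤ Q * δ * π := by gcongr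
  have hQδ : 0 ≤ Q * δ := by positivity
  have hQδπ : 0 ≤ Q * δ * π := by positivity
  rw [hc] at a1 a2
  have b1 : 2 * (2 * u + r / s * δ) ≤ C * δ := by
    simp only [C]; linarith
  have b2 : 4 * ((2 * u) ^ 2 + r / s * δ * (2 * u)) ≤ C * δ * π := by
    simp only [C]; nlinarith
  refine ⟨(SmallStep.of_pos a1 a2 a3).mono b1 ?_ b2, (SmallStep.of_neg a1 a2 a4).mono b1 ?_ b2⟩
  · simp only [C]; linarith
  · simp only [C]; linarith

theorem weight_stats (law : KillLaw A w kill r π δ') (M : Finset X) (ω : X → ℝ) (b q δ : ℝ)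
    (hr : 1 ≤ r) (hω0 : ∀ x, 0 ≤ ω x) (hωδ : ∀ x, ω x ≤ δ) (hω1 : ∑ x ∈ M, ω x ≤ 1)
    (hπ : 0 ≤ π) (hπδ : π ≤ δ) (hπ2 : π ≤ 1 / 2) (hq : 0 < q) (hqb : q ≤ b) (hb1 : b ≤ 1) :
    let C := 100 * (r ^ 2 / q ^ 2 : ℝ)
    SmallStep w (fun _ => True) (fun o => (∑ x ∈ M ∩ (A \ kill o), ω x) / (b * (1 - π)) -
      (∑ x ∈ M ∩ A, ω x) / b) (C * δ) (C * δ * π) (C * δ * π) := by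
  intro C
  classical
  obtain ⟨Q1, Q2, Q3, Q4, Q5, Q6, Q7, Q8⟩ := q_facts r hr q hq (hqb.trans hb1) _ rfl
  set Q : ℝ := r ^ 2 / q ^ 2 with hQ
  have hδ : 0 ≤ δ := hπ.trans hπδ
  have hb : 0 < b := hq.trans_le hqb
  have hΞ : (∑ x ∈ M ∩ A, ω x) / b ≤ 1 / q := by
    have h1 : ∑ x ∈ M ∩ A, ω x ≤ 1 := le_trans
      (Finset.sum_le_sum_of_subset_of_nonneg Finset.inter_subset_left fun x _ _ => hω0 x) hω1
    have h0 : 0 ≤ ∑ x ∈ M ∩ A, ω x := Finset.sum_nonneg fun x _ => hω0 x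
    gcongr
  obtain ⟨a1, a2, a3⟩ := weight_step law (M ∩ A) Finset.inter_subset_right ω δ b _ hω0 hωδ hπ
    hπ2 hb rfl (1 / q) hΞ hδ
  have hy : ∀ o, ((∑ x ∈ M ∩ A, ω x) / b * π - (∑ x ∈ M ∩ A ∩ kill o, ω x) / b) / (1 - π) =
      (∑ x ∈ M ∩ (A \ kill o), ω x) / (b * (1 - π)) - (∑ x ∈ M ∩ A, ω x) / b := by
    intro o
    rw [ratio_change _ _ _ _ hb.ne' (by linarith)]
    congr 2
    rw [sub_eq_iff_eq_add, ← Finset.sum_union]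
    · congr 1
      ext x
      simp only [Finset.mem_inter, Finset.mem_union, Finset.mem_sdiff]
      tauto
    · rw [Finset.disjoint_left]
      intro x h1 h2
      simp only [Finset.mem_inter, Finset.mem_sdiff] at h1 h2
      exact h1.2.2 h2.2
  simp only [hy] at a1 a2 a3
  have hrb : r * δ / b ≤ Q * δ := by
    calc r * δ / b ≤ r * δ / q := by gcongr
      _ = r / q * δ := by ring
      _ ≤ _ := by gcongr
  have h1 : 1 / q * π ≤ Q * δ := by gcongr
  have h2 : (1 / q * π) ^ 2 ≤ Q * δ * π := by
    calc (1 / q * π) ^ 2 = 1 / q ^ 2 * π * π := by ring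
      _ ≤ _ := by gcongr
  have h3 : r * δ / b * (1 / q * π) ≤ Q * δ * π := by
    calc r * δ / b * (1 / q * π) ≤ r * δ / q * (1 / q * π) := by gcongr
      _ = r / q ^ 2 * δ * π := by ring
      _ ≤ _ := by gcongr
  have hQδ : 0 ≤ Q * δ := by positivity
  have hQδπ : 0 ≤ Q * δ * π := by positivity
  have := SmallStep.of_pos (L := fun _ => True) (w := w) (fun o ho _ => a1 o ho)
    (by simpa only [if_true] using a2) (by simpa only [if_true] using a3)
  refine this.mono ?_ ?_ ?_ <;> simp only [C] <;> linarith

theorem edges_stats [DecidableEq E] (law : KillLaw A w kill r π δ') (vs : E → Finset X)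
    (hvs : ∀ g, (vs g).card = r) (𝓖 : Finset E) (D σ q δ : ℝ)
    (hr : 1 ≤ r) (hπ : 0 ≤ π) (hπδ : π ≤ δ)
    (hD : 0 < D) (hq : 0 < q) (hqσ : q ≤ σ) (hσ1 : σ ≤ 1)
    (hπr : r * π ≤ 1 / 2)
    (hdeg : ∀ y, ((Finset.univ.filter fun g => y ∈ vs g).card : ℝ) ≤ D)
    (h𝓖 : D ≤ δ * 𝓖.card) :
    let C := 100 * (r ^ 2 / q ^ 2 : ℝ)
    SmallStep w (fun _ => True) (fun o =>
      -(((Finset.univ.filter fun g => vs g ⊆ A \ kill o ∧ g ∈ 𝓖).card : ℝ) /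
        (𝓖.card * (σ * (1 - r * π))) -
        ((Finset.univ.filter fun g => vs g ⊆ A ∧ g ∈ 𝓖).card : ℝ) / (𝓖.card * σ)))
      (C * δ) (C * δ * π) (C * δ * π) := by
  intro C
  classical
  obtain ⟨Q1, Q2, Q3, Q4, Q5, Q6, Q7, Q8⟩ := q_facts r hr q hq (hqσ.trans hσ1) _ rfl
  set Q : ℝ := r ^ 2 / q ^ 2 with hQ
  have hδ : 0 ≤ δ := hπ.trans hπδ
  have hσ : 0 < σ := hq.trans_le hqσ
  have hG : (0 : ℝ) < 𝓖.card := by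
    rcases (Nat.cast_nonneg (α := ℝ) 𝓖.card).eq_or_lt with h | h
    · rw [← h] at h𝓖; linarith
    · exact h
  set S := Finset.univ.filter fun g => vs g ⊆ A ∧ g ∈ 𝓖 with hS
  have hN : 0 < 𝓖.card * σ := by positivity
  have hSG : (S.card : ℝ) ≤ 𝓖.card := by
    gcongr
    intro g hg
    exact (Finset.mem_filter.1 hg).2.2
  obtain ⟨a1, a2, a3⟩ := edges_step law vs S
    (fun g hg => by
      rw [hS, Finset.mem_filter] at hg
      exact ⟨hg.2.1, hvs g⟩) D (𝓖.card * σ) (r * π) (1 / q) hπ hD.le hN rfl hπr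
      (fun y => le_trans (by
        gcongr
        exact Finset.subset_univ _) (hdeg y))
      (by
        rw [div_le_div_iff₀ hN hq]
        calc S.card * q ≤ 𝓖.card * σ := by gcongr
          _ = _ := by ring)
  have hy : ∀ o, (S.card / (𝓖.card * σ) * (r * π) - lossOf vs S (kill o) / (𝓖.card * σ)) /
      (1 - r * π) = ((Finset.univ.filter fun g => vs g ⊆ A \ kill o ∧ g ∈ 𝓖).card : ℝ) /
        (𝓖.card * (σ * (1 - r * π))) - S.card / (𝓖.card * σ) := by
    intro o
    rw [ratio_change _ _ _ _ hN.ne' (by linarith), ← card_filter_sdiff, mul_assoc]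
  simp only [hy] at a1 a2 a3
  have hc0 : D / (𝓖.card * σ) ≤ δ / q := by
    rw [div_le_div_iff₀ hN hq]
    calc D * q ≤ δ * 𝓖.card * σ := by gcongr
      _ = _ := by ring
  have hc : r * D / (𝓖.card * σ) ≤ r / q * δ := by
    calc r * D / (𝓖.card * σ) = r * (D / (𝓖.card * σ)) := by ring
      _ ≤ r * (δ / q) := by gcongr
      _ = _ := by ring
  have hrb : r / q * δ ≤ Q * δ := by gcongr
  have h1 : 1 / q * (r * π) ≤ Q * δ := by
    calc 1 / q * (r * π) = r / q * π := by ring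
      _ ≤ _ := by gcongr
  have h2 : (1 / q * (r * π)) ^ 2 ≤ Q * δ * π := by
    calc (1 / q * (r * π)) ^ 2 = Q * π * π := by rw [hQ]; ring
      _ ≤ _ := by gcongr
  have h3 : r * D / (𝓖.card * σ) * (1 / q * (r * π)) ≤ Q * δ * π := by
    calc _ ≤ r / q * δ * (1 / q * (r * π)) := by gcongr
      _ = Q * δ * π := by rw [hQ]; ring
  have hQδ : 0 ≤ Q * δ := by positivity
  have hQδπ : 0 ≤ Q * δ * π := by positivity
  have := SmallStep.of_neg (L := fun _ => True) (w := w) (fun o ho _ => a1 o ho)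
    (by simpa only [if_true] using a2) (by simpa only [if_true] using a3)
  refine this.mono ?_ ?_ ?_ <;> simp only [C] <;> linarith

end Stats

section Waste

variable {X E : Type*} [Fintype E] [DecidableEq X] [Fintype X]

/-- The vertex wasted by an elementary event. -/
def wasteSet : E ⊕ X ⊕ Unit → Finset X
  | Sum.inl _ => ∅
  | Sum.inr (Sum.inl y) => {y}
  | Sum.inr (Sum.inr _) => ∅

/-- The edge picked by an elementary event. -/
def pickSet : E ⊕ X ⊕ Unit → Finset E
  | Sum.inl g => {g}
  | Sum.inr _ => ∅

theorem waste_stats {vs : E → Finset X} {A : Finset X} {p D' δ' π : ℝ} {r : ℕ}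
    (law : KillLaw A (stepWeight vs A p D') (killSet vs) r π δ') (M W : Finset X) (ω : X → ℝ)
    (c δ : ℝ) (hω0 : ∀ x, 0 ≤ ω x) (hωδ : ∀ x, ω x ≤ δ) (hω1 : ∑ x ∈ M, ω x ≤ 1)
    (hπ : 0 ≤ π) (hπδ : π ≤ δ) (hc0 : 0 ≤ c) (hc1 : c ≤ 1)
    (hc : ∀ y ∈ A, y ∈ M → p * (D' - aliveDeg vs A y) ≤ c * π) :
    SmallStep (stepWeight vs A p D') (fun _ => True) (fun o => ∑ x ∈ M ∩ (W ∪ wasteSet o), ω x -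
      ∑ x ∈ M ∩ W, ω x - c * π) (2 * δ) 0 (2 * (δ * π)) := by
  have hδ : 0 ≤ δ := hπ.trans hπδ
  set w := stepWeight vs A p D' with hw
  set y : E ⊕ X ⊕ Unit → ℝ := fun o => ∑ x ∈ M ∩ (W ∪ wasteSet o), ω x - ∑ x ∈ M ∩ W, ω x with hy
  have hy0 : ∀ o, 0 ≤ y o := fun o => sub_nonneg.2 <|
    Finset.sum_le_sum_of_subset_of_nonneg (by gcongr; exact Finset.subset_union_left)
      fun x _ _ => hω0 x
  have hyu : ∀ o, y o ≤ ∑ x ∈ M ∩ wasteSet o, ω x := fun o => by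
    rw [hy, sub_le_iff_le_add, add_comm, Finset.inter_union_distrib_left,
      ← Finset.sum_union_inter]
    exact le_add_of_nonneg_right (Finset.sum_nonneg fun x _ => hω0 x)
  have hyδ : ∀ o, y o ≤ δ := by
    intro o
    refine (hyu o).trans ?_
    rcases o with g | z | _
    · simpa [wasteSet] using hδ
    · simp only [wasteSet]
      refine (Finset.sum_le_sum_of_subset_of_nonneg Finset.inter_subset_right
        fun x _ _ => hω0 x).trans ?_
      simpa using hωδ z
    · simpa [wasteSet] using hδ
  have hm : ∑ o, w o * y o ≤ c * π := by
    calc _ ≤ ∑ o, w o * ∑ x ∈ M ∩ wasteSet o, ω x :=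
          Finset.sum_le_sum fun o _ => mul_le_mul_of_nonneg_left (hyu o) (law.nonneg o)
      _ = ∑ z : X, w (Sum.inr (Sum.inl z)) * ∑ x ∈ M ∩ {z}, ω x := by
          rw [Fintype.sum_sum_type, Fintype.sum_sum_type]
          simp [wasteSet]
      _ ≤ ∑ z : X, if z ∈ M then c * π * ω z else 0 := by
          refine Finset.sum_le_sum fun z _ => ?_
          by_cases hz : z ∈ M
          · rw [if_pos hz, Finset.inter_singleton_of_mem hz, Finset.sum_singleton]
            refine mul_le_mul_of_nonneg_right ?_ (hω0 z)
            simp only [hw, stepWeight]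
            split_ifs with hA
            · exact hc z hA hz
            · positivity
          · simp [hz]
      _ = c * π * ∑ x ∈ M, ω x := by
          rw [Finset.sum_ite_mem, Finset.univ_inter, Finset.mul_sum]
      _ ≤ c * π * 1 := by gcongr
      _ = _ := mul_one _
  obtain ⟨a1, a2, a3⟩ := compensated_step w y law.nonneg law.sum_one δ (c * π) (c * π) hy0 hyδ hm
    (by positivity)
  have hcπ : c * π ≤ π := mul_le_of_le_one_left hπ hc1
  have h0 : 0 ≤ c * π := by positivity
  refine (SmallStep.of_pos (μ := 0) (L := fun _ => True) (fun o _ _ => a1 o)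
    (by simpa only [if_true] using a2) ?_).mono (by linarith) le_rfl ?_
  · simp only [if_true, a3]
    linarith
  · have : δ * (c * π) ≤ δ * π := by gcongr
    have : (c * π) ^ 2 ≤ δ * π := by
      calc (c * π) ^ 2 ≤ π ^ 2 := by gcongr
        _ = π * π := sq π
        _ ≤ _ := by gcongr
    linarith

theorem pick_stats [DecidableEq E] {vs : E → Finset X} {A : Finset X} {p D' δ' π : ℝ} {r : ℕ}
    (law : KillLaw A (stepWeight vs A p D') (killSet vs) r π δ') (Mt 𝓖 : Finset E)
    (hMt : ∀ g ∈ Mt, ¬ vs g ⊆ A) (D σ q δ : ℝ) (hq : 0 < q) (hq1 : q ≤ 1) (hp : 0 ≤ p) (hD : 0 < D)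
    (hπ : 0 ≤ π) (hπδ : π ≤ δ) (hσ0 : 0 ≤ σ) (hσ1 : σ ≤ 1) (h𝓖 : D ≤ δ * 𝓖.card)
    (hpD : p * D ≤ π / q)
    (hlow : π * σ / 4 ≤
      p * D * (((Finset.univ.filter fun g => vs g ⊆ A ∧ g ∈ 𝓖).card : ℝ) / 𝓖.card)) :
    SmallStep (stepWeight vs A p D') (fun _ => True) (fun o =>
      -(D * ((Mt ∪ pickSet o) ∩ 𝓖).card / 𝓖.card - D * (Mt ∩ 𝓖).card / 𝓖.card - π * σ / 4))
        (2 * δ) 0 (2 * (δ * π) / q) := by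
  have hδ : 0 ≤ δ := hπ.trans hπδ
  have hG : (0 : ℝ) < 𝓖.card := by
    rcases (Nat.cast_nonneg (α := ℝ) 𝓖.card).eq_or_lt with h | h
    · rw [← h] at h𝓖; linarith
    · exact h
  set w := stepWeight vs A p D' with hw
  set y : E ⊕ X ⊕ Unit → ℝ := fun o => D * ((Mt ∪ pickSet o) ∩ 𝓖).card / 𝓖.card -
    D * (Mt ∩ 𝓖).card / 𝓖.card with hy
  have hDG : D / 𝓖.card ≤ δ := by rwa [div_le_iff₀ hG]
  have hcard : ∀ o : E ⊕ X ⊕ Unit, ((Mt ∪ pickSet o) ∩ 𝓖).card ≤ (Mt ∩ 𝓖).card + 1 := by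
    intro o
    have h1 : (pickSet o).card ≤ 1 := by
      rcases o with g | z <;> simp [pickSet]
    rw [Finset.union_inter_distrib_right]
    refine (Finset.card_union_le _ _).trans ?_
    gcongr
    exact (Finset.card_le_card Finset.inter_subset_left).trans h1
  have hy0 : ∀ o, 0 ≤ y o := by
    intro o
    simp only [hy]
    rw [sub_nonneg]
    gcongr
    exact Finset.subset_union_left
  have hyδ : ∀ o, y o ≤ δ := by
    intro o
    refine le_trans ?_ hDG
    simp only [hy]
    rw [← sub_div, ← mul_sub]
    gcongr
    have h : (((Mt ∪ pickSet o) ∩ 𝓖).card : ℝ) ≤ (Mt ∩ 𝓖).card + 1 := by exact_mod_cast hcard o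
    nlinarith
  have hm : ∑ o, w o * y o =
      p * D * (((Finset.univ.filter fun g => vs g ⊆ A ∧ g ∈ 𝓖).card : ℝ) / 𝓖.card) := by
    rw [Fintype.sum_sum_type]
    have h2 : ∑ z : X ⊕ Unit, w (Sum.inr z) * y (Sum.inr z) = 0 := by
      refine Finset.sum_eq_zero fun z _ => ?_
      simp [hy, pickSet]
    have h1 : ∀ g : E, w (Sum.inl g) * y (Sum.inl g) =
        if vs g ⊆ A ∧ g ∈ 𝓖 then p * (D / 𝓖.card) else 0 := by
      intro g
      by_cases hA : vs g ⊆ A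
      · have hg : g ∉ Mt := fun h => hMt g h hA
        by_cases h𝓖g : g ∈ 𝓖
        · have : ((Mt ∪ {g}) ∩ 𝓖).card = (Mt ∩ 𝓖).card + 1 := by
            rw [Finset.union_inter_distrib_right, Finset.singleton_inter_of_mem h𝓖g,
              Finset.card_union_of_disjoint, Finset.card_singleton]
            simp [hg]
          simp only [hw, stepWeight, hA, hy, pickSet, h𝓖g, this, if_true, true_and]
          push_cast
          ring
        · simp [hy, pickSet, h𝓖g]
      · simp [hw, stepWeight, hA]
    rw [h2, add_zero, Finset.sum_congr rfl fun g _ => h1 g, ← Finset.sum_filter]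
    simp
    ring
  have hGle : ((Finset.univ.filter fun g => vs g ⊆ A ∧ g ∈ 𝓖).card : ℝ) / 𝓖.card ≤ 1 := by
    rw [div_le_one hG]
    gcongr
    intro g hg
    exact (Finset.mem_filter.1 hg).2.2
  have hm' : ∑ o, w o * y o ≤ π / q := by
    rw [hm]
    calc _ ≤ p * D * 1 := by gcongr
      _ ≤ _ := by simpa using hpD
  obtain ⟨a1, a2, a3⟩ := compensated_step w y law.nonneg law.sum_one δ (π / q) (π * σ / 4) hy0 hyδ
    hm' (by positivity)
  have hcπ : π * σ / 4 ≤ π := by nlinarith [mul_nonneg hπ hσ0]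
  have h0 : 0 ≤ π * σ / 4 := by positivity
  refine (SmallStep.of_neg (μ := 0) (L := fun _ => True) (fun o _ _ => a1 o)
    (by simpa only [if_true] using a2) ?_).mono (by linarith) le_rfl ?_
  · simp only [if_true, a3, hm]
    linarith
  · have : (π * σ / 4) ^ 2 ≤ δ * π / q := by
      calc (π * σ / 4) ^ 2 ≤ π ^ 2 := by gcongr
        _ = π * π := sq π
        _ ≤ δ * π := by gcongr
        _ ≤ δ * π / q := by
          rw [le_div_iff₀ hq]
          exact mul_le_of_le_one_right (by positivity) hq1
    calc _ ≤ δ * (π / q) + δ * π / q := by gcongr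
      _ = _ := by ring

end Waste

section Core

variable {X E J K : Type} [DecidableEq X] [DecidableEq E]

/-- The state of the nibble: alive vertices, wasted vertices and chosen edges. -/
structure NibbleState (X E : Type) where
  alive : Finset X
  waste : Finset X
  chosen : Finset E

/-- Invariant of the nibble: the chosen edges form a matching avoiding the alive vertices, and the
vertices which are neither alive nor wasted are covered. -/
def NibbleInv (vs : E → Finset X) (s : NibbleState X E) : Prop :=
  (∀ g ∈ s.chosen, Disjoint (vs g) s.alive) ∧
  (∀ g ∈ s.chosen, ∀ g' ∈ s.chosen, g ≠ g' → Disjoint (vs g) (vs g')) ∧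
  ∀ x, x ∈ s.alive ∨ x ∈ s.waste ∨ ∃ g ∈ s.chosen, x ∈ vs g

/-- The state after an elementary event. -/
def nibbleNext (vs : E → Finset X) (s : NibbleState X E) (o : E ⊕ X ⊕ Unit) : NibbleState X E :=
  ⟨s.alive \ killSet vs o, s.waste ∪ wasteSet o, s.chosen ∪ pickSet o⟩

theorem nibbleInv_next (vs : E → Finset X) (s : NibbleState X E) (h : NibbleInv vs s)
    (o : E ⊕ X ⊕ Unit) (ho : killSet vs o ⊆ s.alive) : NibbleInv vs (nibbleNext vs s o) := by
  obtain ⟨h1, h2, h3⟩ := h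
  refine ⟨?_, ?_, ?_⟩
  · intro g hg
    simp only [nibbleNext, Finset.mem_union] at hg ⊢
    rcases hg with hg | hg
    · exact (h1 g hg).mono_right Finset.sdiff_subset
    · rcases o with g' | z
      · simp only [pickSet, Finset.mem_singleton] at hg
        subst hg
        exact Finset.disjoint_sdiff
      · simp [pickSet] at hg
  · rcases o with g₀ | z
    · have hd : ∀ g ∈ s.chosen, Disjoint (vs g) (vs g₀) := fun g hg => (h1 g hg).mono_right ho
      intro g hg g' hg' hne
      simp only [nibbleNext, Finset.mem_union, pickSet, Finset.mem_singleton] at hg hg'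
      rcases hg with hg | hg <;> rcases hg' with hg' | hg'
      · exact h2 g hg g' hg' hne
      · exact hg' ▸ hd g hg
      · exact hg ▸ (hd g' hg').symm
      · exact absurd (hg.trans hg'.symm) hne
    · simpa [nibbleNext, pickSet] using h2
  · intro x
    simp only [nibbleNext, Finset.mem_union, Finset.mem_sdiff]
    rcases h3 x with hx | hx | ⟨g, hg, hx⟩
    · by_cases hk : x ∈ killSet vs o
      · right
        rcases o with g | y | _
        · exact Or.inr ⟨g, Or.inr (by simp [pickSet]), hk⟩
        · exact Or.inl (Or.inr hk)
        · simp [killSet] at hk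
      · exact Or.inl ⟨hx, hk⟩
    · exact Or.inr (Or.inl (Or.inl hx))
    · exact Or.inr (Or.inr ⟨g, Or.inl hg, hx⟩)

variable [Fintype E]

/-- The statistics followed along the nibble. -/
noncomputable def nibbleStat (vs : E → Finset X) (M : Finset X) (ω : J → X → ℝ) (𝓖 : K → Finset E)
    (D ε π : ℝ) (r : ℕ) : (X ⊕ X) ⊕ (J ⊕ J) ⊕ (K ⊕ K) → ℕ → NibbleState X E → ℝ
  | .inl (.inl x), k, s => (aliveDeg vs s.alive x : ℝ) / (D * (1 - (r - 1) * π) ^ k) - 1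
  | .inl (.inr x), k, s => 1 - ε - (aliveDeg vs s.alive x : ℝ) / (D * (1 - (r - 1) * π) ^ k)
  | .inr (.inl (.inl j)), k, s => (∑ x ∈ M ∩ s.alive, ω j x) / (1 - π) ^ k - 1
  | .inr (.inl (.inr j)), k, s => ∑ x ∈ M ∩ s.waste, ω j x - 3 * ε * π * k
  | .inr (.inr (.inl i)), k, s => 1 -
      ((Finset.univ.filter fun g => vs g ⊆ s.alive ∧ g ∈ 𝓖 i).card : ℝ) /
        ((𝓖 i).card * (1 - r * π) ^ k)
  | .inr (.inr (.inr i)), k, s => (1 - (1 - r * π) ^ k) / (4 * r) -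
      D * (s.chosen ∩ 𝓖 i).card / (𝓖 i).card

/-- The vertices for which a statistic is meaningful must be alive. -/
def nibbleLive (M : Finset X) : (X ⊕ X) ⊕ (J ⊕ J) ⊕ (K ⊕ K) → NibbleState X E → Prop
  | .inl (.inl x), s => x ∈ s.alive
  | .inl (.inr x), s => x ∈ s.alive ∧ x ∈ M
  | .inr _, _ => True

set_option maxHeartbeats 1600000 in
theorem nibble_core [Fintype X] [Fintype J] [Fintype K] (r : ℕ) (hr : 1 ≤ r) (vs : E → Finset X)
    (hvs : ∀ g, (vs g).card = r) (D δ : ℝ)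
    (hD : 0 < D) (hδ : 0 < δ)
    (hdeg : ∀ y, ((Finset.univ.filter fun g => y ∈ vs g).card : ℝ) ≤ D)
    (hcod : ∀ x y, x ≠ y →
      ((Finset.univ.filter fun g => x ∈ vs g ∧ y ∈ vs g).card : ℝ) ≤ δ * D)
    (M : Finset X) (ω : J → X → ℝ) (hω0 : ∀ j x, 0 ≤ ω j x) (hωδ : ∀ j x, ω j x ≤ δ)
    (hω1 : ∀ j, ∑ x ∈ M, ω j x ≤ 1) (𝓖 : K → Finset E) (h𝓖 : ∀ k, D ≤ δ * (𝓖 k).card)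
    (ε π q lam : ℝ) (T : ℕ)
    (hM : ∀ y ∈ M, (1 - ε) * D ≤ ((Finset.univ.filter fun g => y ∈ vs g).card : ℝ))
    (hε : 0 < ε) (hε4 : ε ≤ 1 / 4) (hπ : 0 < π) (hπδ : π ≤ δ)
    (hπr : r * π ≤ 1 / 2) (hπX : Fintype.card X * π ≤ 1) (hq : 0 < q) (hqT : q ≤ (1 - r * π) ^ T)
    (hlam : 0 < lam) (hlamB : lam * (100 * (r ^ 2 / q ^ 2 : ℝ) * δ) ≤ 1)
    (hcard : Real.log (Fintype.card ((X ⊕ X) ⊕ (J ⊕ J) ⊕ (K ⊕ K))) ≤ lam * (ε / 2))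
    (hdrift : T * (100 * (r ^ 2 / q ^ 2 : ℝ) * δ * π + lam * (100 * (r ^ 2 / q ^ 2 : ℝ) * δ * π))
      ≤ ε / 2) :
    ∃ s, NibbleInv vs s ∧ ∀ p, nibbleLive M p s → nibbleStat vs M ω 𝓖 D ε π r p T s ≤ ε := by
  classical
  have hr1 : (1 : ℝ) ≤ r := by exact_mod_cast hr
  have hππ : π ≤ r * π := by nlinarith
  have hsπ : (r - 1) * π ≤ r * π := by nlinarith
  have hs0 : 0 ≤ (r - 1) * π := mul_nonneg (by linarith) hπ.le
  have hπ2 : π ≤ 1 / 2 := hππ.trans hπr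
  have hC : 0 ≤ 100 * (r ^ 2 / q ^ 2 : ℝ) * δ * π := by positivity
  have hG0 : ∀ k, (0 : ℝ) < (𝓖 k).card := fun k => by
    rcases (Nat.cast_nonneg (α := ℝ) (𝓖 k).card).eq_or_lt with h | h
    · have := h𝓖 k
      rw [← h] at this; linarith
    · exact h
  refine exists_trajectory (Ω := E ⊕ X ⊕ Unit) (NibbleInv vs) (nibbleLive M)
    (nibbleStat vs M ω 𝓖 D ε π r) T lam (100 * (r ^ 2 / q ^ 2 : ℝ) * δ)
    (100 * (r ^ 2 / q ^ 2 : ℝ) * δ * π) (100 * (r ^ 2 / q ^ 2 : ℝ) * δ * π) ε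
    ⟨Finset.univ, ∅, ∅⟩ ?_ ?_ hlam hlamB hC hC hcard hdrift ?_
  · exact ⟨by simp, by simp, by simp⟩
  · rintro ((x | x) | (j | j) | (i | i)) hlive
    · simp only [nibbleStat, pow_zero, mul_one, aliveDeg, Finset.subset_univ, true_and]
      rw [sub_nonpos, div_le_one hD]
      exact hdeg x
    · simp only [nibbleStat, pow_zero, mul_one, aliveDeg, Finset.subset_univ, true_and]
      rw [sub_nonpos, le_div_iff₀ hD]
      exact hM x hlive.2
    · simpa [nibbleStat] using hω1 j
    · simp [nibbleStat]
    · have : (Finset.univ.filter fun g => vs g ⊆ Finset.univ ∧ g ∈ 𝓖 i) = 𝓖 i := by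
        ext g; simp
      simp only [nibbleStat, pow_zero, mul_one, this]
      rw [div_self (hG0 i).ne', sub_self]
    · simp [nibbleStat]
  intro k hk s hInv hgood
  set A := s.alive with hAdef
  have hqk : q ≤ (1 - r * π) ^ k := hqT.trans
    (pow_le_pow_of_le_one (by linarith) (by linarith) hk.le)
  have hqb : q ≤ (1 - π) ^ k := hqk.trans (by gcongr; linarith)
  have hqs : q ≤ (1 - (r - 1) * π) ^ k := hqk.trans (by gcongr; linarith)
  have hσ1 : (1 - r * π) ^ k ≤ 1 := pow_le_one₀ (by linarith) (by linarith)
  have hb1 : (1 - π) ^ k ≤ 1 := pow_le_one₀ (by linarith) (by linarith)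
  have hs1 : (1 - (r - 1) * π) ^ k ≤ 1 := pow_le_one₀ (by linarith) (by linarith)
  set sk := (1 - (r - 1) * π) ^ k with hsk
  set σ := (1 - r * π) ^ k with hσ
  have hsk0 : 0 < sk := hq.trans_le hqs
  have hq1 : q ≤ 1 := hqs.trans hs1
  set D' := D * sk * (1 + ε) with hD'
  have hD'0 : 0 < D' := by positivity
  have hpD' : π / D' * D' = π := div_mul_cancel₀ _ hD'0.ne'
  have hup : ∀ x ∈ A, (aliveDeg vs A x : ℝ) / (D * sk) ≤ 1 + ε := by
    intro x hx
    have := hgood (.inl (.inl x)) hx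
    simp only [nibbleStat] at this
    linarith
  have hlow : ∀ x ∈ A, x ∈ M → 1 - 2 * ε ≤ (aliveDeg vs A x : ℝ) / (D * sk) := by
    intro x hx hxM
    have := hgood (.inl (.inr x)) ⟨hx, hxM⟩
    simp only [nibbleStat] at this
    linarith
  have law := killLaw_step vs r hr hvs A (π / D') D' (δ * D) (by positivity)
    (fun y hy => by
      have := hup y hy
      rw [div_le_iff₀ (by positivity)] at this
      rw [hD']; linarith)
    (by
      rw [hpD']
      refine le_trans ?_ hπX
      gcongr
      exact Finset.card_le_univ A) hcod
  rw [hpD'] at law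
  have hpD : π / D' * D ≤ π / q := by
    rw [hD', div_mul_eq_mul_div, div_le_div_iff₀ hD'0 hq, hD']
    have h1 : q ≤ sk * (1 + ε) := by nlinarith
    calc π * D * q ≤ π * D * (sk * (1 + ε)) := by gcongr
      _ = _ := by ring
  have hδ' : π / D' * (δ * D) ≤ π * δ / q := by
    calc π / D' * (δ * D) = π / D' * D * δ := by ring
      _ ≤ π / q * δ := by gcongr
      _ = _ := by ring
  have hQ := q_facts r hr q hq hq1 _ rfl
  have hCδ : 2 * δ ≤ 100 * (r ^ 2 / q ^ 2 : ℝ) * δ := by nlinarith [hQ.1]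
  have hQδπ : δ * π / q ≤ (r ^ 2 / q ^ 2 : ℝ) * δ * π := by
    calc δ * π / q = 1 / q * δ * π := by ring
      _ ≤ _ := by
        have := hQ.2.2.2.2.2.2.1
        exact mul_le_mul_of_nonneg_right (mul_le_mul_of_nonneg_right this hδ.le) hπ.le
  have hQ0 : 0 ≤ (r ^ 2 / q ^ 2 : ℝ) * δ * π := by positivity
  have hQδπ' : δ * π ≤ (r ^ 2 / q ^ 2 : ℝ) * δ * π := by
    rw [mul_assoc]; exact le_mul_of_one_le_left (by positivity) hQ.1
  refine ⟨stepWeight vs A (π / D') D', nibbleNext vs s, law.nonneg, law.sum_one,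
    fun o ho => nibbleInv_next vs s hInv o (killSet_subset vs A _ _ o ho), ?_, ?_⟩
  · rintro ((x | x) | j | i) o
    · exact fun h => (Finset.mem_sdiff.1 h).1
    · exact fun h => ⟨(Finset.mem_sdiff.1 h.1).1, h.2⟩
    · exact fun _ => trivial
    · exact fun _ => trivial
  · rintro ((x | x) | (j | j) | (i | i)) hlive
    · have hx : x ∈ A := hlive
      refine ((degree_stats law vs hvs x hx D sk q δ hr hπ.le hπδ (by positivity) hδ' hD hq hqs hs1
        hπr (hcod x) ((hup x hx).trans (by linarith))).1).congr law.nonneg ?_ ?_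
      · intro o
        simp [nibbleLive, nibbleNext, ← hAdef, hx]
      · intro o _
        simp only [nibbleStat, nibbleNext, pow_succ, ← hAdef, ← hsk]
        ring
    · have hx : x ∈ A := hlive.1
      refine ((degree_stats law vs hvs x hx D sk q δ hr hπ.le hπδ (by positivity) hδ' hD hq hqs hs1
        hπr (hcod x) ((hup x hx).trans (by linarith))).2).congr law.nonneg ?_ ?_
      · intro o
        simp [nibbleLive, nibbleNext, ← hAdef, hx, hlive.2]
      · intro o _
        simp only [nibbleStat, nibbleNext, pow_succ, ← hAdef, ← hsk]
        ring
    · refine (weight_stats law M (ω j) ((1 - π) ^ k) q δ hr (hω0 j) (hωδ j) (hω1 j) hπ.le hπδ hπ2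
        hq hqb hb1).congr law.nonneg (fun o => Iff.rfl) ?_
      intro o _
      simp only [nibbleStat, nibbleNext, pow_succ, ← hAdef]
      ring
    · refine ((waste_stats law M s.waste (ω j) (3 * ε) δ (hω0 j) (hωδ j) (hω1 j) hπ.le hπδ
        (by linarith) (by linarith) ?_).mono hCδ (by positivity) (by linarith)).congr law.nonneg
        (fun o => Iff.rfl) ?_
      · intro y hy hyM
        have h1 := hlow y hy hyM
        rw [le_div_iff₀ (by positivity)] at h1
        rw [div_mul_eq_mul_div, div_le_iff₀ hD'0, hD']
        have h2 : 0 < D * sk := by positivity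
        have h3 : D * sk * (1 + ε) - aliveDeg vs A y ≤ 3 * ε * (D * sk) := by nlinarith
        have h4 : 3 * ε * (D * sk) ≤ 3 * ε * (D * sk * (1 + ε)) :=
          mul_le_mul_of_nonneg_left (le_mul_of_one_le_right h2.le (by linarith)) (by linarith)
        calc π * (D * sk * (1 + ε) - aliveDeg vs A y) ≤ π * (3 * ε * (D * sk * (1 + ε))) := by
              gcongr; linarith
          _ = _ := by ring
      · intro o _
        simp only [nibbleStat, nibbleNext]
        push_cast
        ring
    · refine (edges_stats law vs hvs (𝓖 i) D σ q δ hr hπ.le hπδ hD hq hqk hσ1 hπr hdeg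
        (h𝓖 i)).congr law.nonneg (fun o => Iff.rfl) ?_
      intro o _
      simp only [nibbleStat, nibbleNext, pow_succ, ← hAdef, ← hσ]
      ring
    · refine ((pick_stats law s.chosen (𝓖 i) ?_ D σ q δ hq hq1 (by positivity) hD hπ.le hπδ
        (hq.le.trans hqk) hσ1 (h𝓖 i) hpD ?_).mono hCδ (by positivity) ?_).congr law.nonneg
        (fun o => Iff.rfl) ?_
      · intro g hg hgA
        have h1 := (hInv.1 g hg).mono_right (le_refl A)
        have h2 : vs g = ∅ := by
          rw [← Finset.disjoint_self_iff_empty]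
          exact h1.mono_right hgA
        have := hvs g
        rw [h2, Finset.card_empty] at this
        omega
      · have h1 := hgood (.inr (.inr (.inl i))) trivial
        simp only [nibbleStat, ← hAdef, ← hσ] at h1
        have hσ0 : 0 < σ := hq.trans_le hqk
        have hGσ : 0 < (𝓖 i).card * σ := mul_pos (hG0 i) hσ0
        have h2 : (1 - ε) * ((𝓖 i).card * σ) ≤
            ((Finset.univ.filter fun g => vs g ⊆ A ∧ g ∈ 𝓖 i).card : ℝ) := by
          rw [← le_div_iff₀ hGσ]; linarith
        have h3 : (1 - ε) * σ ≤
            ((Finset.univ.filter fun g => vs g ⊆ A ∧ g ∈ 𝓖 i).card : ℝ) / (𝓖 i).card := by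
          rw [le_div_iff₀ (hG0 i)]; linarith
        have h4 : π / 2 ≤ π / D' * D := by
          rw [hD', div_mul_eq_mul_div, div_le_div_iff₀ two_pos hD'0, hD']
          have : sk * (1 + ε) ≤ 2 := by nlinarith
          calc π * (D * sk * (1 + ε)) = π * D * (sk * (1 + ε)) := by ring
            _ ≤ π * D * 2 := by gcongr
        have h5 : 0 < (1 - ε) * σ := mul_pos (by linarith) hσ0
        calc π * σ / 4 = π / 2 * (1 / 2 * σ) := by ring
          _ ≤ π / 2 * ((1 - ε) * σ) :=
              mul_le_mul_of_nonneg_left (mul_le_mul_of_nonneg_right (by linarith) hσ0.le)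
                (by positivity)
          _ ≤ _ := by gcongr
      · calc 2 * (δ * π) / q = 2 * (δ * π / q) := by ring
          _ ≤ _ := by linarith
      · intro o _
        simp only [nibbleStat, nibbleNext, pow_succ, ← hσ]
        have : (r : ℝ) ≠ 0 := by positivity
        field_simp
        ring

end Core

theorem exp_neg_two_mul_le (x : ℝ) (h0 : 0 ≤ x) (h1 : x ≤ 1 / 2) : Real.exp (-2 * x) ≤ 1 - x := by
  have h2 : 0 < 1 - x := by linarith
  rw [← Real.le_log_iff_exp_le h2]
  have h3 := Real.one_sub_inv_le_log_of_pos h2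
  have h4 : -2 * x ≤ 1 - (1 - x)⁻¹ := by
    have : (1 - x)⁻¹ ≤ 1 + 2 * x := by
      rw [inv_le_iff_one_le_mul₀ h2]
      nlinarith
    linarith
  linarith

set_option maxHeartbeats 1000000 in
/-- A semi-random matching in an almost regular hypergraph with small codegrees, which leaves only
little weight uncovered and uses its share of each of the given families of edges. -/
theorem nibble (r : ℕ) (hr : 1 ≤ r) (γ : ℝ) (hγ : 0 < γ) :
    ∃ θ : ℝ, 0 < θ ∧ ∃ δ₀ : ℝ, 0 < δ₀ ∧ ∀ (X E J K : Type) [DecidableEq X] [DecidableEq E]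
      [Fintype X] [Fintype E] [Fintype J] [Fintype K] (vs : E → Finset X) (_ : ∀ g, (vs g).card = r)
      (D δ : ℝ) (_ : 0 < D) (_ : 0 < δ)
      (_ : ∀ y, ((Finset.univ.filter fun g => y ∈ vs g).card : ℝ) ≤ D)
      (_ : ∀ x y, x ≠ y →
        ((Finset.univ.filter fun g => x ∈ vs g ∧ y ∈ vs g).card : ℝ) ≤ δ * D)
      (M : Finset X) (_ : ∀ y ∈ M, (1 - θ) * D ≤
        ((Finset.univ.filter fun g => y ∈ vs g).card : ℝ))
      (ω : J → X → ℝ) (_ : ∀ j x, 0 ≤ ω j x) (_ : ∀ j x, ω j x ≤ δ)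
      (_ : ∀ j, ∑ x ∈ M, ω j x ≤ 1) (𝓖 : K → Finset E) (_ : ∀ k, D ≤ δ * (𝓖 k).card)
      (_ : δ * Real.log (2 * Fintype.card X + 2 * Fintype.card J + 2 * Fintype.card K + 3) ≤ δ₀),
      ∃ Mt : Finset E, (∀ g ∈ Mt, ∀ g' ∈ Mt, g ≠ g' → Disjoint (vs g) (vs g')) ∧
        (∀ j, ∑ x ∈ M.filter (fun x => ∀ g ∈ Mt, x ∉ vs g), ω j x ≤ γ) ∧
        ∀ k, 1 / (16 * r) * ((𝓖 k).card : ℝ) ≤ D * (Mt ∩ 𝓖 k).card := by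
  have hr1 : (1 : ℝ) ≤ r := by exact_mod_cast hr
  obtain ⟨τ, hτ1, hτ⟩ : ∃ τ : ℝ, 1 ≤ τ ∧ 2 * Real.exp (-τ) ≤ γ / 2 := by
    refine ⟨1 + |Real.log (γ / 4)|, by linarith [abs_nonneg (Real.log (γ / 4))], ?_⟩
    have h1 : Real.exp (-(1 + |Real.log (γ / 4)|)) ≤ γ / 4 := by
      rw [← Real.le_log_iff_exp_le (by positivity)]
      linarith [neg_abs_le (Real.log (γ / 4))]
    linarith
  set q := Real.exp (-2 * r * (τ + 1)) with hq
  have hq0 : 0 < q := Real.exp_pos _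
  obtain ⟨ε, hε, hε4, hεr, hεγ⟩ : ∃ ε : ℝ, 0 < ε ∧ ε ≤ 1 / 4 ∧ ε ≤ 1 / (16 * r) ∧
      ε * (3 * τ + 4) ≤ γ / 2 := by
    refine ⟨min (1 / 4) (min (1 / (16 * r)) (γ / 2 / (3 * τ + 4))), by positivity,
      min_le_left _ _, (min_le_right _ _).trans (min_le_left _ _), ?_⟩
    rw [← le_div_iff₀ (by positivity)]
    exact (min_le_right _ _).trans (min_le_right _ _)
  set C := 100 * (r ^ 2 / q ^ 2 : ℝ) with hC
  have hC0 : 0 < C := by positivity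
  refine ⟨ε, hε, ε ^ 2 / (8 * C * (τ + 1)), by positivity, ?_⟩
  intro X E J K _ _ _ _ _ _ vs hvs D δ hD hδ hdeg hcod M hM ω hω0 hωδ hω1 𝓖 h𝓖 hlog
  set Λ := Real.log (2 * Fintype.card X + 2 * Fintype.card J + 2 * Fintype.card K + 3) with hΛ
  have hΛ1 : 1 ≤ Λ := by
    rw [hΛ, Real.le_log_iff_exp_le (by positivity)]
    have h1 := Real.exp_one_lt_d9
    have : (0 : ℝ) ≤ 2 * Fintype.card X + 2 * Fintype.card J + 2 * Fintype.card K := by positivity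
    linarith
  set π := min (1 / (2 * r : ℝ)) (min δ (1 / (Fintype.card X + 1))) with hπ
  have hπ0 : 0 < π := by positivity
  have hπr : r * π ≤ 1 / 2 := by
    have : π ≤ 1 / (2 * r) := min_le_left _ _
    rw [le_div_iff₀ (by positivity)] at this
    linarith
  have hπδ : π ≤ δ := (min_le_right _ _).trans (min_le_left _ _)
  have hπX : Fintype.card X * π ≤ 1 := by
    have : π ≤ 1 / (Fintype.card X + 1) := (min_le_right _ _).trans (min_le_right _ _)
    rw [le_div_iff₀ (by positivity)] at this
    linarith
  have hπ1 : π ≤ 1 / 2 := le_trans (by nlinarith) hπr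
  set T := ⌈τ / π⌉₊ with hT
  have hT1 : τ ≤ T * π := by
    have := Nat.le_ceil (τ / π)
    rwa [div_le_iff₀ hπ0] at this
  have hT2 : T * π ≤ τ + 1 := by
    have := (Nat.ceil_lt_add_one (a := τ / π) (by positivity)).le
    calc T * π ≤ (τ / π + 1) * π := by gcongr
      _ = τ + π := by field_simp
      _ ≤ _ := by linarith
  have hlow : q ≤ (1 - r * π) ^ T := by
    calc q ≤ Real.exp (T * (-2 * (r * π))) := by
          rw [hq]; apply Real.exp_le_exp.2
          nlinarith
      _ = Real.exp (-2 * (r * π)) ^ T := Real.exp_nat_mul _ _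
      _ ≤ _ := by
        gcongr
        exact exp_neg_two_mul_le _ (by positivity) hπr
  have hδΛ : C * δ * Λ * (8 * (τ + 1)) ≤ ε ^ 2 := by
    rw [le_div_iff₀ (by positivity)] at hlog
    linarith
  have hCδ : C * δ * (8 * (τ + 1)) ≤ ε ^ 2 := by
    refine le_trans ?_ hδΛ
    have : C * δ ≤ C * δ * Λ := le_mul_of_one_le_right (by positivity) hΛ1
    gcongr
  have hlamC : 2 * Λ / ε * (C * δ) * (4 * (τ + 1)) ≤ ε := by
    calc 2 * Λ / ε * (C * δ) * (4 * (τ + 1)) = C * δ * Λ * (8 * (τ + 1)) / ε := by ring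
      _ ≤ ε ^ 2 / ε := by gcongr
      _ = ε := by field_simp
  have hlamC0 : 0 ≤ 2 * Λ / ε * (C * δ) := by positivity
  obtain ⟨s, ⟨-, hs2, hs3⟩, hs⟩ := nibble_core r hr vs hvs D δ hD hδ hdeg hcod M ω hω0 hωδ
    hω1 𝓖 h𝓖 ε π q
    (2 * Λ / ε) T hM hε hε4 hπ0 hπδ hπr hπX hq0 hlow (by positivity) (by nlinarith)
    (by
      have : 2 * Λ / ε * (ε / 2) = Λ := by field_simp
      rw [this, hΛ]
      simp only [Fintype.card_sum]
      push_cast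
      rcases Nat.eq_zero_or_pos (Fintype.card X + Fintype.card X + (Fintype.card J + Fintype.card J
        + (Fintype.card K + Fintype.card K))) with h | h
      · have : ((Fintype.card X + Fintype.card X + (Fintype.card J + Fintype.card J
          + (Fintype.card K + Fintype.card K)) : ℕ) : ℝ) = 0 := by rw [h]; simp
        push_cast at this
        rw [this, Real.log_zero, ← hΛ]
        linarith
      · apply Real.log_le_log
        · exact_mod_cast h
        · linarith)
    (by
      calc _ = T * π * (C * δ + 2 * Λ / ε * (C * δ)) := by rw [hC]; ring
        _ ≤ (τ + 1) * (C * δ + 2 * Λ / ε * (C * δ)) := by gcongr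
        _ ≤ ε / 2 := by nlinarith)
  refine ⟨s.chosen, hs2, ?_, ?_⟩
  · intro j
    have hsub : M.filter (fun x => ∀ g ∈ s.chosen, x ∉ vs g) ⊆ (M ∩ s.alive) ∪ (M ∩ s.waste) := by
      intro x hx
      simp only [Finset.mem_filter, Finset.mem_union, Finset.mem_inter] at hx ⊢
      rcases hs3 x with h | h | ⟨g, hg, hxg⟩
      · exact Or.inl ⟨hx.1, h⟩
      · exact Or.inr ⟨hx.1, h⟩
      · exact absurd hxg (hx.2 g hg)
    have h1 := hs (.inr (.inl (.inl j))) trivial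
    have h2 := hs (.inr (.inl (.inr j))) trivial
    simp only [nibbleStat] at h1 h2
    have hb : (0 : ℝ) < (1 - π) ^ T := pow_pos (by linarith) _
    have h3 : ∑ x ∈ M ∩ s.alive, ω j x ≤ γ / 2 := by
      have h4 : (∑ x ∈ M ∩ s.alive, ω j x) / (1 - π) ^ T ≤ 1 + ε := by linarith
      rw [div_le_iff₀ hb] at h4
      have h5 : (1 - π) ^ T ≤ Real.exp (-τ) := by
        calc (1 - π) ^ T ≤ Real.exp (-π) ^ T := by
              gcongr
              · linarith
              · exact Real.one_sub_le_exp_neg π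
          _ = Real.exp (T * (-π)) := (Real.exp_nat_mul _ _).symm
          _ ≤ _ := Real.exp_le_exp.2 (by linarith)
      nlinarith
    have h6 : 3 * ε * π * T + ε ≤ γ / 2 := by
      refine le_trans ?_ hεγ
      nlinarith
    calc ∑ x ∈ M.filter (fun x => ∀ g ∈ s.chosen, x ∉ vs g), ω j x
        ≤ ∑ x ∈ (M ∩ s.alive) ∪ (M ∩ s.waste), ω j x :=
          Finset.sum_le_sum_of_subset_of_nonneg hsub fun x _ _ => hω0 j x
      _ ≤ ∑ x ∈ M ∩ s.alive, ω j x + ∑ x ∈ M ∩ s.waste, ω j x := by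
          rw [← Finset.sum_union_inter]
          exact le_add_of_nonneg_right (Finset.sum_nonneg fun x _ => hω0 j x)
      _ ≤ γ := by linarith
  · intro k
    have h1 := hs (.inr (.inr (.inr k))) trivial
    simp only [nibbleStat] at h1
    have hG0 : (0 : ℝ) < (𝓖 k).card := by
      have := h𝓖 k
      by_contra h
      have : δ * (𝓖 k).card ≤ 0 := mul_nonpos_of_nonneg_of_nonpos hδ.le (not_lt.1 h)
      linarith [h𝓖 k]
    have h2 : (1 - r * π) ^ T ≤ 1 / 2 := by
      calc (1 - r * π) ^ T ≤ Real.exp (-(r * π)) ^ T := by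
            gcongr
            · linarith
            · exact Real.one_sub_le_exp_neg _
        _ = Real.exp (T * (-(r * π))) := (Real.exp_nat_mul _ _).symm
        _ ≤ Real.exp (-1) := Real.exp_le_exp.2 (by nlinarith)
        _ ≤ 1 / 2 := by
          rw [Real.exp_neg]
          have := Real.add_one_le_exp (1 : ℝ)
          rw [inv_le_comm₀ (Real.exp_pos _) (by norm_num)]
          norm_num
          linarith
    have h3 : 1 / (16 * r) ≤ D * (s.chosen ∩ 𝓖 k).card / (𝓖 k).card := by
      have h4 : 1 / (8 * r) ≤ (1 - (1 - r * π) ^ T) / (4 * r) := by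
        rw [div_le_div_iff₀ (by positivity) (by positivity)]
        nlinarith
      have h5 : 1 / (8 * r : ℝ) = 1 / (16 * r) + 1 / (16 * r) := by field_simp; norm_num
      linarith
    rwa [le_div_iff₀ hG0] at h3

section Choice

variable {I O : Type*} [Fintype I] [DecidableEq I]

open Classical in
/-- The conflict-free choices on `S`, taking a default value outside `S`. -/
noncomputable def goodChoices (opt : I → Finset O) (conf : I → O → I → O → Prop) (o₀ : O)
    (S : Finset I) : Finset (I → O) :=
  (Fintype.piFinset fun i => if i ∈ S then opt i else {o₀}).filter fun c =>
    ∀ i ∈ S, ∀ j ∈ S, i ≠ j → ¬ conf i (c i) j (c j)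

theorem mem_goodChoices {opt : I → Finset O} {conf : I → O → I → O → Prop} {o₀ : O}
    {S : Finset I} {c : I → O} : c ∈ goodChoices opt conf o₀ S ↔
      (∀ i ∈ S, c i ∈ opt i) ∧ (∀ i ∉ S, c i = o₀) ∧
        ∀ i ∈ S, ∀ j ∈ S, i ≠ j → ¬ conf i (c i) j (c j) := by
  classical
  simp only [goodChoices, Finset.mem_filter, Fintype.mem_piFinset]
  constructor
  · rintro ⟨h1, h2⟩
    refine ⟨fun i hi => by simpa [hi] using h1 i, fun i hi => by simpa [hi] using h1 i, h2⟩
  · rintro ⟨h1, h2, h3⟩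
    refine ⟨fun i => ?_, h3⟩
    by_cases hi : i ∈ S
    · simpa [hi] using h1 i hi
    · simpa [hi] using h2 i hi

open Classical in
theorem card_goodChoices_fiber_le (opt : I → Finset O) (conf : I → O → I → O → Prop) (o₀ : O)
    (S : Finset I) (j : I) (o : O) :
    ((goodChoices opt conf o₀ S).filter fun c => c j = o).card ≤
      (goodChoices opt conf o₀ (S.erase j)).card := by
  classical
  refine Finset.card_le_card_of_injOn (fun c => Function.update c j o₀) ?_ ?_
  · intro c hc
    obtain ⟨hc, -⟩ := Finset.mem_filter.1 hc
    obtain ⟨h1, h2, h3⟩ := mem_goodChoices.1 hc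
    refine mem_goodChoices.2 ⟨?_, ?_, ?_⟩
    · intro i hi
      rw [Finset.mem_erase] at hi
      beta_reduce
      rw [Function.update_of_ne hi.1]
      exact h1 i hi.2
    · intro i hi
      by_cases hij : i = j
      · subst hij; simp
      · beta_reduce
        rw [Function.update_of_ne hij]
        exact h2 i fun h => hi (Finset.mem_erase.2 ⟨hij, h⟩)
    · intro i hi k hk hne
      rw [Finset.mem_erase] at hi hk
      beta_reduce
      rw [Function.update_of_ne hi.1, Function.update_of_ne hk.1]
      exact h3 i hi.2 k hk.2 hne
  · intro c hc c' hc' h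
    have h1 := (Finset.mem_filter.1 hc).2
    have h2 := (Finset.mem_filter.1 hc').2
    ext i
    by_cases hij : i = j
    · subst hij; rw [h1, h2]
    · have := congrFun h i
      simpa [Function.update_of_ne hij] using this

open Classical in
theorem card_goodChoices_insert (opt : I → Finset O) (conf : I → O → I → O → Prop)
    (hsymm : ∀ i o j o', conf i o j o' → conf j o' i o) (o₀ : O)
    (S : Finset I) (v : I) (hv : v ∉ S) :
    (opt v).card * (goodChoices opt conf o₀ S).card ≤
      (goodChoices opt conf o₀ (insert v S)).card +
      ∑ o ∈ opt v, ∑ j ∈ S, ∑ _ ∈ (opt j).filter (fun o' => conf v o j o'),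
        (goodChoices opt conf o₀ (S.erase j)).card := by
  rw [← Finset.card_product]
  rw [← Finset.card_filter_add_card_filter_not
    (fun p : O × (I → O) => ∀ j ∈ S, ¬ conf v p.1 j (p.2 j))]
  refine add_le_add ?_ ?_
  · refine Finset.card_le_card_of_injOn (fun p => Function.update p.2 v p.1) ?_ ?_
    · rintro ⟨o, c⟩ hp
      simp only [Finset.coe_filter, Finset.mem_product, Set.mem_ofPred_eq] at hp
      obtain ⟨⟨ho, hc⟩, hconf⟩ := hp
      obtain ⟨h1, h2, h3⟩ := mem_goodChoices.1 hc
      have hne : ∀ i ∈ S, i ≠ v := fun i hi h => hv (h ▸ hi)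
      refine mem_goodChoices.2 ⟨?_, ?_, ?_⟩
      · intro i hi
        rcases Finset.mem_insert.1 hi with rfl | hi
        · simpa using ho
        · simpa [Function.update_of_ne (hne i hi)] using h1 i hi
      · intro i hi
        rw [Finset.mem_insert, not_or] at hi
        simpa [Function.update_of_ne hi.1] using h2 i hi.2
      · intro i hi j hj hij
        rcases Finset.mem_insert.1 hi with hiv | hi' <;>
          rcases Finset.mem_insert.1 hj with hjv | hj'
        · exact absurd (hiv.trans hjv.symm) hij
        · subst hiv
          simpa [Function.update_of_ne (hne j hj')] using hconf j hj'
        · subst hjv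
          simpa [Function.update_of_ne (hne i hi')] using fun h => hconf i hi' (hsymm _ _ _ _ h)
        · simpa [Function.update_of_ne (hne i hi'), Function.update_of_ne (hne j hj')] using
            h3 i hi' j hj' hij
    · rintro ⟨o, c⟩ hp ⟨o', c'⟩ hp' h
      simp only [Finset.coe_filter, Finset.mem_product, Set.mem_ofPred_eq] at hp hp'
      have h1 := (mem_goodChoices.1 hp.1.2).2.1 v hv
      have h2 := (mem_goodChoices.1 hp'.1.2).2.1 v hv
      refine Prod.ext ?_ ?_
      · simpa using congrFun h v
      · ext i
        by_cases hi : i = v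
        · subst hi; exact h1.trans h2.symm
        · simpa [Function.update_of_ne hi] using congrFun h i
  · have hsub : ((opt v ×ˢ goodChoices opt conf o₀ S).filter
        fun p => ¬ ∀ j ∈ S, ¬ conf v p.1 j (p.2 j)) ⊆
        (opt v).biUnion fun o => S.biUnion fun j =>
          ((opt j).filter fun o' => conf v o j o').biUnion fun o' =>
            ((goodChoices opt conf o₀ S).filter fun c => c j = o').image fun c => (o, c) := by
      rintro ⟨o, c⟩ hp
      simp only [Finset.mem_filter, Finset.mem_product, not_forall, not_not] at hp
      obtain ⟨⟨ho, hc⟩, j, hj, hcf⟩ := hp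
      simp only [Finset.mem_biUnion, Finset.mem_image, Finset.mem_filter]
      exact ⟨o, ho, j, hj, c j, ⟨(mem_goodChoices.1 hc).1 j hj, hcf⟩, c, ⟨hc, rfl⟩, rfl⟩
    refine (Finset.card_le_card hsub).trans (Finset.card_biUnion_le.trans ?_)
    refine Finset.sum_le_sum fun o _ => Finset.card_biUnion_le.trans ?_
    refine Finset.sum_le_sum fun j _ => Finset.card_biUnion_le.trans ?_
    refine Finset.sum_le_sum fun o' _ => Finset.card_image_le.trans ?_
    exact card_goodChoices_fiber_le opt conf o₀ S j o'

open Classical in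
/-- If every option conflicts with few other options, there is a conflict-free choice. -/
theorem exists_conflict_free (opt : I → Finset O) (conf : I → O → I → O → Prop)
    (hsymm : ∀ i o j o', conf i o j o' → conf j o' i o) (K Δ : ℝ) (hK : 0 < K)
    (hKΔ : 4 * Δ ≤ K) (hopt : ∀ i, K ≤ (opt i).card)
    (hΔ : ∀ i, ∀ o ∈ opt i, (∑ j ∈ Finset.univ.erase i,
      ((opt j).filter fun o' => conf i o j o').card : ℝ) ≤ Δ) :
    ∃ c : I → O, (∀ i, c i ∈ opt i) ∧ ∀ i j, i ≠ j → ¬ conf i (c i) j (c j) := by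
  rcases isEmpty_or_nonempty I with hI | ⟨⟨i₀⟩⟩
  · exact ⟨fun i => isEmptyElim i, fun i => isEmptyElim i, fun i => isEmptyElim i⟩
  obtain ⟨o₀, -⟩ : (opt i₀).Nonempty := by
    rw [← Finset.card_pos]
    exact_mod_cast hK.trans_le (hopt i₀)
  have key : ∀ m : ℕ, ∀ S : Finset I, S.card = m → ∀ v ∉ S,
      K / 2 * (goodChoices opt conf o₀ S).card ≤
        ((goodChoices opt conf o₀ (insert v S)).card : ℝ) := by
    intro m
    induction m using Nat.strong_induction_on with
    | _ m ih =>
    intro S hS v hv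
    set N : ℝ := ((goodChoices opt conf o₀ S).card : ℝ) with hN
    have hN0 : 0 ≤ N := Nat.cast_nonneg _
    have h1 : ∀ j ∈ S, ((goodChoices opt conf o₀ (S.erase j)).card : ℝ) ≤ 2 / K * N := by
      intro j hj
      have hc : (S.erase j).card < m := hS ▸ Finset.card_erase_lt_of_mem hj
      have := ih _ hc (S.erase j) rfl j (Finset.notMem_erase j S)
      rw [Finset.insert_erase hj, ← hN] at this
      calc ((goodChoices opt conf o₀ (S.erase j)).card : ℝ)
          = 2 / K * (K / 2 * (goodChoices opt conf o₀ (S.erase j)).card) := by field_simp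
        _ ≤ _ := by gcongr
    have h2 := card_goodChoices_insert opt conf hsymm o₀ S v hv
    have h3 : ((opt v).card : ℝ) * N ≤ ((goodChoices opt conf o₀ (insert v S)).card : ℝ) +
      ∑ o ∈ opt v, ∑ j ∈ S, ∑ _ ∈ (opt j).filter (fun o' => conf v o j o'),
        ((goodChoices opt conf o₀ (S.erase j)).card : ℝ) := by
      rw [hN]
      exact_mod_cast h2
    have h4 : ∑ o ∈ opt v, ∑ j ∈ S, ∑ _ ∈ (opt j).filter (fun o' => conf v o j o'),
        ((goodChoices opt conf o₀ (S.erase j)).card : ℝ) ≤ (opt v).card * (N / 2) := by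
      rw [← nsmul_eq_mul]
      refine Finset.sum_le_card_nsmul _ _ _ fun o ho => ?_
      calc ∑ j ∈ S, ∑ _ ∈ (opt j).filter (fun o' => conf v o j o'),
            ((goodChoices opt conf o₀ (S.erase j)).card : ℝ)
          ≤ ∑ j ∈ S, ((opt j).filter fun o' => conf v o j o').card * (2 / K * N) := by
            refine Finset.sum_le_sum fun j hj => ?_
            rw [Finset.sum_const, nsmul_eq_mul]
            exact mul_le_mul_of_nonneg_left (h1 j hj) (Nat.cast_nonneg _)
        _ = (∑ j ∈ S, (((opt j).filter fun o' => conf v o j o').card : ℝ)) * (2 / K * N) := by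
            rw [Finset.sum_mul]
        _ ≤ Δ * (2 / K * N) := by
            gcongr
            refine le_trans ?_ (hΔ v o ho)
            refine Finset.sum_le_sum_of_subset_of_nonneg ?_ fun _ _ _ => Nat.cast_nonneg _
            exact fun j hj => Finset.mem_erase.2 ⟨fun h => hv (h ▸ hj), Finset.mem_univ _⟩
        _ ≤ K / 4 * (2 / K * N) := by gcongr; linarith
        _ = N / 2 := by field_simp; norm_num
    calc K / 2 * N ≤ (opt v).card / 2 * N := by gcongr; exact hopt v
      _ ≤ _ := by linarith
  have hpos : ∀ S : Finset I, (goodChoices opt conf o₀ S).Nonempty := by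
    intro S
    induction S using Finset.induction_on with
    | empty => exact ⟨fun _ => o₀, mem_goodChoices.2 ⟨by simp, by simp, by simp⟩⟩
    | insert v S hv ih =>
      have h1 := key _ S rfl v hv
      have h2 : (0 : ℝ) < (goodChoices opt conf o₀ S).card := by exact_mod_cast ih.card_pos
      rw [← Finset.card_pos]
      have : (0 : ℝ) < K / 2 * (goodChoices opt conf o₀ S).card := by positivity
      exact_mod_cast this.trans_le h1
  obtain ⟨c, hc⟩ := hpos Finset.univ
  obtain ⟨h1, -, h3⟩ := mem_goodChoices.1 hc
  exact ⟨c, fun i => h1 i (Finset.mem_univ i),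
    fun i j => h3 i (Finset.mem_univ i) j (Finset.mem_univ j)⟩

end Choice

open Classical in
/-- The adjacency relation of `G` is close in cut norm to the constant density `q`. -/
def CutClose {V : Type} [Fintype V] (G : SimpleGraph V) (q ε : ℝ) : Prop :=
  ∀ f g : V → ℝ, (∀ x, 0 ≤ f x ∧ f x ≤ 1) → (∀ x, 0 ≤ g x ∧ g x ≤ 1) →
    |∑ x, ∑ y, f x * g y * ((if G.Adj x y then 1 else 0) - q)| ≤ ε * (Fintype.card V : ℝ) ^ 2

section Count

variable {V : Type} [Fintype V] [DecidableEq V] {f : ℕ}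

theorem sum_update_eq (a : Fin f) (X : (Fin f → V) → ℝ) :
    ∑ ψ, ∑ x, X (Function.update ψ a x) = Fintype.card V * ∑ ψ, X ψ := by
  have h1 : Function.Involutive fun p : (Fin f → V) × V => (Function.update p.1 a p.2, p.1 a) := by
    rintro ⟨ψ, x⟩
    simp
  have h2 := Equiv.sum_comp h1.toPerm fun p : (Fin f → V) × V => X p.1
  rw [Fintype.sum_prod_type, Fintype.sum_prod_type] at h2
  simp only [Function.Involutive.coe_toPerm, Finset.sum_const, Finset.card_univ,
    nsmul_eq_mul] at h2
  rw [h2, Finset.mul_sum]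

theorem card_fiber_le (m : Fin f) (Q P : (Fin f → V) → Prop) [DecidablePred Q] [DecidablePred P]
    (k : ℝ) (hQ : ∀ ψ y, Q ψ ↔ Q (Function.update ψ m y))
    (hP : ∀ ψ, Q ψ → ((Finset.univ.filter fun y => P (Function.update ψ m y)).card : ℝ) ≤ k) :
    (Fintype.card V : ℝ) * (Finset.univ.filter fun ψ => Q ψ ∧ P ψ).card ≤
      k * (Finset.univ.filter fun ψ => Q ψ).card := by
  have h1 := sum_update_eq m fun ψ : Fin f → V => if Q ψ ∧ P ψ then (1 : ℝ) else 0
  rw [Finset.sum_boole] at h1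
  rw [← h1]
  have h2 : k * ((Finset.univ.filter fun ψ : Fin f → V => Q ψ).card : ℝ) =
      ∑ ψ : Fin f → V, if Q ψ then k else 0 := by
    rw [← Finset.sum_filter, Finset.sum_const, nsmul_eq_mul, mul_comm]
  rw [h2]
  refine Finset.sum_le_sum fun ψ _ => ?_
  rw [Finset.sum_boole]
  by_cases h : Q ψ
  · rw [if_pos h]
    refine le_trans ?_ (hP ψ h)
    norm_cast
    exact Finset.card_le_card fun y hy => by
      simp only [Finset.mem_filter] at hy ⊢
      exact ⟨hy.1, hy.2.2⟩
  · rw [if_neg h]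
    have : (Finset.univ.filter fun y => Q (Function.update ψ m y) ∧ P (Function.update ψ m y)) =
        ∅ := by
      refine Finset.filter_eq_empty_iff.2 fun y _ h' => h ((hQ ψ y).2 h'.1)
    rw [this]; simp

theorem card_pin_eq (m : Fin f) (Q : (Fin f → V) → Prop) [DecidablePred Q]
    (hQ : ∀ ψ y, Q ψ ↔ Q (Function.update ψ m y)) (v : V) :
    (Fintype.card V : ℝ) * (Finset.univ.filter fun ψ => Q ψ ∧ ψ m = v).card =
      (Finset.univ.filter fun ψ => Q ψ).card := by
  have h1 := sum_update_eq m fun ψ : Fin f → V => if Q ψ ∧ ψ m = v then (1 : ℝ) else 0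
  rw [Finset.sum_boole] at h1
  rw [← h1]
  have h2 : ((Finset.univ.filter fun ψ : Fin f → V => Q ψ).card : ℝ) =
      ∑ ψ : Fin f → V, if Q ψ then 1 else 0 := by rw [Finset.sum_boole]
  rw [h2]
  refine Finset.sum_congr rfl fun ψ _ => ?_
  simp only [← hQ, Function.update_self]
  by_cases h : Q ψ <;> simp [h]

open Classical in
theorem cut_product [Nonempty V] {G : SimpleGraph V} {q ε : ℝ} (hG : CutClose G q ε)
    (a b : Fin f) (hab : a ≠ b) (P Q : (Fin f → V) → ℝ) (hP : ∀ ψ, 0 ≤ P ψ ∧ P ψ ≤ 1)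
    (hQ : ∀ ψ, 0 ≤ Q ψ ∧ Q ψ ≤ 1) (hPb : ∀ ψ y, P (Function.update ψ b y) = P ψ)
    (hQa : ∀ ψ x, Q (Function.update ψ a x) = Q ψ) :
    |∑ ψ, P ψ * Q ψ * ((if G.Adj (ψ a) (ψ b) then 1 else 0) - q)| ≤
      ε * (Fintype.card V : ℝ) ^ f := by
  have hn : (0 : ℝ) < Fintype.card V := by exact_mod_cast Fintype.card_pos
  set X : (Fin f → V) → ℝ := fun ψ => P ψ * Q ψ * ((if G.Adj (ψ a) (ψ b) then 1 else 0) - q)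
    with hX
  have h1 : ∑ ψ, ∑ x, ∑ y, X (Function.update (Function.update ψ a x) b y) =
      (Fintype.card V : ℝ) ^ 2 * ∑ ψ, X ψ := by
    rw [sum_update_eq a fun ψ => ∑ y, X (Function.update ψ b y), sum_update_eq b X]
    ring
  have h2 : ∀ ψ, |∑ x, ∑ y, X (Function.update (Function.update ψ a x) b y)| ≤
      ε * (Fintype.card V : ℝ) ^ 2 := by
    intro ψ
    have h3 := hG (fun x => P (Function.update ψ a x)) (fun y => Q (Function.update ψ b y))
      (fun x => hP _) (fun y => hQ _)
    refine le_of_eq_of_le ?_ h3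
    congr 1
    refine Finset.sum_congr rfl fun x _ => Finset.sum_congr rfl fun y _ => ?_
    simp only [hX, hPb]
    congr 1
    · congr 1
      rw [Function.update_comm hab, hQa]
    · simp [Function.update_of_ne hab]
  have h4 : |(Fintype.card V : ℝ) ^ 2 * ∑ ψ, X ψ| ≤
      (Fintype.card V : ℝ) ^ f * (ε * (Fintype.card V : ℝ) ^ 2) := by
    rw [← h1]
    refine (Finset.abs_sum_le_sum_abs _ _).trans ((Finset.sum_le_sum fun ψ _ => h2 ψ).trans ?_)
    simp
  rw [abs_mul, abs_of_pos (by positivity)] at h4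
  have h5 : 0 < (Fintype.card V : ℝ) ^ 2 := by positivity
  nlinarith

theorem prod_mem_unit {ι : Type*} (s : Finset ι) (g : ι → ℝ) (h : ∀ i ∈ s, 0 ≤ g i ∧ g i ≤ 1) :
    0 ≤ ∏ i ∈ s, g i ∧ ∏ i ∈ s, g i ≤ 1 :=
  ⟨Finset.prod_nonneg fun i hi => (h i hi).1,
    Finset.prod_le_one (fun i hi => (h i hi).1) fun i hi => (h i hi).2⟩

open Classical in
theorem counting_weights [Nonempty V] {G : SimpleGraph V} {q ε : ℝ} (hG : CutClose G q ε)
    (hq0 : 0 ≤ q) (hq2 : q ≤ 2) (w : Fin f → V → ℝ) (hw : ∀ j x, 0 ≤ w j x ∧ w j x ≤ 1)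
    (S : Finset (Fin f × Fin f)) (hS : ∀ p ∈ S, p.1 < p.2) :
    |∑ ψ : Fin f → V, (∏ j, w j (ψ j)) * ∏ p ∈ S, (if G.Adj (ψ p.1) (ψ p.2) then (1 : ℝ) else 0) -
      q ^ S.card * ∏ j, ∑ x, w j x| ≤ (2 ^ S.card - 1) * (ε * (Fintype.card V : ℝ) ^ f) := by
  induction S using Finset.induction_on with
  | empty =>
    simp only [Finset.prod_empty, mul_one, Finset.card_empty, pow_zero, one_mul, sub_self,
      zero_mul]
    rw [Finset.prod_univ_sum, Fintype.piFinset_univ, sub_self, abs_zero]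
  | insert e S he ih =>
    obtain ⟨a, b⟩ := e
    have hab : a < b := hS (a, b) (Finset.mem_insert_self _ _)
    specialize ih fun p hp => hS p (Finset.mem_insert_of_mem hp)
    set B : (Fin f → V) → Fin f × Fin f → ℝ := fun ψ p => if G.Adj (ψ p.1) (ψ p.2) then 1 else 0
      with hB
    have hB1 : ∀ ψ p, 0 ≤ B ψ p ∧ B ψ p ≤ 1 := by
      intro ψ p
      simp only [hB]
      split_ifs <;> norm_num
    have key := cut_product hG a b hab.ne
      (fun ψ => (∏ j ∈ Finset.univ.erase b, w j (ψ j)) *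
        ∏ p ∈ S.filter (fun p => ¬ (p.1 = b ∨ p.2 = b)), B ψ p)
      (fun ψ => w b (ψ b) * ∏ p ∈ S.filter (fun p => p.1 = b ∨ p.2 = b), B ψ p)
      (fun ψ => by
        have h1 := prod_mem_unit (Finset.univ.erase b) (fun j => w j (ψ j)) fun j _ => hw _ _
        have h2 := prod_mem_unit (S.filter (fun p => ¬ (p.1 = b ∨ p.2 = b))) (B ψ)
          fun j _ => hB1 _ _
        exact ⟨mul_nonneg h1.1 h2.1, mul_le_one₀ h1.2 h2.1 h2.2⟩)
      (fun ψ => by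
        have h2 := prod_mem_unit (S.filter (fun p => p.1 = b ∨ p.2 = b)) (B ψ) fun j _ => hB1 _ _
        exact ⟨mul_nonneg (hw _ _).1 h2.1, mul_le_one₀ (hw _ _).2 h2.1 h2.2⟩)
      (fun ψ y => by
        congr 1
        · refine Finset.prod_congr rfl fun j hj => ?_
          rw [Function.update_of_ne (Finset.ne_of_mem_erase hj)]
        · refine Finset.prod_congr rfl fun p hp => ?_
          have := (Finset.mem_filter.1 hp).2
          rw [not_or] at this
          simp only [hB, Function.update_of_ne this.1, Function.update_of_ne this.2])
      (fun ψ x => by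
        rw [Function.update_of_ne hab.ne']
        congr 1
        refine Finset.prod_congr rfl fun p hp => ?_
        obtain ⟨hpS, hpb⟩ := Finset.mem_filter.1 hp
        have hlt := hS p (Finset.mem_insert_of_mem hpS)
        have h1 : p.1 ≠ a := by
          rintro rfl
          rcases hpb with h | h
          · exact absurd h hab.ne
          · exact he (by rw [← h]; exact hpS)
        have h2 : p.2 ≠ a := by
          rintro rfl
          rcases hpb with h | h
          · rw [h] at hlt
            exact absurd (hlt.trans hab) (lt_irrefl _)
          · exact absurd h hab.ne
        simp only [hB, Function.update_of_ne h1, Function.update_of_ne h2])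
    have heq : ∀ ψ : Fin f → V, ((∏ j ∈ Finset.univ.erase b, w j (ψ j)) *
        ∏ p ∈ S.filter (fun p => ¬ (p.1 = b ∨ p.2 = b)), B ψ p) *
        (w b (ψ b) * ∏ p ∈ S.filter (fun p => p.1 = b ∨ p.2 = b), B ψ p) *
        ((if G.Adj (ψ a) (ψ b) then 1 else 0) - q) =
        (∏ j, w j (ψ j)) * ∏ p ∈ insert (a, b) S, B ψ p -
          q * ((∏ j, w j (ψ j)) * ∏ p ∈ S, B ψ p) := by
      intro ψ
      rw [← Finset.mul_prod_erase Finset.univ (fun j => w j (ψ j)) (Finset.mem_univ b),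
        Finset.prod_insert he, ← Finset.prod_filter_mul_prod_filter_not S
          (fun p => p.1 = b ∨ p.2 = b)]
      simp only [hB]
      ring
    simp only [heq, Finset.sum_sub_distrib, ← Finset.mul_sum] at key
    rw [Finset.card_insert_of_notMem he]
    set T' := ∑ ψ, (∏ j, w j (ψ j)) * ∏ p ∈ insert (a, b) S, B ψ p
    set T := ∑ ψ, (∏ j, w j (ψ j)) * ∏ p ∈ S, B ψ p
    set Z := ∏ j, ∑ x, w j x
    have h3 : T' - q ^ (S.card + 1) * Z = (T' - q * T) + q * (T - q ^ S.card * Z) := by ring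
    rw [h3]
    refine (abs_add_le _ _).trans ?_
    rw [abs_mul, abs_of_nonneg hq0]
    have h4 : q * |T - q ^ S.card * Z| ≤ 2 * ((2 ^ S.card - 1) * (ε * (Fintype.card V : ℝ) ^ f)) :=
      mul_le_mul hq2 ih (abs_nonneg _) (by norm_num)
    have h5 : ((2 : ℝ) ^ (S.card + 1) - 1) * (ε * (Fintype.card V : ℝ) ^ f) =
        ε * (Fintype.card V : ℝ) ^ f + 2 * ((2 ^ S.card - 1) * (ε * (Fintype.card V : ℝ) ^ f)) := by
      ring
    linarith

open Classical in
/-- The counting lemma: the number of maps sending `j` to `W j` and the pairs in `S` to edges. -/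
theorem counting [Nonempty V] {G : SimpleGraph V} {q ε : ℝ} (hG : CutClose G q ε)
    (hq0 : 0 ≤ q) (hq2 : q ≤ 2) (hε : 0 ≤ ε) (W : Fin f → Finset V)
    (S : Finset (Fin f × Fin f)) (hS : ∀ p ∈ S, p.1 < p.2) :
    |((Finset.univ.filter fun ψ : Fin f → V =>
        (∀ j, ψ j ∈ W j) ∧ ∀ p ∈ S, G.Adj (ψ p.1) (ψ p.2)).card : ℝ) -
      q ^ S.card * ∏ j, ((W j).card : ℝ)| ≤ 2 ^ S.card * ε * (Fintype.card V : ℝ) ^ f := by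
  have h := counting_weights hG hq0 hq2 (fun j x => if x ∈ W j then 1 else 0)
    (fun j x => by split_ifs <;> norm_num) S hS
  have h1 : ∀ ψ : Fin f → V, (∏ j, if ψ j ∈ W j then (1 : ℝ) else 0) *
      ∏ p ∈ S, (if G.Adj (ψ p.1) (ψ p.2) then (1 : ℝ) else 0) =
      if (∀ j, ψ j ∈ W j) ∧ ∀ p ∈ S, G.Adj (ψ p.1) (ψ p.2) then 1 else 0 := by
    intro ψ
    rw [Finset.prod_boole, Finset.prod_boole]
    simp only [Finset.mem_univ, true_implies]
    split_ifs <;> simp_all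
  simp only [h1, Finset.sum_boole] at h
  simp only [Finset.filter_mem_eq_inter, Finset.univ_inter] at h
  refine h.trans ?_
  rw [mul_assoc]
  gcongr
  linarith

end Count

section Edges

variable {f : ℕ} (F : SimpleGraph (Fin f))

open Classical in
/-- The edges of `F` as increasing pairs. -/
noncomputable def edgeP : Finset (Fin f × Fin f) :=
  Finset.univ.filter fun p => p.1 < p.2 ∧ F.Adj p.1 p.2

theorem mem_edgeP {p : Fin f × Fin f} : p ∈ edgeP F ↔ p.1 < p.2 ∧ F.Adj p.1 p.2 := by
  simp [edgeP]

open Classical in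
/-- The neighbours of a vertex of `F`. -/
noncomputable def nbrs (j : Fin f) : Finset (Fin f) := Finset.univ.filter fun k => F.Adj j k

theorem mem_nbrs {j k : Fin f} : k ∈ nbrs F j ↔ F.Adj j k := by simp [nbrs]

/-- The pair of endpoints in increasing order. -/
def sortP (j k : Fin f) : Fin f × Fin f := if j < k then (j, k) else (k, j)

theorem sortP_mem {j k : Fin f} (h : F.Adj j k) : sortP j k ∈ edgeP F := by
  rw [mem_edgeP, sortP]
  split_ifs with hlt
  · exact ⟨hlt, h⟩
  · exact ⟨lt_of_le_of_ne (not_lt.1 hlt) h.ne', h.symm⟩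

theorem card_edgeP : (edgeP F).card = F.edgeSet.ncard := by
  classical
  rw [Set.ncard_eq_toFinset_card', eq_comm]
  symm
  refine Finset.card_bij (fun p _ => s(p.1, p.2)) ?_ ?_ ?_
  · intro p hp
    simpa using ((mem_edgeP F).1 hp).2
  · intro p hp p' hp' h
    have h1 := ((mem_edgeP F).1 hp).1
    have h2 := ((mem_edgeP F).1 hp').1
    rcases Sym2.eq_iff.1 h with ⟨h3, h4⟩ | ⟨h3, h4⟩
    · exact Prod.ext h3 h4
    · rw [h3, h4] at h1
      exact absurd (h1.trans h2) (lt_irrefl _)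
  · intro e
    induction e using Sym2.ind with
    | _ j k =>
    intro h
    have h' : F.Adj j k := by simpa using h
    refine ⟨sortP j k, sortP_mem F h', ?_⟩
    rw [sortP]
    split_ifs
    · rfl
    · exact Sym2.eq_swap

theorem card_touch (j : Fin f) :
    ((edgeP F).filter fun p => p.1 = j ∨ p.2 = j).card = (nbrs F j).card := by
  symm
  refine Finset.card_bij (fun k _ => sortP j k) ?_ ?_ ?_
  · intro k hk
    rw [mem_nbrs] at hk
    refine Finset.mem_filter.2 ⟨sortP_mem F hk, ?_⟩
    rw [sortP]
    split_ifs <;> simp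
  · intro k hk k' hk' h
    rw [mem_nbrs] at hk hk'
    simp only [sortP] at h
    split_ifs at h <;> simp_all
  · intro p hp
    obtain ⟨hp, hj⟩ := Finset.mem_filter.1 hp
    obtain ⟨h1, h2⟩ := (mem_edgeP F).1 hp
    rcases hj with rfl | rfl
    · exact ⟨p.2, (mem_nbrs F).2 h2, by simp [sortP, h1]⟩
    · exact ⟨p.1, (mem_nbrs F).2 h2.symm, by simp [sortP, h1.le]⟩

theorem card_avoid (j : Fin f) : ((edgeP F).filter fun p => ¬ (p.1 = j ∨ p.2 = j)).card +
    (nbrs F j).card = (edgeP F).card := by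
  rw [← card_touch, add_comm, Finset.card_filter_add_card_filter_not]

theorem card_avoid_two {j k : Fin f} (hjk : F.Adj j k) :
    ((edgeP F).filter fun p => ¬ ((p.1 = j ∨ p.2 = j) ∨ (p.1 = k ∨ p.2 = k))).card +
    (nbrs F j).card + (nbrs F k).card = (edgeP F).card + 1 := by
  have h1 := Finset.card_filter_add_card_filter_not (s := edgeP F)
    (fun p => ((p.1 = j ∨ p.2 = j) ∨ (p.1 = k ∨ p.2 = k)))
  have h2 : ((edgeP F).filter fun p => ((p.1 = j ∨ p.2 = j) ∨ (p.1 = k ∨ p.2 = k))).card + 1 =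
      (nbrs F j).card + (nbrs F k).card := by
    rw [Finset.filter_or, ← card_touch F j, ← card_touch F k, ← Finset.card_union_add_card_inter,
      ← Finset.filter_and]
    congr 1
    symm
    rw [Finset.card_eq_one]
    refine ⟨sortP j k, ?_⟩
    ext p
    simp only [Finset.mem_filter, Finset.mem_singleton]
    constructor
    · rintro ⟨hp, h3, h4⟩
      have h5 := ((mem_edgeP F).1 hp).1
      have h6 := hjk.ne
      rcases h3 with rfl | rfl <;> rcases h4 with h4 | h4
      · exact absurd h4 h6
      · subst h4; simp [sortP, h5]
      · subst h4; simp [sortP, h5.le]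
      · exact absurd h4 h6
    · rintro rfl
      refine ⟨sortP_mem F hjk, ?_⟩
      rw [sortP]
      split_ifs <;> simp
  omega

end Edges

section Rooted

variable {V : Type} [Fintype V] [DecidableEq V] {f : ℕ}

/-- `ψ` maps edges of `F` to edges of `G`. -/
def IsHom (F : SimpleGraph (Fin f)) (G : SimpleGraph V) (ψ : Fin f → V) : Prop :=
  ∀ a b, F.Adj a b → G.Adj (ψ a) (ψ b)

theorem isHom_iff {F : SimpleGraph (Fin f)} {G : SimpleGraph V} {ψ : Fin f → V} :
    IsHom F G ψ ↔ ∀ p ∈ edgeP F, G.Adj (ψ p.1) (ψ p.2) := by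
  constructor
  · exact fun h p hp => h _ _ ((mem_edgeP F).1 hp).2
  · intro h a b hab
    have := h _ (sortP_mem F hab)
    rw [sortP] at this
    split_ifs at this
    · exact this
    · exact this.symm

open Classical in
/-- The neighbours of `v` in `G`. -/
noncomputable def nb (G : SimpleGraph V) (v : V) : Finset V := Finset.univ.filter fun u => G.Adj v u

theorem mem_nb {G : SimpleGraph V} {v u : V} : u ∈ nb G v ↔ G.Adj v u := by simp [nb]

theorem abs_pow_sub_pow_le_two (m : ℕ) (x q ε : ℝ) (hx0 : 0 ≤ x) (hx2 : x ≤ 2) (hq0 : 0 ≤ q)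
    (hq2 : q ≤ 2) (h : |x - q| ≤ ε) : |x ^ m - q ^ m| ≤ m * 2 ^ m * ε := by
  have hε : 0 ≤ ε := (abs_nonneg _).trans h
  have h1 := abs_pow_sub_pow_le x q m
  refine h1.trans ?_
  have h2 : max |x| |q| ≤ 2 := by rw [abs_of_nonneg hx0, abs_of_nonneg hq0]; exact max_le hx2 hq2
  have h3 : max |x| |q| ^ (m - 1) ≤ 2 ^ m :=
    (pow_le_pow_left₀ (le_max_of_le_left (abs_nonneg _)) h2 _).trans
      (pow_le_pow_right₀ (by norm_num) (by omega))
  calc |x - q| * m * max |x| |q| ^ (m - 1) ≤ ε * m * 2 ^ m := by gcongr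
    _ = _ := by ring

open Classical in
/-- The number of homomorphisms of `F` with one root. -/
theorem rooted_vertex [Nonempty V] (F : SimpleGraph (Fin f)) {G : SimpleGraph V} {q ε : ℝ}
    (hG : CutClose G q ε) (hq0 : 0 ≤ q) (hq2 : q ≤ 2) (v : V)
    (hv : |((nb G v).card : ℝ) - q * Fintype.card V| ≤ ε * Fintype.card V) (j : Fin f) :
    |Fintype.card V * ((Finset.univ.filter fun ψ : Fin f → V => IsHom F G ψ ∧ ψ j = v).card : ℝ) -
      q ^ (edgeP F).card * (Fintype.card V : ℝ) ^ f| ≤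
      2 ^ (edgeP F).card * (1 + f * 2 ^ f) * ε * (Fintype.card V : ℝ) ^ f := by
  set n : ℝ := (Fintype.card V : ℝ) with hn
  have hn0 : 0 < n := by rw [hn]; exact_mod_cast Fintype.card_pos
  have hε : 0 ≤ ε := by
    have := (abs_nonneg _).trans hv
    exact nonneg_of_mul_nonneg_left this hn0
  set S := (edgeP F).filter fun p => ¬ (p.1 = j ∨ p.2 = j) with hS
  set W : Fin f → Finset V := fun k => if F.Adj j k then nb G v else Finset.univ with hW
  set m := (nbrs F j).card with hm
  have hSm : S.card + m = (edgeP F).card := card_avoid F j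
  have hmf : m ≤ f := by simpa using Finset.card_le_univ (nbrs F j)
  have h1 := counting hG hq0 hq2 hε W S fun p hp =>
    ((mem_edgeP F).1 (Finset.mem_filter.1 hp).1).1
  have hWj : W j = Finset.univ := by simp [hW]
  have h2 := card_pin_eq j (fun ψ : Fin f → V => (∀ k, ψ k ∈ W k) ∧ ∀ p ∈ S, G.Adj (ψ p.1) (ψ p.2))
    (fun ψ y => by
      refine and_congr ?_ ?_
      · refine forall_congr' fun k => ?_
        by_cases hk : k = j
        · subst hk; simp [hWj]
        · rw [Function.update_of_ne hk]
      · refine forall₂_congr fun p hp => ?_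
        have := (Finset.mem_filter.1 hp).2
        rw [not_or] at this
        rw [Function.update_of_ne this.1, Function.update_of_ne this.2]) v
  have h3 : (Finset.univ.filter fun ψ : Fin f → V =>
      ((∀ k, ψ k ∈ W k) ∧ ∀ p ∈ S, G.Adj (ψ p.1) (ψ p.2)) ∧ ψ j = v) =
      Finset.univ.filter fun ψ : Fin f → V => IsHom F G ψ ∧ ψ j = v := by
    ext ψ
    simp only [Finset.mem_filter, Finset.mem_univ, true_and, and_congr_left_iff]
    rintro rfl
    constructor
    · rintro ⟨h4, h5⟩ a b hab
      by_cases ha : a = j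
      · subst ha
        have := h4 b
        simp only [hW, if_pos hab] at this
        exact mem_nb.1 this
      by_cases hb : b = j
      · subst hb
        have := h4 a
        simp only [hW, if_pos hab.symm] at this
        exact (mem_nb.1 this).symm
      have h6 := h5 (sortP a b) (by
        refine Finset.mem_filter.2 ⟨sortP_mem F hab, ?_⟩
        rw [sortP]
        split_ifs <;> simp [ha, hb])
      rw [sortP] at h6
      split_ifs at h6
      · exact h6
      · exact h6.symm
    · intro h
      refine ⟨fun k => ?_, fun p hp => ?_⟩
      · simp only [hW]
        split_ifs with hk
        · exact mem_nb.2 (h _ _ hk)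
        · exact Finset.mem_univ _
      · exact h _ _ ((mem_edgeP F).1 (Finset.mem_filter.1 hp).1).2
  rw [h3] at h2
  rw [← h2] at h1
  have h4 : ∏ k, ((W k).card : ℝ) = ((nb G v).card / n) ^ m * n ^ f := by
    have : ∀ k, ((W k).card : ℝ) = (if F.Adj j k then ((nb G v).card / n : ℝ) else 1) * n := by
      intro k
      simp only [hW]
      split_ifs
      · rw [div_mul_cancel₀ _ hn0.ne']
      · simp [hn]
    rw [Finset.prod_congr rfl fun k _ => this k, Finset.prod_mul_distrib, Finset.prod_ite]
    simp only [Finset.prod_const, one_pow, mul_one, Finset.card_univ, Fintype.card_fin]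
    rfl
  rw [h4] at h1
  set x := ((nb G v).card / n : ℝ) with hx
  have hx0 : 0 ≤ x := by positivity
  have hx1 : x ≤ 1 := by
    rw [hx, div_le_one hn0, hn]
    exact_mod_cast Finset.card_le_univ _
  have hxq : |x - q| ≤ ε := by
    have : x - q = ((nb G v).card - q * n) / n := by field_simp; rw [hx]; field_simp
    rw [this, abs_div, abs_of_pos hn0, div_le_iff₀ hn0]
    exact hv
  have h5 := abs_pow_sub_pow_le_two m x q ε hx0 (by linarith) hq0 hq2 hxq
  rw [← hn] at h1
  have h6 : |q ^ S.card * (x ^ m * n ^ f) - q ^ (edgeP F).card * n ^ f| ≤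
      2 ^ (edgeP F).card * (f * 2 ^ f) * ε * n ^ f := by
    rw [← hSm, pow_add]
    have : q ^ S.card * (x ^ m * n ^ f) - q ^ S.card * q ^ m * n ^ f =
      q ^ S.card * (x ^ m - q ^ m) * n ^ f := by ring
    rw [this, abs_mul, abs_mul, abs_of_nonneg (pow_nonneg hq0 _), abs_of_pos (pow_pos hn0 _)]
    have h7 : q ^ S.card ≤ 2 ^ (S.card + m) :=
      (pow_le_pow_left₀ hq0 hq2 _).trans (pow_le_pow_right₀ (by norm_num) (by omega))
    have h8 : (m : ℝ) * 2 ^ m * ε ≤ f * 2 ^ f * ε := by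
      gcongr
      norm_num
    calc q ^ S.card * |x ^ m - q ^ m| * n ^ f ≤ 2 ^ (S.card + m) * (f * 2 ^ f * ε) * n ^ f := by
          gcongr
          exact h5.trans h8
      _ = _ := by ring
  have h9 : (2 : ℝ) ^ S.card * ε * n ^ f ≤ 2 ^ (edgeP F).card * ε * n ^ f := by
    have : (2 : ℝ) ^ S.card ≤ 2 ^ (edgeP F).card := pow_le_pow_right₀ (by norm_num) (by omega)
    gcongr
  calc _ ≤ _ := abs_sub_le _ (q ^ S.card * (x ^ m * n ^ f)) _
    _ ≤ 2 ^ (edgeP F).card * ε * n ^ f + 2 ^ (edgeP F).card * (f * 2 ^ f) * ε * n ^ f :=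
      add_le_add (h1.trans h9) h6
    _ = _ := by ring

open Classical in
theorem prod_card_le (F : SimpleGraph (Fin f)) {G : SimpleGraph V} {x : ℝ}
    (hdeg : ∀ v, ((nb G v).card : ℝ) ≤ x * Fintype.card V) (u v : V)
    (huv : ((nb G u ∩ nb G v).card : ℝ) ≤ x ^ 2 * Fintype.card V) (j k : Fin f)
    (hjk : F.Adj j k) (W : Fin f → Finset V) (hW : W = fun m => if m = j ∨ m = k then Finset.univ
      else Finset.univ.filter fun y => (F.Adj j m → G.Adj u y) ∧ (F.Adj k m → G.Adj v y)) :
    ∏ m, ((W m).card : ℝ) ≤ x ^ ((nbrs F j).card - 1 + ((nbrs F k).card - 1)) *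
      (Fintype.card V : ℝ) ^ f := by
  set n : ℝ := (Fintype.card V : ℝ) with hn
  have h7 : ∀ m, ((W m).card : ℝ) ≤ ((if m ∈ (nbrs F j).erase k then x else 1) *
      (if m ∈ (nbrs F k).erase j then x else 1)) * n := by
    intro m
    simp only [hW]
    by_cases hmj : m = j
    · subst hmj; simp [mem_nbrs, hn]
    by_cases hmk : m = k
    · subst hmk; simp [mem_nbrs, hn]
    rw [if_neg (not_or.2 ⟨hmj, hmk⟩)]
    simp only [Finset.mem_erase, mem_nbrs, ne_eq, hmj, hmk, not_false_eq_true, true_and]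
    by_cases h8 : F.Adj j m <;> by_cases h9 : F.Adj k m
    · rw [if_pos h8, if_pos h9, ← sq]
      refine le_trans (le_of_eq ?_) huv
      congr 2
      ext y; simp [mem_nb, h8, h9]
    · rw [if_pos h8, if_neg h9, mul_one]
      refine le_trans (le_of_eq ?_) (hdeg u)
      congr 2
      ext y; simp [mem_nb, h8, h9]
    · rw [if_neg h8, if_pos h9, one_mul]
      refine le_trans (le_of_eq ?_) (hdeg v)
      congr 2
      ext y; simp [mem_nb, h8, h9]
    · rw [if_neg h8, if_neg h9, one_mul, one_mul, hn]
      norm_cast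
      exact Finset.card_le_univ _
  refine (Finset.prod_le_prod (fun _ _ => Nat.cast_nonneg _) fun m _ => h7 m).trans (le_of_eq ?_)
  rw [Finset.prod_mul_distrib, Finset.prod_mul_distrib, Finset.prod_ite_mem, Finset.prod_ite_mem]
  simp only [Finset.prod_const, Finset.univ_inter, Finset.card_univ, Fintype.card_fin]
  rw [Finset.card_erase_of_mem ((mem_nbrs F).2 hjk),
    Finset.card_erase_of_mem ((mem_nbrs F).2 hjk.symm), pow_add]

open Classical in
/-- An upper bound for the number of homomorphisms of `F` with a root edge. -/
theorem rooted_edge [Nonempty V] (F : SimpleGraph (Fin f)) {G : SimpleGraph V} {q x ε : ℝ}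
    (hG : CutClose G q ε) (hq0 : 0 ≤ q) (hq2 : q ≤ 2) (hε : 0 ≤ ε) (hqx : q ≤ x)
    (hdeg : ∀ v, ((nb G v).card : ℝ) ≤ x * Fintype.card V) (u v : V)
    (huv : ((nb G u ∩ nb G v).card : ℝ) ≤ x ^ 2 * Fintype.card V) (j k : Fin f) (hjk : F.Adj j k) :
    (Fintype.card V : ℝ) ^ 2 *
      ((Finset.univ.filter fun ψ : Fin f → V => IsHom F G ψ ∧ ψ j = u ∧ ψ k = v).card : ℝ) ≤
      (x ^ ((edgeP F).card - 1) + 2 ^ (edgeP F).card * ε) * (Fintype.card V : ℝ) ^ f := by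
  set n : ℝ := (Fintype.card V : ℝ) with hn
  have hn0 : 0 < n := by rw [hn]; exact_mod_cast Fintype.card_pos
  have hx0 : 0 ≤ x := hq0.trans hqx
  set S := (edgeP F).filter fun p => ¬ ((p.1 = j ∨ p.2 = j) ∨ (p.1 = k ∨ p.2 = k)) with hS
  set W : Fin f → Finset V := fun m => if m = j ∨ m = k then Finset.univ else
    Finset.univ.filter fun y => (F.Adj j m → G.Adj u y) ∧ (F.Adj k m → G.Adj v y) with hW
  have hScard := card_avoid_two F hjk
  rw [← hS] at hScard
  have h1 := counting hG hq0 hq2 hε W S fun p hp =>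
    ((mem_edgeP F).1 (Finset.mem_filter.1 hp).1).1
  set R : (Fin f → V) → Prop := fun ψ => (∀ k, ψ k ∈ W k) ∧ ∀ p ∈ S, G.Adj (ψ p.1) (ψ p.2) with hR
  have hRup : ∀ i, i = j ∨ i = k → ∀ ψ y, R ψ ↔ R (Function.update ψ i y) := by
    intro i hi ψ y
    refine and_congr ?_ ?_
    · refine forall_congr' fun m => ?_
      by_cases hm : m = i
      · subst hm; simp [hW, hi]
      · rw [Function.update_of_ne hm]
    · refine forall₂_congr fun p hp => ?_
      have h2 := (Finset.mem_filter.1 hp).2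
      simp only [not_or] at h2
      have h3 : p.1 ≠ i ∧ p.2 ≠ i := by rcases hi with rfl | rfl <;> tauto
      rw [Function.update_of_ne h3.1, Function.update_of_ne h3.2]
  have h2 := card_pin_eq j R (hRup j (Or.inl rfl)) u
  have h3 := card_pin_eq k (fun ψ => R ψ ∧ ψ j = u) (fun ψ y => by
    rw [← hRup k (Or.inr rfl), Function.update_of_ne hjk.ne]) v
  have h4 : ((Finset.univ.filter fun ψ : Fin f → V => IsHom F G ψ ∧ ψ j = u ∧ ψ k = v).card : ℝ) ≤
      (Finset.univ.filter fun ψ : Fin f → V => (R ψ ∧ ψ j = u) ∧ ψ k = v).card := by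
    norm_cast
    refine Finset.card_le_card fun ψ hψ => ?_
    simp only [Finset.mem_filter, Finset.mem_univ, true_and] at hψ ⊢
    obtain ⟨h5, rfl, rfl⟩ := hψ
    refine ⟨⟨⟨fun m => ?_, fun p hp => ?_⟩, rfl⟩, rfl⟩
    · simp only [hW]
      split_ifs with hm
      · exact Finset.mem_univ _
      · simp only [Finset.mem_filter, Finset.mem_univ, true_and]
        exact ⟨h5 _ _, h5 _ _⟩
    · exact h5 _ _ ((mem_edgeP F).1 (Finset.mem_filter.1 hp).1).2
  have h5 : n ^ 2 * ((Finset.univ.filter fun ψ : Fin f → V =>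
      (R ψ ∧ ψ j = u) ∧ ψ k = v).card : ℝ) =
      (Finset.univ.filter fun ψ : Fin f → V => R ψ).card := by
    rw [← h2, ← h3, hn]; ring
  have h6 := prod_card_le F hdeg u v huv j k hjk W hW
  rw [← hn] at h6
  have hj1 : 1 ≤ (nbrs F j).card := Finset.card_pos.2 ⟨k, (mem_nbrs F).2 hjk⟩
  have hk1 : 1 ≤ (nbrs F k).card := Finset.card_pos.2 ⟨j, (mem_nbrs F).2 hjk.symm⟩
  have h10 : (edgeP F).card - 1 = S.card + ((nbrs F j).card - 1 + ((nbrs F k).card - 1)) := by omega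
  have h11 : (2 : ℝ) ^ S.card ≤ 2 ^ (edgeP F).card :=
    pow_le_pow_right₀ (by norm_num) (by omega)
  have h12 : (2 : ℝ) ^ S.card * ε * n ^ f ≤ 2 ^ (edgeP F).card * ε * n ^ f :=
    mul_le_mul_of_nonneg_right (mul_le_mul_of_nonneg_right h11 hε) (pow_nonneg hn0.le _)
  have h13 : q ^ S.card * ∏ m, ((W m).card : ℝ) ≤ x ^ S.card *
      (x ^ ((nbrs F j).card - 1 + ((nbrs F k).card - 1)) * n ^ f) :=
    mul_le_mul (pow_le_pow_left₀ hq0 hqx _) h6 (Finset.prod_nonneg fun _ _ => Nat.cast_nonneg _)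
      (pow_nonneg hx0 _)
  have h14 := (abs_sub_le_iff.1 h1).1
  rw [← hn] at h14
  have h15 := mul_le_mul_of_nonneg_left h4 (pow_nonneg hn0.le 2)
  rw [h5] at h15
  rw [h10, pow_add, add_mul, mul_assoc (x ^ S.card)]
  linarith

end Rooted

section Cut

variable {V : Type} [Fintype V] [DecidableEq V]

theorem cut_sq_le (B : V → V → ℝ) (ρ : ℝ) (hB : ∑ x, ∑ x', |∑ y, B x y * B x' y| ≤ ρ)
    (f g : V → ℝ) (hf : ∀ x, 0 ≤ f x ∧ f x ≤ 1) (hg : ∀ x, 0 ≤ g x ∧ g x ≤ 1) :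
    (∑ x, ∑ y, f x * g y * B x y) ^ 2 ≤ Fintype.card V * ρ := by
  have h1 : ∑ x, ∑ y, f x * g y * B x y = ∑ y, g y * ∑ x, f x * B x y := by
    rw [Finset.sum_comm]
    refine Finset.sum_congr rfl fun y _ => ?_
    rw [Finset.mul_sum]
    exact Finset.sum_congr rfl fun x _ => by ring
  rw [h1]
  refine (Finset.sum_mul_sq_le_sq_mul_sq Finset.univ g fun y => ∑ x, f x * B x y).trans ?_
  have h2 : ∑ y, g y ^ 2 ≤ Fintype.card V := by
    calc ∑ y, g y ^ 2 ≤ ∑ _y : V, (1 : ℝ) :=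
          Finset.sum_le_sum fun y _ => pow_le_one₀ (hg y).1 (hg y).2
      _ = _ := by simp
  have h3 : ∑ y, (∑ x, f x * B x y) ^ 2 ≤ ρ := by
    have h4 : ∑ y, (∑ x, f x * B x y) ^ 2 = ∑ x, ∑ x', f x * f x' * ∑ y, B x y * B x' y := by
      have h7 : ∀ y, (∑ x, f x * B x y) ^ 2 = ∑ x, ∑ x', f x * f x' * (B x y * B x' y) := by
        intro y
        rw [sq, Finset.sum_mul_sum]
        refine Finset.sum_congr rfl fun x _ => Finset.sum_congr rfl fun x' _ => by ring
      rw [Finset.sum_congr rfl fun y _ => h7 y, Finset.sum_comm]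
      refine Finset.sum_congr rfl fun x _ => ?_
      rw [Finset.sum_comm]
      refine Finset.sum_congr rfl fun x' _ => ?_
      rw [Finset.mul_sum]
    rw [h4]
    refine le_trans (Finset.sum_le_sum fun x _ => Finset.sum_le_sum fun x' _ => ?_) hB
    have h5 : f x * f x' ≤ 1 := mul_le_one₀ (hf x).2 (hf x').1 (hf x').2
    have h6 : 0 ≤ f x * f x' := mul_nonneg (hf x).1 (hf x').1
    calc f x * f x' * ∑ y, B x y * B x' y ≤ f x * f x' * |∑ y, B x y * B x' y| :=
          mul_le_mul_of_nonneg_left (le_abs_self _) h6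
      _ ≤ _ := mul_le_of_le_one_left (abs_nonneg _) h5
  exact mul_le_mul h2 h3 (Finset.sum_nonneg fun _ _ => sq_nonneg _) (Nat.cast_nonneg _)

theorem cut_le_of_abs (B : V → V → ℝ) (ε : ℝ) (hε : 0 ≤ ε)
    (hB : ∑ x, ∑ x', |∑ y, B x y * B x' y| ≤ ε ^ 2 * (Fintype.card V : ℝ) ^ 3)
    (f g : V → ℝ) (hf : ∀ x, 0 ≤ f x ∧ f x ≤ 1) (hg : ∀ x, 0 ≤ g x ∧ g x ≤ 1) :
    |∑ x, ∑ y, f x * g y * B x y| ≤ ε * (Fintype.card V : ℝ) ^ 2 := by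
  have h := cut_sq_le B _ hB f g hf hg
  refine abs_le_of_sq_le_sq (le_trans ?_ (le_of_eq rfl)) (by positivity)
  calc _ ≤ _ := h
    _ = _ := by ring

theorem cut_le_of_sq (B : V → V → ℝ) (ε : ℝ) (hε : 0 ≤ ε)
    (hB : ∑ x, ∑ x', (∑ y, B x y * B x' y) ^ 2 ≤ ε ^ 4 * (Fintype.card V : ℝ) ^ 4)
    (f g : V → ℝ) (hf : ∀ x, 0 ≤ f x ∧ f x ≤ 1) (hg : ∀ x, 0 ≤ g x ∧ g x ≤ 1) :
    |∑ x, ∑ y, f x * g y * B x y| ≤ ε * (Fintype.card V : ℝ) ^ 2 := by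
  refine cut_le_of_abs B ε hε ?_ f g hf hg
  rw [← Fintype.sum_prod_type'] at hB ⊢
  have h := Finset.sum_mul_sq_le_sq_mul_sq Finset.univ (fun _ : V × V => (1 : ℝ))
    (fun p => |∑ y, B p.1 y * B p.2 y|)
  simp only [one_mul, one_pow, Finset.sum_const, Finset.card_univ, Fintype.card_prod, nsmul_eq_mul,
    mul_one, sq_abs] at h
  have h1 : (∑ p : V × V, |∑ y, B p.1 y * B p.2 y|) ^ 2 ≤
      (ε ^ 2 * (Fintype.card V : ℝ) ^ 3) ^ 2 := by
    refine h.trans ?_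
    push_cast
    calc _ ≤ (Fintype.card V * Fintype.card V : ℝ) * (ε ^ 4 * (Fintype.card V : ℝ) ^ 4) := by gcongr
      _ = _ := by ring
  exact (le_abs_self _).trans (abs_le_of_sq_le_sq h1 (by positivity))

open Classical in
/-- Quasirandomness in terms of finsets. -/
def QR (G : SimpleGraph V) (η d : ℝ) : Prop :=
  (∀ v, |((nb G v).card : ℝ) - d * Fintype.card V| ≤ η * Fintype.card V) ∧
  ((Finset.univ.filter fun p : V × V => p.1 ≠ p.2 ∧
    ¬ |((nb G p.1 ∩ nb G p.2).card : ℝ) - d ^ 2 * Fintype.card V| ≤ η * Fintype.card V).card : ℝ) ≤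
      2 * η * (Fintype.card V : ℝ) ^ 2

open Classical in
theorem sum_boole_adj (G : SimpleGraph V) (x : V) :
    ∑ y, (if G.Adj x y then (1 : ℝ) else 0) = (nb G x).card := by
  rw [Finset.sum_boole, nb]

open Classical in
theorem cutClose_of_QR {G : SimpleGraph V} {η d ε : ℝ} (hη0 : 0 < η) (hd0 : 0 ≤ d) (hd2 : d ≤ 2)
    (hG : QR G η d) (hε : 0 ≤ ε) (hη : 17 * η ≤ ε ^ 2) (hn : 1 ≤ η * Fintype.card V) :
    CutClose G d ε := by
  set n : ℝ := (Fintype.card V : ℝ) with hndef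
  have hn0 : 0 ≤ n := Nat.cast_nonneg _
  set B : V → V → ℝ := fun x y => (if G.Adj x y then 1 else 0) - d with hB
  have hB1 : ∀ x y, |B x y| ≤ 2 := by
    intro x y
    simp only [hB]
    split_ifs <;> rw [abs_le] <;> constructor <;> linarith
  intro f g hf hg
  refine cut_le_of_abs B ε hε ?_ f g hf hg
  have hBB : ∀ x x', |∑ y, B x y * B x' y| ≤ 4 * n := by
    intro x x'
    refine (Finset.abs_sum_le_sum_abs _ _).trans ?_
    calc ∑ y, |B x y * B x' y| ≤ ∑ _y : V, (4 : ℝ) := by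
          refine Finset.sum_le_sum fun y _ => ?_
          rw [abs_mul]
          calc _ ≤ (2 : ℝ) * 2 := mul_le_mul (hB1 _ _) (hB1 _ _) (abs_nonneg _) (by norm_num)
            _ = 4 := by norm_num
      _ = _ := by simp [hndef, mul_comm]
  have hexp : ∀ x x', ∑ y, B x y * B x' y = ((nb G x ∩ nb G x').card - d ^ 2 * n) -
      d * ((nb G x).card - d * n) - d * ((nb G x').card - d * n) := by
    intro x x'
    have h1 : ∀ y, B x y * B x' y = (if G.Adj x y ∧ G.Adj x' y then (1 : ℝ) else 0) -
        d * (if G.Adj x y then 1 else 0) - d * (if G.Adj x' y then 1 else 0) + d ^ 2 := by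
      intro y
      simp only [hB]
      by_cases h2 : G.Adj x y <;> by_cases h3 : G.Adj x' y <;> simp [h2, h3] <;> ring
    have h4 : ∑ y, (if G.Adj x y ∧ G.Adj x' y then (1 : ℝ) else 0) = (nb G x ∩ nb G x').card := by
      rw [Finset.sum_boole, nb, nb, Finset.filter_and]
    rw [Finset.sum_congr rfl fun y _ => h1 y, Finset.sum_add_distrib, Finset.sum_sub_distrib,
      Finset.sum_sub_distrib, ← Finset.mul_sum, ← Finset.mul_sum, sum_boole_adj, sum_boole_adj, h4]
    simp only [Finset.sum_const, Finset.card_univ, nsmul_eq_mul, ← hndef]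
    ring
  have hpt : ∀ p : V × V, |∑ y, B p.1 y * B p.2 y| ≤ 5 * η * n + (if p.1 = p.2 then 4 * n else 0) +
      (if p.1 ≠ p.2 ∧ ¬ |((nb G p.1 ∩ nb G p.2).card : ℝ) - d ^ 2 * n| ≤ η * n then 4 * n
        else 0) := by
    rintro ⟨x, x'⟩
    have h0 : 0 ≤ 5 * η * n := by positivity
    by_cases hx : x = x'
    · simp only [hx, if_true, ne_eq, not_true_eq_false, false_and, if_false]
      linarith [hBB x' x']
    by_cases hbad : |((nb G x ∩ nb G x').card : ℝ) - d ^ 2 * n| ≤ η * n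
    · simp only [hx, hbad, if_false, not_true_eq_false, and_false, add_zero]
      rw [hexp]
      have h1 := hG.1 x
      have h2 := hG.1 x'
      rw [← hndef] at h1 h2
      rw [abs_le] at h1 h2 hbad ⊢
      constructor <;> nlinarith
    · simp only [hx, hbad, if_false, not_false_eq_true, ne_eq, and_self, if_true, add_zero]
      linarith [hBB x x']
  rw [← Fintype.sum_prod_type']
  refine (Finset.sum_le_sum fun p _ => hpt p).trans ?_
  rw [Finset.sum_add_distrib, Finset.sum_add_distrib]
  have h1 : ∑ p : V × V, (if p.1 = p.2 then 4 * n else 0) = 4 * n * n := by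
    rw [Fintype.sum_prod_type]
    simp [hndef]
    ring
  have h2 : ∑ p : V × V, (if p.1 ≠ p.2 ∧
      ¬ |((nb G p.1 ∩ nb G p.2).card : ℝ) - d ^ 2 * n| ≤ η * n then 4 * n else 0) ≤
      (2 * η * n ^ 2) * (4 * n) := by
    rw [← Finset.sum_filter, Finset.sum_const, nsmul_eq_mul]
    exact mul_le_mul_of_nonneg_right hG.2 (by positivity)
  rw [h1]
  simp only [Finset.sum_const, Finset.card_univ, Fintype.card_prod, nsmul_eq_mul]
  push_cast
  rw [← hndef]
  have h3 : 4 * n * n ≤ 4 * η * n ^ 3 := by nlinarith [mul_nonneg hn0 hn0]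
  have h4 : 17 * η * n ^ 3 ≤ ε ^ 2 * n ^ 3 := by gcongr
  nlinarith

end Cut

section Random

variable {K : Type} [Fintype K] [DecidableEq K]

/-- The probability of a set of colours when each colour is chosen with probability `β`. -/
noncomputable def wt (β : ℝ) (C : Finset K) : ℝ := ∏ c, if c ∈ C then β else 1 - β

/-- The centred indicator of a colour. -/
noncomputable def cen (β : ℝ) (C : Finset K) (c : K) : ℝ := (if c ∈ C then 1 else 0) - β

theorem sum_prod_ite (a b : K → ℝ) :
    ∑ C : Finset K, ∏ c, (if c ∈ C then a c else b c) = ∏ c, (a c + b c) := by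
  rw [Finset.prod_add, Finset.powerset_univ]
  refine Finset.sum_congr rfl fun C _ => ?_
  rw [Finset.prod_ite]
  congr 1
  · congr 1; ext; simp
  · congr 1; ext; simp

variable {β : ℝ}

theorem wt_nonneg (h0 : 0 ≤ β) (h1 : β ≤ 1) (C : Finset K) : 0 ≤ wt β C :=
  Finset.prod_nonneg fun c _ => by split_ifs <;> linarith

theorem sum_wt : ∑ C : Finset K, wt β C = 1 := by
  simp only [wt, sum_prod_ite (fun _ => β) fun _ => 1 - β]
  simp

theorem abs_cen_le (h0 : 0 ≤ β) (h1 : β ≤ 1) (C : Finset K) (c : K) : |cen β C c| ≤ 1 := by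
  rw [cen, abs_le]
  split_ifs <;> constructor <;> linarith

theorem sum_wt_mul_cen (c : K) (Y : Finset K → ℝ) (hY : ∀ C, c ∉ C → Y (insert c C) = Y C) :
    ∑ C : Finset K, wt β C * (cen β C c * Y C) = 0 := by
  rw [← Finset.powerset_univ, ← Finset.insert_erase (Finset.mem_univ c),
    Finset.sum_powerset_insert (Finset.notMem_erase c _), ← Finset.sum_add_distrib]
  refine Finset.sum_eq_zero fun C hC => ?_
  have hc : c ∉ C := fun h => by simpa using Finset.mem_powerset.1 hC h
  have h1 : ∀ x ∈ Finset.univ.erase c, (if x ∈ insert c C then β else 1 - β) =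
      if x ∈ C then β else 1 - β := by
    intro x hx
    simp [Finset.mem_insert, (Finset.mem_erase.1 hx).1]
  have h2 : wt β C = (1 - β) * ∏ x ∈ Finset.univ.erase c, (if x ∈ C then β else 1 - β) := by
    rw [wt, ← Finset.mul_prod_erase _ _ (Finset.mem_univ c), if_neg hc]
  have h3 : wt β (insert c C) = β * ∏ x ∈ Finset.univ.erase c, (if x ∈ C then β else 1 - β) := by
    rw [wt, ← Finset.mul_prod_erase _ _ (Finset.mem_univ c), if_pos (Finset.mem_insert_self _ _),
      Finset.prod_congr rfl h1]
  rw [h2, h3, hY C hc, cen, cen, if_neg hc, if_pos (Finset.mem_insert_self _ _)]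
  ring

theorem cen_insert_of_ne {c c' : K} (h : c' ≠ c) (C : Finset K) :
    cen β (insert c C) c' = cen β C c' := by
  simp [cen, h]

theorem sum_wt_mul_cen_four (h0 : 0 ≤ β) (h1 : β ≤ 1) (c₁ c₂ c₃ c₄ : K) :
    ∑ C : Finset K, wt β C * (cen β C c₁ * (cen β C c₂ * cen β C c₃ * cen β C c₄)) ≤
      (if c₁ = c₂ then 1 else 0) + (if c₁ = c₃ then 1 else 0) + (if c₁ = c₄ then 1 else 0) := by
  by_cases h : c₁ = c₂ ∨ c₁ = c₃ ∨ c₁ = c₄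
  · have h2 : ∑ C : Finset K, wt β C *
        (cen β C c₁ * (cen β C c₂ * cen β C c₃ * cen β C c₄)) ≤ 1 := by
      rw [← sum_wt (K := K) (β := β)]
      refine Finset.sum_le_sum fun C _ => mul_le_of_le_one_right (wt_nonneg h0 h1 C) ?_
      refine (le_abs_self _).trans ?_
      rw [abs_mul, abs_mul, abs_mul]
      have h3 := abs_cen_le h0 h1 C
      exact mul_le_one₀ (h3 _) (by positivity)
        (mul_le_one₀ (mul_le_one₀ (h3 _) (abs_nonneg _) (h3 _)) (abs_nonneg _) (h3 _))
    refine h2.trans ?_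
    rcases h with h | h | h <;> rw [if_pos h] <;> split_ifs <;> norm_num
  · simp only [not_or] at h
    rw [sum_wt_mul_cen c₁ _ fun C _ => by
      rw [cen_insert_of_ne (Ne.symm h.1), cen_insert_of_ne (Ne.symm h.2.1),
        cen_insert_of_ne (Ne.symm h.2.2)]]
    positivity

theorem sum_wt_mul_exp (h0 : 0 ≤ β) (h1 : β ≤ 1) (a : K → ℝ) (ha : ∀ c, |a c| ≤ 1) :
    ∑ C : Finset K, wt β C * Real.exp (∑ c, a c * cen β C c) ≤ Real.exp (∑ c, a c ^ 2) := by
  have h2 : ∀ C : Finset K, wt β C * Real.exp (∑ c, a c * cen β C c) =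
      ∏ c, if c ∈ C then β * Real.exp (a c * (1 - β)) else (1 - β) * Real.exp (a c * (0 - β)) := by
    intro C
    rw [wt, Real.exp_sum, ← Finset.prod_mul_distrib]
    refine Finset.prod_congr rfl fun c _ => ?_
    rw [cen]
    split_ifs <;> rfl
  rw [Finset.sum_congr rfl fun C _ => h2 C, sum_prod_ite, Real.exp_sum]
  refine Finset.prod_le_prod (fun c _ => ?_) fun c _ => ?_
  · have : 0 ≤ 1 - β := by linarith
    positivity
  · have h3 : ∀ t : ℝ, |t| ≤ 1 → Real.exp (a c * t) ≤ 1 + a c * t + (a c * t) ^ 2 := by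
      intro t ht
      have h4 : |a c * t| ≤ 1 := by rw [abs_mul]; exact mul_le_one₀ (ha c) (abs_nonneg _) ht
      have := Real.abs_exp_sub_one_sub_id_le h4
      linarith [(abs_le.1 this).2]
    have h5 := h3 (1 - β) (by rw [abs_le]; constructor <;> linarith)
    have h6 := h3 (0 - β) (by rw [abs_le]; constructor <;> linarith)
    have h7 : 0 ≤ 1 - β := by linarith
    have h8 : β * (1 - β) ≤ 1 := by nlinarith
    calc β * Real.exp (a c * (1 - β)) + (1 - β) * Real.exp (a c * (0 - β))
        ≤ β * (1 + a c * (1 - β) + (a c * (1 - β)) ^ 2) +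
          (1 - β) * (1 + a c * (0 - β) + (a c * (0 - β)) ^ 2) := by gcongr
      _ = 1 + a c ^ 2 * (β * (1 - β)) := by ring
      _ ≤ 1 + a c ^ 2 * 1 := by gcongr
      _ ≤ Real.exp (a c ^ 2) := by linarith [Real.add_one_le_exp (a c ^ 2)]

end Random

section Reserve

variable {V K : Type} [Fintype V] [DecidableEq V] [Fintype K] [DecidableEq K]

open Classical in
/-- The expected fourth-moment discrepancy of a random set of colours. -/
theorem expect_square_le {G : SimpleGraph V} (φ : Sym2 V → K) (L β : ℝ) (h0 : 0 ≤ β) (h1 : β ≤ 1)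
    (hL : ∀ v c, ((Finset.univ.filter fun u => G.Adj v u ∧ φ s(v, u) = c).card : ℝ) ≤ L) :
    ∑ C : Finset K, wt β C * ∑ x, ∑ x', (∑ y, (if G.Adj x y then cen β C (φ s(x, y)) else 0) *
      (if G.Adj x' y then cen β C (φ s(x', y)) else 0)) ^ 2 ≤ 3 * L * (Fintype.card V : ℝ) ^ 3 := by
  set n : ℝ := (Fintype.card V : ℝ) with hn
  set B : Finset K → V → V → ℝ := fun C x y => if G.Adj x y then cen β C (φ s(x, y)) else 0 with hB
  have h2 : ∑ C : Finset K, wt β C * ∑ x, ∑ x', (∑ y, B C x y * B C x' y) ^ 2 =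
      ∑ x, ∑ x', ∑ y, ∑ z, ∑ C, wt β C * (B C x y * (B C x' y * B C x z * B C x' z)) := by
    simp only [Finset.mul_sum, sq, Finset.sum_mul]
    rw [Finset.sum_comm]
    refine Finset.sum_congr rfl fun x _ => ?_
    rw [Finset.sum_comm]
    refine Finset.sum_congr rfl fun x' _ => ?_
    rw [Finset.sum_comm, Finset.sum_comm]
    rw [Finset.sum_comm]
    refine Finset.sum_congr rfl fun y _ => ?_
    rw [Finset.sum_comm]
    refine Finset.sum_congr rfl fun z _ => Finset.sum_congr rfl fun C _ => by ring
  have h3 : ∀ x x' y z, ∑ C, wt β C * (B C x y * (B C x' y * B C x z * B C x' z)) ≤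
      (if G.Adj y x' ∧ φ s(y, x') = φ s(x, y) then 1 else 0) +
      (if G.Adj x z ∧ φ s(x, z) = φ s(x, y) then 1 else 0) +
      (if G.Adj x' z ∧ φ s(x', z) = φ s(x, y) then (1 : ℝ) else 0) := by
    intro x x' y z
    by_cases h : G.Adj x y ∧ G.Adj x' y ∧ G.Adj x z ∧ G.Adj x' z
    · obtain ⟨h4, h5, h6, h7⟩ := h
      simp only [hB, h4, h5, h6, h7, h5.symm, if_true, true_and]
      have := sum_wt_mul_cen_four h0 h1 (φ s(x, y)) (φ s(x', y)) (φ s(x, z)) (φ s(x', z))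
      simpa only [eq_comm, Sym2.eq_swap (a := x') (b := y)] using this
    · refine le_trans (le_of_eq ?_) (by positivity : (0 : ℝ) ≤ _)
      refine Finset.sum_eq_zero fun C _ => ?_
      have h4 : B C x y * (B C x' y * B C x z * B C x' z) = 0 := by
        by_contra hne
        simp only [mul_eq_zero, not_or] at hne
        have h5 : ∀ a b, ¬ B C a b = 0 → G.Adj a b := fun a b hab => by
          by_contra hc
          exact hab (if_neg hc)
        exact h ⟨h5 _ _ hne.1, h5 _ _ hne.2.1.1, h5 _ _ hne.2.1.2, h5 _ _ hne.2.2⟩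
      rw [h4, mul_zero]
  rw [h2]
  have h8 : ∀ x, ∑ x', ∑ y, ∑ z, ∑ C, wt β C * (B C x y * (B C x' y * B C x z * B C x' z)) ≤
      n * (n * L) + n * (n * L) + n * (n * L) := by
    intro x
    refine (Finset.sum_le_sum fun x' _ => Finset.sum_le_sum fun y _ => Finset.sum_le_sum fun z _ =>
      h3 x x' y z).trans ?_
    simp only [Finset.sum_add_distrib]
    have hs : ∀ g : V → ℝ, (∀ x, g x ≤ L) → ∑ x, g x ≤ n * L := by
      intro g hg
      refine (Finset.sum_le_sum fun x _ => hg x).trans (le_of_eq (by simp [hn]))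
    have hs' : ∀ g : V → V → ℝ, (∀ x y, g x y ≤ L) → ∑ x, ∑ y, g x y ≤ n * (n * L) := by
      intro g hg
      refine (Finset.sum_le_sum fun x _ => hs _ (hg x)).trans (le_of_eq (by simp [hn]))
    refine add_le_add (add_le_add ?_ ?_) ?_
    · have : ∑ x', ∑ y, ∑ _z : V, (if G.Adj y x' ∧ φ s(y, x') = φ s(x, y) then (1 : ℝ) else 0) =
          ∑ y, ∑ _z : V, ∑ x', (if G.Adj y x' ∧ φ s(y, x') = φ s(x, y) then (1 : ℝ) else 0) := by
        rw [Finset.sum_comm]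
        exact Finset.sum_congr rfl fun y _ => Finset.sum_comm
      rw [this]
      refine hs' _ fun y z => ?_
      rw [Finset.sum_boole]
      exact hL _ _
    · refine hs' _ fun y z => ?_
      rw [Finset.sum_boole]
      exact hL _ _
    · refine hs' _ fun y z => ?_
      rw [Finset.sum_boole]
      exact hL _ _
  calc _ ≤ ∑ _x : V, (n * (n * L) + n * (n * L) + n * (n * L)) := Finset.sum_le_sum fun x _ => h8 x
    _ = _ := by
      simp only [Finset.sum_const, Finset.card_univ, nsmul_eq_mul, ← hn]
      ring

end Reserve

section Reserve

variable {V K : Type} [Fintype V] [DecidableEq V] [Fintype K] [DecidableEq K]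

open Classical in
/-- The number of edges of colour `c` at `v`. -/
noncomputable def cdeg (G : SimpleGraph V) (φ : Sym2 V → K) (v : V) (c : K) : ℕ :=
  (Finset.univ.filter fun u => G.Adj v u ∧ φ s(v, u) = c).card

open Classical in
theorem sum_cdeg_mul (G : SimpleGraph V) (φ : Sym2 V → K) (v : V) (g : K → ℝ) :
    ∑ c, (cdeg G φ v c : ℝ) * g c = ∑ u, if G.Adj v u then g (φ s(v, u)) else 0 := by
  have h1 : ∀ c, (cdeg G φ v c : ℝ) * g c =
      ∑ u, if G.Adj v u ∧ φ s(v, u) = c then g c else 0 := by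
    intro c
    rw [cdeg, ← Finset.sum_boole, Finset.sum_mul]
    refine Finset.sum_congr rfl fun u _ => by split_ifs <;> simp
  rw [Finset.sum_congr rfl fun c _ => h1 c, Finset.sum_comm]
  refine Finset.sum_congr rfl fun u _ => ?_
  by_cases h : G.Adj v u <;> simp [h]

open Classical in
theorem sum_cdeg (G : SimpleGraph V) (φ : Sym2 V → K) (v : V) :
    ∑ c, (cdeg G φ v c : ℝ) = (nb G v).card := by
  have := sum_cdeg_mul G φ v fun _ => 1
  simp only [mul_one] at this
  rw [this, sum_boole_adj]

open Classical in
/-- Fourth-moment discrepancy of the edges with colours in `C`. -/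
noncomputable def discr (G : SimpleGraph V) (φ : Sym2 V → K) (β : ℝ) (C : Finset K) : ℝ :=
  ∑ x, ∑ x', (∑ y, (if G.Adj x y then cen β C (φ s(x, y)) else 0) *
      (if G.Adj x' y then cen β C (φ s(x', y)) else 0)) ^ 2

open Classical in
/-- Deviation of the degree of `v` into the colours in `C`. -/
noncomputable def dev (G : SimpleGraph V) (φ : Sym2 V → K) (β : ℝ) (C : Finset K) (v : V) : ℝ :=
  ∑ u, if G.Adj v u then cen β C (φ s(v, u)) else 0

theorem expect_exp_dev {G : SimpleGraph V} (φ : Sym2 V → K) {β L l : ℝ} (h0 : 0 ≤ β) (h1 : β ≤ 1)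
    (hL : ∀ v c, (cdeg G φ v c : ℝ) ≤ L) (hl : |l| * L ≤ 1) (v : V) :
    ∑ C : Finset K, wt β C * Real.exp (l * dev G φ β C v) ≤
      Real.exp (l ^ 2 * (L * Fintype.card V)) := by
  have h2 : ∀ C : Finset K, l * dev G φ β C v = ∑ c, (l * cdeg G φ v c) * cen β C c := by
    intro C
    rw [dev, ← sum_cdeg_mul, Finset.mul_sum]
    exact Finset.sum_congr rfl fun c _ => by ring
  simp only [h2]
  refine (sum_wt_mul_exp h0 h1 _ fun c => ?_).trans (Real.exp_le_exp.2 ?_)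
  · rw [abs_mul, Nat.abs_cast]
    exact (mul_le_mul_of_nonneg_left (hL v c) (abs_nonneg _)).trans hl
  · have h3 : ∑ c, (l * (cdeg G φ v c : ℝ)) ^ 2 ≤ ∑ c, l ^ 2 * (L * cdeg G φ v c) := by
      refine Finset.sum_le_sum fun c _ => ?_
      rw [mul_pow, sq (cdeg G φ v c : ℝ)]
      have := hL v c
      gcongr
    refine h3.trans ?_
    rw [← Finset.mul_sum, ← Finset.mul_sum, sum_cdeg]
    rcases isEmpty_or_nonempty K with hK | ⟨⟨c⟩⟩
    · have : (nb G v).card = 0 := by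
        have := sum_cdeg G φ v
        simp only [Finset.univ_eq_empty, Finset.sum_empty] at this
        exact_mod_cast this.symm
      have h5 : Fintype.card V = 0 := by
        by_contra hne
        exact hK.elim (φ s(v, v))
      simp [this, h5]
    · have hL0 : 0 ≤ L := (Nat.cast_nonneg _).trans (hL v c)
      have : ((nb G v).card : ℝ) ≤ Fintype.card V := by exact_mod_cast Finset.card_le_univ _
      gcongr

/-- A random set of colours is balanced with positive probability. -/
theorem exists_balanced_colours {G : SimpleGraph V} (φ : Sym2 V → K) {β L η ε ρ : ℝ} (h0 : 0 ≤ β)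
    (h1 : β ≤ 1) (hL0 : 0 ≤ L) (hL : ∀ v c, (cdeg G φ v c : ℝ) ≤ L) (hε0 : 0 < ε) (hε1 : ε ≤ 1)
    (hρ : 0 < ρ) (hηε : 16 * η ≤ ε ^ 2) (hηρ : 12 * η ≤ ρ) (hn : 3 ≤ Fintype.card V)
    (hLn : L * Real.log (Fintype.card V) ≤ η * Fintype.card V) :
    ∃ C : Finset K, discr G φ β C ≤ ρ * (Fintype.card V : ℝ) ^ 4 ∧
      ∀ v, |dev G φ β C v| ≤ ε * Fintype.card V := by
  set n : ℝ := (Fintype.card V : ℝ) with hndef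
  have hn3 : (3 : ℝ) ≤ n := by rw [hndef]; exact_mod_cast hn
  have hn0 : 0 < n := by linarith
  have hlog : 1 ≤ Real.log n := by
    rw [Real.le_log_iff_exp_le hn0]
    linarith [Real.exp_one_lt_d9]
  set l : ℝ := 4 * Real.log n / (ε * n) with hl
  have hl0 : 0 < l := by positivity
  have hlL : l * L ≤ 1 := by
    rw [hl, div_mul_eq_mul_div, div_le_one (by positivity)]
    have h2 : ε ^ 2 ≤ ε := by nlinarith
    have h3 : 4 * η * n ≤ ε * n := by
      have : 4 * η ≤ ε := by nlinarith
      gcongr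
    linarith
  have hlLn : l ^ 2 * (L * n) ≤ Real.log n := by
    have : l ^ 2 * (L * n) = 16 * (L * Real.log n) * Real.log n / (ε ^ 2 * n) := by
      rw [hl]; field_simp; ring
    rw [this, div_le_iff₀ (by positivity)]
    have h2 : 16 * (L * Real.log n) ≤ ε ^ 2 * n := by nlinarith
    nlinarith
  have hle : l * (ε * n) = 4 * Real.log n := by rw [hl]; field_simp
  set Φ : Finset K → ℝ := fun C => discr G φ β C / (ρ * n ^ 4) +
    ∑ v, (Real.exp (l * dev G φ β C v) + Real.exp (-l * dev G φ β C v)) * Real.exp (-(l * (ε * n)))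
    with hΦ
  have hEx : ∀ s : ℝ, |s| = l → ∀ v,
      ∑ C : Finset K, wt β C * Real.exp (s * dev G φ β C v) ≤ n := by
    intro s hs v
    refine (expect_exp_dev φ h0 h1 hL (by rw [hs]; exact hlL) v).trans ?_
    rw [← sq_abs, hs]
    calc _ ≤ Real.exp (Real.log n) := Real.exp_le_exp.2 hlLn
      _ = n := Real.exp_log hn0
  have hE : ∑ C : Finset K, wt β C * Φ C ≤ 3 * L * n ^ 3 / (ρ * n ^ 4) +
      n * ((n + n) * Real.exp (-(l * (ε * n)))) := by
    simp only [hΦ, mul_add, Finset.sum_add_distrib]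
    refine add_le_add ?_ ?_
    · have : ∑ C : Finset K, wt β C * (discr G φ β C / (ρ * n ^ 4)) =
          (∑ C : Finset K, wt β C * discr G φ β C) / (ρ * n ^ 4) := by
        rw [Finset.sum_div]
        exact Finset.sum_congr rfl fun C _ => by ring
      rw [this]
      refine div_le_div_of_nonneg_right ?_ (by positivity)
      exact expect_square_le φ L β h0 h1 fun v c => by
        have := hL v c
        rw [cdeg] at this
        convert this
    · simp only [Finset.mul_sum]
      rw [Finset.sum_comm]
      have h5 : ∀ v, ∑ C : Finset K, wt β C * ((Real.exp (l * dev G φ β C v) +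
          Real.exp (-l * dev G φ β C v)) * Real.exp (-(l * (ε * n)))) ≤
          (n + n) * Real.exp (-(l * (ε * n))) := by
        intro v
        have h6 := hEx l (abs_of_pos hl0) v
        have h7 := hEx (-l) (by rw [abs_neg, abs_of_pos hl0]) v
        calc _ = (∑ C : Finset K, wt β C * Real.exp (l * dev G φ β C v) +
              ∑ C : Finset K, wt β C * Real.exp (-l * dev G φ β C v)) *
                Real.exp (-(l * (ε * n))) := by
              rw [← Finset.sum_add_distrib, Finset.sum_mul]
              exact Finset.sum_congr rfl fun C _ => by ring
          _ ≤ _ := by gcongr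
      refine (Finset.sum_le_sum fun v _ => h5 v).trans (le_of_eq ?_)
      rw [Finset.sum_const, Finset.card_univ, nsmul_eq_mul]
  have hE2 : ∑ C : Finset K, wt β C * Φ C < 1 := by
    refine hE.trans_lt ?_
    have h2 : 3 * L * n ^ 3 / (ρ * n ^ 4) ≤ 1 / 4 := by
      rw [div_le_iff₀ (by positivity)]
      have h3 : L ≤ η * n := by nlinarith
      have h4 : 12 * L ≤ ρ * n := by nlinarith
      have h5 : (12 * L) * n ^ 3 ≤ (ρ * n) * n ^ 3 := by gcongr
      nlinarith
    have h3 : Real.exp (-(l * (ε * n))) = 1 / n ^ 4 := by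
      rw [hle, Real.exp_neg, show (4 : ℝ) * Real.log n = ((4 : ℕ) : ℝ) * Real.log n by norm_num,
        Real.exp_nat_mul, Real.exp_log hn0, one_div]
    have h4 : n * ((n + n) * Real.exp (-(l * (ε * n)))) ≤ 1 / 4 := by
      rw [h3]
      have : n * ((n + n) * (1 / n ^ 4)) = 2 / n ^ 2 := by field_simp; ring
      rw [this, div_le_iff₀ (by positivity)]
      nlinarith
    linarith
  obtain ⟨C, hC⟩ : ∃ C, Φ C < 1 := by
    by_contra hcon
    push Not at hcon
    have : ∑ C : Finset K, wt β C * 1 ≤ ∑ C : Finset K, wt β C * Φ C :=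
      Finset.sum_le_sum fun C _ => mul_le_mul_of_nonneg_left (hcon C) (wt_nonneg h0 h1 C)
    simp only [mul_one, sum_wt] at this
    linarith
  have hd0 : 0 ≤ discr G φ β C :=
    Finset.sum_nonneg fun _ _ => Finset.sum_nonneg fun _ _ => sq_nonneg _
  have hs0 : ∀ v, 0 ≤ (Real.exp (l * dev G φ β C v) + Real.exp (-l * dev G φ β C v)) *
    Real.exp (-(l * (ε * n))) := fun v => by positivity
  refine ⟨C, ?_, fun v => ?_⟩
  · have h2 : discr G φ β C / (ρ * n ^ 4) < 1 := by
      refine lt_of_le_of_lt ?_ hC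
      simp only [hΦ]
      linarith [Finset.sum_nonneg fun v (_ : v ∈ Finset.univ) => hs0 v]
    rw [div_lt_one (by positivity)] at h2
    exact h2.le
  · have h2 : (Real.exp (l * dev G φ β C v) + Real.exp (-l * dev G φ β C v)) *
        Real.exp (-(l * (ε * n))) < 1 := by
      refine lt_of_le_of_lt ?_ hC
      simp only [hΦ]
      have := Finset.single_le_sum (fun v _ => hs0 v) (Finset.mem_univ v)
      have h3 : 0 ≤ discr G φ β C / (ρ * n ^ 4) := by positivity
      linarith
    rw [add_mul, ← Real.exp_add, ← Real.exp_add] at h2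
    have h3 := Real.exp_pos (l * dev G φ β C v + -(l * (ε * n)))
    have h4 := Real.exp_pos (-l * dev G φ β C v + -(l * (ε * n)))
    have h5 : l * dev G φ β C v + -(l * (ε * n)) < 0 := Real.exp_lt_one_iff.1 (by linarith)
    have h6 : -l * dev G φ β C v + -(l * (ε * n)) < 0 := Real.exp_lt_one_iff.1 (by linarith)
    rw [abs_le]
    constructor <;> by_contra hcon <;> push Not at hcon <;> nlinarith

end Reserve

section Graphs

variable {V K : Type} [Fintype V] [DecidableEq V] [Fintype K] [DecidableEq K]

/-- The edges of `G` with colours in `C`. -/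
def reserveGraph (G : SimpleGraph V) (φ : Sym2 V → K) (C : Finset K) : SimpleGraph V where
  Adj u v := G.Adj u v ∧ φ s(u, v) ∈ C
  symm := ⟨fun u v h => ⟨h.1.symm, by rw [Sym2.eq_swap]; exact h.2⟩⟩
  loopless := ⟨fun u h => G.loopless.irrefl u h.1⟩

/-- The edges of `G` with colours outside `C` and small codegree. -/
def mainGraph (G : SimpleGraph V) (φ : Sym2 V → K) (C : Finset K) (s : ℝ) : SimpleGraph V where
  Adj u v := G.Adj u v ∧ φ s(u, v) ∉ C ∧ ((nb G u ∩ nb G v).card : ℝ) ≤ s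
  symm := ⟨fun u v h => ⟨h.1.symm, by rw [Sym2.eq_swap]; exact h.2.1, by
    rw [Finset.inter_comm]; exact h.2.2⟩⟩
  loopless := ⟨fun u h => G.loopless.irrefl u h.1⟩

open Classical in
theorem card_large_codegree_le {G : SimpleGraph V} {d e η ε : ℝ} (hd0 : 0 ≤ d) (hd2 : d ≤ 2)
    (hdeg : ∀ v, |((nb G v).card : ℝ) - d * Fintype.card V| ≤ η * Fintype.card V)
    (hG : CutClose G d ε) (hn : 0 < Fintype.card V) (v : V) :
    ((Finset.univ.filter fun u => (d ^ 2 + e) * Fintype.card V <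
      ((nb G v ∩ nb G u).card : ℝ)).card : ℝ) * (e - 2 * η) ≤ ε * Fintype.card V := by
  set n : ℝ := (Fintype.card V : ℝ) with hndef
  have hn0 : 0 < n := by rw [hndef]; exact_mod_cast hn
  set U := Finset.univ.filter fun u => (d ^ 2 + e) * n < ((nb G v ∩ nb G u).card : ℝ) with hU
  have h1 := (abs_le.1 (hG (fun u => if u ∈ U then 1 else 0) (fun y => if y ∈ nb G v then 1 else 0)
    (fun _ => by split_ifs <;> norm_num) (fun _ => by split_ifs <;> norm_num))).2
  have h2 : ∀ u, ∑ y, (if u ∈ U then (1 : ℝ) else 0) * (if y ∈ nb G v then 1 else 0) *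
      ((if G.Adj u y then 1 else 0) - d) =
      if u ∈ U then ((nb G v ∩ nb G u).card : ℝ) - d * (nb G v).card else 0 := by
    intro u
    split_ifs with hu
    · simp only [one_mul, mul_sub, Finset.sum_sub_distrib, ite_mul, zero_mul, mul_ite, mul_one,
        mul_zero]
      congr 1
      · rw [Finset.card_eq_sum_ones, Nat.cast_sum, ← Finset.univ_inter (nb G v ∩ nb G u),
          ← Finset.sum_ite_mem]
        refine Finset.sum_congr rfl fun y _ => ?_
        simp only [Finset.mem_inter, mem_nb]
        split_ifs <;> simp_all
      · rw [Finset.sum_ite_mem, Finset.univ_inter, Finset.sum_const, nsmul_eq_mul]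
        ring
    · simp
  rw [Finset.sum_congr rfl fun u _ => h2 u, Finset.sum_ite_mem, Finset.univ_inter] at h1
  have h3 : ∑ u ∈ U, (e - 2 * η) * n ≤
      ∑ u ∈ U, (((nb G v ∩ nb G u).card : ℝ) - d * (nb G v).card) := by
    refine Finset.sum_le_sum fun u hu => ?_
    have h4 := (Finset.mem_filter.1 hu).2
    have h5 := (abs_le.1 (hdeg v)).2
    have h8 : 0 ≤ η * n := (abs_nonneg _).trans (hdeg v)
    have h6 : d * ((nb G v).card : ℝ) ≤ d * ((d + η) * n) := by
      refine mul_le_mul_of_nonneg_left ?_ hd0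
      linarith
    have h7 : d * (η * n) ≤ 2 * (η * n) := by gcongr
    nlinarith
  rw [Finset.sum_const, nsmul_eq_mul] at h3
  have h4 : (U.card * (e - 2 * η)) * n ≤ (ε * n) * n := by
    calc _ = U.card * ((e - 2 * η) * n) := by ring
      _ ≤ _ := h3.trans h1
      _ = _ := by ring
  exact le_of_mul_le_mul_right h4 hn0

open Classical in
/-- Splitting a quasirandom graph into a main part and a reserve part with disjoint colours. -/
theorem exists_reserve (β ε : ℝ) (hβ0 : 0 ≤ β) (hβ1 : β ≤ 1) (hε0 : 0 < ε) (hε1 : ε ≤ 1) :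
    ∃ η : ℝ, 0 < η ∧ η ≤ ε ∧ ∀ (V K : Type) [Fintype V] [DecidableEq V] [Fintype K] [DecidableEq K]
      (G : SimpleGraph V) (φ : Sym2 V → K) (d L : ℝ), 0 ≤ d → d ≤ 2 → QR G η d → 0 ≤ L →
      (∀ v c, (cdeg G φ v c : ℝ) ≤ L) → L * Real.log (Fintype.card V) ≤ η * Fintype.card V →
      3 ≤ Fintype.card V → 1 ≤ η * Fintype.card V →
      ∃ (Γ R : SimpleGraph V) (C : Finset K), Γ ≤ G ∧ R ≤ G ∧ (∀ u v, Γ.Adj u v → φ s(u, v) ∉ C) ∧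
        (∀ u v, R.Adj u v → φ s(u, v) ∈ C) ∧
        (∀ u v, Γ.Adj u v → ((nb G u ∩ nb G v).card : ℝ) ≤ (d ^ 2 + ε) * Fintype.card V) ∧
        CutClose Γ ((1 - β) * d) ε ∧ CutClose R (β * d) ε ∧
        (∀ v, |((nb Γ v).card : ℝ) - (1 - β) * d * Fintype.card V| ≤ ε * Fintype.card V) ∧
        (∀ v, |((nb R v).card : ℝ) - β * d * Fintype.card V| ≤ ε * Fintype.card V) := by
  set e := ε / 4 with he
  have he0 : 0 < e := by positivity
  have he1 : e ≤ 1 / 4 := by rw [he]; linarith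
  have hp3 : e ^ 4 ≤ e ^ 2 := pow_le_pow_of_le_one he0.le (by linarith) (by norm_num)
  have hp2 : e ^ 2 ≤ e := by nlinarith
  refine ⟨e ^ 4 / 1000, by positivity, by linarith, ?_⟩
  set η := e ^ 4 / 1000 with hη
  have hη0 : 0 < η := by positivity
  have hηe : η ≤ e / 1000 := by rw [hη]; linarith
  intro V K _ _ _ _ G φ d L hd0 hd2 hQR hL0 hL hLn hn3 hηn
  set n : ℝ := (Fintype.card V : ℝ) with hndef
  have hn0 : 0 < n := by rw [hndef]; exact_mod_cast (by omega : 0 < Fintype.card V)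
  have hcut : CutClose G d (e ^ 2 / 2) := cutClose_of_QR hη0 hd0 hd2 hQR (by positivity)
    (by rw [hη]; nlinarith [pow_pos he0 4]) hηn
  obtain ⟨C, hC1, hC2⟩ := exists_balanced_colours φ hβ0 hβ1 hL0 hL he0 (by linarith)
    (show (0 : ℝ) < e ^ 4 by positivity) (by rw [hη]; nlinarith) (by rw [hη]; linarith) hn3 hLn
  set Γ := mainGraph G φ C ((d ^ 2 + e) * n) with hΓ
  set R := reserveGraph G φ C with hR
  have hbad : ∀ v, ((Finset.univ.filter fun u => (d ^ 2 + e) * n <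
      ((nb G v ∩ nb G u).card : ℝ)).card : ℝ) ≤ e * n := by
    intro v
    have h1 := card_large_codegree_le (e := e) hd0 hd2 hQR.1 hcut
      (by omega) v
    have h2 : (0 : ℝ) ≤ ((Finset.univ.filter fun u => (d ^ 2 + e) * n <
      ((nb G v ∩ nb G u).card : ℝ)).card : ℝ) := Nat.cast_nonneg _
    have h3 : ((Finset.univ.filter fun u => (d ^ 2 + e) * n <
      ((nb G v ∩ nb G u).card : ℝ)).card : ℝ) * (e / 2) ≤ e * n * (e / 2) := by
      calc _ ≤ ((Finset.univ.filter fun u => (d ^ 2 + e) * n <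
          ((nb G v ∩ nb G u).card : ℝ)).card : ℝ) * (e - 2 * η) := by
            refine mul_le_mul_of_nonneg_left ?_ h2
            linarith
        _ ≤ _ := h1
        _ = _ := by ring
    exact le_of_mul_le_mul_right h3 (by positivity)
  have hRe : ∀ x y, (if R.Adj x y then (1 : ℝ) else 0) = (if G.Adj x y then cen β C (φ s(x, y))
      else 0) + β * (if G.Adj x y then 1 else 0) := by
    intro x y
    simp only [hR, reserveGraph, cen]
    by_cases h1 : G.Adj x y <;> by_cases h2 : φ s(x, y) ∈ C <;> simp [h1, h2]
  have hΓe : ∀ x y, (if Γ.Adj x y then (1 : ℝ) else 0) = (if G.Adj x y then 1 else 0) -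
      (if R.Adj x y then 1 else 0) - (if G.Adj x y ∧ φ s(x, y) ∉ C ∧
        (d ^ 2 + e) * n < ((nb G x ∩ nb G y).card : ℝ) then 1 else 0) := by
    intro x y
    simp only [hR, hΓ, reserveGraph, mainGraph, ← not_le]
    by_cases h1 : G.Adj x y <;> by_cases h2 : φ s(x, y) ∈ C <;>
      by_cases h3 : ((nb G x ∩ nb G y).card : ℝ) ≤ (d ^ 2 + e) * n <;> simp [h1, h2, h3]
  have hbad' : ∀ v, ∑ u, (if G.Adj v u ∧ φ s(v, u) ∉ C ∧
        (d ^ 2 + e) * n < ((nb G v ∩ nb G u).card : ℝ) then (1 : ℝ) else 0) ≤ e * n := by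
    intro v
    rw [Finset.sum_boole]
    refine le_trans ?_ (hbad v)
    exact_mod_cast Finset.card_le_card fun u hu => by
      simp only [Finset.mem_filter, Finset.mem_univ, true_and] at hu ⊢
      exact hu.2.2
  have hdR : ∀ v, ((nb R v).card : ℝ) = dev G φ β C v + β * (nb G v).card := by
    intro v
    rw [← sum_boole_adj, ← sum_boole_adj, dev, Finset.mul_sum, ← Finset.sum_add_distrib]
    exact Finset.sum_congr rfl fun u _ => hRe v u
  have hdR' : ∀ v, |((nb R v).card : ℝ) - β * d * n| ≤ (e + η) * n := by
    intro v
    have h1 := abs_le.1 (hC2 v)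
    have h2 := abs_le.1 (hQR.1 v)
    have h4 : 0 ≤ η * n := by positivity
    rw [hdR, show dev G φ β C v + β * ((nb G v).card : ℝ) - β * d * n =
      dev G φ β C v + β * (((nb G v).card : ℝ) - d * n) by ring]
    refine (abs_add_le _ _).trans ?_
    rw [abs_mul, abs_of_nonneg hβ0, add_mul]
    refine add_le_add (hC2 v) ((mul_le_of_le_one_left (abs_nonneg _) hβ1).trans (hQR.1 v))
  have hcR : ∀ f g : V → ℝ, (∀ x, 0 ≤ f x ∧ f x ≤ 1) → (∀ x, 0 ≤ g x ∧ g x ≤ 1) →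
      |∑ x, ∑ y, f x * g y * ((if R.Adj x y then 1 else 0) - β * d)| ≤
        (e + e ^ 2 / 2) * n ^ 2 := by
    intro f g hf hg
    have h1 := cut_le_of_sq (fun x y => if G.Adj x y then cen β C (φ s(x, y)) else 0) e he0.le hC1
      f g hf hg
    have h2 := hcut f g hf hg
    have h3 : ∑ x, ∑ y, f x * g y * ((if R.Adj x y then 1 else 0) - β * d) =
        ∑ x, ∑ y, f x * g y * (if G.Adj x y then cen β C (φ s(x, y)) else 0) +
        β * ∑ x, ∑ y, f x * g y * ((if G.Adj x y then 1 else 0) - d) := by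
      simp only [Finset.mul_sum, ← Finset.sum_add_distrib]
      refine Finset.sum_congr rfl fun x _ => Finset.sum_congr rfl fun y _ => ?_
      rw [hRe]
      ring
    rw [h3]
    refine (abs_add_le _ _).trans ?_
    rw [abs_mul, abs_of_nonneg hβ0, add_mul]
    exact add_le_add h1 ((mul_le_of_le_one_left (abs_nonneg _) hβ1).trans h2)
  have hmono : ∀ {x : ℝ}, x ≤ ε → x * n ^ 2 ≤ ε * n ^ 2 := fun hx => by gcongr
  refine ⟨Γ, R, C, fun u v h => h.1, fun u v h => h.1, fun u v h => h.2.1, fun u v h => h.2,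
    fun u v h => h.2.2.trans ?_, ?_, ?_, ?_, fun v => (hdR' v).trans ?_⟩
  · gcongr
    linarith
  · intro f g hf hg
    have h1 := hcR f g hf hg
    have h2 := hcut f g hf hg
    set X := ∑ x, ∑ y, f x * g y * (if G.Adj x y ∧ φ s(x, y) ∉ C ∧
        (d ^ 2 + e) * n < ((nb G x ∩ nb G y).card : ℝ) then (1 : ℝ) else 0) with hX
    have h3 : ∑ x, ∑ y, f x * g y * ((if Γ.Adj x y then 1 else 0) - (1 - β) * d) =
        ∑ x, ∑ y, f x * g y * ((if G.Adj x y then 1 else 0) - d) -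
        ∑ x, ∑ y, f x * g y * ((if R.Adj x y then 1 else 0) - β * d) - X := by
      simp only [hX, ← Finset.sum_sub_distrib]
      refine Finset.sum_congr rfl fun x _ => Finset.sum_congr rfl fun y _ => ?_
      rw [hΓe]
      ring
    have h4 : ∀ x y, 0 ≤ f x * g y ∧ f x * g y ≤ 1 := fun x y =>
      ⟨mul_nonneg (hf x).1 (hg y).1, mul_le_one₀ (hf x).2 (hg y).1 (hg y).2⟩
    have h5 : 0 ≤ X := Finset.sum_nonneg fun x _ => Finset.sum_nonneg fun y _ =>
      mul_nonneg (h4 x y).1 (by split_ifs <;> norm_num)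
    have h6 : X ≤ e * n ^ 2 := by
      calc X ≤ ∑ _x : V, e * n := by
            refine Finset.sum_le_sum fun x _ => (Finset.sum_le_sum fun y _ => ?_).trans (hbad' x)
            exact mul_le_of_le_one_left (by split_ifs <;> norm_num) (h4 x y).2
        _ = e * n ^ 2 := by
            rw [Finset.sum_const, Finset.card_univ, nsmul_eq_mul]
            ring
    rw [h3]
    rw [abs_le] at h1 h2
    have h7 := hmono (x := e + e ^ 2 / 2 + e ^ 2 / 2 + e) (by linarith)
    rw [add_mul, add_mul, add_mul] at h7
    rw [add_mul] at h1
    have h8 : 0 ≤ e * n ^ 2 := by positivity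
    rw [abs_le]
    constructor <;> linarith
  · intro f g hf hg
    exact (hcR f g hf hg).trans (hmono (by linarith))
  · intro v
    have h1 : ((nb Γ v).card : ℝ) = (nb G v).card - (nb R v).card -
        ∑ u, (if G.Adj v u ∧ φ s(v, u) ∉ C ∧
        (d ^ 2 + e) * n < ((nb G v ∩ nb G u).card : ℝ) then (1 : ℝ) else 0) := by
      rw [← sum_boole_adj, ← sum_boole_adj, ← sum_boole_adj, ← Finset.sum_sub_distrib,
        ← Finset.sum_sub_distrib]
      exact Finset.sum_congr rfl fun u _ => hΓe v u
    have h2 := hbad' v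
    have h3 : 0 ≤ ∑ u, (if G.Adj v u ∧ φ s(v, u) ∉ C ∧
        (d ^ 2 + e) * n < ((nb G v ∩ nb G u).card : ℝ) then (1 : ℝ) else 0) :=
      Finset.sum_nonneg fun u _ => by split_ifs <;> norm_num
    have h4 := abs_le.1 (hQR.1 v)
    have h5 := abs_le.1 (hdR' v)
    have h6 : (2 * e + 2 * η) * n ≤ ε * n := by
      gcongr
      linarith
    rw [h1, abs_le]
    rw [add_mul] at h5
    constructor <;> nlinarith
  · gcongr
    linarith

end Graphs

section Valid

variable {V K : Type} [Fintype V] [DecidableEq V] [Fintype K] [DecidableEq K] {f : ℕ}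

open Classical in
/-- The number of maps with a given property. -/
noncomputable def cnt (P : (Fin f → V) → Prop) : ℝ :=
  ((Finset.univ.filter fun ψ : Fin f → V => P ψ).card : ℝ)

theorem cnt_nonneg (P : (Fin f → V) → Prop) : 0 ≤ cnt P := Nat.cast_nonneg _

theorem cnt_mono {P Q : (Fin f → V) → Prop} (h : ∀ ψ, P ψ → Q ψ) : cnt P ≤ cnt Q := by
  unfold cnt
  exact_mod_cast Finset.card_le_card fun ψ hψ => by
    simp only [Finset.mem_filter, Finset.mem_univ, true_and] at hψ ⊢
    exact h ψ hψ

theorem cnt_congr {P Q : (Fin f → V) → Prop} (h : ∀ ψ, P ψ ↔ Q ψ) : cnt P = cnt Q :=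
  le_antisymm (cnt_mono fun ψ => (h ψ).1) (cnt_mono fun ψ => (h ψ).2)

theorem cnt_exists_le {ι : Type*} (s : Finset ι) (P : ι → (Fin f → V) → Prop) :
    cnt (fun ψ => ∃ i ∈ s, P i ψ) ≤ ∑ i ∈ s, cnt (P i) := by
  classical
  unfold cnt
  norm_cast
  refine le_trans (Finset.card_le_card fun ψ hψ => ?_) Finset.card_biUnion_le
  simp only [Finset.mem_filter, Finset.mem_univ, true_and, Finset.mem_biUnion] at hψ ⊢
  exact hψ

theorem cnt_exists_eq {ι : Type*} (s : Finset ι) (P : ι → (Fin f → V) → Prop)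
    (hd : ∀ i ∈ s, ∀ j ∈ s, i ≠ j → ∀ ψ, P i ψ → ¬ P j ψ) :
    cnt (fun ψ => ∃ i ∈ s, P i ψ) = ∑ i ∈ s, cnt (P i) := by
  classical
  unfold cnt
  norm_cast
  rw [← Finset.card_biUnion]
  · congr 1
    ext ψ
    simp
  · intro i hi j hj hij
    refine Finset.disjoint_filter.2 fun ψ _ h => hd i hi j hj hij ψ h

theorem cnt_or_le (P Q : (Fin f → V) → Prop) : cnt (fun ψ => P ψ ∨ Q ψ) ≤ cnt P + cnt Q := by
  classical
  unfold cnt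
  simp only [Finset.filter_or]
  exact_mod_cast Finset.card_union_le _ _

theorem cnt_true : cnt (fun _ : Fin f → V => True) = (Fintype.card V : ℝ) ^ f := by
  simp [cnt, Finset.filter_true]

theorem cnt_fiber (m : Fin f) (Q P : (Fin f → V) → Prop) (k : ℝ)
    (hQ : ∀ ψ y, Q ψ ↔ Q (Function.update ψ m y))
    (hP : ∀ ψ (s : Finset V), (∀ y ∈ s, P (Function.update ψ m y)) → (s.card : ℝ) ≤ k) :
    (Fintype.card V : ℝ) * cnt (fun ψ => Q ψ ∧ P ψ) ≤ k * cnt Q := by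
  classical
  unfold cnt
  convert card_fiber_le m Q P k hQ fun ψ _ => hP ψ _ fun y hy => (Finset.mem_filter.1 hy).2

theorem cnt_pin (m : Fin f) (Q : (Fin f → V) → Prop)
    (hQ : ∀ ψ y, Q ψ ↔ Q (Function.update ψ m y)) (v : V) :
    (Fintype.card V : ℝ) * cnt (fun ψ => Q ψ ∧ ψ m = v) = cnt Q := by
  classical
  unfold cnt
  convert card_pin_eq m Q hQ v

theorem cnt_vertex (a : Fin f) (v : V) :
    (Fintype.card V : ℝ) * cnt (fun ψ => ψ a = v) = (Fintype.card V : ℝ) ^ f := by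
  rw [← cnt_true (V := V) (f := f), ← cnt_pin a (fun _ => True) (fun _ _ => Iff.rfl) v]
  simp

theorem cnt_vertex_vertex {a b : Fin f} (hab : a ≠ b) (v w : V) :
    (Fintype.card V : ℝ) ^ 2 * cnt (fun ψ => ψ a = v ∧ ψ b = w) = (Fintype.card V : ℝ) ^ f := by
  rw [sq, mul_assoc, cnt_pin b (fun ψ => ψ a = v) (fun ψ y => by
    rw [Function.update_of_ne hab]) w, cnt_vertex]

variable (F : SimpleGraph (Fin f)) (G : SimpleGraph V) (φ : Sym2 V → K)

/-- The image under `ψ` of the edge `p`. -/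
def im (ψ : Fin f → V) (p : Fin f × Fin f) : Sym2 V := s(ψ p.1, ψ p.2)

variable {F}

theorem im_eq_of_endpoint {p : Fin f × Fin f} (hp : p ∈ edgeP F) {m : Fin f}
    (hm : m = p.1 ∨ m = p.2) :
    ∃ o, o ≠ m ∧ (o = p.1 ∨ o = p.2) ∧ ∀ ψ : Fin f → V, im ψ p = s(ψ m, ψ o) := by
  have h := (mem_edgeP F).1 hp
  rcases hm with rfl | rfl
  · exact ⟨p.2, h.1.ne', Or.inr rfl, fun ψ => rfl⟩
  · exact ⟨p.1, h.1.ne, Or.inl rfl, fun ψ => Sym2.eq_swap⟩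

theorem exists_endpoint_ne {p : Fin f × Fin f} (hp : p ∈ edgeP F) (a : Fin f) :
    ∃ m, (m = p.1 ∨ m = p.2) ∧ m ≠ a := by
  have h := (mem_edgeP F).1 hp
  by_cases h1 : p.1 = a
  · exact ⟨p.2, Or.inr rfl, fun h2 => h.1.ne (h1.trans h2.symm)⟩
  · exact ⟨p.1, Or.inl rfl, h1⟩

theorem exists_endpoint_notMem {p p' : Fin f × Fin f} (hp : p ∈ edgeP F) (hp' : p' ∈ edgeP F)
    (h : p ≠ p') : ∃ m, (m = p'.1 ∨ m = p'.2) ∧ m ≠ p.1 ∧ m ≠ p.2 := by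
  have h1 := ((mem_edgeP F).1 hp).1
  have h2 := ((mem_edgeP F).1 hp').1
  by_contra hcon
  push Not at hcon
  have h3 := hcon p'.1 (Or.inl rfl)
  have h4 := hcon p'.2 (Or.inr rfl)
  refine h (Prod.ext ?_ ?_)
  · by_contra h5
    have h6 := h3 (Ne.symm h5)
    by_cases h7 : p'.2 = p.1
    · rw [h6, h7] at h2
      exact absurd h1 h2.asymm
    · have h8 := h4 h7
      rw [h6, h8] at h2
      exact lt_irrefl _ h2
  · by_contra h5
    have h6 : p'.2 = p.1 := by
      by_contra h7
      exact h5 (h4 h7).symm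
    by_cases h7 : p'.1 = p.1
    · rw [h6, h7] at h2
      exact lt_irrefl _ h2
    · have h8 := h3 h7
      rw [h6, h8] at h2
      exact absurd h1 h2.asymm

theorem im_update_of_ne {m : Fin f} {p : Fin f × Fin f} (h1 : m ≠ p.1) (h2 : m ≠ p.2)
    (ψ : Fin f → V) (y : V) : im (Function.update ψ m y) p = im ψ p := by
  rw [im, im, Function.update_of_ne h1.symm, Function.update_of_ne h2.symm]

/-- Varying one endpoint, an edge has a given image at most once. -/
theorem fiber_edge {p : Fin f × Fin f} (hp : p ∈ edgeP F) {m : Fin f} (hm : m = p.1 ∨ m = p.2)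
    (e : Sym2 V) (ψ : Fin f → V) (s : Finset V)
    (hs : ∀ y ∈ s, im (Function.update ψ m y) p = e) : (s.card : ℝ) ≤ 1 := by
  obtain ⟨o, ho, -, him⟩ := im_eq_of_endpoint (V := V) hp hm
  have : s.card ≤ 1 := by
    refine Finset.card_le_one.2 fun y hy z hz => ?_
    have h1 := (hs y hy).trans (hs z hz).symm
    rw [him, him, Function.update_self, Function.update_self, Function.update_of_ne ho,
      Function.update_of_ne ho] at h1
    exact Sym2.congr_left.1 h1
  exact_mod_cast this

/-- The image of the edge `p` is an edge of `G` of colour `c`. -/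
def HasCol (ψ : Fin f → V) (p : Fin f × Fin f) (c : K) : Prop :=
  G.Adj (ψ p.1) (ψ p.2) ∧ φ (im ψ p) = c

variable {G φ}

theorem fiber_colour {L : ℝ} (hL : ∀ v c, (cdeg G φ v c : ℝ) ≤ L) {p : Fin f × Fin f}
    (hp : p ∈ edgeP F) {m : Fin f} (hm : m = p.1 ∨ m = p.2) (ψ : Fin f → V) (c : K) (s : Finset V)
    (hs : ∀ y ∈ s, HasCol G φ (Function.update ψ m y) p c) : (s.card : ℝ) ≤ L := by
  classical
  obtain ⟨o, ho, ho', him⟩ := im_eq_of_endpoint (V := V) hp hm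
  refine le_trans ?_ (hL (ψ o) c)
  rw [cdeg]
  refine Nat.cast_le.2 (Finset.card_le_card fun y hy => ?_)
  have h1 := hs y hy
  rw [HasCol, him, ← SimpleGraph.mem_edgeSet] at h1
  have h2 : s((Function.update ψ m y) p.1, (Function.update ψ m y) p.2) =
      im (Function.update ψ m y) p := rfl
  rw [h2, him, Function.update_self, Function.update_of_ne ho, SimpleGraph.mem_edgeSet] at h1
  simp only [Finset.mem_filter, Finset.mem_univ, true_and]
  exact ⟨h1.1.symm, by rw [Sym2.eq_swap]; exact h1.2⟩

theorem cnt_vertex_edge {p : Fin f × Fin f} (hp : p ∈ edgeP F) (a : Fin f) (v : V) (e : Sym2 V) :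
    (Fintype.card V : ℝ) ^ 2 * cnt (fun ψ => ψ a = v ∧ im ψ p = e) ≤ (Fintype.card V : ℝ) ^ f := by
  obtain ⟨m, hm, hma⟩ := exists_endpoint_ne hp a
  have h1 := cnt_fiber m (fun ψ : Fin f → V => ψ a = v) (fun ψ => im ψ p = e) 1
    (fun ψ y => by rw [Function.update_of_ne hma.symm]) fun ψ s hs => fiber_edge hp hm e ψ s hs
  rw [sq, mul_assoc, ← cnt_vertex a v]
  exact mul_le_mul_of_nonneg_left (h1.trans_eq (one_mul _)) (Nat.cast_nonneg _)

theorem cnt_vertex_colour {L : ℝ} (hL : ∀ v c, (cdeg G φ v c : ℝ) ≤ L) {p : Fin f × Fin f}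
    (hp : p ∈ edgeP F) (a : Fin f) (v : V) (c : K) :
    (Fintype.card V : ℝ) ^ 2 * cnt (fun ψ => ψ a = v ∧ HasCol G φ ψ p c) ≤
      L * (Fintype.card V : ℝ) ^ f := by
  obtain ⟨m, hm, hma⟩ := exists_endpoint_ne hp a
  have h1 := cnt_fiber m (fun ψ : Fin f → V => ψ a = v) (fun ψ => HasCol G φ ψ p c) L
    (fun ψ y => by rw [Function.update_of_ne hma.symm]) fun ψ s hs => fiber_colour hL hp hm ψ c s hs
  rw [sq, mul_assoc, ← cnt_vertex a v, mul_left_comm L]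
  exact mul_le_mul_of_nonneg_left h1 (Nat.cast_nonneg _)

theorem cnt_edge {p : Fin f × Fin f} (hp : p ∈ edgeP F) (e : Sym2 V) :
    (Fintype.card V : ℝ) ^ 2 * cnt (fun ψ => im ψ p = e) ≤ 2 * (Fintype.card V : ℝ) ^ f := by
  have hne : p.1 ≠ p.2 := ((mem_edgeP F).1 hp).1.ne
  induction e with
  | _ u v =>
  have h1 : cnt (fun ψ => im ψ p = s(u, v)) ≤
      cnt (fun ψ => ψ p.1 = u ∧ ψ p.2 = v) + cnt (fun ψ => ψ p.1 = v ∧ ψ p.2 = u) := by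
    refine (cnt_mono fun ψ h => ?_).trans (cnt_or_le _ _)
    simpa [im] using h
  have h2 := cnt_vertex_vertex hne u v
  have h3 := cnt_vertex_vertex hne v u
  calc _ ≤ (Fintype.card V : ℝ) ^ 2 * (cnt (fun ψ => ψ p.1 = u ∧ ψ p.2 = v) +
        cnt (fun ψ => ψ p.1 = v ∧ ψ p.2 = u)) := by gcongr
    _ = _ := by rw [mul_add, h2, h3]; ring

theorem cnt_edge_edge {p p' : Fin f × Fin f} (hp : p ∈ edgeP F) (hp' : p' ∈ edgeP F) (h : p ≠ p')
    (e e' : Sym2 V) :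
    (Fintype.card V : ℝ) ^ 3 * cnt (fun ψ => im ψ p = e ∧ im ψ p' = e') ≤
      2 * (Fintype.card V : ℝ) ^ f := by
  obtain ⟨m, hm, h1, h2⟩ := exists_endpoint_notMem hp hp' h
  have h3 := cnt_fiber m (fun ψ : Fin f → V => im ψ p = e) (fun ψ => im ψ p' = e') 1
    (fun ψ y => by rw [im_update_of_ne h1 h2]) fun ψ s hs => fiber_edge hp' hm e' ψ s hs
  rw [one_mul] at h3
  refine le_trans ?_ (cnt_edge hp e)
  rw [pow_succ, mul_assoc]
  exact mul_le_mul_of_nonneg_left h3 (by positivity)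

theorem hasCol_update_of_ne {m : Fin f} {p : Fin f × Fin f} (h1 : m ≠ p.1) (h2 : m ≠ p.2)
    (ψ : Fin f → V) (y : V) (c : K) :
    HasCol G φ (Function.update ψ m y) p c ↔ HasCol G φ ψ p c := by
  rw [HasCol, HasCol, im_update_of_ne h1 h2, Function.update_of_ne h1.symm,
    Function.update_of_ne h2.symm]

open Classical in
theorem cnt_colour_eq {p : Fin f × Fin f} (c : K) (P : (Fin f → V) → Prop) :
    cnt (fun ψ => P ψ ∧ HasCol G φ ψ p c) = ∑ u, ∑ v,
      if G.Adj u v ∧ φ s(u, v) = c then cnt (fun ψ => P ψ ∧ ψ p.1 = u ∧ ψ p.2 = v) else 0 := by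
  have h1 : cnt (fun ψ => P ψ ∧ HasCol G φ ψ p c) = cnt (fun ψ => ∃ x ∈ Finset.univ.filter
      (fun x : V × V => G.Adj x.1 x.2 ∧ φ s(x.1, x.2) = c), P ψ ∧ ψ p.1 = x.1 ∧ ψ p.2 = x.2) := by
    refine cnt_congr fun ψ => ⟨fun h => ⟨(ψ p.1, ψ p.2), ?_, h.1, rfl, rfl⟩, ?_⟩
    · simp only [Finset.mem_filter, Finset.mem_univ, true_and]
      exact h.2
    · rintro ⟨⟨u, v⟩, hx, hP, h2, h3⟩
      simp only [Finset.mem_filter, Finset.mem_univ, true_and] at hx h2 h3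
      subst h2 h3
      exact ⟨hP, hx⟩
  rw [h1, cnt_exists_eq, Finset.sum_filter, Fintype.sum_prod_type]
  · rintro x - y - hxy ψ ⟨-, h2, h3⟩ ⟨-, h4, h5⟩
    exact hxy (Prod.ext (h2.symm.trans h4) (h3.symm.trans h5))

open Classical in
theorem sum_adj_colour (c : K) (x : ℝ) : (∑ u, ∑ v,
    if G.Adj u v ∧ φ s(u, v) = c then x else 0) = (∑ u, (cdeg G φ u c : ℝ)) * x := by
  rw [Finset.sum_mul]
  refine Finset.sum_congr rfl fun u _ => ?_
  rw [← Finset.sum_filter, Finset.sum_const, nsmul_eq_mul, cdeg]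

theorem cnt_colour {p : Fin f × Fin f} (hp : p ∈ edgeP F) (c : K) :
    (Fintype.card V : ℝ) ^ 2 * cnt (fun ψ => HasCol G φ ψ p c) =
      (∑ v, (cdeg G φ v c : ℝ)) * (Fintype.card V : ℝ) ^ f := by
  have h := cnt_colour_eq (G := G) (φ := φ) (p := p) c fun _ : Fin f → V => True
  simp only [true_and] at h
  rw [h, ← sum_adj_colour, Finset.mul_sum]
  refine Finset.sum_congr rfl fun u _ => ?_
  rw [Finset.mul_sum]
  refine Finset.sum_congr rfl fun v _ => ?_
  rw [mul_ite, mul_zero, cnt_vertex_vertex ((mem_edgeP F).1 hp).1.ne]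

theorem cnt_colour_colour {L : ℝ} (hL : ∀ v c, (cdeg G φ v c : ℝ) ≤ L) {p p' : Fin f × Fin f}
    (hp : p ∈ edgeP F) (hp' : p' ∈ edgeP F) (h : p ≠ p') (c c' : K) :
    (Fintype.card V : ℝ) ^ 3 * cnt (fun ψ => HasCol G φ ψ p c ∧ HasCol G φ ψ p' c') ≤
      L * ((∑ v, (cdeg G φ v c : ℝ)) * (Fintype.card V : ℝ) ^ f) := by
  obtain ⟨m, hm, h1, h2⟩ := exists_endpoint_notMem hp hp' h
  have h3 := cnt_fiber m (fun ψ : Fin f → V => HasCol G φ ψ p c) (fun ψ => HasCol G φ ψ p' c') L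
    (fun ψ y => by rw [hasCol_update_of_ne h1 h2]) fun ψ s hs => fiber_colour hL hp' hm ψ c' s hs
  rw [← cnt_colour hp, pow_succ, mul_assoc, mul_left_comm L]
  exact mul_le_mul_of_nonneg_left h3 (by positivity)

variable (F G φ)

/-- `ψ` is a rainbow embedding of `F` in `G`. -/
structure Valid (ψ : Fin f → V) : Prop where
  inj : Function.Injective ψ
  hom : IsHom F G ψ
  rainbow : ∀ p ∈ edgeP F, ∀ p' ∈ edgeP F, φ (im ψ p) = φ (im ψ p') → p = p'

variable {F G φ}

theorem cnt_rooted_not_injective (j : Fin f) (v : V) :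
    (Fintype.card V : ℝ) ^ 2 * cnt (fun ψ => ψ j = v ∧ ¬ Function.Injective ψ) ≤
      f ^ 2 * (Fintype.card V : ℝ) ^ f := by
  classical
  have h1 : cnt (fun ψ => ψ j = v ∧ ¬ Function.Injective ψ) ≤ cnt (fun ψ =>
      ∃ x ∈ Finset.univ.filter (fun x : Fin f × Fin f => x.1 ≠ x.2 ∧ x.1 ≠ j),
        ψ j = v ∧ ψ x.1 = ψ x.2) := by
    refine cnt_mono fun ψ h => ?_
    obtain ⟨h2, h3⟩ := h
    rw [Function.Injective] at h3
    push Not at h3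
    obtain ⟨a, b, h4, h5⟩ := h3
    by_cases h6 : a = j
    · exact ⟨(b, a), by simpa using ⟨h5.symm, fun h7 => h5 (h6.trans h7.symm)⟩, h2, h4.symm⟩
    · exact ⟨(a, b), by simpa using ⟨h5, h6⟩, h2, h4⟩
  have h2 : ∀ x ∈ Finset.univ.filter (fun x : Fin f × Fin f => x.1 ≠ x.2 ∧ x.1 ≠ j),
      (Fintype.card V : ℝ) ^ 2 * cnt (fun ψ => ψ j = v ∧ ψ x.1 = ψ x.2) ≤
        (Fintype.card V : ℝ) ^ f := by
    intro x hx
    simp only [Finset.mem_filter, Finset.mem_univ, true_and] at hx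
    have h3 := cnt_fiber x.1 (fun ψ : Fin f → V => ψ j = v) (fun ψ => ψ x.1 = ψ x.2) 1
      (fun ψ y => by rw [Function.update_of_ne hx.2.symm]) fun ψ s hs => by
        have : s.card ≤ 1 := Finset.card_le_one.2 fun y hy z hz => by
          have h4 := hs y hy
          have h5 := hs z hz
          rw [Function.update_self, Function.update_of_ne hx.1.symm] at h4 h5
          exact h4.trans h5.symm
        exact_mod_cast this
    rw [sq, mul_assoc, ← cnt_vertex j v]
    exact mul_le_mul_of_nonneg_left (h3.trans_eq (one_mul _)) (Nat.cast_nonneg _)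
  refine (mul_le_mul_of_nonneg_left (h1.trans (cnt_exists_le _ _)) (by positivity)).trans ?_
  rw [Finset.mul_sum]
  refine (Finset.sum_le_sum h2).trans ?_
  rw [Finset.sum_const, nsmul_eq_mul]
  refine mul_le_mul_of_nonneg_right ?_ (by positivity)
  have h3 := Finset.card_le_univ
    (Finset.univ.filter fun x : Fin f × Fin f => x.1 ≠ x.2 ∧ x.1 ≠ j)
  rw [Fintype.card_prod, Fintype.card_fin, ← sq] at h3
  exact_mod_cast h3

theorem cnt_rooted_not_rainbow {L : ℝ} (hL : ∀ v c, (cdeg G φ v c : ℝ) ≤ L) (j : Fin f) (v : V) :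
    (Fintype.card V : ℝ) ^ 2 * cnt (fun ψ => ψ j = v ∧ IsHom F G ψ ∧
      ¬ ∀ p ∈ edgeP F, ∀ p' ∈ edgeP F, φ (im ψ p) = φ (im ψ p') → p = p') ≤
      ((edgeP F).card : ℝ) ^ 2 * (L * (Fintype.card V : ℝ) ^ f) := by
  classical
  have h1 : cnt (fun ψ => ψ j = v ∧ IsHom F G ψ ∧
      ¬ ∀ p ∈ edgeP F, ∀ p' ∈ edgeP F, φ (im ψ p) = φ (im ψ p') → p = p') ≤ cnt (fun ψ =>
      ∃ x ∈ (edgeP F ×ˢ edgeP F).filter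
        (fun x => ∃ m, m ≠ j ∧ (m = x.1.1 ∨ m = x.1.2) ∧ m ≠ x.2.1 ∧ m ≠ x.2.2),
        ψ j = v ∧ HasCol G φ ψ x.1 (φ (im ψ x.2))) := by
    refine cnt_mono fun ψ h => ?_
    obtain ⟨h2, hom, h3⟩ := h
    push Not at h3
    obtain ⟨p, hp, p', hp', h4, h5⟩ := h3
    obtain ⟨a, ha, ha1, ha2⟩ := exists_endpoint_notMem hp hp' h5
    obtain ⟨b, hb, hb1, hb2⟩ := exists_endpoint_notMem hp' hp (Ne.symm h5)
    have hh := isHom_iff.1 hom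
    by_cases h6 : a = j
    · refine ⟨(p, p'), ?_, h2, hh p hp, h4⟩
      simp only [Finset.mem_filter, Finset.mem_product]
      refine ⟨⟨hp, hp'⟩, b, fun h7 => ?_, hb, hb1, hb2⟩
      rw [h7, ← h6] at hb
      tauto
    · refine ⟨(p', p), ?_, h2, hh p' hp', h4.symm⟩
      simp only [Finset.mem_filter, Finset.mem_product]
      exact ⟨⟨hp', hp⟩, a, h6, ha, ha1, ha2⟩
  have h2 : ∀ x ∈ (edgeP F ×ˢ edgeP F).filter
        (fun x => ∃ m, m ≠ j ∧ (m = x.1.1 ∨ m = x.1.2) ∧ m ≠ x.2.1 ∧ m ≠ x.2.2),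
      (Fintype.card V : ℝ) ^ 2 * cnt (fun ψ => ψ j = v ∧ HasCol G φ ψ x.1 (φ (im ψ x.2))) ≤
        L * (Fintype.card V : ℝ) ^ f := by
    intro x hx
    simp only [Finset.mem_filter, Finset.mem_product] at hx
    obtain ⟨⟨hp, hp'⟩, m, hmj, hm, h1, h2⟩ := hx
    have h3 := cnt_fiber m (fun ψ : Fin f → V => ψ j = v)
      (fun ψ => HasCol G φ ψ x.1 (φ (im ψ x.2))) L
      (fun ψ y => by rw [Function.update_of_ne hmj.symm]) fun ψ s hs =>
        fiber_colour hL hp hm ψ (φ (im ψ x.2)) s fun y hy => by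
          have := hs y hy
          rwa [im_update_of_ne h1 h2] at this
    rw [sq, mul_assoc, ← cnt_vertex j v, mul_left_comm L]
    exact mul_le_mul_of_nonneg_left h3 (Nat.cast_nonneg _)
  refine (mul_le_mul_of_nonneg_left (h1.trans (cnt_exists_le _ _)) (by positivity)).trans ?_
  rw [Finset.mul_sum]
  refine (Finset.sum_le_sum h2).trans ?_
  rw [Finset.sum_const, nsmul_eq_mul]
  rcases (edgeP F).eq_empty_or_nonempty with h0 | ⟨p, hp⟩
  · simp [h0]
  have hL0 : 0 ≤ L := (Nat.cast_nonneg _).trans (hL v (φ s(v, v)))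
  refine mul_le_mul_of_nonneg_right ?_ (by positivity)
  have h3 := Finset.card_filter_le (edgeP F ×ˢ edgeP F)
    (fun x => ∃ m, m ≠ j ∧ (m = x.1.1 ∨ m = x.1.2) ∧ m ≠ x.2.1 ∧ m ≠ x.2.2)
  rw [Finset.card_product, ← sq] at h3
  exact_mod_cast h3

/-- Almost all rooted homomorphisms are rainbow embeddings. -/
theorem cnt_rooted_valid {L : ℝ} (hL : ∀ v c, (cdeg G φ v c : ℝ) ≤ L) (j : Fin f) (v : V) :
    (Fintype.card V : ℝ) ^ 2 * cnt (fun ψ => IsHom F G ψ ∧ ψ j = v) ≤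
      (Fintype.card V : ℝ) ^ 2 * cnt (fun ψ => Valid F G φ ψ ∧ ψ j = v) +
      (f ^ 2 + ((edgeP F).card : ℝ) ^ 2 * L) * (Fintype.card V : ℝ) ^ f := by
  have h1 : cnt (fun ψ => IsHom F G ψ ∧ ψ j = v) ≤ cnt (fun ψ => Valid F G φ ψ ∧ ψ j = v) +
      (cnt (fun ψ => ψ j = v ∧ ¬ Function.Injective ψ) + cnt (fun ψ => ψ j = v ∧ IsHom F G ψ ∧
      ¬ ∀ p ∈ edgeP F, ∀ p' ∈ edgeP F, φ (im ψ p) = φ (im ψ p') → p = p')) := by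
    refine (cnt_mono fun ψ h => ?_).trans ((cnt_or_le _ _).trans
      (add_le_add le_rfl (cnt_or_le _ _)))
    by_cases h2 : Function.Injective ψ
    · by_cases h3 : ∀ p ∈ edgeP F, ∀ p' ∈ edgeP F, φ (im ψ p) = φ (im ψ p') → p = p'
      · exact Or.inl ⟨⟨h2, h.1, h3⟩, h.2⟩
      · exact Or.inr (Or.inr ⟨h.2, h.1, h3⟩)
    · exact Or.inr (Or.inl ⟨h.2, h2⟩)
  have h2 := cnt_rooted_not_injective (V := V) j v
  have h3 := cnt_rooted_not_rainbow (F := F) hL j v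
  have h4 := mul_le_mul_of_nonneg_left h1 (sq_nonneg (Fintype.card V : ℝ))
  linarith

end Valid

section Hyper

variable {V K : Type} [Fintype V] [DecidableEq V] [Fintype K] [DecidableEq K] {f : ℕ}
variable {F : SimpleGraph (Fin f)} {G : SimpleGraph V} {φ : Sym2 V → K}

theorem cnt_eq_zero {P : (Fin f → V) → Prop} (h : ∀ ψ, ¬ P ψ) : cnt P = 0 := by
  classical
  simp [cnt, h]

theorem cnt_valid_edge [Nonempty V] {q x ε : ℝ} (hG : CutClose G q ε) (hq0 : 0 ≤ q) (hq2 : q ≤ 2)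
    (hε : 0 ≤ ε) (hqx : q ≤ x) (hdeg : ∀ v, ((nb G v).card : ℝ) ≤ x * Fintype.card V)
    (hcod : ∀ u v, G.Adj u v → ((nb G u ∩ nb G v).card : ℝ) ≤ x ^ 2 * Fintype.card V)
    {p : Fin f × Fin f} (hp : p ∈ edgeP F) (u v : V) :
    (Fintype.card V : ℝ) ^ 2 * cnt (fun ψ => Valid F G φ ψ ∧ ψ p.1 = u ∧ ψ p.2 = v) ≤
      (x ^ ((edgeP F).card - 1) + 2 ^ (edgeP F).card * ε) * (Fintype.card V : ℝ) ^ f := by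
  have hx0 := hq0.trans hqx
  by_cases h : G.Adj u v
  · have h1 : cnt (fun ψ => Valid F G φ ψ ∧ ψ p.1 = u ∧ ψ p.2 = v) ≤
        cnt (fun ψ => IsHom F G ψ ∧ ψ p.1 = u ∧ ψ p.2 = v) :=
      cnt_mono fun ψ h => ⟨h.1.hom, h.2⟩
    refine le_trans (mul_le_mul_of_nonneg_left h1 (by positivity)) ?_
    refine le_of_eq_of_le ?_ (rooted_edge F hG hq0 hq2 hε hqx hdeg u v (hcod u v h) p.1 p.2
      ((mem_edgeP F).1 hp).2)
    unfold cnt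
    congr!
  · have : cnt (fun ψ => Valid F G φ ψ ∧ ψ p.1 = u ∧ ψ p.2 = v) = 0 := by
      refine cnt_eq_zero ?_
      rintro ψ ⟨h1, rfl, rfl⟩
      exact h (h1.hom _ _ ((mem_edgeP F).1 hp).2)
    rw [this, mul_zero]
    positivity

theorem cnt_valid_im [Nonempty V] {z : ℝ} {p : Fin f × Fin f}
    (hz : ∀ u v, (Fintype.card V : ℝ) ^ 2 *
      cnt (fun ψ => Valid F G φ ψ ∧ ψ p.1 = u ∧ ψ p.2 = v) ≤ z) (e : Sym2 V) :
    (Fintype.card V : ℝ) ^ 2 * cnt (fun ψ => Valid F G φ ψ ∧ im ψ p = e) ≤ 2 * z := by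
  induction e with
  | _ u v =>
  have h1 : cnt (fun ψ => Valid F G φ ψ ∧ im ψ p = s(u, v)) ≤
      cnt (fun ψ => Valid F G φ ψ ∧ ψ p.1 = u ∧ ψ p.2 = v) +
        cnt (fun ψ => Valid F G φ ψ ∧ ψ p.1 = v ∧ ψ p.2 = u) := by
    refine (cnt_mono fun ψ h => ?_).trans (cnt_or_le _ _)
    have h2 := h.2
    simp only [im, Sym2.eq_iff] at h2
    exact h2.imp (fun h3 => ⟨h.1, h3⟩) fun h3 => ⟨h.1, h3⟩
  have h4 := mul_le_mul_of_nonneg_left h1 (sq_nonneg (Fintype.card V : ℝ))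
  linarith [hz u v, hz v u]

theorem cnt_valid_colour [Nonempty V] {z : ℝ} {p : Fin f × Fin f} (hp : p ∈ edgeP F)
    (hz : ∀ u v, (Fintype.card V : ℝ) ^ 2 *
      cnt (fun ψ => Valid F G φ ψ ∧ ψ p.1 = u ∧ ψ p.2 = v) ≤ z) (c : K) :
    (Fintype.card V : ℝ) ^ 2 * cnt (fun ψ => Valid F G φ ψ ∧ φ (im ψ p) = c) ≤
      (∑ v, (cdeg G φ v c : ℝ)) * z := by
  have h0 : cnt (fun ψ => Valid F G φ ψ ∧ φ (im ψ p) = c) =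
      cnt (fun ψ => Valid F G φ ψ ∧ HasCol G φ ψ p c) :=
    cnt_congr fun ψ => ⟨fun h => ⟨h.1, h.1.hom _ _ ((mem_edgeP F).1 hp).2, h.2⟩,
      fun h => ⟨h.1, h.2.2⟩⟩
  rw [h0, cnt_colour_eq, ← sum_adj_colour, Finset.mul_sum]
  refine Finset.sum_le_sum fun u _ => ?_
  rw [Finset.mul_sum]
  refine Finset.sum_le_sum fun v _ => ?_
  rw [mul_ite, mul_zero]
  split_ifs
  · exact hz u v
  · rfl

/-- The positions of a hyperedge: edges, vertices and colours of a copy of `F`. -/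
abbrev Slot (f : ℕ) := (Fin f × Fin f) ⊕ (Fin f ⊕ (Fin f × Fin f))

/-- Vertices of the auxiliary hypergraph. -/
abbrev HV (V K : Type) (t : ℕ) := Sym2 V ⊕ ((V × Fin t) ⊕ (K × Fin t))

variable (F) in
/-- The positions of a copy of `F`. -/
noncomputable def slots : Finset (Slot f) :=
  (edgeP F).disjSum (Finset.univ.disjSum (edgeP F))

theorem card_slots : (slots F).card = f + 2 * (edgeP F).card := by
  simp [slots, Finset.card_disjSum]
  ring

variable {t : ℕ}

variable (φ) in
/-- The vertex of the auxiliary hypergraph at a given position. -/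
def slotMap (ψ : Fin f → V) (i : Fin t) : Slot f → HV V K t
  | .inl p => .inl (im ψ p)
  | .inr (.inl a) => .inr (.inl (ψ a, i))
  | .inr (.inr p) => .inr (.inr (φ (im ψ p), i))

variable (F φ) in
/-- The vertices of a hyperedge. -/
noncomputable def hverts (ψ : Fin f → V) (i : Fin t) : Finset (HV V K t) :=
  (slots F).image (slotMap φ ψ i)

theorem slotMap_injOn {ψ : Fin f → V} (hψ : Valid F G φ ψ) (i : Fin t) :
    Set.InjOn (slotMap φ ψ i) (slots F) := by
  rintro (p | a | p) hs (p' | b | p') hs' h <;>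
    simp only [slots, Finset.mem_coe, Finset.inl_mem_disjSum, Finset.inr_mem_disjSum] at hs hs' <;>
    simp only [slotMap, Sum.inl.injEq, Sum.inr.injEq, reduceCtorEq, Prod.mk.injEq, and_true] at h
  · rw [hψ.rainbow p hs p' hs' (by rw [h])]
  · rw [hψ.inj h]
  · rw [hψ.rainbow p hs p' hs' h]

theorem card_hverts {ψ : Fin f → V} (hψ : Valid F G φ ψ) (i : Fin t) :
    (hverts F φ ψ i).card = f + 2 * (edgeP F).card := by
  rw [hverts, Finset.card_image_of_injOn (slotMap_injOn hψ i), card_slots]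

theorem mem_hverts {ψ : Fin f → V} {i : Fin t} {y : HV V K t} :
    y ∈ hverts F φ ψ i ↔ ∃ s ∈ slots F, slotMap φ ψ i s = y := by
  simp [hverts]

theorem sum_cnt_pin {P : Fin t → (Fin f → V) → Prop} {Q : (Fin f → V) → Prop} (i₀ : Fin t)
    (h : ∀ i ψ, P i ψ → i = i₀ ∧ Q ψ) : ∑ i, cnt (P i) ≤ cnt Q := by
  rw [← cnt_exists_eq (s := Finset.univ) (P := P) fun i _ j _ hij ψ h1 h2 =>
    hij ((h i ψ h1).1.trans (h j ψ h2).1.symm)]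
  exact cnt_mono fun ψ ⟨i, _, hi⟩ => (h i ψ hi).2

/-- The number of hyperedges with two prescribed vertices at given positions. -/
theorem pair_count {L B : ℝ} (hL0 : 0 ≤ L) (hB0 : 0 ≤ B) (hL : ∀ v c, (cdeg G φ v c : ℝ) ≤ L)
    (hB : ∀ c, ∑ v, (cdeg G φ v c : ℝ) ≤ B * Fintype.card V) (ht : 2 * (t : ℝ) ≤ B * Fintype.card V)
    (hn : 0 < Fintype.card V) {s s' : Slot f} (hs : s ∈ slots F) (hs' : s' ∈ slots F) (hne : s ≠ s')
    (x y : HV V K t) :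
    (Fintype.card V : ℝ) ^ 2 *
      ∑ i : Fin t, cnt (fun ψ => Valid F G φ ψ ∧ slotMap φ ψ i s = x ∧ slotMap φ ψ i s' = y) ≤
      (2 + B) * (1 + L) * (Fintype.card V : ℝ) ^ f := by
  set n : ℝ := (Fintype.card V : ℝ) with hndef
  have hn0 : 0 < n := by rw [hndef]; exact_mod_cast hn
  have hnf : 0 < n ^ f := by positivity
  have hBL : 0 ≤ B * L := mul_nonneg hB0 hL0
  by_cases hx : ∃ (ψ : Fin f → V) (i : Fin t), slotMap φ ψ i s = x
  swap
  · have : ∀ i : Fin t, cnt (fun ψ => Valid F G φ ψ ∧ slotMap φ ψ i s = x ∧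
        slotMap φ ψ i s' = y) = 0 := by
      exact fun i => cnt_eq_zero fun ψ h => hx ⟨ψ, i, h.2.1⟩
    simp only [this, Finset.sum_const_zero, mul_zero]
    positivity
  by_cases hy : ∃ (ψ : Fin f → V) (i : Fin t), slotMap φ ψ i s' = y
  swap
  · have : ∀ i : Fin t, cnt (fun ψ => Valid F G φ ψ ∧ slotMap φ ψ i s = x ∧
        slotMap φ ψ i s' = y) = 0 := by
      exact fun i => cnt_eq_zero fun ψ h => hy ⟨ψ, i, h.2.2⟩
    simp only [this, Finset.sum_const_zero, mul_zero]
    positivity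
  obtain ⟨ψ₀, i₀, rfl⟩ := hx
  obtain ⟨ψ₁, i₁, rfl⟩ := hy
  have hb1 : n ^ f ≤ (2 + B) * (1 + L) * n ^ f := by nlinarith
  have hb2 : 2 * n ^ f ≤ (2 + B) * (1 + L) * n ^ f := by
    refine mul_le_mul_of_nonneg_right ?_ hnf.le
    linarith
  have hbL : L * n ^ f ≤ (2 + B) * (1 + L) * n ^ f := by
    refine mul_le_mul_of_nonneg_right ?_ hnf.le
    linarith
  have hbB : B * n ^ f ≤ (2 + B) * (1 + L) * n ^ f := by
    refine mul_le_mul_of_nonneg_right ?_ hnf.le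
    linarith
  have hbBL : L * (B * n ^ f) ≤ (2 + B) * (1 + L) * n ^ f := by
    rw [← mul_assoc]
    refine mul_le_mul_of_nonneg_right ?_ hnf.le
    linarith
  have hpin : ∀ (P : Fin t → (Fin f → V) → Prop) (Q : (Fin f → V) → Prop) (j : Fin t),
      (∀ i ψ, P i ψ → i = j ∧ Q ψ) → n ^ 2 * cnt Q ≤ (2 + B) * (1 + L) * n ^ f →
      n ^ 2 * ∑ i, cnt (P i) ≤ (2 + B) * (1 + L) * n ^ f := fun P Q j h1 h2 =>
    (mul_le_mul_of_nonneg_left (sum_cnt_pin j h1) (by positivity)).trans h2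
  have hcol : ∀ {p : Fin f × Fin f} {ψ : Fin f → V} {c : K}, p ∈ edgeP F → Valid F G φ ψ →
      φ (im ψ p) = c → HasCol G φ ψ p c :=
    fun hp hψ h => ⟨hψ.hom _ _ ((mem_edgeP F).1 hp).2, h⟩
  have hmem : ∀ {p : Fin f × Fin f}, Sum.inl p ∈ slots F → p ∈ edgeP F := fun h => by
    simpa [slots] using h
  have hmem' : ∀ {p : Fin f × Fin f}, Sum.inr (Sum.inr p) ∈ slots F → p ∈ edgeP F := fun h => by
    simpa [slots] using h
  rcases s with p | a | p <;> rcases s' with p' | b | p' <;>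
    simp only [slotMap, Sum.inl.injEq, Sum.inr.injEq, Prod.mk.injEq, ne_eq] at hne ⊢
  · have h1 := cnt_edge_edge (hmem hs) (hmem hs') hne (im ψ₀ p) (im ψ₁ p')
    have h2 : n ^ 2 * (t * cnt (fun ψ : Fin f → V => im ψ p = im ψ₀ p ∧ im ψ p' = im ψ₁ p')) ≤
        B * n ^ f := by
      have h3 := cnt_nonneg fun ψ : Fin f → V => im ψ p = im ψ₀ p ∧ im ψ p' = im ψ₁ p'
      have h4 := mul_le_mul_of_nonneg_right ht (mul_nonneg (sq_nonneg n) h3)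
      have h5 := mul_le_mul_of_nonneg_left h1 hB0
      rw [← hndef] at h5
      nlinarith
    refine le_trans ?_ (h2.trans hbB)
    refine mul_le_mul_of_nonneg_left ?_ (by positivity)
    calc _ ≤ ∑ _i : Fin t, cnt (fun ψ : Fin f → V => im ψ p = im ψ₀ p ∧ im ψ p' = im ψ₁ p') :=
          Finset.sum_le_sum fun i _ => cnt_mono fun ψ h => h.2
      _ = _ := by simp
  · exact hpin _ (fun ψ => ψ b = ψ₁ b ∧ im ψ p = im ψ₀ p) i₁
      (fun i ψ h => ⟨h.2.2.2, h.2.2.1, h.2.1⟩) ((cnt_vertex_edge (hmem hs) _ _ _).trans hb1)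
  · exact hpin _ (fun ψ => im ψ p = im ψ₀ p) i₁
      (fun i ψ h => ⟨h.2.2.2, h.2.1⟩) ((cnt_edge (hmem hs) _).trans hb2)
  · exact hpin _ (fun ψ => ψ a = ψ₀ a ∧ im ψ p' = im ψ₁ p') i₀
      (fun i ψ h => ⟨h.2.1.2, h.2.1.1, h.2.2⟩) ((cnt_vertex_edge (hmem hs') _ _ _).trans hb1)
  · exact hpin _ (fun ψ => ψ a = ψ₀ a ∧ ψ b = ψ₁ b) i₀
      (fun i ψ h => ⟨h.2.1.2, h.2.1.1, h.2.2.1⟩) ((cnt_vertex_vertex hne _ _).le.trans hb1)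
  · exact hpin _ (fun ψ => ψ a = ψ₀ a ∧ HasCol G φ ψ p' (φ (im ψ₁ p'))) i₀
      (fun i ψ h => ⟨h.2.1.2, h.2.1.1, hcol (hmem' hs') h.1 h.2.2.1⟩)
      ((cnt_vertex_colour hL (hmem' hs') _ _ _).trans hbL)
  · exact hpin _ (fun ψ => im ψ p' = im ψ₁ p') i₀
      (fun i ψ h => ⟨h.2.1.2, h.2.2⟩) ((cnt_edge (hmem hs') _).trans hb2)
  · exact hpin _ (fun ψ => ψ b = ψ₁ b ∧ HasCol G φ ψ p (φ (im ψ₀ p))) i₁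
      (fun i ψ h => ⟨h.2.2.2, h.2.2.1, hcol (hmem' hs) h.1 h.2.1.1⟩)
      ((cnt_vertex_colour hL (hmem' hs) _ _ _).trans hbL)
  · refine hpin _ (fun ψ => HasCol G φ ψ p (φ (im ψ₀ p)) ∧ HasCol G φ ψ p' (φ (im ψ₁ p'))) i₀
      (fun i ψ h => ⟨h.2.1.2, hcol (hmem' hs) h.1 h.2.1.1, hcol (hmem' hs') h.1 h.2.2.1⟩)
      (le_trans ?_ hbBL)
    have h1 := cnt_colour_colour hL (hmem' hs) (hmem' hs') hne (φ (im ψ₀ p)) (φ (im ψ₁ p'))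
    rw [← hndef] at h1
    have h2 : L * ((∑ v, (cdeg G φ v (φ (im ψ₀ p)) : ℝ)) * n ^ f) ≤ L * ((B * n) * n ^ f) :=
      mul_le_mul_of_nonneg_left (mul_le_mul_of_nonneg_right (hB _) hnf.le) hL0
    refine le_of_mul_le_mul_right ?_ hn0
    calc _ = n ^ 3 * cnt (fun ψ => HasCol G φ ψ p (φ (im ψ₀ p)) ∧
          HasCol G φ ψ p' (φ (im ψ₁ p'))) := by ring
      _ ≤ _ := h1.trans h2
      _ = _ := by ring

end Hyper

section Slots

variable {V K : Type} [Fintype V] [DecidableEq V] [Fintype K] [DecidableEq K] {f t : ℕ}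
variable {F : SimpleGraph (Fin f)} {G : SimpleGraph V} {φ : Sym2 V → K}

theorem mem_hverts_inl {ψ : Fin f → V} {i : Fin t} {e : Sym2 V} :
    (Sum.inl e : HV V K t) ∈ hverts F φ ψ i ↔ ∃ p ∈ edgeP F, im ψ p = e := by
  simp [mem_hverts, slots, slotMap]

theorem mem_hverts_vertex {ψ : Fin f → V} {i j : Fin t} {v : V} :
    (Sum.inr (Sum.inl (v, j)) : HV V K t) ∈ hverts F φ ψ i ↔ i = j ∧ ∃ a, ψ a = v := by
  simp [mem_hverts, slots, slotMap, and_comm]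

theorem mem_hverts_colour {ψ : Fin f → V} {i j : Fin t} {c : K} :
    (Sum.inr (Sum.inr (c, j)) : HV V K t) ∈ hverts F φ ψ i ↔
      i = j ∧ ∃ p ∈ edgeP F, φ (im ψ p) = c := by
  simp [mem_hverts, slots, slotMap]
  grind

variable (F G φ) in
/-- The degree of a vertex of the auxiliary hypergraph. -/
noncomputable def hyperDeg (y : HV V K t) : ℝ :=
  ∑ i : Fin t, cnt fun ψ => Valid F G φ ψ ∧ y ∈ hverts F φ ψ i

theorem hyperDeg_vertex (v : V) (j : Fin t) :
    hyperDeg F G φ (Sum.inr (Sum.inl (v, j)) : HV V K t) =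
      ∑ a, cnt fun ψ => Valid F G φ ψ ∧ ψ a = v := by
  have h1 : ∑ a, cnt (fun ψ => Valid F G φ ψ ∧ ψ a = v) =
      cnt (fun ψ => Valid F G φ ψ ∧ ∃ a, ψ a = v) := by
    rw [← cnt_exists_eq Finset.univ (fun a ψ => Valid F G φ ψ ∧ ψ a = v)]
    · exact cnt_congr fun ψ => by simp
    · exact fun a _ b _ hab ψ h1 h2 => hab (h1.1.inj (h1.2.trans h2.2.symm))
  rw [h1, hyperDeg]
  refine (Finset.sum_eq_single_of_mem j (Finset.mem_univ _) fun i _ hij => ?_).trans ?_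
  · exact cnt_eq_zero fun ψ h => hij (mem_hverts_vertex.1 h.2).1
  · exact cnt_congr fun ψ => by simp [mem_hverts_vertex]

theorem hyperDeg_edge_le [Nonempty V] {z : ℝ} (hz : ∀ p ∈ edgeP F, ∀ u v, (Fintype.card V : ℝ) ^ 2 *
      cnt (fun ψ => Valid F G φ ψ ∧ ψ p.1 = u ∧ ψ p.2 = v) ≤ z) (e : Sym2 V) :
    (Fintype.card V : ℝ) ^ 2 * hyperDeg F G φ (Sum.inl e : HV V K t) ≤
      2 * t * ((edgeP F).card * z) := by
  have h1 : ∀ i : Fin t, (Fintype.card V : ℝ) ^ 2 * cnt (fun ψ => Valid F G φ ψ ∧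
      (Sum.inl e : HV V K t) ∈ hverts F φ ψ i) ≤ (edgeP F).card * (2 * z) := by
    intro i
    have h2 : cnt (fun ψ => Valid F G φ ψ ∧ (Sum.inl e : HV V K t) ∈ hverts F φ ψ i) ≤
        ∑ p ∈ edgeP F, cnt fun ψ => Valid F G φ ψ ∧ im ψ p = e := by
      refine le_trans (cnt_mono fun ψ h => ?_) (cnt_exists_le _ _)
      obtain ⟨p, hp, h3⟩ := mem_hverts_inl.1 h.2
      exact ⟨p, hp, h.1, h3⟩
    refine (mul_le_mul_of_nonneg_left h2 (by positivity)).trans ?_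
    rw [Finset.mul_sum, ← nsmul_eq_mul]
    exact Finset.sum_le_card_nsmul _ _ _ fun p hp => cnt_valid_im (hz p hp) e
  rw [hyperDeg, Finset.mul_sum]
  refine (Finset.sum_le_sum fun i _ => h1 i).trans ?_
  simp
  linarith

theorem hyperDeg_colour_le [Nonempty V] {z S : ℝ} (hz0 : 0 ≤ z)
    (hz : ∀ p ∈ edgeP F, ∀ u v, (Fintype.card V : ℝ) ^ 2 *
      cnt (fun ψ => Valid F G φ ψ ∧ ψ p.1 = u ∧ ψ p.2 = v) ≤ z) (c : K)
    (hS : ∑ v, (cdeg G φ v c : ℝ) ≤ S) (j : Fin t) :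
    (Fintype.card V : ℝ) ^ 2 * hyperDeg F G φ (Sum.inr (Sum.inr (c, j)) : HV V K t) ≤
      S * ((edgeP F).card * z) := by
  have h1 : hyperDeg F G φ (Sum.inr (Sum.inr (c, j)) : HV V K t) ≤
      ∑ p ∈ edgeP F, cnt fun ψ => Valid F G φ ψ ∧ φ (im ψ p) = c := by
    refine le_trans (sum_cnt_pin (Q := fun ψ => ∃ p ∈ edgeP F, Valid F G φ ψ ∧ φ (im ψ p) = c) j
      fun i ψ h => ?_) (cnt_exists_le _ _)
    obtain ⟨h2, p, hp, h3⟩ := mem_hverts_colour.1 h.2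
    exact ⟨h2, p, hp, h.1, h3⟩
  refine (mul_le_mul_of_nonneg_left h1 (by positivity)).trans ?_
  rw [Finset.mul_sum]
  calc _ ≤ (edgeP F).card • (S * z) := Finset.sum_le_card_nsmul _ _ _ fun p hp =>
        (cnt_valid_colour hp (hz p hp) c).trans (mul_le_mul_of_nonneg_right hS hz0)
    _ = _ := by rw [nsmul_eq_mul]; ring

theorem hcodeg_le {L B : ℝ} (hL0 : 0 ≤ L) (hB0 : 0 ≤ B) (hL : ∀ v c, (cdeg G φ v c : ℝ) ≤ L)
    (hB : ∀ c, ∑ v, (cdeg G φ v c : ℝ) ≤ B * Fintype.card V)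
    (ht : 2 * (t : ℝ) ≤ B * Fintype.card V) (hn : 0 < Fintype.card V)
    {x y : HV V K t} (hxy : x ≠ y) :
    (Fintype.card V : ℝ) ^ 2 *
      ∑ i : Fin t, cnt (fun ψ => Valid F G φ ψ ∧ x ∈ hverts F φ ψ i ∧ y ∈ hverts F φ ψ i) ≤
      ((f + 2 * (edgeP F).card : ℕ) : ℝ) ^ 2 * ((2 + B) * (1 + L) * (Fintype.card V : ℝ) ^ f) := by
  classical
  set T := ((slots F) ×ˢ (slots F)).filter fun s => s.1 ≠ s.2 with hT
  have hTc : (T.card : ℝ) ≤ ((f + 2 * (edgeP F).card : ℕ) : ℝ) ^ 2 := by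
    rw [← card_slots (F := F), sq]
    exact_mod_cast (Finset.card_filter_le _ _).trans (Finset.card_product _ _).le
  have h1 : ∀ i : Fin t, cnt (fun ψ => Valid F G φ ψ ∧ x ∈ hverts F φ ψ i ∧ y ∈ hverts F φ ψ i) ≤
      ∑ s ∈ T, cnt fun ψ => Valid F G φ ψ ∧ slotMap φ ψ i s.1 = x ∧ slotMap φ ψ i s.2 = y := by
    intro i
    refine le_trans (cnt_mono fun ψ h => ?_) (cnt_exists_le _ _)
    obtain ⟨s, hs, hsx⟩ := mem_hverts.1 h.2.1
    obtain ⟨s', hs', hsy⟩ := mem_hverts.1 h.2.2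
    refine ⟨(s, s'), ?_, h.1, hsx, hsy⟩
    simp only [hT, Finset.mem_filter, Finset.mem_product]
    refine ⟨⟨hs, hs'⟩, fun h3 => hxy ?_⟩
    rw [← hsx, ← hsy]
    exact congrArg _ h3
  calc _ ≤ (Fintype.card V : ℝ) ^ 2 * ∑ i : Fin t, ∑ s ∈ T,
        cnt (fun ψ => Valid F G φ ψ ∧ slotMap φ ψ i s.1 = x ∧ slotMap φ ψ i s.2 = y) :=
        mul_le_mul_of_nonneg_left (Finset.sum_le_sum fun i _ => h1 i) (by positivity)
    _ = ∑ s ∈ T, (Fintype.card V : ℝ) ^ 2 * ∑ i : Fin t,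
        cnt (fun ψ => Valid F G φ ψ ∧ slotMap φ ψ i s.1 = x ∧ slotMap φ ψ i s.2 = y) := by
        rw [Finset.sum_comm, Finset.mul_sum]
    _ ≤ T.card • ((2 + B) * (1 + L) * (Fintype.card V : ℝ) ^ f) := by
        refine Finset.sum_le_card_nsmul _ _ _ fun s hs => ?_
        simp only [hT, Finset.mem_filter, Finset.mem_product] at hs
        exact pair_count hL0 hB0 hL hB ht hn hs.1.1 hs.1.2 hs.2 x y
    _ ≤ _ := by
        rw [nsmul_eq_mul]
        exact mul_le_mul_of_nonneg_right hTc (by positivity)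

open Classical in
/-- Counting hyperedges slice by slice. -/
theorem card_hyperedges (P : Fin t → (Fin f → V) → Prop)
    (T : Finset ({ψ // Valid F G φ ψ} × Fin t)) (hT : ∀ g, g ∈ T ↔ P g.2 g.1.1) :
    (T.card : ℝ) = ∑ i, cnt fun ψ => Valid F G φ ψ ∧ P i ψ := by
  have h0 : T = Finset.univ.filter fun g => P g.2 g.1.1 := by
    ext g
    simp [hT]
  have h1 : T.card = ∑ i, (Finset.univ.filter fun ψ : {ψ // Valid F G φ ψ} => P i ψ.1).card := by
    rw [h0]
    simp only [Finset.card_filter]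
    rw [Fintype.sum_prod_type, Finset.sum_comm]
  rw [h1, Nat.cast_sum]
  refine Finset.sum_congr rfl fun i _ => ?_
  unfold cnt
  congr 1
  rw [← Finset.card_map (Function.Embedding.subtype _)]
  congr 1
  ext ψ
  simp [and_comm]

end Slots

section SliceAbs

variable {V K : Type} [Fintype V] [DecidableEq V] [Fintype K] [DecidableEq K] {f t : ℕ}

open Classical in
/-- The vertices not covered by a family of maps. -/
noncomputable def unc (𝓜 : Finset (Fin f → V)) : Finset V :=
  Finset.univ.filter fun u => ∀ ψ ∈ 𝓜, ∀ a, ψ a ≠ u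

theorem mem_unc {𝓜 : Finset (Fin f → V)} {u : V} : u ∈ unc 𝓜 ↔ ∀ ψ ∈ 𝓜, ∀ a, ψ a ≠ u := by
  simp [unc]

variable (F : SimpleGraph (Fin f)) (G : SimpleGraph V) (φ : Sym2 V → K)

/-- Slices of rainbow embeddings which are vertex-disjoint and colour-disjoint within a slice and
globally edge-disjoint. -/
structure Slices (𝓜 : Fin t → Finset (Fin f → V)) : Prop where
  valid : ∀ i, ∀ ψ ∈ 𝓜 i, Valid F G φ ψ
  disj : ∀ i, ∀ ψ ∈ 𝓜 i, ∀ ψ' ∈ 𝓜 i, ψ ≠ ψ' → ∀ a b, ψ a ≠ ψ' b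
  colour : ∀ i, ∀ ψ ∈ 𝓜 i, ∀ ψ' ∈ 𝓜 i, ψ ≠ ψ' → ∀ p ∈ edgeP F, ∀ p' ∈ edgeP F,
    φ (im ψ p) ≠ φ (im ψ' p')
  edge : ∀ i j, i ≠ j → ∀ ψ ∈ 𝓜 i, ∀ ψ' ∈ 𝓜 j, ∀ p ∈ edgeP F, ∀ p' ∈ edgeP F,
    im ψ p ≠ im ψ' p'

variable {F φ}

/-- The weight functions controlling the uncovered vertices. -/
noncomputable def wgt (G : SimpleGraph V) (φ : Sym2 V → K) (w : ℝ) :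
    (Fin t × K) ⊕ (V ⊕ Fin t) → HV V K t → ℝ
  | .inl (i, c), .inr (.inl (u, i')) => if i' = i then cdeg G φ u c / w else 0
  | .inr (.inl v), .inr (.inl (u, _)) => if u = v then 1 / w else 0
  | .inr (.inr i), .inr (.inl (_, i')) => if i' = i then 1 / w else 0
  | _, .inl _ => 0
  | _, .inr (.inr _) => 0

/-- The vertices of the auxiliary hypergraph which should be covered. -/
def target (V K : Type) [Fintype V] (t : ℕ) : Finset (HV V K t) :=
  (Finset.univ : Finset (V × Fin t)).map
    (Function.Embedding.inl.trans Function.Embedding.inr)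

theorem mem_target {x : HV V K t} : x ∈ target V K t ↔ ∃ v i, x = Sum.inr (Sum.inl (v, i)) := by
  simp [target, eq_comm]

open Classical in
theorem sum_target_filter (P : HV V K t → Prop) (g : HV V K t → ℝ) (s : Finset (HV V K t))
    (hs : ∀ x, x ∈ s ↔ x ∈ target V K t ∧ P x) : ∑ x ∈ s, g x =
      ∑ i, ∑ v, if P (Sum.inr (Sum.inl (v, i))) then g (Sum.inr (Sum.inl (v, i))) else 0 := by
  have h0 : s = (target V K t).filter P := by
    ext x
    simp [hs]
  rw [h0]
  rw [Finset.sum_filter, target, Finset.sum_map, Fintype.sum_prod_type, Finset.sum_comm]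
  rfl

theorem exists_slices_of_nibble {Γ : SimpleGraph V} {r : ℕ} (hr : r = f + 2 * (edgeP F).card)
    {γ θ δ₀ D δ w : ℝ}
    (hnib : ∀ (X E J K : Type) [DecidableEq X] [DecidableEq E] [Fintype X] [Fintype E]
      [Fintype J] [Fintype K] (vs : E → Finset X), (∀ g, (vs g).card = r) →
      ∀ D δ : ℝ, 0 < D → 0 < δ →
      (∀ y, ((Finset.univ.filter fun g => y ∈ vs g).card : ℝ) ≤ D) →
      (∀ x y, x ≠ y → ((Finset.univ.filter fun g => x ∈ vs g ∧ y ∈ vs g).card : ℝ) ≤ δ * D) →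
      ∀ M : Finset X, (∀ y ∈ M, (1 - θ) * D ≤ ((Finset.univ.filter fun g => y ∈ vs g).card : ℝ)) →
      ∀ ω : J → X → ℝ, (∀ j x, 0 ≤ ω j x) → (∀ j x, ω j x ≤ δ) → (∀ j, ∑ x ∈ M, ω j x ≤ 1) →
      ∀ 𝓖 : K → Finset E, (∀ k, D ≤ δ * (𝓖 k).card) →
      δ * Real.log (2 * Fintype.card X + 2 * Fintype.card J + 2 * Fintype.card K + 3) ≤ δ₀ →
      ∃ Mt : Finset E, (∀ g ∈ Mt, ∀ g' ∈ Mt, g ≠ g' → Disjoint (vs g) (vs g')) ∧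
        (∀ j, ∑ x ∈ M.filter (fun x => ∀ g ∈ Mt, x ∉ vs g), ω j x ≤ γ) ∧
        ∀ k, 1 / (16 * r : ℝ) * (𝓖 k).card ≤ D * (Mt ∩ 𝓖 k).card)
    (hD : 0 < D) (hδ : 0 < δ) (hw : 0 < w)
    (hdeg : ∀ y : HV V K t, hyperDeg F Γ φ y ≤ D)
    (hcod : ∀ x y : HV V K t, x ≠ y → ∑ i : Fin t,
      cnt (fun ψ => Valid F Γ φ ψ ∧ x ∈ hverts F φ ψ i ∧ y ∈ hverts F φ ψ i) ≤ δ * D)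
    (hlow : ∀ v j, (1 - θ) * D ≤ hyperDeg F Γ φ (Sum.inr (Sum.inl (v, j)) : HV V K t))
    (hcd : ∀ v c, (cdeg G φ v c : ℝ) ≤ δ * w) (h1w : 1 ≤ δ * w)
    (hcs : ∀ c, ∑ v, (cdeg G φ v c : ℝ) ≤ w) (htw : (t : ℝ) ≤ w)
    (hnw : (Fintype.card V : ℝ) ≤ w)
    (good : V → (Fin f → V) → Prop)
    (hgood : ∀ u, D ≤ δ * cnt fun ψ => Valid F Γ φ ψ ∧ good u ψ)
    (hlog : δ * Real.log (2 * Fintype.card (HV V K t) +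
      2 * Fintype.card ((Fin t × K) ⊕ (V ⊕ Fin t)) + 2 * Fintype.card (Fin t × V) + 3) ≤ δ₀) :
    ∃ 𝓜 : Fin t → Finset (Fin f → V), Slices F Γ φ 𝓜 ∧
      (∀ i, ((unc (𝓜 i)).card : ℝ) ≤ γ * w) ∧
      (∀ v, ((Finset.univ.filter fun i => v ∈ unc (𝓜 i)).card : ℝ) ≤ γ * w) ∧
      (∀ i c, ∑ u ∈ unc (𝓜 i), (cdeg G φ u c : ℝ) ≤ γ * w) ∧
      ∀ i u, 1 / (16 * r : ℝ) * cnt (fun ψ => Valid F Γ φ ψ ∧ good u ψ) ≤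
        D * ({ψ | ψ ∈ 𝓜 i ∧ good u ψ} : Set (Fin f → V)).ncard := by
  classical
  set ω : (Fin t × K) ⊕ (V ⊕ Fin t) → HV V K t → ℝ := wgt G φ w with hω
  set vs : {ψ // Valid F Γ φ ψ} × Fin t → Finset (HV V K t) := fun g => hverts F φ g.1.1 g.2
    with hvs
  set 𝓖 : Fin t × V → Finset ({ψ // Valid F Γ φ ψ} × Fin t) := fun k =>
    Finset.univ.filter fun g => g.2 = k.1 ∧ good k.2 g.1.1 with h𝓖
  have h𝓖c : ∀ k, ((𝓖 k).card : ℝ) = cnt fun ψ => Valid F Γ φ ψ ∧ good k.2 ψ := by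
    intro k
    refine (card_hyperedges (F := F) (G := Γ) (φ := φ)
      (fun i ψ => i = k.1 ∧ good k.2 ψ) _ fun g => by simp [h𝓖]).trans ?_
    rw [Finset.sum_eq_single_of_mem k.1 (Finset.mem_univ _)]
    · exact cnt_congr fun ψ => by simp
    · exact fun i _ hi => cnt_eq_zero fun ψ h => hi h.2.1
  have hsumω : ∀ j (P : HV V K t → Prop) (s : Finset (HV V K t)),
      (∀ x, x ∈ s ↔ x ∈ target V K t ∧ P x) → ∑ x ∈ s, ω j x =
      ∑ i, ∑ v, if P (Sum.inr (Sum.inl (v, i))) then ω j (Sum.inr (Sum.inl (v, i))) else 0 :=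
    fun j P s hs => sum_target_filter P _ s hs
  have hs1 : ∀ i c (P : HV V K t → Prop) (s : Finset (HV V K t)),
      (∀ x, x ∈ s ↔ x ∈ target V K t ∧ P x) → ∑ x ∈ s, ω (.inl (i, c)) x =
      (∑ v ∈ Finset.univ.filter fun v => P (Sum.inr (Sum.inl (v, i))), (cdeg G φ v c : ℝ)) / w := by
    intro i c P s hs
    rw [hsumω _ P s hs, Finset.sum_eq_single_of_mem i (Finset.mem_univ _), Finset.sum_filter,
      Finset.sum_div]
    · refine Finset.sum_congr rfl fun v _ => ?_
      simp only [hω, wgt, if_true]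
      split_ifs <;> simp
    · intro i' _ hi'
      refine Finset.sum_eq_zero fun v _ => ?_
      simp [hω, wgt, hi']
  have hs2 : ∀ v (P : HV V K t → Prop) (s : Finset (HV V K t)),
      (∀ x, x ∈ s ↔ x ∈ target V K t ∧ P x) → ∑ x ∈ s, ω (.inr (.inl v)) x =
      (Finset.univ.filter fun i => P (Sum.inr (Sum.inl (v, i)))).card / w := by
    intro v P s hs
    rw [hsumω _ P s hs, ← Finset.sum_boole, Finset.sum_div]
    refine Finset.sum_congr rfl fun i _ => ?_
    rw [Finset.sum_eq_single_of_mem v (Finset.mem_univ _)]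
    · simp only [hω, wgt, if_true]
      split_ifs <;> simp
    · intro v' _ hv'
      simp [hω, wgt, hv']
  have hs3 : ∀ i (P : HV V K t → Prop) (s : Finset (HV V K t)),
      (∀ x, x ∈ s ↔ x ∈ target V K t ∧ P x) → ∑ x ∈ s, ω (.inr (.inr i)) x =
      (Finset.univ.filter fun v => P (Sum.inr (Sum.inl (v, i)))).card / w := by
    intro i P s hs
    rw [hsumω _ P s hs, Finset.sum_eq_single_of_mem i (Finset.mem_univ _), ← Finset.sum_boole,
      Finset.sum_div]
    · refine Finset.sum_congr rfl fun v _ => ?_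
      simp only [hω, wgt, if_true]
      split_ifs <;> simp
    · intro i' _ hi'
      refine Finset.sum_eq_zero fun v _ => ?_
      simp [hω, wgt, hi']
  have hdeg' : ∀ y : HV V K t, ((Finset.univ.filter fun g => y ∈ vs g).card : ℝ) =
      hyperDeg F Γ φ y := fun y =>
    card_hyperedges (F := F) (G := Γ) (φ := φ) (fun i ψ => y ∈ hverts F φ ψ i) _
      fun g => by simp [hvs]
  obtain ⟨Mt, hM1, hM2, hM3⟩ := hnib (HV V K t) ({ψ // Valid F Γ φ ψ} × Fin t)
    ((Fin t × K) ⊕ (V ⊕ Fin t)) (Fin t × V) vs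
    (fun g => by rw [hr]; exact card_hverts g.1.2 g.2) D δ hD hδ
    (fun y => (hdeg' y).le.trans (hdeg y))
    (fun x y hxy => by
      refine le_trans (le_of_eq ?_) (hcod x y hxy)
      exact card_hyperedges (F := F) (G := Γ) (φ := φ)
        (fun i ψ => x ∈ hverts F φ ψ i ∧ y ∈ hverts F φ ψ i) _ fun g => by simp [hvs])
    (target V K t) (fun y hy => by
      obtain ⟨v, i, rfl⟩ := mem_target.1 hy
      rw [hdeg']
      exact hlow v i)
    ω (by
      rintro (⟨i, c⟩ | v | i) (e | ⟨u, i'⟩ | ⟨c', i'⟩) <;> simp only [hω, wgt] <;>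
        first | exact le_rfl | (split_ifs <;> positivity))
    (by
      have h1 : 1 / w ≤ δ := by rw [div_le_iff₀ hw]; exact h1w
      have h2 : ∀ v c, (cdeg G φ v c : ℝ) / w ≤ δ := fun v c => by
        rw [div_le_iff₀ hw]; exact hcd v c
      rintro (⟨i, c⟩ | v | i) (e | ⟨u, i'⟩ | ⟨c', i'⟩) <;> simp only [hω, wgt] <;>
        first | exact hδ.le | (split_ifs <;> first | exact hδ.le | exact h1 | exact h2 _ _))
    (by
      have h0 : ∀ x, x ∈ target V K t ↔ x ∈ target V K t ∧ True := fun x => by simp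
      rintro (⟨i, c⟩ | v | i)
      · rw [hs1 i c _ _ h0, div_le_one hw]
        simpa using hcs c
      · rw [hs2 v _ _ h0, div_le_one hw]
        simpa using htw
      · rw [hs3 i _ _ h0, div_le_one hw]
        simpa using hnw)
    𝓖 (fun k => by rw [h𝓖c]; exact hgood k.2) hlog
  set 𝓜 : Fin t → Finset (Fin f → V) := fun i =>
    (Mt.filter fun g => g.2 = i).image fun g => g.1.1 with h𝓜
  have hmem : ∀ i ψ, ψ ∈ 𝓜 i ↔ ∃ h : Valid F Γ φ ψ, ((⟨ψ, h⟩, i) :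
      {ψ // Valid F Γ φ ψ} × Fin t) ∈ Mt := by
    intro i ψ
    simp only [h𝓜, Finset.mem_image, Finset.mem_filter]
    constructor
    · rintro ⟨⟨⟨ψ', h⟩, j⟩, ⟨h1, rfl⟩, rfl⟩
      exact ⟨h, h1⟩
    · rintro ⟨h, h1⟩
      exact ⟨_, ⟨h1, rfl⟩, rfl⟩
  have hunc : ∀ i v, (∀ g ∈ Mt, (Sum.inr (Sum.inl (v, i)) : HV V K t) ∉ vs g) ↔
      v ∈ unc (𝓜 i) := by
    intro i v
    rw [mem_unc]
    constructor
    · intro h ψ hψ a ha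
      obtain ⟨h1, h2⟩ := (hmem i ψ).1 hψ
      exact h _ h2 (mem_hverts_vertex.2 ⟨rfl, a, ha⟩)
    · rintro h ⟨⟨ψ, hψ⟩, j⟩ hg hv
      obtain ⟨rfl, a, ha⟩ := mem_hverts_vertex.1 hv
      exact h ψ ((hmem j ψ).2 ⟨hψ, hg⟩) a ha
  have hdisj : ∀ i j ψ ψ', ψ ∈ 𝓜 i → ψ' ∈ 𝓜 j → (i ≠ j ∨ ψ ≠ ψ') →
      Disjoint (hverts F φ ψ i) (hverts F φ ψ' j) := by
    intro i j ψ ψ' h h' hne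
    obtain ⟨h1, h2⟩ := (hmem i ψ).1 h
    obtain ⟨h1', h2'⟩ := (hmem j ψ').1 h'
    refine hM1 _ h2 _ h2' fun h3 => ?_
    simp only [Prod.mk.injEq, Subtype.mk.injEq] at h3
    exact hne.elim (fun h4 => h4 h3.2) fun h4 => h4 h3.1
  have hM2s : ∀ j, ∃ s : Finset (HV V K t),
      (∀ x, x ∈ s ↔ x ∈ target V K t ∧ ∀ g ∈ Mt, x ∉ vs g) ∧ ∑ x ∈ s, ω j x ≤ γ := fun j =>
    ⟨_, fun x => by simp only [Finset.mem_filter], hM2 j⟩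
  refine ⟨𝓜, ⟨fun i ψ h => ((hmem i ψ).1 h).1, ?_, ?_, ?_⟩, ?_, ?_, ?_, ?_⟩
  · intro i ψ h ψ' h' hne a b hab
    exact Finset.disjoint_left.1 (hdisj i i ψ ψ' h h' (Or.inr hne))
      (mem_hverts_vertex.2 ⟨rfl, a, rfl⟩)
      (mem_hverts_vertex.2 ⟨rfl, b, hab.symm⟩)
  · intro i ψ h ψ' h' hne p hp p' hp' hab
    exact Finset.disjoint_left.1 (hdisj i i ψ ψ' h h' (Or.inr hne))
      (mem_hverts_colour.2 ⟨rfl, p, hp, rfl⟩)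
      (mem_hverts_colour.2 ⟨rfl, p', hp', hab.symm⟩)
  · intro i j hij ψ h ψ' h' p hp p' hp' hab
    exact Finset.disjoint_left.1 (hdisj i j ψ ψ' h h' (Or.inl hij))
      (mem_hverts_inl.2 ⟨p, hp, rfl⟩)
      (mem_hverts_inl.2 ⟨p', hp', hab.symm⟩)
  · intro i
    obtain ⟨s, hs, h1⟩ := hM2s (.inr (.inr i))
    rw [hs3 i _ s hs, div_le_iff₀ hw] at h1
    simpa only [hunc, Finset.filter_univ_mem] using h1
  · intro v
    obtain ⟨s, hs, h1⟩ := hM2s (.inr (.inl v))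
    rw [hs2 v _ s hs, div_le_iff₀ hw] at h1
    simpa only [hunc] using h1
  · intro i c
    obtain ⟨s, hs, h1⟩ := hM2s (.inl (i, c))
    rw [hs1 i c _ s hs, div_le_iff₀ hw] at h1
    simpa only [hunc, Finset.filter_univ_mem] using h1
  · intro i u
    have h1 := hM3 (i, u)
    rw [h𝓖c] at h1
    refine h1.trans (mul_le_mul_of_nonneg_left ?_ hD.le)
    norm_cast
    rw [← Set.ncard_coe_finset]
    refine Set.ncard_le_ncard_of_injOn (fun g => g.1.1) ?_ ?_ ?_
    · rintro ⟨⟨ψ, hψ⟩, j⟩ hg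
      simp only [h𝓖, Finset.coe_inter, Set.mem_inter_iff, Finset.mem_coe, Finset.mem_filter,
        Finset.mem_univ, true_and] at hg
      obtain ⟨hg1, rfl, hg2⟩ := hg
      exact ⟨(hmem _ _).2 ⟨hψ, hg1⟩, hg2⟩
    · rintro ⟨⟨ψ, hψ⟩, j⟩ hg ⟨⟨ψ', hψ'⟩, j'⟩ hg' h
      simp only [h𝓖, Finset.coe_inter, Set.mem_inter_iff, Finset.mem_coe, Finset.mem_filter,
        Finset.mem_univ, true_and] at hg hg'
      obtain ⟨-, rfl, -⟩ := hg
      obtain ⟨-, h2, -⟩ := hg'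
      simp only at h h2
      subst h2 h
      rfl
    · exact (Set.toFinite _)

end SliceAbs

theorem card_sym2_le (V : Type) [Fintype V] [DecidableEq V] :
    Fintype.card (Sym2 V) ≤ Fintype.card V ^ 2 := by
  rw [Sym2.card, sq, Nat.choose_two_right]
  rcases Nat.eq_zero_or_pos (Fintype.card V) with h | h
  · simp [h]
  · refine Nat.div_le_of_le_mul ?_
    simp only [Nat.add_sub_cancel]
    nlinarith

theorem size_le {f n k t : ℕ} (hk : k ≤ n ^ 2) (ht : t ≤ f * n) (hn : 10 * f + 7 ≤ n) :
    2 * (n ^ 2 + (n * t + k * t)) + 2 * (t * k + (n + t)) + 2 * (t * n) + 3 ≤ n ^ 4 := by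
  have hn1 : 1 ≤ n := by omega
  have h1 : t * k ≤ f * n ^ 3 := by nlinarith [Nat.mul_le_mul ht hk]
  have h2 : n * t ≤ f * n ^ 3 := by
    have : n * t ≤ f * n ^ 2 := by nlinarith
    exact this.trans (Nat.mul_le_mul_left _ (Nat.pow_le_pow_right hn1 (by norm_num)))
  have h3 : t ≤ f * n ^ 3 :=
    ht.trans (Nat.mul_le_mul_left _ (Nat.le_self_pow (by norm_num) n))
  have h4 : n ^ 2 ≤ n ^ 3 := Nat.pow_le_pow_right hn1 (by norm_num)
  have h5 : n ≤ n ^ 3 := Nat.le_self_pow (by norm_num) n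
  have h6 : 1 ≤ n ^ 3 := Nat.one_le_pow _ _ hn1
  have h7 : (10 * f + 7) * n ^ 3 ≤ n ^ 4 := by
    rw [pow_succ n 3, mul_comm]
    exact Nat.mul_le_mul_left _ hn
  rw [mul_comm k t, mul_comm t n]
  nlinarith

set_option maxHeartbeats 2000000 in
theorem exists_slices (f h : ℕ) (hf : 1 ≤ f) {q₀ κ γ : ℝ} (hq₀ : 0 < q₀) (hκ : 0 < κ)
    (hγ : 0 < γ) : ∃ ε₀, 0 < ε₀ ∧ ∃ η, 0 < η ∧ ∃ n₀ : ℕ, ∀ (V K : Type) [Fintype V]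
      [DecidableEq V] [Fintype K] [DecidableEq K] (F : SimpleGraph (Fin f)) (G Γ : SimpleGraph V)
      (φ : Sym2 V → K) (ε q x B L : ℝ) (t : ℕ), (edgeP F).card = h → Γ ≤ G → 0 < ε → ε ≤ ε₀ →
      n₀ ≤ Fintype.card V → Fintype.card K ≤ Fintype.card V ^ 2 → CutClose Γ q ε →
      q₀ ≤ q → q ≤ 2 → q ≤ x →
      (∀ v, |((nb Γ v).card : ℝ) - q * Fintype.card V| ≤ ε * Fintype.card V) →
      (∀ v, ((nb Γ v).card : ℝ) ≤ x * Fintype.card V) →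
      (∀ u v, Γ.Adj u v → ((nb Γ u ∩ nb Γ v).card : ℝ) ≤ x ^ 2 * Fintype.card V) →
      0 ≤ B → B ≤ 2 * f → h * B * (x ^ (h - 1) + 2 ^ h * ε) ≤ f * q ^ h →
      2 * (t : ℝ) ≤ B * Fintype.card V → 0 ≤ L → (∀ v c, (cdeg G φ v c : ℝ) ≤ L) →
      (∀ c, ∑ v, (cdeg G φ v c : ℝ) ≤ B * Fintype.card V) →
      (1 + L) * Real.log (Fintype.card V) ≤ η * Fintype.card V →
      ∀ good : V → (Fin f → V) → Prop,
      (∀ u, κ * (Fintype.card V : ℝ) ^ f ≤ cnt fun ψ => Valid F Γ φ ψ ∧ good u ψ) →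
      ∃ 𝓜 : Fin t → Finset (Fin f → V), Slices F Γ φ 𝓜 ∧
        (∀ i, ((unc (𝓜 i)).card : ℝ) ≤ γ * Fintype.card V) ∧
        (∀ v, ((Finset.univ.filter fun i => v ∈ unc (𝓜 i)).card : ℝ) ≤ γ * Fintype.card V) ∧
        (∀ i c, ∑ u ∈ unc (𝓜 i), (cdeg G φ u c : ℝ) ≤ γ * Fintype.card V) ∧
        ∀ i u, κ / (16 * (f + 2 * h : ℕ) * f * (2 ^ h + 1)) * Fintype.card V ≤
          ({ψ | ψ ∈ 𝓜 i ∧ good u ψ} : Set (Fin f → V)).ncard := by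
  have hf' : (1 : ℝ) ≤ f := by exact_mod_cast hf
  set r := f + 2 * h with hr
  have hr1 : 1 ≤ r := by omega
  have hr' : (1 : ℝ) ≤ r := by exact_mod_cast hr1
  obtain ⟨θ, hθ, δ₀, hδ₀, hnib⟩ := nibble r hr1 (γ / (2 * f + 1)) (by positivity)
  set A : ℝ := 2 ^ h * (1 + f * 2 ^ f) with hA
  have hA0 : 0 < A := by positivity
  set C : ℝ := (r : ℝ) ^ 2 * (2 + 2 * f) / (f * q₀ ^ h) + f * (2 ^ h + 1) / κ + 1 with hC
  have hC1 : (1 : ℝ) ≤ C := by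
    have : 0 ≤ (r : ℝ) ^ 2 * (2 + 2 * f) / (f * q₀ ^ h) + f * (2 ^ h + 1) / κ := by positivity
    linarith
  have hCa : (r : ℝ) ^ 2 * (2 + 2 * f) ≤ C * (f * q₀ ^ h) := by
    rw [← div_le_iff₀ (by positivity)]
    have : 0 ≤ f * (2 ^ h + 1) / κ := by positivity
    linarith
  have hCb : f * (2 ^ h + 1) ≤ C * κ := by
    rw [← div_le_iff₀ (by positivity)]
    have : 0 ≤ (r : ℝ) ^ 2 * (2 + 2 * f) / (f * q₀ ^ h) := by positivity
    linarith
  refine ⟨min (θ * q₀ ^ h / (4 * A)) (1 / A), by positivity,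
    min (θ * q₀ ^ h / (2 * (f ^ 2 + h ^ 2))) (δ₀ / (4 * C)), by positivity, 10 * f + 7, ?_⟩
  intro V K _ _ _ _ F G Γ φ ε q x B L t hF hΓG hε hεε hn hK hcut hq₀q hq2 hqx hreg hdegx hcodx
    hB0 hB2 hslack ht hL0 hL hS hη good hgood
  set n : ℝ := (Fintype.card V : ℝ) with hndef
  have hnpos : 0 < Fintype.card V := by omega
  have : Nonempty V := Fintype.card_pos_iff.1 hnpos
  have hn0 : 0 < n := by rw [hndef]; exact_mod_cast hnpos
  have hn7 : (7 : ℝ) ≤ n := by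
    rw [hndef]
    exact_mod_cast (by omega : 7 ≤ Fintype.card V)
  have hq0 : 0 < q := hq₀.trans_le hq₀q
  have hx0 : 0 < x := hq0.trans_le hqx
  have hqh : q₀ ^ h ≤ q ^ h := pow_le_pow_left₀ hq₀.le hq₀q h
  have hqh2 : q ^ h ≤ 2 ^ h := pow_le_pow_left₀ hq0.le hq2 h
  have hqh0 : 0 < q ^ h := by positivity
  have hnf : 0 < n ^ f := by positivity
  have hAε : A * ε ≤ θ * q₀ ^ h / 4 := by
    have h1 := hεε.trans (min_le_left _ _)
    rw [le_div_iff₀ (by positivity)] at h1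
    linarith
  have hAε1 : A * ε ≤ 1 := by
    have h1 := hεε.trans (min_le_right _ _)
    rw [le_div_iff₀ hA0] at h1
    linarith
  have hAε0 : 0 ≤ A * ε := by positivity
  have hlogn : 1 ≤ Real.log n := by
    rw [← Real.log_exp 1]
    exact Real.log_le_log (Real.exp_pos 1) (Real.exp_one_lt_d9.le.trans (by linarith))
  have hL1n : 1 + L ≤ min (θ * q₀ ^ h / (2 * (f ^ 2 + h ^ 2))) (δ₀ / (4 * C)) * n :=
    le_trans (le_mul_of_one_le_right (by positivity) hlogn) hη
  set D : ℝ := f * (q ^ h + A * ε) * n ^ f / n with hD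
  have hD0 : 0 < D := by positivity
  have hnD : n ^ 2 * D = n * (f * (q ^ h + A * ε) * n ^ f) := by
    rw [hD]; field_simp
  set δ : ℝ := C * (1 + L) / n with hδ
  have hδ0 : 0 < δ := by positivity
  have hδn : δ * n = C * (1 + L) := by rw [hδ]; field_simp
  set w : ℝ := (2 * f + 1) * n with hw
  have hw0 : 0 < w := by positivity
  have hDle : n * D ≤ f * (2 ^ h + 1) * n ^ f := by
    have h1 : n * D = f * (q ^ h + A * ε) * n ^ f := by rw [hD]; field_simp
    rw [h1]
    refine mul_le_mul_of_nonneg_right ?_ hnf.le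
    refine mul_le_mul_of_nonneg_left ?_ (by positivity)
    linarith
  -- the number of embeddings rooted at an edge
  have hz : ∀ p ∈ edgeP F, ∀ u v, n ^ 2 *
      cnt (fun ψ => Valid F Γ φ ψ ∧ ψ p.1 = u ∧ ψ p.2 = v) ≤
      (x ^ (h - 1) + 2 ^ h * ε) * n ^ f := by
    intro p hp u v
    rw [← hF]
    exact cnt_valid_edge hcut hq0.le hq2 hε.le hqx hdegx hcodx hp u v
  have hz0 : 0 ≤ (x ^ (h - 1) + 2 ^ h * ε) * n ^ f := by positivity
  have hΓc : ∀ v c, (cdeg Γ φ v c : ℝ) ≤ cdeg G φ v c := by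
    classical
    intro v c
    unfold cdeg
    norm_cast
    refine Finset.card_le_card fun u hu => ?_
    simp only [Finset.mem_filter, Finset.mem_univ, true_and] at hu ⊢
    exact ⟨hΓG hu.1, hu.2⟩
  have hΓL : ∀ v c, (cdeg Γ φ v c : ℝ) ≤ L := fun v c => (hΓc v c).trans (hL v c)
  have hΓS : ∀ c, ∑ v, (cdeg Γ φ v c : ℝ) ≤ B * n := fun c =>
    (Finset.sum_le_sum fun v _ => hΓc v c).trans (hS c)
  have hedge : B * n * (h * ((x ^ (h - 1) + 2 ^ h * ε) * n ^ f)) ≤ n ^ 2 * D := by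
    rw [hnD]
    calc _ = n * (h * B * (x ^ (h - 1) + 2 ^ h * ε)) * n ^ f := by ring
      _ ≤ n * (f * q ^ h) * n ^ f := by gcongr
      _ ≤ n * (f * (q ^ h + A * ε)) * n ^ f := by gcongr; linarith
      _ = _ := by ring
  -- vertex degrees
  have hrv : ∀ v j, |n * cnt (fun ψ => IsHom F Γ ψ ∧ ψ j = v) - q ^ h * n ^ f| ≤
      A * ε * n ^ f := by
    intro v j
    have h1 := rooted_vertex F hcut hq0.le hq2 v (hreg v) j
    rw [hF] at h1
    unfold cnt
    convert h1
  have hup : ∀ v j, n * cnt (fun ψ => Valid F Γ φ ψ ∧ ψ j = v) ≤ (q ^ h + A * ε) * n ^ f := by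
    intro v j
    have h1 := (abs_le.1 (hrv v j)).2
    have h2 : cnt (fun ψ => Valid F Γ φ ψ ∧ ψ j = v) ≤ cnt (fun ψ => IsHom F Γ ψ ∧ ψ j = v) :=
      cnt_mono fun ψ h => ⟨h.1.hom, h.2⟩
    have h3 := mul_le_mul_of_nonneg_left h2 hn0.le
    linarith
  have hdn : ∀ v j, (1 - θ) * ((q ^ h + A * ε) * n ^ f) ≤
      n * cnt (fun ψ => Valid F Γ φ ψ ∧ ψ j = v) := by
    intro v j
    have h1 := (abs_le.1 (hrv v j)).1
    have h2 := cnt_rooted_valid (F := F) hΓL j v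
    rw [hF, ← hndef] at h2
    have h3 : (f : ℝ) ^ 2 + (h : ℝ) ^ 2 * L ≤ n * (θ * q₀ ^ h / 2) := by
      have h4 := hL1n.trans (mul_le_mul_of_nonneg_right (min_le_left _ _) hn0.le)
      have h5 : (0 : ℝ) < f ^ 2 + h ^ 2 := by positivity
      have h6 := mul_le_mul_of_nonneg_left h4 h5.le
      have h7 : ((f : ℝ) ^ 2 + h ^ 2) * (θ * q₀ ^ h / (2 * (f ^ 2 + h ^ 2)) * n) =
          n * (θ * q₀ ^ h / 2) := by field_simp
      rw [h7] at h6
      refine le_trans ?_ h6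
      linarith [mul_nonneg (sq_nonneg (f : ℝ)) hL0, sq_nonneg (h : ℝ)]
    have h8 := mul_le_mul_of_nonneg_right h3 hnf.le
    have h9 : θ * q₀ ^ h ≤ θ * (q ^ h + A * ε) :=
      mul_le_mul_of_nonneg_left (by linarith) hθ.le
    have h10 : (1 - θ) * (q ^ h + A * ε) ≤ q ^ h - A * ε - θ * q₀ ^ h / 2 := by linarith
    have h11 := mul_le_mul_of_nonneg_right h10 (mul_pos hn0 hnf).le
    refine le_of_mul_le_mul_left ?_ hn0
    have h12 := mul_le_mul_of_nonneg_left h1 hn0.le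
    linarith
  have hvs : ∀ v j, n * hyperDeg F Γ φ (Sum.inr (Sum.inl (v, j)) : HV V K t) =
      ∑ a, n * cnt (fun ψ => Valid F Γ φ ψ ∧ ψ a = v) := fun v j => by
    rw [hyperDeg_vertex, Finset.mul_sum]
  obtain ⟨𝓜, hM0, hM1, hM2, hM3, hM4⟩ := exists_slices_of_nibble (F := F) (Γ := Γ) (G := G)
    (φ := φ) (t := t) (r := r) (γ := γ / (2 * f + 1)) (θ := θ) (δ₀ := δ₀) (D := D) (δ := δ)
    (w := w) (by rw [hF])
    (fun X E J K _ _ _ _ _ _ vs h1 D δ h2 h3 h4 h5 M h6 ω h7 h8 h9 𝓖 h10 h11 =>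
      hnib X E J K vs h1 D δ h2 h3 h4 h5 M h6 ω h7 h8 h9 𝓖 h10 h11)
    hD0 hδ0 hw0
    (by
      rintro (e | ⟨v, j⟩ | ⟨c, j⟩)
      · refine le_of_mul_le_mul_left ?_ (by positivity : 0 < n ^ 2)
        refine le_trans (hyperDeg_edge_le hz e) ?_
        rw [hF]
        exact (mul_le_mul_of_nonneg_right ht (by positivity)).trans hedge
      · refine le_of_mul_le_mul_left ?_ (by positivity : 0 < n ^ 2)
        rw [hnD, sq, mul_assoc, hvs]
        refine mul_le_mul_of_nonneg_left ?_ hn0.le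
        refine (Finset.sum_le_sum fun a _ => hup v a).trans ?_
        simp [mul_assoc]
      · refine le_of_mul_le_mul_left ?_ (by positivity : 0 < n ^ 2)
        refine le_trans (hyperDeg_colour_le hz0 hz c (hΓS c) j) ?_
        rw [hF]
        exact hedge)
    (by
      intro y y' hyy
      refine le_of_mul_le_mul_left ?_ (by positivity : 0 < n ^ 2)
      refine (hcodeg_le hL0 hB0 hΓL hΓS ht hnpos hyy).trans ?_
      rw [hF, ← hr, ← hndef]
      have h1 : n ^ 2 * (δ * D) = C * (1 + L) * (f * (q ^ h + A * ε)) * n ^ f := by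
        rw [mul_left_comm, hnD, ← hδn]
        ring
      rw [h1]
      have h2 : (r : ℝ) ^ 2 * (2 + B) ≤ C * (f * (q ^ h + A * ε)) := by
        refine le_trans ?_ (hCa.trans ?_)
        · gcongr
        · gcongr
          linarith
      have h3 := mul_le_mul_of_nonneg_right h2 (by positivity : 0 ≤ (1 + L) * n ^ f)
      linarith)
    (by
      intro v j
      refine le_of_mul_le_mul_left ?_ hn0
      rw [hvs]
      refine le_trans ?_ (Finset.sum_le_sum fun a _ => hdn v a)
      rw [hD]
      simp only [Finset.sum_const, Finset.card_univ, Fintype.card_fin, nsmul_eq_mul]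
      apply le_of_eq
      field_simp)
    (by
      intro v c
      refine (hL v c).trans ?_
      rw [hw, mul_left_comm, hδn]
      have h1 : 1 + L ≤ C * (1 + L) := le_mul_of_one_le_left (by positivity) hC1
      have h2 : C * (1 + L) ≤ (2 * f + 1) * (C * (1 + L)) :=
        le_mul_of_one_le_left (by positivity) (by linarith)
      linarith)
    (by
      rw [hw, mul_left_comm, hδn]
      have h1 : 1 + L ≤ C * (1 + L) := le_mul_of_one_le_left (by positivity) hC1
      have h2 : C * (1 + L) ≤ (2 * f + 1) * (C * (1 + L)) :=
        le_mul_of_one_le_left (by positivity) (by linarith)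
      linarith)
    (fun c => (hS c).trans (by rw [hw]; gcongr; linarith))
    (by
      have : B * n ≤ w := by rw [hw]; gcongr; linarith
      have : (0 : ℝ) ≤ t := Nat.cast_nonneg _
      linarith)
    (by
      rw [hw]
      exact le_mul_of_one_le_left hn0.le (by linarith))
    good
    (by
      intro u
      refine le_of_mul_le_mul_left ?_ hn0
      refine hDle.trans ?_
      have h1 := mul_le_mul_of_nonneg_left (hgood u) (by positivity : 0 ≤ C * (1 + L))
      rw [← mul_assoc n, mul_comm n δ, hδn]
      refine le_trans ?_ h1
      have h2 : C * κ ≤ C * κ * (1 + L) := le_mul_of_one_le_right (by positivity) (by linarith)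
      have h3 := mul_le_mul_of_nonneg_right (hCb.trans h2) hnf.le
      linarith)
    (by
      have h1 : (t : ℝ) ≤ f * n := by
        have := mul_le_mul_of_nonneg_right hB2 hn0.le
        linarith
      have h2 : t ≤ f * Fintype.card V := by
        rw [hndef] at h1
        exact_mod_cast h1
      have h3 := size_le hK h2 hn
      have h4 := card_sym2_le V
      have h5 : (2 * Fintype.card (HV V K t) : ℝ) +
          2 * Fintype.card ((Fin t × K) ⊕ (V ⊕ Fin t)) + 2 * Fintype.card (Fin t × V) + 3 ≤
          n ^ 4 := by
        rw [hndef]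
        norm_cast
        simp only [Fintype.card_sum, Fintype.card_prod, Fintype.card_fin]
        omega
      have h6 := Real.log_le_log (by positivity) h5
      rw [Real.log_pow] at h6
      refine (mul_le_mul_of_nonneg_left h6 hδ0.le).trans ?_
      refine le_of_mul_le_mul_right ?_ hn0
      have h7 := hη.trans (mul_le_mul_of_nonneg_right (min_le_right _ _) hn0.le)
      have h8 := mul_le_mul_of_nonneg_left h7 (by positivity : 0 ≤ 4 * C)
      have h9 : 4 * C * (δ₀ / (4 * C) * n) = δ₀ * n := by field_simp
      rw [h9] at h8
      refine le_trans (le_of_eq ?_) h8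
      rw [mul_right_comm, hδn]
      push_cast
      ring)
  have hγw : γ / (2 * f + 1) * w = γ * n := by rw [hw]; field_simp
  rw [hγw] at hM1 hM2 hM3
  refine ⟨𝓜, hM0, hM1, hM2, hM3, fun i u => ?_⟩
  have h1 := hM4 i u
  set N : ℝ := (({ψ | ψ ∈ 𝓜 i ∧ good u ψ} : Set (Fin f → V)).ncard : ℝ) with hN
  have hN0 : 0 ≤ N := Nat.cast_nonneg _
  have h2 := mul_le_mul_of_nonneg_left (hgood u) (by positivity : 0 ≤ 1 / (16 * r : ℝ))
  have h3 := mul_le_mul_of_nonneg_left (h2.trans h1) hn0.le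
  have h4 := mul_le_mul_of_nonneg_right hDle hN0
  have h5 : n * (1 / (16 * r : ℝ) * (κ * n ^ f)) ≤ f * (2 ^ h + 1) * n ^ f * N := by linarith
  rw [div_mul_eq_mul_div, div_le_iff₀ (by positivity)]
  refine le_of_mul_le_mul_right ?_ hnf
  have h6 := mul_le_mul_of_nonneg_left h5 (by positivity : (0 : ℝ) ≤ 16 * r)
  have h7 : (16 * r : ℝ) * (n * (1 / (16 * r : ℝ) * (κ * n ^ f))) = κ * n * n ^ f := by
    field_simp
  rw [h7] at h6
  linarith

section Good

variable {V K : Type} [Fintype V] [DecidableEq V] [Fintype K] [DecidableEq K] {f : ℕ}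
variable {F : SimpleGraph (Fin f)} {G R : SimpleGraph V} {φ : Sym2 V → K}

theorem cnt_le_add_of_imp {P Q S : (Fin f → V) → Prop} (h : ∀ ψ, P ψ → Q ψ ∨ S ψ) :
    cnt P ≤ cnt Q + cnt S := (cnt_mono h).trans (cnt_or_le _ _)

theorem cnt_hom_not_valid {L : ℝ} (hL : ∀ v c, (cdeg G φ v c : ℝ) ≤ L) (j : Fin f) :
    (Fintype.card V : ℝ) * cnt (fun ψ => IsHom F G ψ ∧ ¬ Valid F G φ ψ) ≤
      (f ^ 2 + ((edgeP F).card : ℝ) ^ 2 * L) * (Fintype.card V : ℝ) ^ f := by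
  rcases isEmpty_or_nonempty V with hV | hV
  · have hf : f ≠ 0 := fun h => by subst h; exact j.elim0
    simp [hf]
  have hn : (0 : ℝ) < Fintype.card V := by exact_mod_cast Fintype.card_pos
  have hsum : ∀ P : (Fin f → V) → Prop, cnt P = ∑ v, cnt (fun ψ => P ψ ∧ ψ j = v) := by
    intro P
    rw [← cnt_exists_eq]
    · exact cnt_congr fun ψ => by simp
    · rintro v - w - hvw ψ ⟨-, h1⟩ ⟨-, h2⟩
      exact hvw (h1.symm.trans h2)
  have h1 : cnt (IsHom F G) = cnt (Valid F G φ) + cnt (fun ψ => IsHom F G ψ ∧ ¬ Valid F G φ ψ) := by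
    have h2 := cnt_exists_eq (V := V) (f := f) (Finset.univ : Finset Bool) (fun b ψ =>
      if b then Valid F G φ ψ else IsHom F G ψ ∧ ¬ Valid F G φ ψ) (by
        rintro (_ | _) - (_ | _) - hb ψ h3 <;> simp_all)
    simp only [Fintype.sum_bool, if_true, Bool.false_eq_true, if_false] at h2
    rw [← h2]
    refine cnt_congr fun ψ => ?_
    simp only [Finset.mem_univ, true_and, Bool.exists_bool, if_true, Bool.false_eq_true, if_false]
    constructor
    · intro h3
      by_cases h4 : Valid F G φ ψ
      · exact Or.inr h4
      · exact Or.inl ⟨h3, h4⟩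
    · rintro (h3 | h3)
      exacts [h3.1, h3.hom]
  have h2 := Finset.sum_le_sum fun v (_ : v ∈ Finset.univ) =>
    cnt_rooted_valid (F := F) (G := G) (φ := φ) hL j v
  rw [Finset.sum_add_distrib, ← Finset.mul_sum, ← Finset.mul_sum, ← hsum, ← hsum, h1,
    Finset.sum_const, nsmul_eq_mul, Finset.card_univ] at h2
  refine le_of_mul_le_mul_left ?_ hn
  nlinarith [h2]

theorem cnt_hom_ge [Nonempty V] {q ε ω : ℝ} (hG : CutClose G q ε) (hq0 : 0 ≤ q) (hq2 : q ≤ 2)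
    (hε : 0 ≤ ε) (hω : 0 ≤ ω) (W : Fin f → Finset V)
    (hW : ∀ j, ω * Fintype.card V ≤ (W j).card) :
    (q ^ (edgeP F).card * ω ^ f - 2 ^ (edgeP F).card * ε) * (Fintype.card V : ℝ) ^ f ≤
      cnt (fun ψ => (∀ j, ψ j ∈ W j) ∧ IsHom F G ψ) := by
  have h := counting hG hq0 hq2 hε W (edgeP F) fun p hp => ((mem_edgeP F).1 hp).1
  have h1 : |cnt (fun ψ => (∀ j, ψ j ∈ W j) ∧ IsHom F G ψ) -
      q ^ (edgeP F).card * ∏ j, ((W j).card : ℝ)| ≤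
        2 ^ (edgeP F).card * ε * (Fintype.card V : ℝ) ^ f := by
    rw [cnt_congr (Q := fun ψ => (∀ j, ψ j ∈ W j) ∧ ∀ p ∈ edgeP F, G.Adj (ψ p.1) (ψ p.2))
      fun ψ => by rw [isHom_iff], cnt]
    convert h
  have h2 : (ω * Fintype.card V) ^ f ≤ ∏ j, ((W j).card : ℝ) := by
    have := Finset.prod_le_prod (s := (Finset.univ : Finset (Fin f)))
      (fun j _ => mul_nonneg hω (Nat.cast_nonneg (Fintype.card V))) fun j _ => hW j
    simpa using this
  have h3 := mul_le_mul_of_nonneg_left h2 (pow_nonneg hq0 (edgeP F).card)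
  have h4 := (abs_le.1 h1).1
  rw [mul_pow] at h3
  linarith

theorem fiber_star {u : V} {g : V → V} {P : Finset V} (hadj : ∀ x ∈ P, R.Adj u (g x))
    (hinj : ∀ x ∈ P, ∀ y ∈ P, g x = g y → x = y) (c : K) (s : Finset V)
    (hs : ∀ y ∈ s, y ∈ P ∧ φ s(u, g y) = c) : s.card ≤ cdeg R φ u c := by
  classical
  rw [cdeg]
  refine Finset.card_le_card_of_injOn g (fun y hy => ?_) fun x hx y hy h =>
    hinj x (hs x hx).1 y (hs y hy).1 h
  simp only [Finset.coe_filter, Finset.mem_univ, true_and, Set.mem_ofPred_eq]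
  exact ⟨hadj y (hs y hy).1, (hs y hy).2⟩

/-- The map `ψ` can be used to absorb `u` at the vertex `j` along the graph `R`. -/
structure Switch (F : SimpleGraph (Fin f)) (R : SimpleGraph V) (φ : Sym2 V → K) (j : Fin f)
    (u : V) (ψ : Fin f → V) : Prop where
  adj : ∀ k ∈ nbrs F j, R.Adj u (ψ k)
  colour : ∀ k ∈ nbrs F j, ∀ k' ∈ nbrs F j, φ s(u, ψ k) = φ s(u, ψ k') → k = k'

theorem cnt_switch_ge [Nonempty V] {q ε ω L : ℝ} (hG : CutClose G q ε) (hq0 : 0 ≤ q) (hq2 : q ≤ 2)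
    (hε : 0 ≤ ε) (hω : 0 ≤ ω) (hω1 : ω ≤ 1) (hL0 : 0 ≤ L)
    (hLG : ∀ v c, (cdeg G φ v c : ℝ) ≤ L)
    (hLR : ∀ v c, (cdeg R φ v c : ℝ) ≤ L) (hR : ∀ v, ω * Fintype.card V ≤ (nb R v).card)
    (j : Fin f) (u : V) :
    (q ^ (edgeP F).card * ω ^ f - 2 ^ (edgeP F).card * ε) * (Fintype.card V : ℝ) ^ f *
      Fintype.card V ≤ Fintype.card V * cnt (fun ψ => Valid F G φ ψ ∧ Switch F R φ j u ψ) +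
        (2 * f ^ 2 + ((edgeP F).card : ℝ) ^ 2) * (1 + L) * (Fintype.card V : ℝ) ^ f := by
  classical
  set n : ℝ := (Fintype.card V : ℝ) with hn
  have hn0 : 0 ≤ n := Nat.cast_nonneg _
  set W : Fin f → Finset V := fun k => if k ∈ nbrs F j then nb R u else Finset.univ with hW
  have h1 := cnt_hom_ge (F := F) hG hq0 hq2 hε hω W fun k => by
    rw [hW]
    dsimp only
    split_ifs
    · exact hR u
    · rw [Finset.card_univ]
      exact mul_le_of_le_one_left hn0 hω1
  have h2 : cnt (fun ψ => (∀ k, ψ k ∈ W k) ∧ IsHom F G ψ) ≤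
      cnt (fun ψ => Valid F G φ ψ ∧ Switch F R φ j u ψ) +
        (cnt (fun ψ => IsHom F G ψ ∧ ¬ Valid F G φ ψ) +
          cnt (fun ψ => ∃ x ∈ (nbrs F j ×ˢ nbrs F j).filter (fun x => x.1 ≠ x.2),
            R.Adj u (ψ x.1) ∧ φ s(u, ψ x.1) = φ s(u, ψ x.2))) := by
    refine (cnt_le_add_of_imp fun ψ h => ?_).trans (add_le_add le_rfl (cnt_or_le _ _))
    obtain ⟨hw, hom⟩ := h
    have hadj : ∀ k ∈ nbrs F j, R.Adj u (ψ k) := fun k hk => by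
      have := hw k
      rw [hW] at this
      dsimp only at this
      rw [if_pos hk] at this
      exact mem_nb.1 this
    by_cases hv : Valid F G φ ψ
    · by_cases hc : ∀ k ∈ nbrs F j, ∀ k' ∈ nbrs F j, φ s(u, ψ k) = φ s(u, ψ k') → k = k'
      · exact Or.inl ⟨hv, hadj, hc⟩
      · push Not at hc
        obtain ⟨k, hk, k', hk', h3, h4⟩ := hc
        exact Or.inr (Or.inr ⟨(k, k'), by simp [hk, hk', h4], hadj k hk, h3⟩)
    · exact Or.inr (Or.inl ⟨hom, hv⟩)
  have h3 := cnt_hom_not_valid (F := F) hLG j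
  have h4 : n * cnt (fun ψ => ∃ x ∈ (nbrs F j ×ˢ nbrs F j).filter (fun x => x.1 ≠ x.2),
      R.Adj u (ψ x.1) ∧ φ s(u, ψ x.1) = φ s(u, ψ x.2)) ≤ f ^ 2 * (L * n ^ f) := by
    refine (mul_le_mul_of_nonneg_left (cnt_exists_le _ _) hn0).trans ?_
    rw [Finset.mul_sum]
    refine (Finset.sum_le_card_nsmul _ _ (L * n ^ f) fun x hx => ?_).trans ?_
    · simp only [Finset.mem_filter] at hx
      have h5 := cnt_fiber x.1 (fun _ : Fin f → V => True) (fun ψ =>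
        R.Adj u (ψ x.1) ∧ φ s(u, ψ x.1) = φ s(u, ψ x.2)) L (fun _ _ => Iff.rfl) fun ψ s hs => by
          refine le_trans ?_ (hLR u (φ s(u, ψ x.2)))
          refine Nat.cast_le.2 (fiber_star (g := id) (P := nb R u) (fun x hx => mem_nb.1 hx)
            (fun x _ y _ h => h) _ s fun y hy => ?_)
          have h6 := hs y hy
          rw [Function.update_self, Function.update_of_ne hx.2.symm] at h6
          exact ⟨mem_nb.2 h6.1, h6.2⟩
      simpa only [true_and, cnt_true] using h5
    · rw [nsmul_eq_mul]
      refine mul_le_mul_of_nonneg_right ?_ (by positivity)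
      have h5 : ((nbrs F j ×ˢ nbrs F j).filter (fun x => x.1 ≠ x.2)).card ≤ f ^ 2 := by
        refine (Finset.card_le_univ _).trans_eq ?_
        rw [Fintype.card_prod, Fintype.card_fin, sq]
      exact_mod_cast h5
  have h5 := mul_le_mul_of_nonneg_right (h1.trans h2) hn0
  refine h5.trans ?_
  have h6 : (f ^ 2 + ((edgeP F).card : ℝ) ^ 2 * L) * n ^ f + f ^ 2 * (L * n ^ f) ≤
      (2 * f ^ 2 + ((edgeP F).card : ℝ) ^ 2) * (1 + L) * n ^ f := by
    have h7 : (0 : ℝ) ≤ f ^ 2 * n ^ f := by positivity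
    have h8 : (0 : ℝ) ≤ (((edgeP F).card : ℝ) ^ 2) * n ^ f := by positivity
    have h9 : (0 : ℝ) ≤ f ^ 2 * n ^ f * L := by positivity
    linarith
  linarith

end Good

section Absorber

variable {V K : Type} [Fintype V] [DecidableEq V] [Fintype K] [DecidableEq K] {f : ℕ}

/-- The new edges of an absorber: those at the absorbed vertices, and those of the new copy. -/
noncomputable def newSlots (F : SimpleGraph (Fin f)) (N : Finset (Fin f)) :
    Finset ((Fin f × Fin f) ⊕ (Fin f × Fin f)) :=
  (Finset.univ ×ˢ N).disjSum (edgeP F)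

theorem inl_mem_newSlots {F : SimpleGraph (Fin f)} {N : Finset (Fin f)} {x : Fin f × Fin f} :
    Sum.inl x ∈ newSlots F N ↔ x.2 ∈ N := by simp [newSlots]

theorem inr_mem_newSlots {F : SimpleGraph (Fin f)} {N : Finset (Fin f)} {p : Fin f × Fin f} :
    Sum.inr p ∈ newSlots F N ↔ p ∈ edgeP F := by simp [newSlots]

theorem card_newSlots_le (F : SimpleGraph (Fin f)) (N : Finset (Fin f)) :
    (newSlots F N).card ≤ f ^ 2 + (edgeP F).card := by
  rw [newSlots, Finset.card_disjSum, Finset.card_product, Finset.card_univ, Fintype.card_fin, sq]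
  have := Finset.card_le_univ N
  rw [Fintype.card_fin] at this
  gcongr

/-- The edge of the graph placed at a slot by the absorber `w`. -/
def slotEdge (u : Fin f → V) (g : Fin f → V → V) (w : Fin f → V) :
    (Fin f × Fin f) ⊕ (Fin f × Fin f) → Sym2 V
  | .inl x => s(u x.1, g x.2 (w x.1))
  | .inr p => im w p

/-- The maps `w` which can serve as absorbers for the vertices `u`. -/
structure Absorbs (F : SimpleGraph (Fin f)) (N : Finset (Fin f)) (R : SimpleGraph V)
    (φ : Sym2 V → K) (u : Fin f → V) (P : Fin f → Finset V) (g : Fin f → V → V)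
    (w : Fin f → V) : Prop where
  mem : ∀ j, w j ∈ P j
  hom : IsHom F R w
  inj : Function.Injective w
  rainbow : ∀ x ∈ newSlots F N, ∀ y ∈ newSlots F N,
    φ (slotEdge u g w x) = φ (slotEdge u g w y) → x = y

/-- The hypotheses on the vertices `P j` which can be freed for `u j`. -/
structure Freeable (N : Finset (Fin f)) (R : SimpleGraph V) (φ : Sym2 V → K) (u : Fin f → V)
    (P : Fin f → Finset V) (g : Fin f → V → V) : Prop where
  adj : ∀ j, ∀ x ∈ P j, ∀ k ∈ N, R.Adj (u j) (g k x)
  colour : ∀ j, ∀ x ∈ P j, ∀ k ∈ N, ∀ k' ∈ N, φ s(u j, g k x) = φ s(u j, g k' x) → k = k'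
  inj : ∀ j, ∀ k ∈ N, ∀ x ∈ P j, ∀ y ∈ P j, g k x = g k y → x = y

variable {F : SimpleGraph (Fin f)} {N : Finset (Fin f)} {R : SimpleGraph V} {φ : Sym2 V → K}
variable {u : Fin f → V} {P : Fin f → Finset V} {g : Fin f → V → V}

theorem cnt_absorbs_inl_edge {j k : Fin f} (hg : Freeable N R φ u P g) (hk : k ∈ N) (e : Sym2 V) :
    (Fintype.card V : ℝ) * cnt (fun w => Absorbs F N R φ u P g w ∧ slotEdge u g w (.inl (j, k)) = e)
      ≤ if u j ∈ e then (Fintype.card V : ℝ) ^ f else 0 := by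
  split_ifs with hu
  · have h := cnt_fiber j (fun _ : Fin f → V => True) (fun w => w j ∈ P j ∧ s(u j, g k (w j)) = e) 1
      (fun _ _ => Iff.rfl) fun ψ s hs => by
        have : s.card ≤ 1 := Finset.card_le_one.2 fun y hy z hz => by
          have h1 := hs y hy
          have h2 := hs z hz
          rw [Function.update_self] at h1 h2
          exact hg.inj j k hk y h1.1 z h2.1 (Sym2.congr_right.1 (h1.2.trans h2.2.symm))
        exact_mod_cast this
    simp only [true_and, one_mul, cnt_true] at h
    refine le_trans (mul_le_mul_of_nonneg_left (cnt_mono fun w hw => ?_) (Nat.cast_nonneg _)) h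
    exact ⟨hw.1.mem j, hw.2⟩
  · rw [cnt_eq_zero, mul_zero]
    rintro w ⟨-, rfl⟩
    exact hu (Sym2.mem_mk_left _ _)

theorem cnt_absorbs_inr_edge {p : Fin f × Fin f} (hp : p ∈ edgeP F) (e : Sym2 V) :
    (Fintype.card V : ℝ) ^ 2 *
      cnt (fun w => Absorbs F N R φ u P g w ∧ slotEdge u g w (.inr p) = e) ≤
        2 * (Fintype.card V : ℝ) ^ f :=
  le_trans (mul_le_mul_of_nonneg_left (cnt_mono fun _ hw => hw.2) (by positivity)) (cnt_edge hp e)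

theorem cnt_inl_colour {j k : Fin f} (hg : Freeable N R φ u P g) (hk : k ∈ N)
    (Q : (Fin f → V) → Prop) (c : (Fin f → V) → K) (x : ℝ) (hx : ∀ c, (cdeg R φ (u j) c : ℝ) ≤ x)
    (hQ : ∀ ψ y, Q ψ ↔ Q (Function.update ψ j y)) (hc : ∀ ψ y, c (Function.update ψ j y) = c ψ) :
    (Fintype.card V : ℝ) * cnt (fun w => Q w ∧ w j ∈ P j ∧ φ (slotEdge u g w (.inl (j, k))) = c w)
      ≤ x * cnt Q := by
  refine cnt_fiber j Q (fun w => w j ∈ P j ∧ φ (slotEdge u g w (.inl (j, k))) = c w) _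
    hQ fun ψ s hs => ?_
  refine le_trans (Nat.cast_le.2 (fiber_star (u := u j) (hg.adj j · · k hk) (hg.inj j k hk) (c ψ) s
    fun y hy => ?_)) (hx (c ψ))
  have h1 := hs y hy
  rw [hc, slotEdge, Function.update_self] at h1
  exact h1

theorem cnt_absorbs_inl_colour {j k : Fin f} (hg : Freeable N R φ u P g) (hk : k ∈ N) (c : K) :
    (Fintype.card V : ℝ) *
      cnt (fun w => Absorbs F N R φ u P g w ∧ φ (slotEdge u g w (.inl (j, k))) = c) ≤
        cdeg R φ (u j) c * (Fintype.card V : ℝ) ^ f := by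
  have h := cnt_fiber j (fun _ : Fin f → V => True)
    (fun w => w j ∈ P j ∧ φ (slotEdge u g w (.inl (j, k))) = c) (cdeg R φ (u j) c)
      (fun _ _ => Iff.rfl) fun ψ s hs => by
        refine Nat.cast_le.2 (fiber_star (u := u j) (hg.adj j · · k hk) (hg.inj j k hk) c s
          fun y hy => ?_)
        have h1 := hs y hy
        rw [slotEdge, Function.update_self] at h1
        exact h1
  simp only [true_and, cnt_true] at h
  refine le_trans (mul_le_mul_of_nonneg_left (cnt_mono fun w hw => ?_) (Nat.cast_nonneg _)) h
  exact ⟨hw.1.mem j, hw.2⟩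

theorem cnt_absorbs_inr_colour {p : Fin f × Fin f} (hp : p ∈ edgeP F) (c : K) :
    (Fintype.card V : ℝ) ^ 2 *
      cnt (fun w => Absorbs F N R φ u P g w ∧ φ (slotEdge u g w (.inr p)) = c) ≤
        (∑ v, (cdeg R φ v c : ℝ)) * (Fintype.card V : ℝ) ^ f := by
  refine le_trans (mul_le_mul_of_nonneg_left (cnt_mono fun w hw => ?_) (by positivity))
    (cnt_colour hp c).le
  exact ⟨hw.1.hom _ _ ((mem_edgeP F).1 hp).2, hw.2⟩

theorem cnt_absorbs_vertex (j : Fin f) (v : V) :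
    (Fintype.card V : ℝ) * cnt (fun w => Absorbs F N R φ u P g w ∧ w j = v) ≤
      (Fintype.card V : ℝ) ^ f :=
  le_trans (mul_le_mul_of_nonneg_left (cnt_mono fun _ hw => hw.2) (by positivity))
    (cnt_vertex j v).le

theorem cnt_clash (hg : Freeable N R φ u P g) {L : ℝ} (hL0 : 0 ≤ L)
    (hL : ∀ v c, (cdeg R φ v c : ℝ) ≤ L)
    (x : Fin f × Fin f) (y : (Fin f × Fin f) ⊕ (Fin f × Fin f)) (hx : x.2 ∈ N)
    (hy : y ∈ newSlots F N) (hxy : Sum.inl x ≠ y) :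
    (Fintype.card V : ℝ) * cnt (fun w => (∀ j, w j ∈ P j) ∧ IsHom F R w ∧
      φ (slotEdge u g w (.inl x)) = φ (slotEdge u g w y)) ≤ L * (Fintype.card V : ℝ) ^ f := by
  obtain ⟨j, k⟩ := x
  rcases y with ⟨j', k'⟩ | p
  · by_cases hj : j = j'
    · subst hj
      rw [cnt_eq_zero, mul_zero]
      · positivity
      · rintro w ⟨h1, -, h2⟩
        have h3 := hg.colour j (w j) (h1 j) k hx k' (inl_mem_newSlots.1 hy) h2
        exact hxy (by rw [h3])
    · have h := cnt_inl_colour hg hx (fun _ => True)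
        (fun w => φ (slotEdge u g w (.inl (j', k')))) L (hL (u j)) (fun _ _ => Iff.rfl)
        fun ψ y => by rw [slotEdge, slotEdge, Function.update_of_ne (Ne.symm hj)]
      simp only [true_and, cnt_true] at h
      refine le_trans (mul_le_mul_of_nonneg_left (cnt_mono fun w hw => ?_) (Nat.cast_nonneg _)) h
      exact ⟨hw.1 j, hw.2.2⟩
  · have hp := inr_mem_newSlots.1 hy
    obtain ⟨m, hm, hmj⟩ := exists_endpoint_ne hp j
    have h := cnt_fiber m (fun _ : Fin f → V => True)
      (fun w => HasCol R φ w p (φ s(u j, g k (w j)))) L (fun _ _ => Iff.rfl) fun ψ s hs =>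
        fiber_colour hL hp hm ψ (φ s(u j, g k (ψ j))) s fun y hy => by
          have h1 := hs y hy
          rwa [Function.update_of_ne hmj.symm] at h1
    simp only [true_and, cnt_true] at h
    refine le_trans (mul_le_mul_of_nonneg_left (cnt_mono fun w hw => ?_) (Nat.cast_nonneg _)) h
    exact ⟨hw.2.1 _ _ ((mem_edgeP F).1 hp).2, hw.2.2.symm⟩

theorem cnt_absorbs_ge [Nonempty V] {q ε ω L : ℝ} (hR : CutClose R q ε) (hq0 : 0 ≤ q) (hq2 : q ≤ 2)
    (hε : 0 ≤ ε) (hω : 0 ≤ ω) (hL0 : 0 ≤ L) (hL : ∀ v c, (cdeg R φ v c : ℝ) ≤ L)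
    (hf : 1 ≤ f) (hg : Freeable N R φ u P g) (hP : ∀ j, ω * Fintype.card V ≤ (P j).card) :
    (q ^ (edgeP F).card * ω ^ f - 2 ^ (edgeP F).card * ε) * (Fintype.card V : ℝ) ^ f *
      Fintype.card V ≤ Fintype.card V * cnt (Absorbs F N R φ u P g) +
        2 * ((f ^ 2 + (edgeP F).card : ℕ) : ℝ) ^ 2 * (1 + L) * (Fintype.card V : ℝ) ^ f := by
  classical
  set n : ℝ := (Fintype.card V : ℝ) with hn
  have hn0 : 0 ≤ n := Nat.cast_nonneg _
  have h1 := cnt_hom_ge (F := F) hR hq0 hq2 hε hω P hP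
  have h2 : cnt (fun w => (∀ j, w j ∈ P j) ∧ IsHom F R w) ≤ cnt (Absorbs F N R φ u P g) +
      (cnt (fun w => IsHom F R w ∧ ¬ Valid F R φ w) +
        cnt (fun w => ∃ z ∈ ((Finset.univ ×ˢ N) ×ˢ newSlots F N).filter
          (fun z => Sum.inl z.1 ≠ z.2), (∀ j, w j ∈ P j) ∧ IsHom F R w ∧
            φ (slotEdge u g w (.inl z.1)) = φ (slotEdge u g w z.2))) := by
    refine (cnt_le_add_of_imp fun w h => ?_).trans (add_le_add le_rfl (cnt_or_le _ _))
    obtain ⟨hm, hom⟩ := h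
    by_cases hv : Valid F R φ w
    · by_cases hc : ∃ z ∈ ((Finset.univ ×ˢ N) ×ˢ newSlots F N).filter
          (fun z => Sum.inl z.1 ≠ z.2), (∀ j, w j ∈ P j) ∧ IsHom F R w ∧
            φ (slotEdge u g w (.inl z.1)) = φ (slotEdge u g w z.2)
      · exact Or.inr (Or.inr hc)
      · refine Or.inl ⟨hm, hom, hv.inj, ?_⟩
        have key : ∀ x, Sum.inl x ∈ newSlots F N → ∀ y ∈ newSlots F N,
            φ (slotEdge u g w (.inl x)) = φ (slotEdge u g w y) → Sum.inl x = y := by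
          intro x hx y hy h3
          by_contra h4
          refine hc ⟨(x, y), ?_, hm, hom, h3⟩
          simp only [Finset.mem_filter, Finset.mem_product, Finset.mem_univ, true_and]
          exact ⟨⟨inl_mem_newSlots.1 hx, hy⟩, h4⟩
        rintro (x | p) hx (y | p') hy h3
        · exact key x hx _ hy h3
        · exact key x hx _ hy h3
        · exact (key y hy _ hx h3.symm).symm
        · exact congrArg _ (hv.rainbow p (inr_mem_newSlots.1 hx) p' (inr_mem_newSlots.1 hy) h3)
    · exact Or.inr (Or.inl ⟨hom, hv⟩)
  have h3 := cnt_hom_not_valid (F := F) hL ⟨0, hf⟩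
  set σ : ℝ := ((f ^ 2 + (edgeP F).card : ℕ) : ℝ) with hσ
  have h4 : n * cnt (fun w => ∃ z ∈ ((Finset.univ ×ˢ N) ×ˢ newSlots F N).filter
          (fun z => Sum.inl z.1 ≠ z.2), (∀ j, w j ∈ P j) ∧ IsHom F R w ∧
            φ (slotEdge u g w (.inl z.1)) = φ (slotEdge u g w z.2)) ≤ σ ^ 2 * (L * n ^ f) := by
    refine (mul_le_mul_of_nonneg_left (cnt_exists_le _ _) hn0).trans ?_
    rw [Finset.mul_sum]
    refine (Finset.sum_le_card_nsmul _ _ (L * n ^ f) fun z hz => ?_).trans ?_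
    · simp only [Finset.mem_filter, Finset.mem_product, Finset.mem_univ, true_and] at hz
      exact cnt_clash hg hL0 hL z.1 z.2 hz.1.1 hz.1.2 hz.2
    · rw [nsmul_eq_mul]
      refine mul_le_mul_of_nonneg_right ?_ (by positivity)
      have h5 : (((Finset.univ ×ˢ N) ×ˢ newSlots F N).filter
          (fun z => Sum.inl z.1 ≠ z.2)).card ≤ (f ^ 2 + (edgeP F).card) ^ 2 := by
        refine (Finset.card_filter_le _ _).trans ?_
        rw [Finset.card_product, sq]
        refine Nat.mul_le_mul ?_ (card_newSlots_le F N)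
        rw [Finset.card_product, Finset.card_univ, Fintype.card_fin, sq]
        have := Finset.card_le_univ N
        rw [Fintype.card_fin] at this
        exact (Nat.mul_le_mul_left f this).trans (Nat.le_add_right _ _)
      rw [hσ]
      exact_mod_cast h5
  have h5 := mul_le_mul_of_nonneg_right (h1.trans h2) hn0
  refine h5.trans ?_
  have hf' : (1 : ℝ) ≤ f := by exact_mod_cast hf
  have h6 : (f ^ 2 + ((edgeP F).card : ℝ) ^ 2 * L) ≤ σ ^ 2 * (1 + L) := by
    have h7 : (f : ℝ) ^ 2 ≤ σ ^ 2 := by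
      rw [hσ]
      push_cast
      have : (0 : ℝ) ≤ (edgeP F).card := Nat.cast_nonneg _
      have h8 : (f : ℝ) ≤ f ^ 2 := by nlinarith
      exact pow_le_pow_left₀ (by positivity) (by linarith) 2
    have h8 : ((edgeP F).card : ℝ) ^ 2 ≤ σ ^ 2 := by
      rw [hσ]
      push_cast
      exact pow_le_pow_left₀ (by positivity) (by nlinarith) 2
    have h9 := mul_le_mul_of_nonneg_right h8 hL0
    linarith
  have h7 := mul_le_mul_of_nonneg_right h6 (pow_nonneg hn0 f)
  have h8 : (0 : ℝ) ≤ σ ^ 2 * n ^ f := by positivity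
  linarith

end Absorber

section Absorb

variable {V K : Type} [Fintype V] [DecidableEq V] [Fintype K] [DecidableEq K] {f t : ℕ}
variable {F : SimpleGraph (Fin f)} {N : Finset (Fin f)} {R : SimpleGraph V} {φ : Sym2 V → K}
variable {I : Type} [Fintype I] [DecidableEq I] {sl : I → Fin t}
variable {u : I → Fin f → V} {P : I → Fin f → Finset V} {g : I → Fin f → V → V}

theorem sum_cnt_edge [Nonempty V] (hf : 1 ≤ f) {γ : ℝ}
    (hg : ∀ D, Freeable N R φ (u D) (P D) (g D))
    (h2 : ∀ j y, ((Finset.univ.filter fun D => u D j = y).card : ℝ) ≤ γ * Fintype.card V)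
    (h4 : (Fintype.card I : ℝ) ≤ f * γ * (Fintype.card V : ℝ) ^ 2)
    {y : (Fin f × Fin f) ⊕ (Fin f × Fin f)} (hy : y ∈ newSlots F N) (e : Sym2 V) :
    ∑ D, cnt (fun w => Absorbs F N R φ (u D) (P D) (g D) w ∧ slotEdge (u D) (g D) w y = e) ≤
      2 * f * γ * (Fintype.card V : ℝ) ^ f := by
  have hn : (0 : ℝ) < Fintype.card V := by exact_mod_cast Fintype.card_pos
  set n : ℝ := (Fintype.card V : ℝ) with hnd
  have hf' : (1 : ℝ) ≤ f := by exact_mod_cast hf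
  rcases y with ⟨j, k⟩ | p
  · have hγ : 0 ≤ γ := by
      have := (Nat.cast_nonneg _).trans (h2 j (Classical.arbitrary V))
      exact nonneg_of_mul_nonneg_left this hn
    have hcard : ((Finset.univ.filter fun D => u D j ∈ e).card : ℝ) ≤ 2 * (γ * n) := by
      induction e with
      | _ a b =>
      have : (Finset.univ.filter fun D => u D j ∈ s(a, b)) =
          (Finset.univ.filter fun D => u D j = a) ∪ Finset.univ.filter fun D => u D j = b := by
        ext D
        simp
      rw [this]
      have h5 := h2 j a
      have h6 := h2 j b
      have h7 : (((Finset.univ.filter fun D => u D j = a) ∪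
          Finset.univ.filter fun D => u D j = b).card : ℝ) ≤ _ :=
        Nat.cast_le.2 (Finset.card_union_le _ _)
      push_cast at h7
      linarith
    refine le_of_mul_le_mul_left ?_ hn
    rw [Finset.mul_sum]
    refine (Finset.sum_le_sum fun D _ =>
      cnt_absorbs_inl_edge (hg D) (inl_mem_newSlots.1 hy) e).trans ?_
    rw [← Finset.sum_filter, Finset.sum_const, nsmul_eq_mul]
    refine (mul_le_mul_of_nonneg_right hcard (by positivity)).trans ?_
    have : (0 : ℝ) ≤ γ * n * n ^ f := by positivity
    nlinarith
  · refine le_of_mul_le_mul_left ?_ (pow_pos hn 2)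
    rw [Finset.mul_sum]
    refine (Finset.sum_le_sum fun D _ =>
      cnt_absorbs_inr_edge (inr_mem_newSlots.1 hy) e).trans ?_
    rw [Finset.sum_const, nsmul_eq_mul, Finset.card_univ]
    refine (mul_le_mul_of_nonneg_right h4 (by positivity)).trans_eq ?_
    ring

theorem sum_cnt_colour [Nonempty V] {γ B : ℝ} (hγ : 0 ≤ γ) (hB0 : 0 ≤ B)
    (hg : ∀ D, Freeable N R φ (u D) (P D) (g D))
    (h1 : ∀ i, ((Finset.univ.filter fun D => sl D = i).card : ℝ) ≤ γ * Fintype.card V)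
    (h3 : ∀ i j c, ∑ D ∈ Finset.univ.filter (fun D => sl D = i), (cdeg R φ (u D j) c : ℝ) ≤
      γ * Fintype.card V)
    (hB : ∀ c, ∑ v, (cdeg R φ v c : ℝ) ≤ B * Fintype.card V)
    {y : (Fin f × Fin f) ⊕ (Fin f × Fin f)} (hy : y ∈ newSlots F N) (c : K) (i : Fin t) :
    ∑ D ∈ Finset.univ.filter (fun D => sl D = i),
      cnt (fun w => Absorbs F N R φ (u D) (P D) (g D) w ∧ φ (slotEdge (u D) (g D) w y) = c) ≤
      (1 + B) * γ * (Fintype.card V : ℝ) ^ f := by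
  have hn : (0 : ℝ) < Fintype.card V := by exact_mod_cast Fintype.card_pos
  set n : ℝ := (Fintype.card V : ℝ) with hnd
  rcases y with ⟨j, k⟩ | p
  · refine le_of_mul_le_mul_left ?_ hn
    rw [Finset.mul_sum]
    refine (Finset.sum_le_sum fun D _ =>
      cnt_absorbs_inl_colour (hg D) (inl_mem_newSlots.1 hy) c).trans ?_
    rw [← Finset.sum_mul]
    refine (mul_le_mul_of_nonneg_right (h3 i j c) (by positivity)).trans ?_
    have : (0 : ℝ) ≤ γ * n * n ^ f := by positivity
    nlinarith
  · refine le_of_mul_le_mul_left ?_ (pow_pos hn 2)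
    rw [Finset.mul_sum]
    refine (Finset.sum_le_sum fun D _ => (cnt_absorbs_inr_colour (inr_mem_newSlots.1 hy) c).trans
      (mul_le_mul_of_nonneg_right (hB c) (by positivity))).trans ?_
    rw [Finset.sum_const, nsmul_eq_mul]
    refine (mul_le_mul_of_nonneg_right (h1 i) (by positivity)).trans ?_
    have : (0 : ℝ) ≤ γ * n ^ 2 * n ^ f := by positivity
    nlinarith

theorem sum_cnt_vertex [Nonempty V] {γ : ℝ}
    (h1 : ∀ i, ((Finset.univ.filter fun D => sl D = i).card : ℝ) ≤ γ * Fintype.card V)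
    (j : Fin f) (v : V) (i : Fin t) :
    ∑ D ∈ Finset.univ.filter (fun D => sl D = i),
      cnt (fun w => Absorbs F N R φ (u D) (P D) (g D) w ∧ w j = v) ≤
      γ * (Fintype.card V : ℝ) ^ f := by
  have hn : (0 : ℝ) < Fintype.card V := by exact_mod_cast Fintype.card_pos
  refine le_of_mul_le_mul_left ?_ hn
  rw [Finset.mul_sum]
  refine (Finset.sum_le_sum fun D _ => cnt_absorbs_vertex j v).trans ?_
  rw [Finset.sum_const, nsmul_eq_mul]
  refine (mul_le_mul_of_nonneg_right (h1 i) (by positivity)).trans_eq ?_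
  ring

variable (F N R φ sl u P g) in
/-- Absorbers chosen for all demands, compatible within slices and edge-disjoint overall. -/
structure Absorbers (c : I → Fin f → V) : Prop where
  absorbs : ∀ D, Absorbs F N R φ (u D) (P D) (g D) (c D)
  edge : ∀ D D', D ≠ D' → ∀ x ∈ newSlots F N, ∀ y ∈ newSlots F N,
    slotEdge (u D) (g D) (c D) x ≠ slotEdge (u D') (g D') (c D') y
  colour : ∀ D D', D ≠ D' → sl D = sl D' → ∀ x ∈ newSlots F N, ∀ y ∈ newSlots F N,
    φ (slotEdge (u D) (g D) (c D) x) ≠ φ (slotEdge (u D') (g D') (c D') y)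
  vertex : ∀ D D', D ≠ D' → sl D = sl D' → ∀ j j', c D j ≠ c D' j'

variable (F N φ sl u g) in
/-- Two choices of absorbers are in conflict. -/
def Conflict (D : I) (w : Fin f → V) (D' : I) (w' : Fin f → V) : Prop :=
  (∃ z ∈ newSlots F N ×ˢ newSlots F N,
    slotEdge (u D') (g D') w' z.2 = slotEdge (u D) (g D) w z.1) ∨
  (sl D' = sl D ∧ ∃ z ∈ newSlots F N ×ˢ newSlots F N,
    φ (slotEdge (u D') (g D') w' z.2) = φ (slotEdge (u D) (g D) w z.1)) ∨
  (sl D' = sl D ∧ ∃ z ∈ (Finset.univ : Finset (Fin f × Fin f)), w' z.2 = w z.1)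

theorem Conflict.symm {D D' : I} {w w' : Fin f → V} (h : Conflict F N φ sl u g D w D' w') :
    Conflict F N φ sl u g D' w' D w := by
  rcases h with ⟨z, hz, h⟩ | ⟨h0, z, hz, h⟩ | ⟨h0, z, hz, h⟩
  · exact Or.inl ⟨z.swap, by simpa [and_comm] using hz, h.symm⟩
  · exact Or.inr (Or.inl ⟨h0.symm, z.swap, by simpa [and_comm] using hz, h.symm⟩)
  · exact Or.inr (Or.inr ⟨h0.symm, z.swap, Finset.mem_univ _, h.symm⟩)

theorem sum_conflict [Nonempty V] (hf : 1 ≤ f) {γ B : ℝ} (hγ : 0 ≤ γ) (hB0 : 0 ≤ B)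
    (hg : ∀ D, Freeable N R φ (u D) (P D) (g D))
    (h1 : ∀ i, ((Finset.univ.filter fun D => sl D = i).card : ℝ) ≤ γ * Fintype.card V)
    (h2 : ∀ j y, ((Finset.univ.filter fun D => u D j = y).card : ℝ) ≤ γ * Fintype.card V)
    (h3 : ∀ i j c, ∑ D ∈ Finset.univ.filter (fun D => sl D = i), (cdeg R φ (u D j) c : ℝ) ≤
      γ * Fintype.card V)
    (h4 : (Fintype.card I : ℝ) ≤ f * γ * (Fintype.card V : ℝ) ^ 2)
    (hB : ∀ c, ∑ v, (cdeg R φ v c : ℝ) ≤ B * Fintype.card V) (D : I) (w : Fin f → V) :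
    ∑ D', cnt (fun w' => Absorbs F N R φ (u D') (P D') (g D') w' ∧
      Conflict F N φ sl u g D w D' w') ≤
      (((f ^ 2 + (edgeP F).card : ℕ) : ℝ) ^ 2 * (2 * f + (1 + B)) + f ^ 2) * γ *
        (Fintype.card V : ℝ) ^ f := by
  classical
  set n : ℝ := (Fintype.card V : ℝ) with hnd
  have hn0 : 0 ≤ n := Nat.cast_nonneg _
  set S := newSlots F N ×ˢ newSlots F N with hS
  have hScard : (S.card : ℝ) ≤ ((f ^ 2 + (edgeP F).card : ℕ) : ℝ) ^ 2 := by
    have := Nat.mul_le_mul (card_newSlots_le F N) (card_newSlots_le F N)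
    rw [hS, Finset.card_product]
    rw [← sq (f ^ 2 + (edgeP F).card)] at this
    exact_mod_cast this
  let A := fun D' => Absorbs F N R φ (u D') (P D') (g D')
  have hsplit : ∀ D', cnt (fun w' => A D' w' ∧ Conflict F N φ sl u g D w D' w') ≤
      (∑ z ∈ S, cnt (fun w' => A D' w' ∧
        slotEdge (u D') (g D') w' z.2 = slotEdge (u D) (g D) w z.1)) +
      ((if sl D' = sl D then ∑ z ∈ S, cnt (fun w' => A D' w' ∧
        φ (slotEdge (u D') (g D') w' z.2) = φ (slotEdge (u D) (g D) w z.1)) else 0) +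
      (if sl D' = sl D then ∑ z ∈ (Finset.univ : Finset (Fin f × Fin f)),
        cnt (fun w' => A D' w' ∧ w' z.2 = w z.1) else 0)) := by
    intro D'
    have e1 : cnt (fun w' => A D' w' ∧ Conflict F N φ sl u g D w D' w') ≤
        cnt (fun w' => ∃ z ∈ S, A D' w' ∧
          slotEdge (u D') (g D') w' z.2 = slotEdge (u D) (g D) w z.1) +
        (cnt (fun w' => sl D' = sl D ∧ ∃ z ∈ S, A D' w' ∧
          φ (slotEdge (u D') (g D') w' z.2) = φ (slotEdge (u D) (g D) w z.1)) +
        cnt (fun w' => sl D' = sl D ∧ ∃ z ∈ (Finset.univ : Finset (Fin f × Fin f)),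
          A D' w' ∧ w' z.2 = w z.1)) := by
      refine (cnt_le_add_of_imp fun w' h => ?_).trans (add_le_add le_rfl (cnt_or_le _ _))
      obtain ⟨ha, ⟨z, hz, h⟩ | ⟨h0, z, hz, h⟩ | ⟨h0, z, hz, h⟩⟩ := h
      · exact Or.inl ⟨z, hz, ha, h⟩
      · exact Or.inr (Or.inl ⟨h0, z, hz, ha, h⟩)
      · exact Or.inr (Or.inr ⟨h0, z, hz, ha, h⟩)
    refine e1.trans (add_le_add (cnt_exists_le _ _) (add_le_add ?_ ?_))
    · split_ifs with h0
      · simp only [h0, true_and]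
        exact cnt_exists_le _ _
      · exact (cnt_eq_zero fun w' h => h0 h.1).le
    · split_ifs with h0
      · simp only [h0, true_and]
        exact cnt_exists_le _ _
      · exact (cnt_eq_zero fun w' h => h0 h.1).le
  refine (Finset.sum_le_sum fun D' _ => hsplit D').trans ?_
  rw [Finset.sum_add_distrib, Finset.sum_add_distrib, ← Finset.sum_filter, ← Finset.sum_filter]
  have b1 : ∑ z ∈ S, ∑ D', cnt (fun w' => A D' w' ∧
      slotEdge (u D') (g D') w' z.2 = slotEdge (u D) (g D) w z.1) ≤
      S.card * (2 * f * γ * n ^ f) := by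
    rw [← nsmul_eq_mul]
    exact Finset.sum_le_card_nsmul _ _ _ fun z hz =>
      sum_cnt_edge hf hg h2 h4 (Finset.mem_product.1 hz).2 _
  have b2 : ∑ z ∈ S, ∑ D' ∈ Finset.univ.filter (fun D' => sl D' = sl D), cnt (fun w' => A D' w' ∧
      φ (slotEdge (u D') (g D') w' z.2) = φ (slotEdge (u D) (g D) w z.1)) ≤
      S.card * ((1 + B) * γ * n ^ f) := by
    rw [← nsmul_eq_mul]
    exact Finset.sum_le_card_nsmul _ _ _ fun z hz =>
      sum_cnt_colour hγ hB0 hg h1 h3 hB (Finset.mem_product.1 hz).2 _ _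
  have b3 : ∑ z ∈ (Finset.univ : Finset (Fin f × Fin f)),
      ∑ D' ∈ Finset.univ.filter (fun D' => sl D' = sl D), cnt (fun w' => A D' w' ∧
        w' z.2 = w z.1) ≤ (f : ℝ) ^ 2 * (γ * n ^ f) := by
    have : ((f : ℝ) ^ 2) = (((Finset.univ : Finset (Fin f × Fin f)).card : ℕ) : ℝ) := by
      rw [Finset.card_univ, Fintype.card_prod, Fintype.card_fin, sq]
      push_cast
      rfl
    rw [this, ← nsmul_eq_mul]
    exact Finset.sum_le_card_nsmul _ _ _ fun z hz => sum_cnt_vertex h1 _ _ _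
  rw [Finset.sum_comm] at b1 b2 b3
  refine (add_le_add b1 (add_le_add b2 b3)).trans ?_
  have c1 := mul_le_mul_of_nonneg_right hScard (show (0 : ℝ) ≤ 2 * f * γ * n ^ f by positivity)
  have c2 := mul_le_mul_of_nonneg_right hScard (show (0 : ℝ) ≤ (1 + B) * γ * n ^ f by positivity)
  linarith

theorem exists_absorbers [Nonempty V] (hf : 1 ≤ f) {γ B κ : ℝ} (hγ : 0 ≤ γ) (hB0 : 0 ≤ B)
    (hκ : 0 < κ)
    (hκγ : 4 * ((((f ^ 2 + (edgeP F).card : ℕ) : ℝ) ^ 2 * (2 * f + (1 + B)) + f ^ 2) * γ) ≤ κ)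
    (hg : ∀ D, Freeable N R φ (u D) (P D) (g D))
    (h1 : ∀ i, ((Finset.univ.filter fun D => sl D = i).card : ℝ) ≤ γ * Fintype.card V)
    (h2 : ∀ j y, ((Finset.univ.filter fun D => u D j = y).card : ℝ) ≤ γ * Fintype.card V)
    (h3 : ∀ i j c, ∑ D ∈ Finset.univ.filter (fun D => sl D = i), (cdeg R φ (u D j) c : ℝ) ≤
      γ * Fintype.card V)
    (h4 : (Fintype.card I : ℝ) ≤ f * γ * (Fintype.card V : ℝ) ^ 2)
    (hB : ∀ c, ∑ v, (cdeg R φ v c : ℝ) ≤ B * Fintype.card V)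
    (hcnt : ∀ D, κ * (Fintype.card V : ℝ) ^ f ≤ cnt (Absorbs F N R φ (u D) (P D) (g D))) :
    ∃ c : I → Fin f → V, Absorbers F N R φ sl u P g c := by
  classical
  have hn : (0 : ℝ) < Fintype.card V := by exact_mod_cast Fintype.card_pos
  obtain ⟨c, hc, hconf⟩ := exists_conflict_free
    (fun D => Finset.univ.filter fun w => Absorbs F N R φ (u D) (P D) (g D) w)
    (Conflict F N φ sl u g) (fun D w D' w' h => h.symm) (κ * (Fintype.card V : ℝ) ^ f)
    ((((f ^ 2 + (edgeP F).card : ℕ) : ℝ) ^ 2 * (2 * f + (1 + B)) + f ^ 2) * γ *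
      (Fintype.card V : ℝ) ^ f) (by positivity)
    (by
      rw [← mul_assoc]
      exact mul_le_mul_of_nonneg_right hκγ (by positivity))
    (fun D => by
      have := hcnt D
      unfold cnt at this
      convert this)
    (fun D w _ => by
      refine le_trans ?_ (sum_conflict hf hγ hB0 hg h1 h2 h3 h4 hB D w)
      refine le_trans (le_of_eq ?_) (Finset.sum_le_sum_of_subset_of_nonneg (Finset.subset_univ
        (Finset.univ.erase D)) fun _ _ _ => cnt_nonneg _)
      refine Finset.sum_congr rfl fun D' _ => ?_
      rw [cnt, Finset.filter_filter]
      congr!)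
  refine ⟨c, ⟨fun D => ?_, fun D D' hD x hx y hy h => ?_, fun D D' hD hs x hx y hy h => ?_,
    fun D D' hD hs j j' h => ?_⟩⟩
  · have := hc D
    simpa only [Finset.mem_filter, Finset.mem_univ, true_and] using this
  · exact hconf D D' hD (Or.inl ⟨(x, y), Finset.mem_product.2 ⟨hx, hy⟩, h.symm⟩)
  · exact hconf D D' hD (Or.inr (Or.inl ⟨hs.symm, (x, y), Finset.mem_product.2 ⟨hx, hy⟩, h.symm⟩))
  · exact hconf D D' hD (Or.inr (Or.inr ⟨hs.symm, (j, j'), Finset.mem_univ _, h.symm⟩))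

end Absorb

section Complete

variable {V K : Type} [Fintype V] [DecidableEq V] [Fintype K] [DecidableEq K] {f t : ℕ}
variable {F : SimpleGraph (Fin f)} {Γ R G : SimpleGraph V} {φ : Sym2 V → K}
variable {𝓜 : Fin t → Finset (Fin f → V)}

theorem Slices.eq_of_vertex (h : Slices F Γ φ 𝓜) {i : Fin t} {ψ ψ' : Fin f → V} (hψ : ψ ∈ 𝓜 i)
    (hψ' : ψ' ∈ 𝓜 i) {a b : Fin f} (hab : ψ a = ψ' b) : ψ = ψ' := by
  by_contra hne
  exact h.disj i ψ hψ ψ' hψ' hne a b hab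

variable (𝓜) in
open Classical in
/-- The map of the family `𝓜 i` sending `j` to `x`. -/
noncomputable def rooted (j : Fin f) (i : Fin t) (x : V) : Fin f → V :=
  if h : ∃ ψ ∈ 𝓜 i, ψ j = x then h.choose else fun _ => x

theorem Slices.rooted_eq (h : Slices F Γ φ 𝓜) {j : Fin f} {i : Fin t} {ψ : Fin f → V}
    (hψ : ψ ∈ 𝓜 i) : rooted 𝓜 j i (ψ j) = ψ := by
  have h1 : ∃ ψ' ∈ 𝓜 i, ψ' j = ψ j := ⟨ψ, hψ, rfl⟩
  rw [rooted, dif_pos h1]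
  exact h.eq_of_vertex h1.choose_spec.1 hψ h1.choose_spec.2

variable (F R φ 𝓜) in
open Classical in
/-- The vertices which can be freed for the uncovered vertex `u`. -/
noncomputable def freeable (j : Fin f) (i : Fin t) (u : V) : Finset V :=
  ((𝓜 i).filter fun ψ => Switch F R φ j u ψ).image fun ψ => ψ j

theorem mem_freeable {j : Fin f} {i : Fin t} {u x : V} : x ∈ freeable F R φ 𝓜 j i u ↔
    ∃ ψ ∈ 𝓜 i, Switch F R φ j u ψ ∧ ψ j = x := by
  simp [freeable, and_assoc]

theorem Slices.card_freeable (h : Slices F Γ φ 𝓜) (j : Fin f) (i : Fin t) (u : V) :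
    (freeable F R φ 𝓜 j i u).card =
      ({ψ | ψ ∈ 𝓜 i ∧ Switch F R φ j u ψ} : Set (Fin f → V)).ncard := by
  classical
  rw [freeable, Finset.card_image_of_injOn, ← Set.ncard_coe_finset]
  · congr 1
    ext ψ
    simp
  · intro ψ hψ ψ' hψ' hj
    simp only [Finset.coe_filter, Set.mem_ofPred_eq] at hψ hψ'
    exact h.eq_of_vertex hψ.1 hψ'.1 hj

theorem Slices.freeable (h : Slices F Γ φ 𝓜) (j : Fin f) (i : Fin t) (u : Fin f → V) :
    Freeable (nbrs F j) R φ u (fun k => freeable F R φ 𝓜 j i (u k))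
      (fun k x => rooted 𝓜 j i x k) := by
  refine ⟨fun l x hx k hk => ?_, fun l x hx k hk k' hk' hc => ?_, fun l k hk x hx y hy hxy => ?_⟩
  · obtain ⟨ψ, hψ, hs, rfl⟩ := mem_freeable.1 hx
    simp only [h.rooted_eq hψ]
    exact hs.adj k hk
  · obtain ⟨ψ, hψ, hs, rfl⟩ := mem_freeable.1 hx
    simp only [h.rooted_eq hψ] at hc
    exact hs.colour k hk k' hk' hc
  · obtain ⟨ψ, hψ, -, rfl⟩ := mem_freeable.1 hx
    obtain ⟨ψ', hψ', -, rfl⟩ := mem_freeable.1 hy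
    simp only [h.rooted_eq hψ, h.rooted_eq hψ'] at hxy
    rw [h.eq_of_vertex hψ hψ' hxy]

variable {I : Type} [Fintype I] [DecidableEq I] {sl : I → Fin t} {u c : I → Fin f → V} {w : Fin f}

variable (𝓜 sl u c w) in
/-- The copies of the completed factor. -/
inductive Piece (i : Fin t) : (Fin f → V) → Prop
  | keep (ψ : Fin f → V) (hψ : ψ ∈ 𝓜 i) (hu : ∀ D j, sl D = i → c D j ≠ ψ w) : Piece i ψ
  | swap (ψ : Fin f → V) (hψ : ψ ∈ 𝓜 i) (D : I) (j : Fin f) (hD : sl D = i) (hc : c D j = ψ w) :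
      Piece i (Function.update ψ w (u D j))
  | new (D : I) (hD : sl D = i) : Piece i (c D)

variable (𝓜 sl u) in
/-- The demands cover the uncovered vertices exactly once. -/
structure Demands : Prop where
  mem : ∀ D j, u D j ∈ unc (𝓜 (sl D))
  inj : ∀ D D' j j', sl D = sl D' → u D j = u D' j' → D = D' ∧ j = j'
  surj : ∀ i, ∀ v ∈ unc (𝓜 i), ∃ D j, sl D = i ∧ u D j = v

variable (F R φ 𝓜 sl u c w) in
/-- Absorbers for all demands, with respect to the switches available in `𝓜`. -/
abbrev SliceAbsorbers : Prop :=
  Absorbers F (nbrs F w) R φ sl u (fun D k => RainbowFactor.freeable F R φ 𝓜 w (sl D) (u D k))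
    (fun D k x => rooted 𝓜 w (sl D) x k) c

theorem SliceAbsorbers.exists_root (hA : SliceAbsorbers F R φ 𝓜 sl u c w) (D : I) (j : Fin f) :
    ∃ ψ ∈ 𝓜 (sl D), Switch F R φ w (u D j) ψ ∧ ψ w = c D j :=
  mem_freeable.1 ((hA.absorbs D).mem j)

theorem Piece.eq_of_vertex (h : Slices F Γ φ 𝓜) (hA : SliceAbsorbers F R φ 𝓜 sl u c w)
    (hd : Demands 𝓜 sl u) {i : Fin t} {ψ ψ' : Fin f → V}
    (hψ : Piece 𝓜 sl u c w i ψ) (hψ' : Piece 𝓜 sl u c w i ψ') {a b : Fin f} (hab : ψ a = ψ' b) :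
    ψ = ψ' := by
  have hunc : ∀ D j, sl D = i → ∀ ψ ∈ 𝓜 i, ∀ a, ψ a ≠ u D j := fun D j hD => by
    have := mem_unc.1 (hd.mem D j)
    rwa [hD] at this
  have keep_swap : ∀ ψ ∈ 𝓜 i, (∀ D j, sl D = i → c D j ≠ ψ w) → ∀ ψ' ∈ 𝓜 i, ∀ D j, sl D = i →
      c D j = ψ' w → ∀ a b, ψ a ≠ Function.update ψ' w (u D j) b := by
    intro ψ hψ hu ψ' hψ' D j hD hc a b hab
    by_cases hb : b = w
    · rw [hb, Function.update_self] at hab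
      exact hunc D j hD ψ hψ a hab
    · rw [Function.update_of_ne hb] at hab
      have := h.eq_of_vertex hψ hψ' hab
      exact hu D j hD (hc.trans (by rw [this]))
  have keep_new : ∀ ψ ∈ 𝓜 i, (∀ D j, sl D = i → c D j ≠ ψ w) → ∀ D, sl D = i →
      ∀ a b, ψ a ≠ c D b := by
    intro ψ hψ hu D hD a b hab
    obtain ⟨ψ', hψ', -, h1⟩ := hA.exists_root D b
    rw [hD] at hψ'
    have := h.eq_of_vertex hψ hψ' (hab.trans h1.symm)
    exact hu D b hD (h1.symm.trans (by rw [this]))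
  have swap_new : ∀ ψ ∈ 𝓜 i, ∀ D j, sl D = i → ∀ D', sl D' = i →
      ∀ a b, Function.update ψ w (u D j) a ≠ c D' b := by
    intro ψ hψ D j hD D' hD' a b hab
    obtain ⟨ψ', hψ', -, h1⟩ := hA.exists_root D' b
    rw [hD'] at hψ'
    by_cases ha : a = w
    · rw [ha, Function.update_self] at hab
      exact hunc D j hD ψ' hψ' w (h1.trans hab.symm)
    · rw [Function.update_of_ne ha] at hab
      have h2 := h.eq_of_vertex hψ hψ' (hab.trans h1.symm)
      rw [h2] at hab
      exact ha ((h.valid i ψ' hψ').inj (hab.trans h1.symm))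
  cases hψ with
  | keep _ hψ hu =>
    cases hψ' with
    | keep _ hψ' hu' => exact h.eq_of_vertex hψ hψ' hab
    | swap ψ' hψ' D j hD hc => exact (keep_swap _ hψ hu _ hψ' D j hD hc a b hab).elim
    | new D hD => exact (keep_new _ hψ hu D hD a b hab).elim
  | swap ψ hψ D j hD hc =>
    cases hψ' with
    | keep _ hψ' hu' => exact (keep_swap _ hψ' hu' _ hψ D j hD hc b a hab.symm).elim
    | new D' hD' => exact (swap_new _ hψ D j hD D' hD' a b hab).elim
    | swap ψ' hψ' D' j' hD' hc' =>
      by_cases ha : a = w <;> by_cases hb : b = w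
      · rw [ha, hb, Function.update_self, Function.update_self] at hab
        obtain ⟨rfl, rfl⟩ := hd.inj D D' j j' (hD.trans hD'.symm) hab
        rw [h.eq_of_vertex hψ hψ' (hc.symm.trans hc')]
      · rw [ha, Function.update_self, Function.update_of_ne hb] at hab
        exact (hunc D j hD ψ' hψ' b hab.symm).elim
      · rw [hb, Function.update_self, Function.update_of_ne ha] at hab
        exact (hunc D' j' hD' ψ hψ a hab).elim
      · rw [Function.update_of_ne ha, Function.update_of_ne hb] at hab
        obtain rfl := h.eq_of_vertex hψ hψ' hab
        have hcc := hc.trans hc'.symm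
        by_cases hDD : D = D'
        · subst hDD
          rw [(hA.absorbs D).inj hcc]
        · exact (hA.vertex D D' hDD (hD.trans hD'.symm) j j' hcc).elim
  | new D hD =>
    cases hψ' with
    | keep _ hψ' hu' => exact (keep_new _ hψ' hu' D hD b a hab.symm).elim
    | swap ψ' hψ' D' j hD' hc => exact (swap_new _ hψ' D' j hD' D hD b a hab.symm).elim
    | new D' hD' =>
      by_cases hDD : D = D'
      · rw [hDD]
      · exact (hA.vertex D D' hDD (hD.trans hD'.symm) a b hab).elim

variable (F 𝓜 sl u c w) in
/-- The edges available to the `i`-th factor: those of `𝓜 i` and those of the absorbers. -/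
def Available (i : Fin t) (e : Sym2 V) : Prop :=
  (∃ ψ ∈ 𝓜 i, ∃ p ∈ edgeP F, e = im ψ p) ∨
  (∃ D, sl D = i ∧ ∃ x ∈ newSlots F (nbrs F w),
    e = slotEdge (u D) (fun k x => rooted 𝓜 w (sl D) x k) (c D) x)

theorem im_mem_edgeSet {ψ : Fin f → V} (h : IsHom F G ψ) {p : Fin f × Fin f} (hp : p ∈ edgeP F) :
    im ψ p ∈ G.edgeSet := h _ _ ((mem_edgeP F).1 hp).2

theorem slotEdge_mem_edgeSet (h : Slices F Γ φ 𝓜) (hA : SliceAbsorbers F R φ 𝓜 sl u c w) (D : I)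
    {x : (Fin f × Fin f) ⊕ (Fin f × Fin f)} (hx : x ∈ newSlots F (nbrs F w)) :
    slotEdge (u D) (fun k x => rooted 𝓜 w (sl D) x k) (c D) x ∈ R.edgeSet := by
  rcases x with ⟨j, k⟩ | p
  · exact (h.freeable w (sl D) (u D)).adj j _ ((hA.absorbs D).mem j) k (inl_mem_newSlots.1 hx)
  · exact im_mem_edgeSet (hA.absorbs D).hom (inr_mem_newSlots.1 hx)

theorem Available.eq_of_colour (h : Slices F Γ φ 𝓜) (hA : SliceAbsorbers F R φ 𝓜 sl u c w)
    {C : Set K} (hΓ : ∀ e ∈ Γ.edgeSet, φ e ∉ C) (hR : ∀ e ∈ R.edgeSet, φ e ∈ C) {i : Fin t}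
    {e e' : Sym2 V} (he : Available F 𝓜 sl u c w i e) (he' : Available F 𝓜 sl u c w i e')
    (hc : φ e = φ e') : e = e' := by
  rcases he with ⟨ψ, hψ, p, hp, rfl⟩ | ⟨D, hD, x, hx, rfl⟩ <;>
    rcases he' with ⟨ψ', hψ', p', hp', rfl⟩ | ⟨D', hD', x', hx', rfl⟩
  · by_cases hne : ψ = ψ'
    · subst hne
      rw [(h.valid i ψ hψ).rainbow p hp p' hp' hc]
    · exact (h.colour i ψ hψ ψ' hψ' hne p hp p' hp' hc).elim
  · refine (hΓ _ (im_mem_edgeSet (h.valid i ψ hψ).hom hp) ?_).elim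
    rw [hc]
    exact hR _ (slotEdge_mem_edgeSet h hA D' hx')
  · refine (hΓ _ (im_mem_edgeSet (h.valid i ψ' hψ').hom hp') ?_).elim
    rw [← hc]
    exact hR _ (slotEdge_mem_edgeSet h hA D hx)
  · by_cases hDD : D = D'
    · subst hDD
      rw [(hA.absorbs D).rainbow x hx x' hx' hc]
    · exact (hA.colour D D' hDD (hD.trans hD'.symm) x hx x' hx' hc).elim

theorem Available.ne (h : Slices F Γ φ 𝓜) (hA : SliceAbsorbers F R φ 𝓜 sl u c w)
    {C : Set K} (hΓ : ∀ e ∈ Γ.edgeSet, φ e ∉ C) (hR : ∀ e ∈ R.edgeSet, φ e ∈ C) {i i' : Fin t}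
    (hi : i ≠ i') {e e' : Sym2 V} (he : Available F 𝓜 sl u c w i e)
    (he' : Available F 𝓜 sl u c w i' e') : e ≠ e' := by
  intro hee
  rcases he with ⟨ψ, hψ, p, hp, rfl⟩ | ⟨D, hD, x, hx, rfl⟩ <;>
    rcases he' with ⟨ψ', hψ', p', hp', rfl⟩ | ⟨D', hD', x', hx', rfl⟩
  · exact h.edge i i' hi ψ hψ ψ' hψ' p hp p' hp' hee
  · refine hΓ _ (im_mem_edgeSet (h.valid i ψ hψ).hom hp) ?_
    rw [hee]
    exact hR _ (slotEdge_mem_edgeSet h hA D' hx')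
  · refine hΓ _ (im_mem_edgeSet (h.valid i' ψ' hψ').hom hp') ?_
    rw [← hee]
    exact hR _ (slotEdge_mem_edgeSet h hA D hx)
  · refine hA.edge D D' ?_ x hx x' hx' hee
    rintro rfl
    exact hi (hD.symm.trans hD')

theorem Piece.switch (h : Slices F Γ φ 𝓜) (hA : SliceAbsorbers F R φ 𝓜 sl u c w) {i : Fin t}
    {ψ : Fin f → V} (hψ : ψ ∈ 𝓜 i) {D : I} {j : Fin f} (hD : sl D = i) (hc : c D j = ψ w) :
    Switch F R φ w (u D j) ψ := by
  obtain ⟨ψ', hψ', hs, h1⟩ := hA.exists_root D j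
  rw [hD] at hψ'
  rwa [h.eq_of_vertex hψ hψ' (hc.symm.trans h1.symm)]

theorem Piece.injective (h : Slices F Γ φ 𝓜) (hA : SliceAbsorbers F R φ 𝓜 sl u c w)
    (hd : Demands 𝓜 sl u) {i : Fin t} {ψ : Fin f → V} (hψ : Piece 𝓜 sl u c w i ψ) :
    Function.Injective ψ := by
  cases hψ with
  | keep _ hψ hu => exact (h.valid i _ hψ).inj
  | new D hD => exact (hA.absorbs D).inj
  | swap ψ hψ D j hD hc =>
    have h1 := hd.mem D j
    rw [hD] at h1
    have h2 := mem_unc.1 h1 ψ hψ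
    intro a b hab
    by_cases ha : a = w <;> by_cases hb : b = w
    · rw [ha, hb]
    · rw [ha, Function.update_self, Function.update_of_ne hb] at hab
      exact (h2 b hab.symm).elim
    · rw [hb, Function.update_self, Function.update_of_ne ha] at hab
      exact (h2 a hab).elim
    · rw [Function.update_of_ne ha, Function.update_of_ne hb] at hab
      exact (h.valid i ψ hψ).inj hab

theorem Piece.isHom (h : Slices F Γ φ 𝓜) (hA : SliceAbsorbers F R φ 𝓜 sl u c w)
    (hΓG : Γ ≤ G) (hRG : R ≤ G) {i : Fin t} {ψ : Fin f → V} (hψ : Piece 𝓜 sl u c w i ψ) :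
    IsHom F G ψ := by
  intro a b hab
  cases hψ with
  | keep _ hψ hu => exact hΓG ((h.valid i _ hψ).hom a b hab)
  | new D hD => exact hRG ((hA.absorbs D).hom a b hab)
  | swap ψ hψ D j hD hc =>
    have hs := Piece.switch h hA hψ hD hc
    by_cases ha : a = w <;> by_cases hb : b = w
    · exact (hab.ne (ha.trans hb.symm)).elim
    · subst ha
      rw [Function.update_self, Function.update_of_ne hb]
      exact hRG (hs.adj b ((mem_nbrs F).2 hab))
    · subst hb
      rw [Function.update_self, Function.update_of_ne ha]
      exact (hRG (hs.adj a ((mem_nbrs F).2 hab.symm))).symm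
    · rw [Function.update_of_ne ha, Function.update_of_ne hb]
      exact hΓG ((h.valid i ψ hψ).hom a b hab)

theorem Piece.available (h : Slices F Γ φ 𝓜) {i : Fin t} {ψ : Fin f → V}
    (hψ : Piece 𝓜 sl u c w i ψ) {p : Fin f × Fin f} (hp : p ∈ edgeP F) :
    Available F 𝓜 sl u c w i (im ψ p) := by
  cases hψ with
  | keep _ hψ hu => exact Or.inl ⟨_, hψ, p, hp, rfl⟩
  | new D hD => exact Or.inr ⟨D, hD, .inr p, inr_mem_newSlots.2 hp, rfl⟩
  | swap ψ hψ D j hD hc =>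
    by_cases hw : w = p.1 ∨ w = p.2
    · obtain ⟨o, how, ho, him⟩ := im_eq_of_endpoint (V := V) hp hw
      have hadj : F.Adj w o := by
        have h1 := ((mem_edgeP F).1 hp).2
        rcases hw with hw | hw <;> rcases ho with ho | ho
        · exact (how (ho.trans hw.symm)).elim
        · rwa [hw, ho]
        · rw [hw, ho]
          exact h1.symm
        · exact (how (ho.trans hw.symm)).elim
      refine Or.inr ⟨D, hD, .inl (j, o), inl_mem_newSlots.2 ((mem_nbrs F).2 hadj), ?_⟩
      rw [him, Function.update_self, Function.update_of_ne how, slotEdge]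
      dsimp only
      rw [hc, hD, h.rooted_eq hψ]
    · push Not at hw
      exact Or.inl ⟨ψ, hψ, p, hp, im_update_of_ne hw.1 hw.2 ψ _⟩

theorem eq_of_im_eq {ψ : Fin f → V} (hinj : Function.Injective ψ) {p p' : Fin f × Fin f}
    (hp : p ∈ edgeP F) (hp' : p' ∈ edgeP F) (h : im ψ p = im ψ p') : p = p' := by
  have h1 := ((mem_edgeP F).1 hp).1
  have h2 := ((mem_edgeP F).1 hp').1
  rw [im, im, Sym2.eq_iff] at h
  rcases h with ⟨h3, h4⟩ | ⟨h3, h4⟩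
  · exact Prod.ext (hinj h3) (hinj h4)
  · rw [hinj h3, hinj h4] at h1
    exact (h1.asymm h2).elim

/-- Slices with absorbers for the uncovered vertices can be completed to perfect factors. -/
theorem exists_factors (h : Slices F Γ φ 𝓜) (hA : SliceAbsorbers F R φ 𝓜 sl u c w)
    (hd : Demands 𝓜 sl u) (hΓG : Γ ≤ G) (hRG : R ≤ G)
    {C : Set K} (hΓ : ∀ e ∈ Γ.edgeSet, φ e ∉ C) (hR : ∀ e ∈ R.edgeSet, φ e ∈ C) :
    ∃ 𝓝 : Fin t → Finset (Fin f → V), Slices F G φ 𝓝 ∧ ∀ i, unc (𝓝 i) = ∅ := by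
  classical
  have hmem : ∀ i ψ, ψ ∈ Finset.univ.filter (Piece 𝓜 sl u c w i) ↔ Piece 𝓜 sl u c w i ψ := by
    simp
  refine ⟨fun i => Finset.univ.filter (Piece 𝓜 sl u c w i), ⟨?_, ?_, ?_, ?_⟩, ?_⟩
  · intro i ψ hψ
    have hP := (hmem i ψ).1 hψ
    have hinj := hP.injective h hA hd
    exact ⟨hinj, hP.isHom h hA hΓG hRG, fun p hp p' hp' hc => eq_of_im_eq hinj hp hp'
      ((hP.available h hp).eq_of_colour h hA hΓ hR (hP.available h hp') hc)⟩
  · intro i ψ hψ ψ' hψ' hne a b hab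
    exact hne (((hmem i ψ).1 hψ).eq_of_vertex h hA hd ((hmem i ψ').1 hψ') hab)
  · intro i ψ hψ ψ' hψ' hne p hp p' hp' hc
    have hP := (hmem i ψ).1 hψ
    have hP' := (hmem i ψ').1 hψ'
    have he := (hP.available h hp).eq_of_colour h hA hΓ hR (hP'.available h hp') hc
    rw [im, im, Sym2.eq_iff] at he
    rcases he with ⟨h3, -⟩ | ⟨h3, -⟩
    · exact hne (hP.eq_of_vertex h hA hd hP' h3)
    · exact hne (hP.eq_of_vertex h hA hd hP' h3)
  · intro i i' hi ψ hψ ψ' hψ' p hp p' hp'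
    exact (((hmem i ψ).1 hψ).available h hp).ne h hA hΓ hR hi
      (((hmem i' ψ').1 hψ').available h hp')
  · intro i
    refine Finset.eq_empty_of_forall_notMem fun v hv => ?_
    have hv' : ∀ ψ, Piece 𝓜 sl u c w i ψ → ∀ a, ψ a ≠ v := fun ψ hψ =>
      mem_unc.1 hv ψ ((hmem i ψ).2 hψ)
    have hcov : ∀ ψ ∈ 𝓜 i, ∀ a, a ≠ w → ψ a ≠ v := by
      intro ψ hψ a ha hav
      by_cases hu : ∀ D j, sl D = i → c D j ≠ ψ w
      · exact hv' ψ (.keep ψ hψ hu) a hav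
      · push Not at hu
        obtain ⟨D, j, hD, hc⟩ := hu
        exact hv' _ (.swap ψ hψ D j hD hc) a (by rw [Function.update_of_ne ha]; exact hav)
    by_cases hvu : v ∈ unc (𝓜 i)
    · obtain ⟨D, j, rfl, rfl⟩ := hd.surj i v hvu
      obtain ⟨ψ, hψ, -, h1⟩ := hA.exists_root D j
      exact hv' _ (.swap ψ hψ D j rfl h1.symm) w (Function.update_self ..)
    · rw [mem_unc] at hvu
      push Not at hvu
      obtain ⟨ψ, hψ, a, ha⟩ := hvu
      by_cases haw : a = w
      · subst haw
        by_cases hu : ∀ D j, sl D = i → c D j ≠ ψ a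
        · exact hv' ψ (.keep ψ hψ hu) a ha
        · push Not at hu
          obtain ⟨D, j, hD, hc⟩ := hu
          exact hv' _ (.new D hD) j (hc.trans ha)
      · exact hcov ψ hψ a haw ha

/-- If the number of vertices is divisible by `f`, the uncovered vertices split into demands. -/
theorem Slices.exists_demands (h : Slices F Γ φ 𝓜) (hdiv : f ∣ Fintype.card V) :
    ∃ (I : Type) (_ : Fintype I) (_ : DecidableEq I) (sl : I → Fin t) (u : I → Fin f → V),
      Demands 𝓜 sl u := by
  classical
  have hcard : ∀ i, ∃ m, (unc (𝓜 i)).card = m * f := by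
    intro i
    have h1 : (unc (𝓜 i))ᶜ.card = (𝓜 i).card * f := by
      have h2 : (unc (𝓜 i))ᶜ = (𝓜 i).biUnion fun ψ => Finset.univ.image ψ := by
        ext v
        rw [Finset.mem_compl, mem_unc]
        push Not
        simp
      rw [h2, Finset.card_biUnion]
      · refine Finset.sum_const_nat fun ψ hψ => ?_
        rw [Finset.card_image_of_injective _ (h.valid i ψ hψ).inj, Finset.card_univ,
          Fintype.card_fin]
      · intro ψ hψ ψ' hψ' hne
        refine Finset.disjoint_left.2 fun v hv hv' => ?_
        simp only [Finset.mem_image, Finset.mem_univ, true_and] at hv hv'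
        obtain ⟨a, rfl⟩ := hv
        obtain ⟨b, hb⟩ := hv'
        exact h.disj i ψ hψ ψ' hψ' hne a b hb.symm
    have h3 := Finset.card_add_card_compl (unc (𝓜 i))
    rw [h1] at h3
    have h4 : f ∣ (unc (𝓜 i)).card :=
      (Nat.dvd_add_left (Dvd.intro_left _ rfl)).1 (h3 ▸ hdiv)
    obtain ⟨m, hm⟩ := h4
    exact ⟨m, hm.trans (mul_comm _ _)⟩
  choose m hm using hcard
  have he : ∀ i, Nonempty ((Fin (m i) × Fin f) ≃ unc (𝓜 i)) := fun i =>
    ⟨Fintype.equivOfCardEq (by simp [hm])⟩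
  let e := fun i => (he i).some
  refine ⟨Σ i, Fin (m i), inferInstance, inferInstance, Sigma.fst,
    fun D j => (e D.1 (D.2, j) : V), ⟨fun D j => (e D.1 (D.2, j)).2, ?_, fun i v hv => ?_⟩⟩
  · rintro ⟨i, x⟩ ⟨i', x'⟩ j j' hi huu
    obtain rfl : i = i' := hi
    have h1 := (e i).injective (Subtype.ext huu)
    simp only [Prod.mk.injEq] at h1
    exact ⟨by rw [h1.1], h1.2⟩
  · refine ⟨⟨i, ((e i).symm ⟨v, hv⟩).1⟩, ((e i).symm ⟨v, hv⟩).2, rfl, ?_⟩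
    simp

end Complete

section Perfect

theorem cdeg_mono {V K : Type} [Fintype V] [DecidableEq V] [Fintype K] [DecidableEq K]
    {R G : SimpleGraph V} (hRG : R ≤ G) (φ : Sym2 V → K) (v : V) (c : K) :
    cdeg R φ v c ≤ cdeg G φ v c := by
  classical
  unfold cdeg
  refine Finset.card_le_card fun u => ?_
  simp only [Finset.mem_filter, Finset.mem_univ, true_and]
  exact fun h => ⟨hRG h.1, h.2⟩

theorem card_nb_mono {V : Type} [Fintype V] [DecidableEq V] {R G : SimpleGraph V} (hRG : R ≤ G)
    (u v : V) : (nb R u ∩ nb R v).card ≤ (nb G u ∩ nb G v).card := by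
  refine Finset.card_le_card fun x => ?_
  simp only [Finset.mem_inter, mem_nb]
  exact fun h => ⟨hRG h.1, hRG h.2⟩

theorem QR.mono {V : Type} [Fintype V] [DecidableEq V] {G : SimpleGraph V} {η η' d : ℝ}
    (h : QR G η d) (hη : η ≤ η') : QR G η' d := by
  have hn : (0 : ℝ) ≤ Fintype.card V := Nat.cast_nonneg _
  have h1 := mul_le_mul_of_nonneg_right hη hn
  refine ⟨fun v => (h.1 v).trans h1, le_trans ?_ (h.2.trans ?_)⟩
  · refine Nat.cast_le.2 (Finset.card_le_card fun p => ?_)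
    simp only [Finset.mem_filter, Finset.mem_univ, true_and]
    exact fun hp => ⟨hp.1, fun h2 => hp.2 (h2.trans h1)⟩
  · exact mul_le_mul_of_nonneg_right (by linarith) (by positivity)

theorem one_add_pow_le {β : ℝ} (hβ0 : 0 ≤ β) (hβ1 : β ≤ 1) (m : ℕ) :
    (1 + β) ^ m ≤ 1 + (2 ^ m - 1) * β := by
  induction m with
  | zero => simp
  | succ m ih =>
    have h1 : (1 : ℝ) ≤ 2 ^ m := one_le_pow₀ (by norm_num)
    have h2 : 0 ≤ (2 ^ m - 1) * β := mul_nonneg (by linarith) hβ0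
    rw [pow_succ, pow_succ]
    nlinarith [mul_le_mul_of_nonneg_right ih (show 0 ≤ 1 + β by linarith)]

theorem density_bound {f h : ℕ} (hh : 1 ≤ h) {α β d d₀ ε : ℝ} (hα0 : 0 ≤ α) (hα : α ≤ 1)
    (hβ0 : 0 ≤ β) (hβ1 : β ≤ 1) (hβ : (2 ^ h + h) * β ≤ α / 2) (hd₀ : 0 ≤ d₀) (hd : d₀ ≤ d)
    (hε : 2 ^ h * ε ≤ β * d₀ ^ (h - 1)) :
    h * ((1 - α / 2) * f * d / h) * (((1 + β) * d) ^ (h - 1) + 2 ^ h * ε) ≤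
      f * ((1 - β) * d) ^ h := by
  obtain ⟨m, rfl⟩ : ∃ m, h = m + 1 := ⟨h - 1, by omega⟩
  rw [Nat.add_sub_cancel] at *
  have hh0 : ((m + 1 : ℕ) : ℝ) ≠ 0 := by positivity
  have hd0 : 0 ≤ d := hd₀.trans hd
  have h1 : ((m + 1 : ℕ) : ℝ) * ((1 - α / 2) * f * d / (m + 1 : ℕ)) = (1 - α / 2) * f * d := by
    field_simp
  rw [h1, mul_pow, mul_pow]
  have h2 := one_add_pow_le hβ0 hβ1 m
  have h3 := one_add_mul_le_pow (show (-2 : ℝ) ≤ -β by linarith) (m + 1)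
  have h4 : d₀ ^ m ≤ d ^ m := pow_le_pow_left₀ hd₀ hd m
  have h5 : 0 ≤ d ^ m := pow_nonneg hd0 m
  have h6 : (1 + β) ^ m * d ^ m + 2 ^ (m + 1) * ε ≤ (1 + 2 ^ (m + 1) * β) * d ^ m := by
    have e1 := mul_le_mul_of_nonneg_right h2 h5
    have e2 := mul_le_mul_of_nonneg_left h4 hβ0
    have e3 : (0 : ℝ) ≤ 2 ^ m * β * d ^ m := by positivity
    have e4 : (2 : ℝ) ^ (m + 1) = 2 * 2 ^ m := by ring
    rw [e4] at hε ⊢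
    nlinarith
  have h7 : (1 - α / 2) * (1 + 2 ^ (m + 1) * β) ≤ (1 - β) ^ (m + 1) := by
    have e1 : (0 : ℝ) ≤ α / 2 * (2 ^ (m + 1) * β) := by positivity
    have e2 : 1 + ((m + 1 : ℕ) : ℝ) * -β ≤ (1 - β) ^ (m + 1) := by
      rw [sub_eq_add_neg]
      exact h3
    nlinarith
  calc (1 - α / 2) * f * d * ((1 + β) ^ m * d ^ m + 2 ^ (m + 1) * ε)
      ≤ (1 - α / 2) * f * d * ((1 + 2 ^ (m + 1) * β) * d ^ m) :=
        mul_le_mul_of_nonneg_left h6 (by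
          have : 0 ≤ 1 - α / 2 := by linarith
          positivity)
    _ = f * d ^ (m + 1) * ((1 - α / 2) * (1 + 2 ^ (m + 1) * β)) := by ring
    _ ≤ f * d ^ (m + 1) * (1 - β) ^ (m + 1) := mul_le_mul_of_nonneg_left h7 (by positivity)
    _ = f * ((1 - β) ^ (m + 1) * d ^ (m + 1)) := by ring

theorem exists_pos_forall_le (l : List ℝ) (hl : ∀ x ∈ l, 0 < x) : ∃ ε, 0 < ε ∧ ∀ x ∈ l, ε ≤ x := by
  induction l with
  | nil => exact ⟨1, one_pos, by simp⟩
  | cons a l ih =>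
    simp only [List.mem_cons, forall_eq_or_imp] at hl ⊢
    obtain ⟨ε, hε, h⟩ := ih hl.2
    exact ⟨min a ε, lt_min hl.1 hε, min_le_left _ _, fun x hx => (min_le_right _ _).trans (h x hx)⟩

/-- The common form of the two counting bounds, absorbing the error terms. -/
theorem half_mul_le_of_count {M q₁ q₂ ω e n N L c X η : ℝ} {m f : ℕ} (hM : M = q₁ ^ m * ω ^ f)
    (hq : q₁ ≤ q₂) (hq0 : 0 ≤ q₁) (hω : 0 ≤ ω) (he : e ≤ M / 4) (hc : 0 ≤ c) (hη : c * η ≤ M / 4)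
    (hL : 1 + L ≤ η * n) (hn : 0 < n) (hN : 0 ≤ N)
    (h : (q₂ ^ m * ω ^ f - e) * N * n ≤ n * X + c * (1 + L) * N) : M / 2 * N ≤ X := by
  have h1 : M ≤ q₂ ^ m * ω ^ f := by
    rw [hM]
    exact mul_le_mul_of_nonneg_right (pow_le_pow_left₀ hq0 hq _) (by positivity)
  have hNn : 0 ≤ N * n := by positivity
  have h2 := mul_le_mul_of_nonneg_right (show 3 / 4 * M ≤ q₂ ^ m * ω ^ f - e by linarith) hNn
  have h3 : c * (1 + L) * N ≤ M / 4 * (N * n) := by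
    calc c * (1 + L) * N ≤ c * (η * n) * N := by gcongr
      _ = c * η * (N * n) := by ring
      _ ≤ _ := mul_le_mul_of_nonneg_right hη hNn
  have h4 : n * (M / 2 * N) ≤ n * X := by nlinarith
  exact le_of_mul_le_mul_left h4 hn

theorem Slices.exists_perfect {V K : Type} [Fintype V] [DecidableEq V] [Fintype K] [DecidableEq K]
    [Nonempty V] {f t : ℕ} {F : SimpleGraph (Fin f)} {Γ R G : SimpleGraph V} {φ : Sym2 V → K}
    {𝓜 : Fin t → Finset (Fin f → V)} (h𝓜 : Slices F Γ φ 𝓜) (hf : 1 ≤ f) {w : Fin f}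
    {γ B M κ η ε q₁ q L : ℝ} (hdiv : f ∣ Fintype.card V) (hΓG : Γ ≤ G) (hRG : R ≤ G)
    {C : Finset K} (hΓC : ∀ u v, Γ.Adj u v → φ s(u, v) ∉ C)
    (hRC : ∀ u v, R.Adj u v → φ s(u, v) ∈ C) (hγ : 0 ≤ γ) (hB0 : 0 ≤ B) (hM0 : 0 < M)
    (hM : M = q₁ ^ (edgeP F).card * κ ^ f)
    (hγM : 4 * ((((f ^ 2 + (edgeP F).card : ℕ) : ℝ) ^ 2 * (2 * f + (1 + B)) + f ^ 2) * γ) ≤ M / 2)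
    (ht : (t : ℝ) ≤ f * Fintype.card V)
    (hunc : ∀ i, ((unc (𝓜 i)).card : ℝ) ≤ γ * Fintype.card V)
    (hmiss : ∀ v, ((Finset.univ.filter fun i => v ∈ unc (𝓜 i)).card : ℝ) ≤ γ * Fintype.card V)
    (hcol : ∀ i c, ∑ u ∈ unc (𝓜 i), (cdeg G φ u c : ℝ) ≤ γ * Fintype.card V)
    (hBG : ∀ c, ∑ v, (cdeg G φ v c : ℝ) ≤ B * Fintype.card V)
    (hκ : 0 ≤ κ) (hsw : ∀ i u, κ * Fintype.card V ≤
      ({ψ | ψ ∈ 𝓜 i ∧ Switch F R φ w u ψ} : Set (Fin f → V)).ncard)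
    (hR : CutClose R q ε) (hq₁ : 0 ≤ q₁) (hq : q₁ ≤ q) (hq2 : q ≤ 2) (hε0 : 0 ≤ ε) (hL0 : 0 ≤ L)
    (hLR : ∀ v c, (cdeg R φ v c : ℝ) ≤ L) (hε : 2 ^ (edgeP F).card * ε ≤ M / 4)
    (hη : 2 * ((f ^ 2 + (edgeP F).card : ℕ) : ℝ) ^ 2 * η ≤ M / 4)
    (hL : 1 + L ≤ η * Fintype.card V) :
    ∃ 𝓝 : Fin t → Finset (Fin f → V), Slices F G φ 𝓝 ∧ ∀ i, unc (𝓝 i) = ∅ := by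
  classical
  have hn0 : (0 : ℝ) < Fintype.card V := by exact_mod_cast Fintype.card_pos
  obtain ⟨I, _, _, sl, u, hdem⟩ := h𝓜.exists_demands hdiv
  have hfib : ∀ i j, Set.InjOn (fun D => u D j)
      (Finset.univ.filter fun D => sl D = i : Finset I) := fun i j D hD D' hD' hDD => by
    simp only [Finset.coe_filter, Finset.mem_univ, true_and, Set.mem_ofPred_eq] at hD hD'
    exact (hdem.inj D D' j j (hD.trans hD'.symm) hDD).1
  have hmaps : ∀ i j, ∀ D ∈ (Finset.univ.filter fun D => sl D = i : Finset I), u D j ∈ unc (𝓜 i) :=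
    fun i j D hD => (Finset.mem_filter.1 hD).2 ▸ hdem.mem D j
  have hfibcard : ∀ i, ((Finset.univ.filter fun D => sl D = i).card : ℝ) ≤ γ * Fintype.card V :=
    fun i => (Nat.cast_le.2 (Finset.card_le_card_of_injOn _ (hmaps i w) (hfib i w))).trans (hunc i)
  have hA : ∃ c, SliceAbsorbers F R φ 𝓜 sl u c w := by
    refine exists_absorbers hf (γ := γ) (B := B) (κ := M / 2) hγ hB0
      (by positivity) hγM (fun D => h𝓜.freeable w (sl D) (u D)) hfibcard ?_ ?_ ?_ ?_ ?_
    · refine fun j y => le_trans (Nat.cast_le.2 ?_) (hmiss y)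
      refine Finset.card_le_card_of_injOn sl (fun D hD => ?_) fun D hD D' hD' hDD => ?_
      · simp only [Finset.coe_filter, Finset.mem_univ, true_and, Set.mem_ofPred_eq] at hD ⊢
        exact hD ▸ hdem.mem D j
      · simp only [Finset.coe_filter, Finset.mem_univ, true_and, Set.mem_ofPred_eq] at hD hD'
        exact (hdem.inj D D' j j hDD (hD.trans hD'.symm)).1
    · intro i j c
      calc ∑ D ∈ Finset.univ.filter (fun D => sl D = i), (cdeg R φ (u D j) c : ℝ)
          = ∑ v ∈ (Finset.univ.filter fun D => sl D = i).image (fun D => u D j),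
              (cdeg R φ v c : ℝ) :=
            (Finset.sum_image (f := fun v => (cdeg R φ v c : ℝ)) (hfib i j)).symm
        _ ≤ ∑ v ∈ unc (𝓜 i), (cdeg R φ v c : ℝ) :=
          Finset.sum_le_sum_of_subset_of_nonneg (Finset.image_subset_iff.2 (hmaps i j))
            fun _ _ _ => Nat.cast_nonneg _
        _ ≤ ∑ v ∈ unc (𝓜 i), (cdeg G φ v c : ℝ) :=
          Finset.sum_le_sum fun v _ => Nat.cast_le.2 (cdeg_mono hRG φ v c)
        _ ≤ _ := hcol i c
    · have h1 : (Fintype.card I : ℝ) =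
          ∑ i, ((Finset.univ.filter fun D => sl D = i).card : ℝ) := by
        rw [← Nat.cast_sum, ← Finset.card_univ]
        exact congrArg _ (Finset.card_eq_sum_card_fiberwise fun D _ => Finset.mem_univ _)
      rw [h1]
      refine (Finset.sum_le_sum fun i _ => hfibcard i).trans ?_
      rw [Finset.sum_const, Finset.card_univ, Fintype.card_fin, nsmul_eq_mul]
      have := mul_le_mul_of_nonneg_right ht (show 0 ≤ γ * Fintype.card V by positivity)
      linarith
    · exact fun c => (Finset.sum_le_sum fun v _ =>
        Nat.cast_le.2 (cdeg_mono hRG φ v c)).trans (hBG c)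
    · intro D
      have h1 := cnt_absorbs_ge (F := F) (N := nbrs F w) hR (hq₁.trans hq) hq2 hε0 hκ hL0 hLR hf
        (h𝓜.freeable w (sl D) (u D)) fun k => by
          rw [h𝓜.card_freeable]
          exact hsw _ _
      exact half_mul_le_of_count hM hq hq₁ hκ hε (by positivity) hη hL hn0 (by positivity) h1
  obtain ⟨c, hc⟩ := hA
  exact exists_factors h𝓜 hc hdem hΓG hRG (C := ↑C)
    (fun e => Sym2.ind (fun x y hxy => by simpa using hΓC x y hxy) e)
    (fun e => Sym2.ind (fun x y hxy => by simpa using hRC x y hxy) e)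

set_option maxHeartbeats 1000000 in
theorem exists_perfect_slices (f h : ℕ) (hf : 1 ≤ f) (hh : 1 ≤ h) {α d₀ : ℝ} (hα : 0 < α)
    (hα1 : α ≤ 1) (hd₀ : 0 < d₀) : ∃ η, 0 < η ∧ ∃ n₀ : ℕ, ∀ (V K : Type)
      [Fintype V] [DecidableEq V] [Fintype K] [DecidableEq K] (F : SimpleGraph (Fin f))
      (G : SimpleGraph V) (φ : Sym2 V → K) (d L : ℝ) (t : ℕ), (edgeP F).card = h →
      f ∣ Fintype.card V → n₀ ≤ Fintype.card V → Fintype.card K ≤ Fintype.card V ^ 2 →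
      d₀ ≤ d → d ≤ 2 → QR G η d → 0 ≤ L → (∀ v c, (cdeg G φ v c : ℝ) ≤ L) →
      (1 + L) * Real.log (Fintype.card V) ≤ η * Fintype.card V →
      (∀ c, ∑ v, (cdeg G φ v c : ℝ) ≤ (1 - α) * f * d * Fintype.card V / h) →
      2 * (t : ℝ) ≤ (1 - α / 2) * f * d / h * Fintype.card V →
      ∃ 𝓝 : Fin t → Finset (Fin f → V), Slices F G φ 𝓝 ∧ ∀ i, unc (𝓝 i) = ∅ := by
  have hf' : (1 : ℝ) ≤ f := by exact_mod_cast hf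
  have hh' : (1 : ℝ) ≤ h := by exact_mod_cast hh
  obtain ⟨β, hβ⟩ : ∃ β, β = α / (2 * (2 ^ h + h)) := ⟨_, rfl⟩
  have hβ0 : 0 < β := by rw [hβ]; positivity
  have hβα : (2 ^ h + h) * β = α / 2 := by rw [hβ]; field_simp
  have hβ1 : β ≤ 1 / 4 := by
    have e1 : (1 : ℝ) ≤ 2 ^ h := one_le_pow₀ (by norm_num)
    have e2 := mul_le_mul_of_nonneg_right (show (2 : ℝ) ≤ 2 ^ h + h by linarith) hβ0.le
    linarith
  obtain ⟨M, hM⟩ : ∃ M, M = (d₀ / 2) ^ h * (β * d₀ / 2) ^ f := ⟨_, rfl⟩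
  have hM0 : 0 < M := by rw [hM]; positivity
  obtain ⟨κ, hκ⟩ : ∃ κ, κ = M / 2 / (16 * (f + 2 * h : ℕ) * f * (2 ^ h + 1)) := ⟨_, rfl⟩
  have hκ0 : 0 < κ := by
    have : (0 : ℝ) < (f + 2 * h : ℕ) := by exact_mod_cast (by omega : 0 < f + 2 * h)
    rw [hκ]
    positivity
  obtain ⟨M', hM'⟩ : ∃ M', M' = (β * d₀) ^ h * κ ^ f := ⟨_, rfl⟩
  have hM'0 : 0 < M' := by rw [hM']; positivity
  obtain ⟨σ, hσ⟩ : ∃ σ : ℝ, σ = (f ^ 2 + h : ℕ) := ⟨_, rfl⟩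
  have hσ0 : 0 < σ := by rw [hσ]; exact_mod_cast (by positivity : 0 < f ^ 2 + h)
  obtain ⟨γ, hγ⟩ : ∃ γ, γ = M' / 2 / (4 * (σ ^ 2 * (4 * f + 1) + f ^ 2)) := ⟨_, rfl⟩
  have hγ0 : 0 < γ := by rw [hγ]; positivity
  have hγM : 4 * ((σ ^ 2 * (4 * f + 1) + f ^ 2) * γ) = M' / 2 := by rw [hγ]; field_simp
  obtain ⟨ε₀, hε₀, η₁, hη₁, n₁, hslices⟩ := exists_slices f h hf (q₀ := d₀ / 2) (κ := M / 2)
    (γ := γ) (by positivity) (by positivity) hγ0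
  obtain ⟨ε, hε0, hεs⟩ : ∃ ε, 0 < ε ∧ ∀ e ∈ [ε₀, 1, β * d₀ ^ 2, β * d₀ / 2,
      β * d₀ ^ (h - 1) / 2 ^ h, M / 4 / 2 ^ h, M' / 4 / 2 ^ h], ε ≤ e := by
    refine exists_pos_forall_le _ ?_
    simp only [List.mem_cons, List.not_mem_nil, or_false, forall_eq_or_imp, forall_eq]
    refine ⟨hε₀, ?_, ?_, ?_, ?_, ?_, ?_⟩ <;> positivity
  simp only [List.mem_cons, List.not_mem_nil, or_false, forall_eq_or_imp, forall_eq] at hεs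
  obtain ⟨ha1, ha2, ha3, ha4, ha5, ha6, ha7⟩ := hεs
  rw [le_div_iff₀' (by positivity)] at ha5 ha6 ha7
  obtain ⟨η₂, hη₂, -, hreserve⟩ := exists_reserve β ε hβ0.le (by linarith) hε0 ha2
  obtain ⟨η, hη0, hηs⟩ : ∃ η, 0 < η ∧ ∀ e ∈ [η₁, η₂, M / 4 / (2 * f ^ 2 + h ^ 2),
      M' / 4 / (2 * σ ^ 2)], η ≤ e := by
    refine exists_pos_forall_le _ ?_
    simp only [List.mem_cons, List.not_mem_nil, or_false, forall_eq_or_imp, forall_eq]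
    refine ⟨hη₁, hη₂, ?_, ?_⟩ <;> positivity
  simp only [List.mem_cons, List.not_mem_nil, or_false, forall_eq_or_imp, forall_eq] at hηs
  obtain ⟨hb1, hb2, hb3, hb4⟩ := hηs
  rw [le_div_iff₀' (by positivity)] at hb3 hb4
  refine ⟨η, hη0, max n₁ (max 3 ⌈1 / η₂⌉₊), ?_⟩
  intro V K _ _ _ _ F G φ d L t hFh hdiv hn hK hd hd2 hQR hL0 hL hLn hB ht
  simp only [max_le_iff] at hn
  obtain ⟨hn1, hn3, hn2⟩ := hn
  have : Nonempty V := Fintype.card_pos_iff.1 (by omega)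
  set n : ℝ := (Fintype.card V : ℝ) with hndef
  have hn3' : (3 : ℝ) ≤ n := by rw [hndef]; exact_mod_cast hn3
  have hn0 : 0 < n := by linarith
  have hlog : 1 ≤ Real.log n := by
    rw [Real.le_log_iff_exp_le hn0]
    exact (Real.exp_one_lt_d9.le.trans (by norm_num)).trans hn3'
  have hd0 : 0 < d := hd₀.trans_le hd
  have hβd : β * d₀ ≤ β * d := mul_le_mul_of_nonneg_left hd hβ0.le
  have hβd4 : β * d ≤ 1 / 4 * d := mul_le_mul_of_nonneg_right hβ1 hd0.le
  have hL1 : 1 + L ≤ η * n := (le_mul_of_one_le_right (by positivity) hlog).trans hLn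
  obtain ⟨Γ, R, C, hΓG, hRG, hΓC, hRC, hcod, hΓcut, hRcut, hΓdeg, hRdeg⟩ :=
    hreserve V K G φ d L hd0.le hd2 (hQR.mono hb2) hL0 hL
      (by
        have := mul_le_mul_of_nonneg_right hb2 hn0.le
        linarith) hn3
      (by
        have h1 := Nat.ceil_le.1 hn2
        rwa [div_le_iff₀' hη₂] at h1)
  have hLΓ : ∀ v c, (cdeg Γ φ v c : ℝ) ≤ L := fun v c =>
    (Nat.cast_le.2 (cdeg_mono hΓG φ v c)).trans (hL v c)
  have hLR : ∀ v c, (cdeg R φ v c : ℝ) ≤ L := fun v c =>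
    (Nat.cast_le.2 (cdeg_mono hRG φ v c)).trans (hL v c)
  have hRmin : ∀ v, β * d₀ / 2 * n ≤ (nb R v).card := fun v => by
    have h1 := (abs_le.1 (hRdeg v)).1
    have h2 := mul_le_mul_of_nonneg_right (show β * d₀ / 2 ≤ β * d - ε by linarith) hn0.le
    linarith
  obtain ⟨w, -⟩ : ∃ w : Fin f, True := ⟨⟨0, by omega⟩, trivial⟩
  obtain ⟨B, hBdef⟩ : ∃ B, B = (1 - α / 2) * f * d / h := ⟨_, rfl⟩
  have hα2 : 0 ≤ 1 - α / 2 := by linarith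
  have hB0 : 0 ≤ B := by rw [hBdef]; positivity
  have hBf : B ≤ 2 * f := by
    rw [hBdef, div_le_iff₀ (by positivity)]
    have e1 : (1 - α / 2) * f * d ≤ 1 * f * 2 := by gcongr; linarith
    have e2 := mul_le_mul_of_nonneg_left hh' (show (0 : ℝ) ≤ 2 * f by positivity)
    linarith
  have hBG : ∀ c, ∑ v, (cdeg G φ v c : ℝ) ≤ B * n := fun c => (hB c).trans (by
    rw [hBdef, div_mul_eq_mul_div]
    gcongr
    linarith)
  have hgood : ∀ u, M / 2 * n ^ f ≤ cnt fun ψ => Valid F Γ φ ψ ∧ Switch F R φ w u ψ := fun u => by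
    have h1 := cnt_switch_ge (F := F) hΓcut (by linarith) (by linarith) hε0.le
      (ω := β * d₀ / 2) (by positivity) (by linarith) hL0 hLΓ hLR hRmin w u
    rw [hFh] at h1
    refine half_mul_le_of_count (q₁ := d₀ / 2) hM ?_ (by positivity) (by positivity) ha6
      (by positivity) hb3 hL1 hn0 (by positivity) h1
    linarith
  obtain ⟨𝓜, h𝓜, hunc, hmiss, hcol, hsw⟩ := hslices V K F G Γ φ ε ((1 - β) * d) ((1 + β) * d) B L t
    hFh hΓG hε0 ha1 hn1 hK hΓcut (by linarith) (by linarith) (by linarith) hΓdeg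
    (fun v => by
      have h1 := (abs_le.1 (hΓdeg v)).2
      have h2 := mul_le_mul_of_nonneg_right (show (1 - β) * d + ε ≤ (1 + β) * d by linarith) hn0.le
      linarith)
    (fun u v huv => by
      refine (Nat.cast_le.2 (card_nb_mono hΓG u v)).trans ((hcod u v huv).trans ?_)
      refine mul_le_mul_of_nonneg_right ?_ hn0.le
      have e1 : d₀ ^ 2 ≤ d ^ 2 := pow_le_pow_left₀ hd₀.le hd 2
      linarith [mul_le_mul_of_nonneg_left e1 hβ0.le, sq_nonneg (β * d), sq_nonneg d])
    hB0 hBf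
    (by
      rw [hBdef]
      exact density_bound hh hα.le hα1 hβ0.le (by linarith) hβα.le hd₀.le hd ha5)
    (by rw [hBdef]; exact ht) hL0 hL hBG
    (hLn.trans (mul_le_mul_of_nonneg_right hb1 hn0.le)) (Switch F R φ w) hgood
  rw [← hκ] at hsw
  refine h𝓜.exists_perfect hf hdiv hΓG hRG hΓC hRC hγ0.le hB0 hM'0 (κ := κ) (q₁ := β * d₀)
    (by rw [hFh, hM']) ?_ ?_ hunc hmiss hcol hBG hκ0.le hsw hRcut (by positivity) hβd (by linarith)
    hε0.le hL0 hLR (by rwa [hFh]) (by rwa [hFh, ← hσ]) hL1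
  · rw [hFh, ← hγM, ← hσ]
    have e1 : 2 * (f : ℝ) + (1 + B) ≤ 4 * f + 1 := by linarith
    gcongr 4 * ((σ ^ 2 * ?_ + _) * γ)
  · have := mul_le_mul_of_nonneg_right hBf hn0.le
    rw [← hBdef] at ht
    linarith

end Perfect

section Factor

variable {V K : Type} [Fintype V] [DecidableEq V] [Fintype K] [DecidableEq K] {f t : ℕ}
variable {F : SimpleGraph (Fin f)} {G : SimpleGraph V} {φ : Sym2 V → K}
variable {𝓝 : Fin t → Finset (Fin f → V)}

variable (F G) in
/-- The subgraphs of `G` traced out by a set of maps. -/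
def copies (N : Finset (Fin f → V)) : Set G.Subgraph :=
  {H | ∃ c : SimpleGraph.Copy F G, ⇑c ∈ N ∧ H = c.toSubgraph}

theorem Valid.exists_copy {ψ : Fin f → V} (h : Valid F G φ ψ) :
    ∃ c : SimpleGraph.Copy F G, ⇑c = ψ :=
  ⟨⟨⟨ψ, fun {a b} hab => h.hom a b hab⟩, h.inj⟩, rfl⟩

theorem mem_edgeSet_toSubgraph {c : SimpleGraph.Copy F G} {e : Sym2 V} :
    e ∈ c.toSubgraph.edgeSet ↔ ∃ p ∈ edgeP F, im c p = e := by
  rw [SimpleGraph.Subgraph.edgeSet_map, Set.mem_image]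
  constructor
  · rintro ⟨x, hx, rfl⟩
    induction x using Sym2.ind with
    | _ j k =>
    have hjk : F.Adj j k := by simpa using hx
    refine ⟨sortP j k, sortP_mem F hjk, ?_⟩
    rw [sortP]
    split_ifs
    · rfl
    · exact Sym2.eq_swap
  · rintro ⟨p, hp, rfl⟩
    exact ⟨s(p.1, p.2), by simpa using ((mem_edgeP F).1 hp).2, rfl⟩

theorem mem_edgeSet_sSup {N : Finset (Fin f → V)} (hN : ∀ ψ ∈ N, Valid F G φ ψ) {e : Sym2 V} :
    e ∈ (sSup (copies F G N)).edgeSet ↔ ∃ ψ ∈ N, ∃ p ∈ edgeP F, im ψ p = e := by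
  simp only [SimpleGraph.Subgraph.edgeSet_sSup, Set.mem_iUnion, exists_prop]
  constructor
  · rintro ⟨H, ⟨c, hc, rfl⟩, he⟩
    exact ⟨c, hc, mem_edgeSet_toSubgraph.1 he⟩
  · rintro ⟨ψ, hψ, he⟩
    obtain ⟨c, rfl⟩ := (hN ψ hψ).exists_copy
    exact ⟨_, ⟨c, hψ, rfl⟩, mem_edgeSet_toSubgraph.2 he⟩

theorem Slices.isFFactorSub (h : Slices F G φ 𝓝) (i : Fin t) :
    Paper.IsFFactorSub F (sSup (copies F G (𝓝 i))) := by
  refine ⟨_, ?_, ?_, rfl⟩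
  · rintro H ⟨c, -, rfl⟩
    exact ⟨c.isoToSubgraph⟩
  · rintro H ⟨c, hc, rfl⟩ H' ⟨c', hc', rfl⟩ hne
    refine Set.disjoint_left.2 fun v hv hv' => ?_
    obtain ⟨a, -, rfl⟩ := hv
    obtain ⟨b, -, hb⟩ := hv'
    refine h.disj i c hc c' hc' (fun hcc => hne ?_) a b hb.symm
    rw [DFunLike.coe_injective hcc]

theorem Slices.rainbow {C : Type} {χ : Sym2 V → C} (hχ : ∀ e e', χ e = χ e' → φ e = φ e')
    (h : Slices F G φ 𝓝) (i : Fin t) :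
    Paper.Rainbow χ (sSup (copies F G (𝓝 i))).edgeSet := by
  intro e he e' he' hee
  obtain ⟨ψ, hψ, p, hp, rfl⟩ := (mem_edgeSet_sSup (h.valid i)).1 he
  obtain ⟨ψ', hψ', p', hp', rfl⟩ := (mem_edgeSet_sSup (h.valid i)).1 he'
  have h1 := hχ _ _ hee
  by_cases hψψ : ψ = ψ'
  · subst hψψ
    rw [(h.valid i ψ hψ).rainbow p hp p' hp' h1]
  · exact (h.colour i ψ hψ ψ' hψ' hψψ p hp p' hp' h1).elim

theorem Slices.isSpanning (h : Slices F G φ 𝓝) {i : Fin t} (hi : unc (𝓝 i) = ∅) :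
    (sSup (copies F G (𝓝 i))).IsSpanning := by
  intro v
  have h1 : v ∉ unc (𝓝 i) := by simp [hi]
  rw [mem_unc] at h1
  push Not at h1
  obtain ⟨ψ, hψ, a, rfl⟩ := h1
  obtain ⟨c, rfl⟩ := (h.valid i ψ hψ).exists_copy
  rw [SimpleGraph.Subgraph.verts_sSup]
  exact Set.mem_biUnion ⟨c, hψ, rfl⟩ ⟨a, trivial, rfl⟩

theorem Slices.pairwise_disjoint (h : Slices F G φ 𝓝) :
    Pairwise fun i j => Disjoint (sSup (copies F G (𝓝 i))).edgeSet
      (sSup (copies F G (𝓝 j))).edgeSet := by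
  intro i j hij
  refine Set.disjoint_left.2 fun e he he' => ?_
  obtain ⟨ψ, hψ, p, hp, rfl⟩ := (mem_edgeSet_sSup (h.valid i)).1 he
  obtain ⟨ψ', hψ', p', hp', hpp⟩ := (mem_edgeSet_sSup (h.valid j)).1 he'
  exact h.edge i j hij ψ hψ ψ' hψ' p hp p' hp' hpp.symm

theorem Slices.card_mul (h : Slices F G φ 𝓝) {i : Fin t} (hi : unc (𝓝 i) = ∅) :
    (𝓝 i).card * f = Fintype.card V := by
  have h2 : (Finset.univ : Finset V) = (𝓝 i).biUnion fun ψ => Finset.univ.image ψ := by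
    ext v
    have h1 : v ∉ unc (𝓝 i) := by simp [hi]
    rw [mem_unc] at h1
    push Not at h1
    simpa using h1
  rw [← Finset.card_univ, h2, Finset.card_biUnion]
  · refine (Finset.sum_const_nat fun ψ hψ => ?_).symm
    rw [Finset.card_image_of_injective _ (h.valid i ψ hψ).inj, Finset.card_univ, Fintype.card_fin]
  · intro ψ hψ ψ' hψ' hne
    refine Finset.disjoint_left.2 fun v hv hv' => ?_
    simp only [Finset.mem_image, Finset.mem_univ, true_and] at hv hv'
    obtain ⟨a, rfl⟩ := hv
    obtain ⟨b, hb⟩ := hv'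
    exact h.disj i ψ hψ ψ' hψ' hne a b hb.symm

theorem Slices.le_ncard_iUnion (h : Slices F G φ 𝓝) (hunc : ∀ i, unc (𝓝 i) = ∅) :
    t * Fintype.card V * (edgeP F).card ≤
      f * (⋃ i, (sSup (copies F G (𝓝 i))).edgeSet : Set (Sym2 V)).ncard := by
  classical
  set S : Finset ((_ : Fin t) × ((Fin f → V) × (Fin f × Fin f))) :=
    Finset.univ.sigma fun i => 𝓝 i ×ˢ edgeP F with hS
  have hScard : t * Fintype.card V * (edgeP F).card = f * S.card := by
    rw [hS, Finset.card_sigma, Finset.mul_sum]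
    simp only [Finset.card_product]
    have : ∀ i ∈ (Finset.univ : Finset (Fin t)), f * ((𝓝 i).card * (edgeP F).card) =
        Fintype.card V * (edgeP F).card := fun i _ => by
      rw [← h.card_mul (hunc i)]
      ring
    rw [Finset.sum_congr rfl this, Finset.sum_const, Finset.card_univ, Fintype.card_fin,
      smul_eq_mul, mul_assoc]
  rw [hScard]
  refine Nat.mul_le_mul_left _ ?_
  have hinj : Set.InjOn (fun x : (_ : Fin t) × ((Fin f → V) × (Fin f × Fin f)) =>
      im x.2.1 x.2.2) S := by
    rintro ⟨i, ψ, p⟩ hx ⟨j, ψ', p'⟩ hx' hxx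
    simp only [hS, Finset.coe_sigma, Set.mem_sigma_iff, Finset.coe_univ, Set.mem_univ, true_and,
      Finset.mem_coe, Finset.mem_product] at hx hx'
    dsimp only at hxx
    obtain rfl : i = j := by
      by_contra hij
      exact h.edge i j hij ψ hx.1 ψ' hx'.1 p hx.2 p' hx'.2 hxx
    obtain rfl : ψ = ψ' := by
      by_contra hij
      exact h.colour i ψ hx.1 ψ' hx'.1 hij p hx.2 p' hx'.2 (congrArg φ hxx)
    rw [eq_of_im_eq (h.valid i ψ hx.1).inj hx.2 hx'.2 hxx]
  rw [← Finset.card_image_of_injOn hinj, ← Set.ncard_coe_finset]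
  refine Set.ncard_le_ncard ?_ (Set.toFinite _)
  intro e he
  simp only [hS, Finset.coe_image, Set.mem_image, Finset.mem_coe, Finset.mem_sigma, Finset.mem_univ,
    true_and, Finset.mem_product] at he
  obtain ⟨x, hx, rfl⟩ := he
  exact Set.mem_iUnion.2 ⟨x.1, (mem_edgeSet_sSup (h.valid x.1)).2 ⟨x.2.1, hx.1, x.2.2, hx.2, rfl⟩⟩

theorem ncard_edgeSet_le {D : ℝ} (hD : ∀ v, ((nb G v).card : ℝ) ≤ D) :
    2 * (G.edgeSet.ncard : ℝ) ≤ D * Fintype.card V := by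
  classical
  have h1 := G.sum_degrees_eq_twice_card_edges
  have h2 : G.edgeSet.ncard = G.edgeFinset.card := by
    rw [Set.ncard_eq_toFinset_card', SimpleGraph.edgeFinset]
  have h3 : ∀ v, G.degree v = (nb G v).card := fun v => by
    rw [← SimpleGraph.card_neighborFinset_eq_degree]
    congr 1
    ext u
    simp [mem_nb]
  rw [h2]
  have h4 : (2 * (G.edgeFinset.card : ℝ)) = ∑ v, ((nb G v).card : ℝ) := by
    exact_mod_cast (by rw [← h1]; exact Finset.sum_congr rfl fun v _ => h3 v)
  rw [h4, mul_comm D]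
  simpa using Finset.sum_le_card_nsmul Finset.univ _ D fun v _ => hD v

theorem card_le_two_mul_ncard (P : Finset (V × V)) (S : Set (Sym2 V))
    (h : ∀ p ∈ P, s(p.1, p.2) ∈ S) : P.card ≤ 2 * S.ncard := by
  classical
  have h1 := Finset.card_le_mul_card_image (f := fun p : V × V => s(p.1, p.2)) P 2
    (fun e _ => by
      induction e using Sym2.ind with
      | _ x y =>
      refine (Finset.card_le_card (t := {(x, y), (y, x)}) fun p hp => ?_).trans Finset.card_le_two
      have h2 := (Finset.mem_filter.1 hp).2
      rw [Sym2.eq_iff] at h2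
      simp only [Finset.mem_insert, Finset.mem_singleton]
      exact h2.imp (fun h => Prod.ext h.1 h.2) (fun h => Prod.ext h.1 h.2))
  refine h1.trans (Nat.mul_le_mul_left _ ?_)
  rw [← Set.ncard_coe_finset]
  refine Set.ncard_le_ncard ?_ (Set.toFinite _)
  intro e he
  rw [Finset.coe_image] at he
  obtain ⟨p, hp, rfl⟩ := he
  exact h p hp

theorem qr_of_quasirandom {η d : ℝ} (h : Paper.Quasirandom G η d) : QR G η d := by
  classical
  have hnb : ∀ v, (Paper.degIn G v Set.univ) = (nb G v).card := fun v => by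
    rw [Paper.degIn, ← Set.ncard_coe_finset]
    congr 1
    ext u
    simp [mem_nb]
  have hco : ∀ u v, (Paper.codegIn G u v Set.univ) = (nb G u ∩ nb G v).card := fun u v => by
    rw [Paper.codegIn, ← Set.ncard_coe_finset]
    congr 1
    ext x
    simp [mem_nb]
  obtain ⟨h1, h2⟩ := h
  rw [Set.ncard_univ, Nat.card_eq_fintype_card] at h2
  simp only [Set.ncard_univ, Nat.card_eq_fintype_card, hnb] at h1
  simp only [hco] at h2
  refine ⟨fun v => h1 v trivial, ?_⟩
  have h3 := mul_le_mul_of_nonneg_left h2 (show (0 : ℝ) ≤ 2 by norm_num)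
  rw [← mul_assoc] at h3
  refine le_trans ?_ h3
  refine le_trans (Nat.cast_le.2 (card_le_two_mul_ncard _ _ fun p hp => ?_))
    (le_of_eq (by rw [Nat.cast_mul, Nat.cast_ofNat]))
  simp only [Finset.mem_filter, Finset.mem_univ, true_and] at hp
  exact ⟨p.1, p.2, rfl, hp.1, trivial, trivial, hp.2⟩

theorem cdeg_le_of_lBounded {C : Type} {χ : Sym2 V → C} (hχ : ∀ e e', φ e = φ e' → χ e = χ e')
    {l : ℝ} (hl0 : 0 ≤ l) (h : Paper.LBounded G χ l) (v : V) (c : K) : (cdeg G φ v c : ℝ) ≤ l := by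
  classical
  by_cases hc : ∃ e, φ e = c
  · obtain ⟨e, rfl⟩ := hc
    refine le_trans (Nat.cast_le.2 ?_) (h v (χ e))
    rw [cdeg, ← Set.ncard_coe_finset]
    refine Set.ncard_le_ncard (fun u hu => ?_) (Set.toFinite _)
    simp only [Finset.coe_filter, Finset.mem_univ, true_and, Set.mem_ofPred_eq] at hu ⊢
    exact ⟨hu.1, hχ _ _ hu.2⟩
  · rw [cdeg, Finset.filter_false_of_mem fun u _ hu => hc ⟨_, hu.2⟩]
    simpa using hl0

theorem sum_cdeg_le_of_gBounded {C : Type} {χ : Sym2 V → C}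
    (hχ : ∀ e e', φ e = φ e' → χ e = χ e') {g : ℝ} (hg0 : 0 ≤ g) (h : Paper.GBounded G χ g)
    (c : K) : ∑ v, (cdeg G φ v c : ℝ) ≤ 2 * g := by
  classical
  have h1 : ∑ v, cdeg G φ v c =
      (Finset.univ.filter fun p : V × V => G.Adj p.1 p.2 ∧ φ s(p.1, p.2) = c).card := by
    rw [Finset.card_filter, Fintype.sum_prod_type]
    refine Finset.sum_congr rfl fun v _ => ?_
    rw [cdeg, Finset.card_filter]
  rw [← Nat.cast_sum, h1]
  by_cases hc : ∃ e, φ e = c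
  · obtain ⟨e, rfl⟩ := hc
    refine (Nat.cast_le.2 (card_le_two_mul_ncard _ (Paper.colourCls G χ (χ e))
      fun p hp => ?_)).trans ?_
    · simp only [Finset.mem_filter, Finset.mem_univ, true_and] at hp
      exact ⟨hp.1, hχ _ _ hp.2⟩
    · rw [Nat.cast_mul, Nat.cast_ofNat]
      exact mul_le_mul_of_nonneg_left (h _) (by norm_num)
  · rw [Finset.filter_false_of_mem fun p _ hp => hc ⟨_, hp.2⟩]
    simpa using hg0

theorem exists_recolour [Nonempty V] {C : Type} (χ : Sym2 V → C) :
    ∃ φ : Sym2 V → Sym2 V, ∀ e e', φ e = φ e' ↔ χ e = χ e' := by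
  have : Nonempty (Sym2 V) := ⟨s(Classical.arbitrary V, Classical.arbitrary V)⟩
  have h : ∀ e, χ (Function.invFun χ (χ e)) = χ e := fun e => Function.invFun_eq ⟨e, rfl⟩
  exact ⟨fun e => Function.invFun χ (χ e), fun e e' =>
    ⟨fun hee => by rw [← h e, ← h e']; exact congrArg χ hee,
      fun hee => congrArg (Function.invFun χ) hee⟩⟩

end Factor

theorem leftover_le {α d η n h f t e u : ℝ} (hα : 0 ≤ α) (hα1 : α ≤ 1) (hf : 1 ≤ f)
    (hh : 0 < h) (hn : 0 ≤ n) (hη0 : 0 ≤ η) (hη : η ≤ α * d / 4) (hnh : 8 * h ≤ α * d * n)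
    (ht : (1 - α / 2) * f * d * n / (2 * h) ≤ t + 1) (he : 2 * e ≤ (d + η) * n * n)
    (hu : t * n * h ≤ f * u) : e - u ≤ α * e := by
  rw [div_le_iff₀ (by positivity)] at ht
  have h1 := mul_le_mul_of_nonneg_right ht hn
  have h2 : n * h ≤ f * (n * h) := le_mul_of_one_le_left (by positivity) hf
  have h3 := mul_le_mul_of_nonneg_right hnh hn
  have h4 : (1 - α) * (2 * e) ≤ (1 - α) * ((d + η) * n * n) :=
    mul_le_mul_of_nonneg_left he (by linarith)
  have h5 := mul_le_mul_of_nonneg_right hη (mul_nonneg hn hn)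
  have h6 : 0 ≤ α * (η * (n * n)) := by positivity
  have h7 : f * ((1 - α / 2) * d * n * n / 2 - n * h) ≤ f * u := by linarith
  have h8 := le_of_mul_le_mul_left h7 (by linarith)
  linarith

theorem exists_forall_log_le {ε : ℝ} (hε : 0 < ε) :
    ∃ N : ℕ, ∀ n : ℕ, N ≤ n → Real.log n ≤ ε * n := by
  have h := (Real.isLittleO_log_id_atTop.comp_tendsto tendsto_natCast_atTop_atTop).bound hε
  obtain ⟨N, hN⟩ := Filter.eventually_atTop.1 h
  refine ⟨N, fun n hn => ?_⟩
  have := hN n hn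
  simp only [Function.comp_apply, id_eq, Real.norm_eq_abs, Nat.abs_cast] at this
  exact (le_abs_self _).trans this

theorem le_two_of_qr {V : Type} [Fintype V] [DecidableEq V] [Nonempty V] {G : SimpleGraph V}
    {η d : ℝ} (h : QR G η d) (hη : η ≤ 1) : d ≤ 2 := by
  have hn : (0 : ℝ) < Fintype.card V := by exact_mod_cast Fintype.card_pos
  have h1 := (abs_le.1 (h.1 (Classical.arbitrary V))).1
  have h2 : ((nb G (Classical.arbitrary V)).card : ℝ) ≤ Fintype.card V := by
    exact_mod_cast Finset.card_le_univ _
  have h3 := mul_le_mul_of_nonneg_right hη hn.le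
  exact le_of_mul_le_mul_right (by linarith : d * Fintype.card V ≤ 2 * Fintype.card V) hn

end RainbowFactor

/-- Theorem 1.6: approximate decomposition of a quasirandom graph into rainbow
(perfect) `F`-factors. -/
theorem stmt_5 :
    ∀ α d₀ : ℝ, 0 < α → 0 < d₀ →
    ∀ a f h : ℕ, 1 ≤ h →
    ∃ η : ℝ, 0 < η ∧ ∃ n₀ : ℕ, ∀ n : ℕ, n₀ ≤ n → f ∣ n → ∀ d : ℝ, d₀ ≤ d →
    ∀ F : SimpleGraph (Fin f), F.edgeSet.ncard = h → AParamLe F a →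
    ∀ G : SimpleGraph (Fin n), Quasirandom G η d →
    ∀ φ : Sym2 (Fin n) → ℕ,
      GBounded G φ ((1 - α) * ((f : ℝ) * d * n) / (2 * (h : ℝ))) →
      LBounded G φ (η * n / (Real.log n) ^ (2 * a)) →
      ∃ (t : ℕ) (L : Fin t → G.Subgraph),
        ApxDecomp G α L ∧
        ∀ i, IsFFactorSub F (L i) ∧ Rainbow φ (L i).edgeSet ∧ (L i).IsSpanning := by
  classical
  intro α d₀ hα hd₀ a f h hh
  rcases Nat.eq_zero_or_pos f with rfl | hf
  · refine ⟨1, one_pos, 0, fun n _ _ d _ F hF => ?_⟩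
    rw [← RainbowFactor.card_edgeP F, Finset.card_eq_zero.2 (Subsingleton.elim _ _)] at hF
    omega
  obtain ⟨β, hβ0, hβs⟩ := RainbowFactor.exists_pos_forall_le [α, 1]
    (by simpa using hα)
  simp only [List.mem_cons, List.not_mem_nil, or_false, forall_eq_or_imp, forall_eq] at hβs
  obtain ⟨hβα, hβ1⟩ := hβs
  obtain ⟨η₁, hη₁, n₁, hmain⟩ := RainbowFactor.exists_perfect_slices f h hf hh hβ0 hβ1 hd₀
  obtain ⟨η, hη0, hηs⟩ : ∃ η, 0 < η ∧ ∀ e ∈ [η₁ / 2, 1, β * d₀ / 4], η ≤ e := by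
    refine RainbowFactor.exists_pos_forall_le _ ?_
    simp only [List.mem_cons, List.not_mem_nil, or_false, forall_eq_or_imp, forall_eq]
    refine ⟨?_, ?_, ?_⟩ <;> positivity
  simp only [List.mem_cons, List.not_mem_nil, or_false, forall_eq_or_imp, forall_eq] at hηs
  obtain ⟨hη₁', hη1, hηβ⟩ := hηs
  obtain ⟨N, hN⟩ := RainbowFactor.exists_forall_log_le (half_pos hη₁)
  refine ⟨η, hη0, max n₁ (max N (max 3 ⌈8 * h / (β * d₀)⌉₊)), ?_⟩
  intro n hn hdiv d hd F hF hFa G hG χ hg hl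
  simp only [max_le_iff] at hn
  obtain ⟨hn₁, hnN, hn3, hn8⟩ := hn
  have hn3' : (3 : ℝ) ≤ n := by exact_mod_cast hn3
  have hn8' : 8 * (h : ℝ) ≤ β * d * n := by
    have h1 := Nat.ceil_le.1 hn8
    rw [div_le_iff₀' (by positivity)] at h1
    exact h1.trans (by gcongr)
  have hd0 : 0 < d := hd₀.trans_le hd
  have : Nonempty (Fin n) := ⟨⟨0, by omega⟩⟩
  have hlog : 1 ≤ Real.log n := by
    rw [Real.le_log_iff_exp_le (by linarith)]
    exact Real.exp_one_lt_three.le.trans hn3'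
  have ha : 1 ≤ a := by
    obtain ⟨e, he⟩ := Set.nonempty_of_ncard_ne_zero (s := F.edgeSet) (by omega)
    induction e using Sym2.ind with
    | _ u v =>
    refine le_trans ?_ (hFa.1 u)
    exact (Set.ncard_pos (Set.toFinite _)).2 ⟨v, he⟩
  set L := η * n / Real.log n ^ (2 * a) with hLdef
  have hL0 : 0 ≤ L := by positivity
  have hLlog : L * Real.log n ≤ η * n := by
    rw [hLdef, div_mul_eq_mul_div, div_le_iff₀ (by positivity)]
    exact mul_le_mul_of_nonneg_left (le_self_pow₀ hlog (by omega)) (by positivity)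
  have hηn := mul_le_mul_of_nonneg_right hη₁' (show (0 : ℝ) ≤ n by positivity)
  have hqr := RainbowFactor.qr_of_quasirandom hG
  obtain ⟨φ, hφ⟩ := RainbowFactor.exists_recolour χ
  set g : ℝ := (1 - β) * ((f : ℝ) * d * n) / (2 * (h : ℝ)) with hgdef
  have hβ1' : 0 ≤ 1 - β := by linarith
  have hh0 : (0 : ℝ) < h := by exact_mod_cast hh
  have hg0 : 0 ≤ g := by positivity
  have hg' : GBounded G χ g := fun c => (hg c).trans (by rw [hgdef]; gcongr)
  set t := ⌊(1 - β / 2) * f * d * n / (2 * h)⌋₊ with htdef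
  have hβ2 : 0 ≤ 1 - β / 2 := by linarith
  obtain ⟨𝓝, h𝓝, hunc⟩ := hmain (Fin n) (Sym2 (Fin n)) F G φ d L t
    (by rw [RainbowFactor.card_edgeP, hF]) (by simpa using hdiv) (by simpa using hn₁)
    (RainbowFactor.card_sym2_le _) hd (RainbowFactor.le_two_of_qr hqr hη1)
    (hqr.mono (by linarith)) hL0
    (RainbowFactor.cdeg_le_of_lBounded (fun e e' => (hφ e e').1) hL0 hl)
    (by
      rw [Fintype.card_fin]
      have := hN n hnN
      linarith)
    (fun c => (RainbowFactor.sum_cdeg_le_of_gBounded (fun e e' => (hφ e e').1) hg0 hg' c).trans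
      (le_of_eq (by rw [hgdef, Fintype.card_fin]; field_simp)))
    (by
      have h1 : (t : ℝ) ≤ (1 - β / 2) * f * d * n / (2 * h) := Nat.floor_le (by positivity)
      rw [Fintype.card_fin]
      calc 2 * (t : ℝ) ≤ 2 * ((1 - β / 2) * f * d * n / (2 * h)) := by linarith
        _ = _ := by field_simp)
  refine ⟨t, fun i => sSup (RainbowFactor.copies F G (𝓝 i)), ⟨h𝓝.pairwise_disjoint, ?_⟩,
    fun i => ⟨h𝓝.isFFactorSub i, h𝓝.rainbow (fun e e' => (hφ e e').2) i,
      h𝓝.isSpanning (hunc i)⟩⟩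
  have hcount := h𝓝.le_ncard_iUnion hunc
  rw [Fintype.card_fin, RainbowFactor.card_edgeP, hF] at hcount
  have hsub : (⋃ i, (sSup (RainbowFactor.copies F G (𝓝 i))).edgeSet) ⊆ G.edgeSet :=
    Set.iUnion_subset fun i => SimpleGraph.Subgraph.edgeSet_subset _
  rw [Set.ncard_sdiff hsub (Set.toFinite _),
    Nat.cast_sub (Set.ncard_le_ncard hsub (Set.toFinite _))]
  have he := RainbowFactor.ncard_edgeSet_le (G := G) (D := (d + η) * n) fun v => by
    have := (abs_le.1 (hqr.1 v)).2
    rw [Fintype.card_fin] at this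
    linarith
  rw [Fintype.card_fin] at he
  refine (RainbowFactor.leftover_le hβ0.le hβ1 (f := f) (t := t) (by exact_mod_cast hf) hh0
    (by positivity) hη0.le (hηβ.trans (by gcongr)) hn8' (Nat.lt_floor_add_one _).le he
    (by exact_mod_cast hcount)).trans ?_
  gcongr
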